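/- Let k be a field, let A = k[[x,t]] with fraction field K, and let 1 → N → Γ → G → 1 be a split short exact sequence of finite groups with N ≠ 1. Let L be a Galois field extension of K (inside a fixed algebraic closure of K) with Galois group G, and let B be the integral closure of A in L. Then there exists a Galois field extension M of K with Galois group Γ, containing L, such that the restriction map Gal(M/K) → Gal(L/K) is identified with the given quotient map Γ → G, and such that for every height-one prime ideal q of B whose inertia subgroup {σ ∈ Gal(L/K) : σ(q) = q and σ(b) ≡ b (mod q) for all b ∈ B} is non-trivial, the extension M/L is totally split at q: the integral closure of B in M has exactly [M : L] distinct prime ideals lying over q. Moreover, the set of such extensions M inside the fixed algebraic closure has cardinality card K, and there is a subset of cardinality card K whose members are pairwise linearly disjoint over L. -/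

import Mathlib

set_option synthInstance.maxHeartbeats 1000000
set_option maxHeartbeats 1000000

/-- `k[[x,t]]` is a domain. -/
instance (k : Type) [Field k] : IsDomain (MvPowerSeries (Fin 2) k) :=
  NoZeroDivisors.to_isDomain _

/-- The power series ring `A = k[[x,t]]`. -/
abbrev PSRing (k : Type) [Field k] : Type := MvPowerSeries (Fin 2) k

/-- The field `K = k((x,t)) = Frac k[[x,t]]`. -/
abbrev PSField (k : Type) [Field k] : Type := FractionRing (PSRing k)

/-- A fixed algebraic closure of `K = k((x,t))`. -/
abbrev PSClosure (k : Type) [Field k] : Type := AlgebraicClosure (PSField k)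

/-- Given a split exact sequence `1 → N → Γ → G → 1` (encoded by `f : Γ →* G`), a `G`-Galois
extension `L/K` (with identification `eG`), and `B` the integral closure of `A = k[[x,t]]` in
`L`, the predicate on intermediate fields `M` of the algebraic closure of `K` expressing:
`M ⊇ L` is Galois over `K` with group `Γ` compatibly with `f` (via `eG`), and for every
height-one prime `q` of `B` whose inertia subgroup in `Gal(L/K)` is non-trivial, `M/L` is
totally split at `q`, i.e. the integral closure of `B` in `M` has exactly `[M : L]` distinct
primes lying over `q`. -/
def GoodSolution (k : Type) [Field k] (Γ G : Type) [Group Γ] [Group G]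
    (f : Γ →* G)
    (L : IntermediateField (PSField k) (PSClosure k))
    [Algebra (PSRing k) ↥L] [IsScalarTower (PSRing k) (PSField k) ↥L]
    (eG : G ≃* (↥L ≃ₐ[PSField k] ↥L))
    (M : IntermediateField (PSField k) (PSClosure k)) : Prop :=
  ∃ hLM : L ≤ M,
    IsGalois (PSField k) ↥M ∧ FiniteDimensional (PSField k) ↥M ∧
    ∃ eΓ : Γ ≃* (↥M ≃ₐ[PSField k] ↥M),
      (∀ (γ : Γ) (x : PSClosure k) (hx : x ∈ L),
        ((eΓ γ) ⟨x, hLM hx⟩ : PSClosure k) = ((eG (f γ)) ⟨x, hx⟩ : PSClosure k)) ∧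
      (∀ q : Ideal ↥(integralClosure (PSRing k) ↥L), q.IsPrime → q ≠ ⊥ →
        (∀ p : Ideal ↥(integralClosure (PSRing k) ↥L), p.IsPrime → p < q → p = ⊥) →
        (∃ σ : ↥L ≃ₐ[PSField k] ↥L, σ ≠ 1 ∧
          (⇑σ) '' (Subtype.val '' (q : Set ↥(integralClosure (PSRing k) ↥L))) =
            Subtype.val '' (q : Set ↥(integralClosure (PSRing k) ↥L)) ∧
          (∀ b : ↥L, b ∈ integralClosure (PSRing k) ↥L →
            σ b - b ∈ Subtype.val '' (q : Set ↥(integralClosure (PSRing k) ↥L)))) →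
        letI : Algebra (PSRing k) ↥M :=
          ((algebraMap (PSField k) ↥M).comp (algebraMap (PSRing k) (PSField k))).toAlgebra
        Nat.card {Q : Ideal ↥(integralClosure (PSRing k) ↥M) //
            Q.IsPrime ∧
            ((fun c : ↥(integralClosure (PSRing k) ↥M) => ((c : ↥M) : PSClosure k)) ''
                (Q : Set ↥(integralClosure (PSRing k) ↥M))) ∩
              Set.range (fun b : ↥(integralClosure (PSRing k) ↥L) =>
                ((b : ↥L) : PSClosure k)) =
              ((fun b : ↥(integralClosure (PSRing k) ↥L) => ((b : ↥L) : PSClosure k)) ''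
                (q : Set ↥(integralClosure (PSRing k) ↥L)))} =
          IntermediateField.relfinrank L M)

section Induced

variable {Γ : Type} [Group Γ] {H : Subgroup Γ} {S Ω : Type} [CommRing S] [Field Ω]
  [MulSemiringAction H S]

/-- Functions on `Γ` with values in `j(S)` that are `H`-equivariant for right translation. -/
def inducedRing (H : Subgroup Γ) [MulSemiringAction H S] (j : S →+* Ω) : Subring (Γ → Ω) where
  carrier := {a | ∃ b : Γ → S, (∀ θ (h : H), b (θ * h) = h⁻¹ • b θ) ∧ ∀ θ, a θ = j (b θ)}
  mul_mem' := by
    rintro a a' ⟨b, hb, h⟩ ⟨b', hb', h'⟩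
    exact ⟨b * b', by simp [hb, hb', smul_mul'], by simp [h, h']⟩
  one_mem' := ⟨1, by simp, by simp⟩
  add_mem' := by
    rintro a a' ⟨b, hb, h⟩ ⟨b', hb', h'⟩
    exact ⟨b + b', by simp [hb, hb'], by simp [h, h']⟩
  zero_mem' := ⟨0, by simp, by simp⟩
  neg_mem' := by
    rintro a ⟨b, hb, h⟩
    exact ⟨-b, by simp [hb], by simp [h]⟩

open Classical in
/-- The function supported on `θ₀ H` with value `s` at `θ₀`. -/
noncomputable def inducedSingle (H : Subgroup Γ) [MulSemiringAction H S] (θ₀ : Γ) (s : S)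
    (θ : Γ) : S :=
  if h : θ₀⁻¹ * θ ∈ H then (⟨θ₀⁻¹ * θ, h⟩ : H)⁻¹ • s else 0

lemma inducedSingle_equivariant (θ₀ : Γ) (s : S) (θ : Γ) (h : H) :
    inducedSingle H θ₀ s (θ * h) = h⁻¹ • inducedSingle H θ₀ s θ := by
  unfold inducedSingle
  by_cases h1 : θ₀⁻¹ * θ ∈ H
  · have h2 : θ₀⁻¹ * (θ * h) ∈ H := by
      rw [← mul_assoc]; exact H.mul_mem h1 h.2
    rw [dif_pos h1, dif_pos h2, ← mul_smul]
    congr 1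
    ext; simp [mul_assoc]
  · have h2 : θ₀⁻¹ * (θ * h) ∉ H := by
      rw [← mul_assoc]; exact fun h3 => h1 ((H.mul_mem_cancel_right h.2).1 h3)
    rw [dif_neg h1, dif_neg h2, smul_zero]

lemma inducedSingle_mem (j : S →+* Ω) (θ₀ : Γ) (s : S) :
    (fun θ => j (inducedSingle H θ₀ s θ)) ∈ inducedRing H j :=
  ⟨inducedSingle H θ₀ s, inducedSingle_equivariant θ₀ s, fun _ => rfl⟩

lemma inducedSingle_self (θ₀ : Γ) (s : S) : inducedSingle H θ₀ s θ₀ = s := by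
  unfold inducedSingle
  rw [dif_pos (by simp)]
  have : (⟨θ₀⁻¹ * θ₀, by simp⟩ : H) = 1 := by ext; simp
  rw [this]; simp

lemma exists_mem_inducedRing_ne [FaithfulSMul H S] [Nontrivial S] (j : S →+* Ω)
    (hj : Function.Injective j) {θ θ' : Γ} (hne : θ ≠ θ') :
    ∃ a ∈ inducedRing H j, a θ ≠ a θ' := by
  by_cases h1 : θ⁻¹ * θ' ∈ H
  · have h2 : (⟨θ⁻¹ * θ', h1⟩ : H)⁻¹ ≠ 1 := by
      intro h
      rw [inv_eq_one] at h
      have := congrArg Subtype.val h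
      simp only [OneMemClass.coe_one] at this
      exact hne (inv_mul_eq_one.1 this)
    obtain ⟨s, hs⟩ : ∃ s : S, (⟨θ⁻¹ * θ', h1⟩ : H)⁻¹ • s ≠ s := by
      by_contra! hcon
      exact h2 (FaithfulSMul.eq_of_smul_eq_smul (α := S) fun s => by rw [hcon s, one_smul])
    refine ⟨_, inducedSingle_mem j θ s, ?_⟩
    simp only [inducedSingle_self]
    intro h
    apply hs
    have := hj h
    conv_rhs => rw [this]
    unfold inducedSingle
    rw [dif_pos h1]
  · refine ⟨_, inducedSingle_mem j θ 1, ?_⟩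
    simp only [inducedSingle_self]
    unfold inducedSingle
    rw [dif_neg h1]
    simp

lemma span_eq_top_of_separates {X : Type} [Finite X] (N : Subring (X → Ω))
    (h : ∀ x y, x ≠ y → ∃ a ∈ N, a x ≠ a y) :
    Submodule.span Ω (N : Set (X → Ω)) = ⊤ := by
  classical
  cases nonempty_fintype X
  let P : Subalgebra Ω (X → Ω) := Algebra.adjoin Ω (N : Set (X → Ω))
  have hP : Submodule.span Ω (N : Set (X → Ω)) = Subalgebra.toSubmodule P := by
    rw [Algebra.adjoin_eq_span]
    congr 1
    exact (congrArg SetLike.coe (Submonoid.closure_eq N.toSubmonoid)).symm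
  rw [hP]
  have key : ∀ x, Pi.single x (1 : Ω) ∈ P := by
    intro x
    have h' : ∀ y, ∃ a ∈ P, a x = 1 ∧ (y ≠ x → a y = 0) := by
      intro y
      by_cases hy : y = x
      · exact ⟨1, P.one_mem, rfl, fun h => (h hy).elim⟩
      · obtain ⟨a, ha, hxy⟩ := h x y (Ne.symm hy)
        have ha' : a ∈ P := Algebra.subset_adjoin ha
        refine ⟨(a x - a y)⁻¹ • (a - algebraMap Ω _ (a y)),
          P.smul_mem (P.sub_mem ha' (P.algebraMap_mem _)) _, ?_, fun _ => ?_⟩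
        · simp [inv_mul_cancel₀ (sub_ne_zero.2 hxy)]
        · simp
    choose a ha h1 h2 using h'
    have : Pi.single x (1 : Ω) = ∏ y ∈ Finset.univ.erase x, a y := by
      ext z
      rw [Finset.prod_apply]
      by_cases hz : z = x
      · subst hz; simp [h1]
      · rw [Pi.single_eq_of_ne hz]
        exact (Finset.prod_eq_zero (f := fun c => a c z) (Finset.mem_erase.2 ⟨hz, Finset.mem_univ z⟩) (h2 z hz)).symm
    rw [this]
    exact P.prod_mem fun y _ => ha y
  rw [eq_top_iff]
  intro v _
  have : v = ∑ x, v x • Pi.single x (1 : Ω) := by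
    ext z; simp [Finset.sum_apply, Pi.single_apply]
  rw [this]
  exact Submodule.sum_mem _ fun x _ => Submodule.smul_mem _ _ (key x)

lemma exists_basis_of_span {X : Type} [Fintype X] (s : Set (X → Ω))
    (h : Submodule.span Ω s = ⊤) : ∃ b : Module.Basis X Ω (X → Ω), ∀ x, b x ∈ s := by
  obtain ⟨t, hts, hspan, hli⟩ := exists_linearIndependent Ω s
  let b₀ : Module.Basis t Ω (X → Ω) :=
    Module.Basis.mk hli (by rw [Subtype.range_coe, hspan, h])
  let e : t ≃ X := b₀.indexEquiv (Pi.basisFun Ω X)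
  refine ⟨b₀.reindex e, fun x => ?_⟩
  simp [b₀]
  exact hts (e.symm x).2

lemma exists_basis_inducedRing [Fintype Γ] [FaithfulSMul H S] [Nontrivial S] (j : S →+* Ω)
    (hj : Function.Injective j) :
    ∃ b : Module.Basis Γ Ω (Γ → Ω), ∀ x, b x ∈ inducedRing H j :=
  exists_basis_of_span _
    (span_eq_top_of_separates _ fun _ _ => exists_mem_inducedRing_ne j hj)

/-- Left translation by `γ` on functions on `Γ`. -/
lemma inducedRing_translate (j : S →+* Ω) {a : Γ → Ω} (ha : a ∈ inducedRing H j) (γ : Γ) :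
    (fun θ => a (γ⁻¹ * θ)) ∈ inducedRing H j := by
  obtain ⟨b, hb, h⟩ := ha
  exact ⟨fun θ => b (γ⁻¹ * θ), fun θ h => by simp only [← mul_assoc, hb], fun θ => h _⟩

end Induced

section Glue

variable {K Ω : Type} [Field K] [Field Ω] [Algebra K Ω] {K₁ K₂ : IntermediateField K Ω}
  {Γ : Type} [Group Γ] {H₁ H₂ : Subgroup Γ}
  (S₁ : IntermediateField K₁ Ω) (S₂ : IntermediateField K₂ Ω)
  [MulSemiringAction H₁ S₁] [MulSemiringAction H₂ S₂]

lemma inducedRing_mul_apply_eq_zero {H : Subgroup Γ} {S : Type} [Field S] [MulSemiringAction H S]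
    (j : S →+* Ω) {a : Γ → Ω} (ha : a ∈ inducedRing H j) {θ : Γ} (h0 : a θ = 0)
    {h : Γ} (hh : h ∈ H) : a (θ * h) = 0 := by
  obtain ⟨b, hb, h⟩ := ha
  rw [h, hb θ ⟨_, hh⟩]
  rw [h, map_eq_zero] at h0
  rw [h0, smul_zero, map_zero]

lemma inducedRing_inv {H : Subgroup Γ} {S : Type} [Field S] [MulSemiringAction H S]
    (j : S →+* Ω) {a : Γ → Ω} (ha : a ∈ inducedRing H j) : a⁻¹ ∈ inducedRing H j := by
  obtain ⟨b, hb, h⟩ := ha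
  exact ⟨b⁻¹, fun θ h => by
    have := smul_inv₀' h⁻¹ (b θ)
    simp [hb, this], fun θ => by simp [h]⟩

/-- The glued ring: functions equivariant for both subgroups. -/
def gluedRing (H₁ H₂ : Subgroup Γ) [MulSemiringAction H₁ S₁] [MulSemiringAction H₂ S₂] :
    Subring (Γ → Ω) :=
  inducedRing H₁ (algebraMap S₁ Ω) ⊓ inducedRing H₂ (algebraMap S₂ Ω)

variable {S₁ S₂}

lemma gluedRing_eq_zero (hH : H₁ ⊔ H₂ = ⊤) {a : Γ → Ω} (ha : a ∈ gluedRing S₁ S₂ H₁ H₂)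
    {θ : Γ} (h0 : a θ = 0) : a = 0 := by
  have key : ∀ g ∈ H₁ ⊔ H₂, ∀ θ, a θ = 0 → a (θ * g) = 0 := by
    intro g hg
    rw [Subgroup.sup_eq_closure] at hg
    induction hg using Subgroup.closure_induction'' with
    | one => simp
    | mem x hx =>
      rcases hx with hx | hx
      · exact fun θ h => inducedRing_mul_apply_eq_zero _ ha.1 h hx
      · exact fun θ h => inducedRing_mul_apply_eq_zero _ ha.2 h hx
    | inv_mem x hx =>
      rcases hx with hx | hx
      · exact fun θ h => inducedRing_mul_apply_eq_zero _ ha.1 h (H₁.inv_mem hx)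
      · exact fun θ h => inducedRing_mul_apply_eq_zero _ ha.2 h (H₂.inv_mem hx)
    | mul x y _ _ hx hy =>
      intro θ h
      rw [← mul_assoc]
      exact hy _ (hx _ h)
  ext g
  have := key (θ⁻¹ * g) (by rw [hH]; trivial) θ h0
  rwa [mul_inv_cancel_left] at this

lemma gluedRing_translate {a : Γ → Ω} (ha : a ∈ gluedRing S₁ S₂ H₁ H₂) (γ : Γ) :
    (fun θ => a (γ⁻¹ * θ)) ∈ gluedRing S₁ S₂ H₁ H₂ :=
  ⟨inducedRing_translate _ ha.1 γ, inducedRing_translate _ ha.2 γ⟩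

lemma const_mem_inducedRing {K₁ : IntermediateField K Ω} {S₁ : IntermediateField K₁ Ω}
    {H : Subgroup Γ} [MulSemiringAction H S₁]
    (hfix : ∀ (h : H) (c : K₁), h • algebraMap K₁ S₁ c = algebraMap K₁ S₁ c) {c : Ω}
    (hc : c ∈ K₁) : (fun _ => c) ∈ inducedRing H (algebraMap S₁ Ω) :=
  ⟨fun _ => algebraMap K₁ S₁ ⟨c, hc⟩, fun _ _ => (hfix _ _).symm, fun _ => rfl⟩

/-- The glued field with its group action. -/
theorem exists_gluedField (hH : H₁ ⊔ H₂ = ⊤) (hK : K₁ ⊓ K₂ = ⊥)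
    (hfix₁ : ∀ (h : H₁) (c : K₁), h • algebraMap K₁ S₁ c = algebraMap K₁ S₁ c)
    (hfix₂ : ∀ (h : H₂) (c : K₂), h • algebraMap K₂ S₂ c = algebraMap K₂ S₂ c)
    (hinv₁ : ∀ s : S₁, (∀ h : H₁, h • s = s) → (s : Ω) ∈ K₁)
    (hinv₂ : ∀ s : S₂, (∀ h : H₂, h • s = s) → (s : Ω) ∈ K₂) :
    ∃ (F : IntermediateField K Ω) (φ : Γ →* (F ≃ₐ[K] F)),
      (∀ x ∈ F, x ∈ S₁ ∧ x ∈ S₂) ∧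
      (∀ x : F, ∃ a ∈ gluedRing S₁ S₂ H₁ H₂, a 1 = x) ∧
      (∀ a ∈ gluedRing S₁ S₂ H₁ H₂, ∃ ha : a 1 ∈ F, ∀ γ, (φ γ ⟨a 1, ha⟩ : Ω) = a γ⁻¹) ∧
      (∀ x : F, (∀ γ, φ γ x = x) → ∃ c : K, algebraMap K F c = x) := by
  let N := gluedRing S₁ S₂ H₁ H₂
  have hconst : ∀ c : K, (fun _ => algebraMap K Ω c) ∈ N := fun c =>
    ⟨const_mem_inducedRing hfix₁ (K₁.algebraMap_mem c),
      const_mem_inducedRing hfix₂ (K₂.algebraMap_mem c)⟩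
  let F : IntermediateField K Ω :=
    { carrier := {ω | ∃ a ∈ N, a 1 = ω}
      mul_mem' := by
        rintro _ _ ⟨a, ha, rfl⟩ ⟨b, hb, rfl⟩
        exact ⟨a * b, N.mul_mem ha hb, rfl⟩
      one_mem' := ⟨1, N.one_mem, rfl⟩
      add_mem' := by
        rintro _ _ ⟨a, ha, rfl⟩ ⟨b, hb, rfl⟩
        exact ⟨a + b, N.add_mem ha hb, rfl⟩
      zero_mem' := ⟨0, N.zero_mem, rfl⟩
      algebraMap_mem' := fun c => ⟨_, hconst c, rfl⟩
      inv_mem' := by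
        rintro _ ⟨a, ha, rfl⟩
        exact ⟨a⁻¹, ⟨inducedRing_inv _ ha.1, inducedRing_inv _ ha.2⟩, rfl⟩ }
  have huniq : ∀ {a b : Γ → Ω}, a ∈ N → b ∈ N → a 1 = b 1 → a = b := by
    intro a b ha hb h
    exact sub_eq_zero.1 (gluedRing_eq_zero hH (N.sub_mem ha hb) (θ := 1) (by simp [h]))
  choose s hsN hs1 using fun x : F => x.2
  have hs : ∀ a (ha : a ∈ N), s ⟨a 1, ⟨a, ha, rfl⟩⟩ = a := fun a ha =>
    huniq (hsN _) ha (hs1 _)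
  let act : Γ → F → F := fun γ x => ⟨s x γ⁻¹, ⟨_, gluedRing_translate (hsN x) γ, by simp⟩⟩
  have hact : ∀ γ x, s (act γ x) = fun θ => s x (γ⁻¹ * θ) := fun γ x =>
    huniq (hsN _) (gluedRing_translate (hsN x) γ) (by rw [hs1]; simp [act])
  have s_add : ∀ x y, s (x + y) = s x + s y := fun x y =>
    huniq (hsN _) (N.add_mem (hsN _) (hsN _)) (by simp [hs1])
  have s_mul : ∀ x y, s (x * y) = s x * s y := fun x y =>
    huniq (hsN _) (N.mul_mem (hsN _) (hsN _)) (by simp [hs1])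
  have s_alg : ∀ c : K, s (algebraMap K F c) = fun _ => algebraMap K Ω c := fun c =>
    huniq (hsN _) (hconst c) (by simp [hs1])
  have act_one : ∀ x, act 1 x = x := fun x => Subtype.ext (by simp [act, hs1])
  have act_mul : ∀ γ δ x, act (γ * δ) x = act γ (act δ x) := fun γ δ x =>
    Subtype.ext (by change s x _ = s (act δ x) _; rw [hact]; simp)
  let φ₀ : Γ → (F ≃ₐ[K] F) := fun γ => AlgEquiv.ofRingEquiv (f :=
    { toFun := act γ
      invFun := act γ⁻¹
      left_inv := fun x => by rw [← act_mul, inv_mul_cancel, act_one]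
      right_inv := fun x => by rw [← act_mul, mul_inv_cancel, act_one]
      map_mul' := fun x y => Subtype.ext (by simp [act, s_mul])
      map_add' := fun x y => Subtype.ext (by simp [act, s_add]) })
    (fun c => Subtype.ext (by simp [act, s_alg]))
  let φ : Γ →* (F ≃ₐ[K] F) :=
    { toFun := φ₀
      map_one' := AlgEquiv.ext act_one
      map_mul' := fun γ δ => AlgEquiv.ext (act_mul γ δ) }
  refine ⟨F, φ, ?_, fun x => x.2, fun a ha => ⟨⟨a, ha, rfl⟩, fun γ => ?_⟩, fun x hx => ?_⟩
  · rintro _ ⟨a, ⟨⟨b, _, h⟩, ⟨b', _, h'⟩⟩, rfl⟩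
    exact ⟨by rw [h]; exact (b 1).2, by rw [h']; exact (b' 1).2⟩
  · change s _ γ⁻¹ = _
    rw [hs a ha]
  · have hc : ∀ γ, s x γ = x := fun γ => by
      have := congrArg Subtype.val (hx γ⁻¹)
      change s x _ = _ at this
      rwa [inv_inv] at this
    obtain ⟨⟨b, hb, h⟩, ⟨b', hb', h'⟩⟩ := hsN x
    have hb1 : ∀ θ, b θ = b 1 := fun θ => by
      have := (h θ).symm.trans ((hc θ).trans ((hc 1).symm.trans (h 1)))
      exact (algebraMap S₁ Ω).injective this
    have hb2 : ∀ θ, b' θ = b' 1 := fun θ => by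
      have := (h' θ).symm.trans ((hc θ).trans ((hc 1).symm.trans (h' 1)))
      exact (algebraMap S₂ Ω).injective this
    have m1 : (x : Ω) ∈ K₁ := by
      rw [← hc 1, h 1]
      refine hinv₁ _ fun g => ?_
      have := hb 1 g⁻¹
      rw [inv_inv, hb1] at this
      exact this.symm
    have m2 : (x : Ω) ∈ K₂ := by
      rw [← hc 1, h' 1]
      refine hinv₂ _ fun g => ?_
      have := hb' 1 g⁻¹
      rw [inv_inv, hb2] at this
      exact this.symm
    have : (x : Ω) ∈ (⊥ : IntermediateField K Ω) := by
      rw [← hK]; exact ⟨m1, m2⟩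
    obtain ⟨c, hc⟩ := IntermediateField.mem_bot.1 this
    exact ⟨c, Subtype.ext hc⟩

/-- Artin's theorem for an injective action by algebra automorphisms. -/
theorem isGalois_of_faithful_of_fixed {K F : Type} [Field K] [Field F] [Algebra K F]
    {Γ : Type} [Group Γ] [Finite Γ] (φ : Γ →* (F ≃ₐ[K] F))
    (hfix : ∀ x : F, (∀ γ, φ γ x = x) → ∃ c : K, algebraMap K F c = x) :
    IsGalois K F ∧ FiniteDimensional K F ∧ Function.Surjective φ := by
  let : MulSemiringAction Γ F := MulSemiringAction.compHom F φ
  let P : Subgroup (F ≃ₐ[K] F) := φ.range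
  have : Finite P := Finite.of_surjective φ.rangeRestrict φ.rangeRestrict_surjective
  have hP : IntermediateField.fixedField P = ⊥ := by
    rw [eq_bot_iff]
    intro x hx
    obtain ⟨c, hc⟩ := hfix x fun γ => hx ⟨φ γ, γ, rfl⟩
    exact IntermediateField.mem_bot.2 ⟨c, hc⟩
  have hfd0 : FiniteDimensional (FixedPoints.subfield P F) F := inferInstance
  have hfd : FiniteDimensional (IntermediateField.fixedField P) F := hfd0
  rw [hP] at hfd
  have hfdK : FiniteDimensional K F := by
    have := hfd
    exact FiniteDimensional.trans K (⊥ : IntermediateField K F) F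
  have hgal : IsGalois K F := by
    rw [isGalois_iff_isGalois_bot.symm, ← hP]
    have := hfdK
    exact (inferInstance : IsGalois (FixedPoints.subfield P F) F)
  refine ⟨hgal, hfdK, ?_⟩
  rw [← MonoidHom.range_eq_top]
  have := IntermediateField.fixingSubgroup_fixedField (F := K) (E := F) P
  rw [hP, IntermediateField.fixingSubgroup_bot] at this
  exact this.symm

end Glue

section BaseChange

open IntermediateField

theorem exists_baseChange_action {K Ω M : Type} [Field K] [Field Ω] [Algebra K Ω] [Field M]
    [Algebra K M] [IsGalois K M] [FiniteDimensional K M] {K₁ K₂ : IntermediateField K Ω}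
    (hK : K₁ ⊓ K₂ = ⊥) (i : M →ₐ[K] Ω) (hi : ∀ m, i m ∈ K₁)
    (S₂ : IntermediateField K₂ Ω) (hS : S₂ = adjoin K₂ (Set.range i)) :
    IsGalois K₂ S₂ ∧ FiniteDimensional K₂ S₂ ∧ ∃ hm : ∀ m, i m ∈ S₂,
      ∃ e : (M ≃ₐ[K] M) ≃* (S₂ ≃ₐ[K₂] S₂), ∀ σ m, (e σ ⟨i m, hm m⟩ : Ω) = i (σ m) := by
  have hm : ∀ m, i m ∈ S₂ := fun m => by
    rw [hS]; exact subset_adjoin K₂ _ ⟨m, rfl⟩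
  obtain ⟨T, hT₁, hT₂⟩ := IsGalois.is_separable_splitting_field K M
  let T' := T.map (algebraMap K K₂)
  have hsplit : (T'.map (algebraMap K₂ Ω)).Splits := by
    rw [Polynomial.map_map, ← IsScalarTower.algebraMap_eq, ← i.comp_algebraMap, ← Polynomial.map_map]
    exact hT₂.splits'.map _
  have hroots : T'.rootSet Ω = i '' T.rootSet M := by
    have h1 : T'.rootSet Ω = T.rootSet Ω := by simp [Set.ext_iff, Polynomial.mem_rootSet', T']
    rw [h1]
    exact (hT₂.splits'.image_rootSet i).symm
  have hS' : S₂ = adjoin K₂ (T'.rootSet Ω) := by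
    rw [hS, hroots]
    apply le_antisymm
    · rw [adjoin_le_iff]
      rintro _ ⟨m, rfl⟩
      have hmT : m ∈ Algebra.adjoin K (T.rootSet M) := by
        rw [hT₂.adjoin_rootSet']; trivial
      change i m ∈ (adjoin K₂ (i '' T.rootSet M)).restrictScalars K
      induction hmT using Algebra.adjoin_induction with
      | mem x hx => exact subset_adjoin K₂ _ ⟨x, hx, rfl⟩
      | algebraMap r => rw [i.commutes]; exact IntermediateField.algebraMap_mem _ r
      | add x y _ _ hx hy => rw [map_add]; exact add_mem hx hy
      | mul x y _ _ hx hy => rw [map_mul]; exact mul_mem hx hy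
    · exact adjoin.mono _ _ _ (Set.image_subset_range _ _)
  have hSF : T'.IsSplittingField K₂ S₂ := by
    rw [hS']
    exact adjoin_rootSet_isSplittingField hsplit
  have hgal : IsGalois K₂ S₂ := IsGalois.of_separable_splitting_field (p := T') hT₁.map
  have hfd : FiniteDimensional K₂ S₂ := Polynomial.IsSplittingField.finiteDimensional S₂ T'
  refine ⟨hgal, hfd, hm, ?_⟩
  let ι : M →ₐ[K] S₂ := 
    { toFun := fun m => ⟨i m, hm m⟩
      map_one' := Subtype.ext (map_one i)
      map_mul' := fun x y => Subtype.ext (map_mul i x y)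
      map_zero' := Subtype.ext (map_zero i)
      map_add' := fun x y => Subtype.ext (map_add i x y)
      commutes' := fun r => Subtype.ext (i.commutes r) }
  letI : Algebra M S₂ := ι.toRingHom.toAlgebra
  haveI : IsScalarTower K M S₂ := IsScalarTower.of_algebraMap_eq fun x => (ι.commutes x).symm
  let ρ := restrictRestrictAlgEquivMapHom K M K₂ S₂
  have hρ : ∀ (φ : S₂ ≃ₐ[K₂] S₂) (m : M), ι (ρ φ m) = φ (ι m) := fun φ m =>
    AlgEquiv.restrictNormal_commutes (MulSemiringAction.toAlgAut (S₂ ≃ₐ[K₂] S₂) K S₂ φ) M m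
  have hinj : Function.Injective ρ := by
    refine (injective_iff_map_eq_one _).mpr fun φ hφ => ?_
    have h1 : ∀ m, φ (ι m) = ι m := fun m => by rw [← hρ, hφ]; rfl
    have h2 : S₂ ≤ (IntermediateField.fixedField (Subgroup.zpowers φ)).map S₂.val := by
      conv_lhs => rw [hS]
      rw [adjoin_le_iff]
      rintro _ ⟨m, rfl⟩
      refine ⟨ι m, ?_, rfl⟩
      rintro ⟨_, k, rfl⟩
      have : φ ∈ MulAction.stabilizer (S₂ ≃ₐ[K₂] S₂) (ι m) := h1 m
      exact (Subgroup.zpow_mem _ this k)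
    ext x
    obtain ⟨y, hy, hyx⟩ := h2 x.2
    have : y = x := Subtype.ext hyx
    rw [this] at hy
    exact congrArg Subtype.val (hy ⟨φ, Subgroup.mem_zpowers φ⟩)
  have hsurj : Function.Surjective ρ := by
    suffices fixedField ρ.range = ⊥ from
      MonoidHom.range_eq_top.mp <| fixingSubgroup_fixedField ρ.range ▸ this ▸ fixingSubgroup_bot
    refine eq_bot_iff.mpr fun x hx => ?_
    obtain ⟨y, hy⟩ : ι x ∈ Set.range (algebraMap K₂ S₂) := by
      refine mem_bot.mp <| (IsGalois.mem_bot_iff_fixed _).mpr fun φ => ?_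
      rw [← hρ]
      exact congrArg ι (hx ⟨ρ φ, φ, rfl⟩)
    have hy' : (y : Ω) = i x := congrArg Subtype.val hy
    have hz : i x ∈ (⊥ : IntermediateField K Ω) := by
      rw [← hK]; exact ⟨hi x, hy' ▸ y.2⟩
    obtain ⟨z, hz⟩ := mem_bot.1 hz
    exact mem_bot.2 ⟨z, i.injective ((i.commutes z).trans hz)⟩
  let e := (MulEquiv.ofBijective ρ ⟨hinj, hsurj⟩).symm
  refine ⟨e, fun σ m => ?_⟩
  have h := hρ (e σ) m
  have h2 : ρ (e σ) = σ := (MulEquiv.ofBijective ρ ⟨hinj, hsurj⟩).apply_symm_apply σ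
  rw [h2] at h
  exact (congrArg Subtype.val h).symm

end BaseChange

section ConjPoly
open Polynomial

/-- The monic polynomial with the given family of roots. -/
noncomputable def conjPoly {Δ R : Type} [CommRing R] (u : Δ → R) : R[X] :=
  ∏ᶠ δ, (X - C (u δ))

variable {Δ R : Type} [Finite Δ] [CommRing R]

lemma conjPoly_eq_prod {Δ : Type} [Fintype Δ] (u : Δ → R) : conjPoly u = ∏ δ, (X - C (u δ)) :=
  finprod_eq_prod_of_fintype _

lemma map_conjPoly {R' : Type} [CommRing R'] (φ : R →+* R') (u : Δ → R) :
    (conjPoly u).map φ = conjPoly (fun δ => φ (u δ)) := by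
  cases nonempty_fintype Δ
  simp [conjPoly_eq_prod, Polynomial.map_prod]

lemma conjPoly_comp_equiv {Δ' : Type} [Finite Δ'] (e : Δ' ≃ Δ) (u : Δ → R) :
    conjPoly (fun δ => u (e δ)) = conjPoly u := by
  cases nonempty_fintype Δ
  cases nonempty_fintype Δ'
  simp only [conjPoly_eq_prod]
  exact e.prod_comp (fun δ => X - C (u δ))

/-- Coefficients of `conjPoly` depend on the roots modulo an ideal. -/
lemma conjPoly_coeff_sub (P : Subring R) (c : R) (hc : c ∈ P) (u v r : Δ → R)
    (hv : ∀ δ, v δ ∈ P) (hr : ∀ δ, r δ ∈ P) (h : ∀ δ, u δ = v δ + c * r δ) (n : ℕ) :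
    ∃ ρ ∈ P, (conjPoly u).coeff n = (conjPoly v).coeff n + c * ρ := by
  have hu : ∀ δ, u δ ∈ P := fun δ => by
    rw [h]; exact P.add_mem (hv δ) (P.mul_mem hc (hr δ))
  let u' : Δ → P := fun δ => ⟨u δ, hu δ⟩
  let v' : Δ → P := fun δ => ⟨v δ, hv δ⟩
  let c' : P := ⟨c, hc⟩
  have h1 : (conjPoly u).coeff n = ((conjPoly u').coeff n : P) := by
    rw [← Subring.subtype_apply, ← coeff_map, map_conjPoly]; rfl
  have h2 : (conjPoly v).coeff n = ((conjPoly v').coeff n : P) := by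
    rw [← Subring.subtype_apply, ← coeff_map, map_conjPoly]; rfl
  have h3 : (conjPoly u').map (Ideal.Quotient.mk (Ideal.span {c'})) =
      (conjPoly v').map (Ideal.Quotient.mk (Ideal.span {c'})) := by
    rw [map_conjPoly, map_conjPoly]
    congr 1
    ext δ
    rw [Ideal.Quotient.eq, Ideal.mem_span_singleton]
    exact ⟨⟨r δ, hr δ⟩, Subtype.ext (by simp [u', v', c', h])⟩
  have h4 := congrArg (fun q => q.coeff n) h3
  simp only [coeff_map] at h4
  rw [Ideal.Quotient.eq, Ideal.mem_span_singleton] at h4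
  obtain ⟨ρ, hρ⟩ := h4
  refine ⟨ρ, ρ.2, ?_⟩
  rw [h1, h2, sub_eq_iff_eq_add.1 hρ]
  simp [c', add_comm]

lemma conjPoly_natDegree [Nontrivial R] (u : Δ → R) : (conjPoly u).natDegree = Nat.card Δ := by
  cases nonempty_fintype Δ
  rw [conjPoly_eq_prod, natDegree_prod_of_monic _ _ (fun _ _ => monic_X_sub_C _)]
  simp

lemma conjPoly_monic (u : Δ → R) : (conjPoly u).Monic := by
  cases nonempty_fintype Δ
  rw [conjPoly_eq_prod]
  exact monic_prod_of_monic _ _ (fun _ _ => monic_X_sub_C _)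

lemma conjPoly_eval (u : Δ → R) (δ : Δ) : (conjPoly u).eval (u δ) = 0 := by
  cases nonempty_fintype Δ
  rw [conjPoly_eq_prod, eval_prod]
  exact Finset.prod_eq_zero (Finset.mem_univ δ) (by simp)

lemma conjPoly_zero [Nontrivial R] : conjPoly (fun _ : Δ => (0 : R)) = X ^ Nat.card Δ := by
  cases nonempty_fintype Δ
  simp [conjPoly_eq_prod]

lemma conjPoly_smul_coeff [IsDomain R] (s : R) (u : Δ → R) (n : ℕ) :
    (conjPoly fun δ => s * u δ).coeff n = s ^ (Nat.card Δ - n) * (conjPoly u).coeff n := by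
  have : conjPoly (fun δ => s * u δ) = (conjPoly u).scaleRoots s := by
    cases nonempty_fintype Δ
    rw [conjPoly_eq_prod, conjPoly_eq_prod]
    classical
    have : ∀ t : Finset Δ, ∏ δ ∈ t, (X - C (s * u δ)) = (∏ δ ∈ t, (X - C (u δ))).scaleRoots s := by
      intro t
      induction t using Finset.induction_on with
      | empty => simp
      | insert a t ha ih =>
        rw [Finset.prod_insert ha, Finset.prod_insert ha, ih, mul_scaleRoots_of_noZeroDivisors]
        congr 1
        ext n
        rw [coeff_scaleRoots, natDegree_X_sub_C]
        rcases n with _ | _ | n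
        · simp [mul_comm]
        · simp [coeff_C]
        · simp [coeff_X, coeff_C]
    exact this _
  rw [this, coeff_scaleRoots, conjPoly_natDegree, mul_comm]

open Classical in
lemma conjPoly_extend_zero [Nontrivial R] {Δ' : Type} [Finite Δ'] (ι : Δ' → Δ)
    (hι : Function.Injective ι)
    (u : Δ' → R) (v : Δ → R) (h : ∀ δ, v (ι δ) = u δ) (h0 : ∀ δ, δ ∉ Set.range ι → v δ = 0) :
    conjPoly v = X ^ (Nat.card Δ - Nat.card Δ') * conjPoly u := by
  cases nonempty_fintype Δ
  cases nonempty_fintype Δ'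
  rw [conjPoly_eq_prod, conjPoly_eq_prod,
    ← Finset.prod_mul_prod_compl (Finset.univ.image ι), mul_comm]
  congr 1
  · rw [Finset.prod_congr rfl (g := fun _ => (X : R[X]))]
    · rw [Finset.prod_const, Finset.card_compl, Finset.card_image_of_injective _ hι]
      simp
    · intro x hx
      rw [h0 x (by simpa using hx)]; simp
  · rw [Finset.prod_image (fun _ _ _ _ h => hι h)]
    simp [h]

end ConjPoly

section PatchData

/-- Fields `K₁, K₂` over `K` inside `Ω`, together with a subring `R` of `K₂`, for which patching
over `K` works and such that `R ∩ K` is close to `A` at the primes dividing `D`. -/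
structure PatchData (A : Type) {K Ω : Type} [CommRing A] [Field K] [Field Ω] [Algebra A K]
    [Algebra K Ω] (K₁ K₂ : IntermediateField K Ω) (R : Subring Ω) (D : A) : Prop where
  inf_eq : K₁ ⊓ K₂ = ⊥
  mem_of_mem : ∀ r ∈ R, r ∈ K₂
  algebraMap_mem : ∀ a : A, algebraMap K Ω (algebraMap A K a) ∈ R
  split : ∀ (ι : Type) [Fintype ι] [DecidableEq ι] (T : Matrix ι ι Ω), IsUnit T.det →
    ∀ w : ι → Ω, ∃ a r : ι → Ω, (∀ x, a x ∈ K₁) ∧ (∀ x, r x ∈ R) ∧ w = T.mulVec a + r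
  exists_nonunit : ∃ τ : A, τ ≠ 0 ∧ (algebraMap K Ω (algebraMap A K τ))⁻¹ ∉ R
  local_mem : ∀ p : Ideal A, p.IsPrime → D ∈ p → ¬ p.IsMaximal → ∀ c : K, algebraMap K Ω c ∈ R →
    ∃ s ∉ p, ∃ b : A, algebraMap A K s * c = algebraMap A K b

variable {A K Ω M : Type} [CommRing A] [IsDomain A] [IsIntegrallyClosed A] [Field K] [Field Ω]
  [Algebra A K] [IsFractionRing A K] [Algebra K Ω] [Field M] [Algebra K M]
  [IsGalois K M] [FiniteDimensional K M] {K₁ K₂ : IntermediateField K Ω} {R : Subring Ω} {D : A}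

lemma exists_trace_conductor (pd : PatchData A K₁ K₂ R D) [Algebra A M] [IsScalarTower A K M]
    (i : M →ₐ[K] Ω)
    (S₂ : IntermediateField K₂ Ω) (hm : ∀ m, i m ∈ S₂)
    (e : (M ≃ₐ[K] M) ≃* (S₂ ≃ₐ[K₂] S₂)) (he : ∀ σ m, (e σ ⟨i m, hm m⟩ : Ω) = i (σ m)) :
    ∃ δ : A, δ ≠ 0 ∧
      ∀ ω ∈ Subring.closure ((R : Set Ω) ∪ i '' {m | IsIntegral A m}), ∀ κ : K,
        algebraMap K Ω κ = algebraMap K Ω (algebraMap A K (D * δ)) * ω →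
        ∃ ρ : K, κ = algebraMap A K D * ρ ∧ algebraMap K Ω ρ ∈ R := by
  classical
  obtain ⟨z₀, hz₀⟩ := Algebra.trace_surjective K M 1
  haveI : Algebra.IsAlgebraic A K := (IsFractionRing.comap_isAlgebraic_iff (A := A) (K := K) (C := K)).2 inferInstance
  haveI : Algebra.IsAlgebraic A M := Algebra.IsAlgebraic.trans A K M
  obtain ⟨y, hy0, hy⟩ := (Algebra.IsAlgebraic.isAlgebraic (R := A) z₀).exists_integral_multiple
  set z := y • z₀ with hz
  have tr_int : ∀ c : M, IsIntegral A c → ∃ a : A, algebraMap A K a = Algebra.trace K M c :=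
    fun c hc => IsIntegrallyClosed.isIntegral_iff.1 (Algebra.isIntegral_trace hc)
  have htrz : Algebra.trace K M z = algebraMap A K y := by
    rw [hz, ← IsScalarTower.algebraMap_smul K y z₀, map_smul, hz₀, smul_eq_mul, mul_one]
  have hT : ∀ ω ∈ Subring.closure ((R : Set Ω) ∪ i '' {m | IsIntegral A m}),
      ∃ hω : ω ∈ S₂, ((∑ σ, e σ (⟨ω, hω⟩ * ⟨i z, hm z⟩) : S₂) : Ω) ∈ R := by
    intro ω hω
    rw [Subring.mem_closure_iff] at hω
    have hmon : ∀ x ∈ Submonoid.closure ((R : Set Ω) ∪ i '' {m | IsIntegral A m}),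
        ∃ r ∈ R, ∃ c, IsIntegral A c ∧ x = r * i c := by
      intro x hx
      induction hx using Submonoid.closure_induction with
      | mem x hx =>
        rcases hx with hx | ⟨c, hc, rfl⟩
        · exact ⟨x, hx, 1, isIntegral_one, by simp⟩
        · exact ⟨1, R.one_mem, c, hc, by simp⟩
      | one => exact ⟨1, R.one_mem, 1, isIntegral_one, by simp⟩
      | mul x y _ _ hx hy =>
        obtain ⟨r, hr, c, hc, rfl⟩ := hx
        obtain ⟨r', hr', c', hc', rfl⟩ := hy
        exact ⟨r * r', R.mul_mem hr hr', c * c', hc.mul hc', by rw [map_mul]; ring⟩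
    induction hω using AddSubgroup.closure_induction with
    | mem x hx =>
      obtain ⟨r, hr, c, hc, rfl⟩ := hmon x hx
      let r' : K₂ := ⟨r, pd.mem_of_mem r hr⟩
      have h1 : r * i c ∈ S₂ := S₂.mul_mem (S₂.algebraMap_mem r') (hm c)
      refine ⟨h1, ?_⟩
      have h2 : ∀ σ, e σ (⟨r * i c, h1⟩ * ⟨i z, hm z⟩) =
          algebraMap K₂ S₂ r' * e σ ⟨i (c * z), hm _⟩ := by
        intro σ
        rw [← (e σ).commutes r', ← map_mul]
        congr 1
        exact Subtype.ext (by
          change r * i c * i z = r * i (c * z)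
          rw [map_mul, mul_assoc])
      simp only [h2]
      rw [← Finset.mul_sum]
      obtain ⟨a, ha⟩ := tr_int (c * z) (hc.mul hy)
      have h3 : ((∑ σ, e σ ⟨i (c * z), hm _⟩ : S₂) : Ω) =
          algebraMap K Ω (algebraMap A K a) := by
        rw [ha, ← i.commutes, trace_eq_sum_automorphisms, map_sum]
        rw [IntermediateField.coe_sum]
        exact Finset.sum_congr rfl fun σ _ => he σ _
      rw [show ((algebraMap K₂ S₂ r' * ∑ σ, e σ ⟨i (c * z), hm _⟩ : S₂) : Ω) =
        r * ((∑ σ, e σ ⟨i (c * z), hm _⟩ : S₂) : Ω) from rfl, h3]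
      exact R.mul_mem hr (pd.algebraMap_mem a)
    | zero =>
      refine ⟨S₂.zero_mem, ?_⟩
      have : (⟨0, S₂.zero_mem⟩ : S₂) = 0 := rfl
      simp [this]
    | add x y _ _ hx hy =>
      obtain ⟨h1, h2⟩ := hx
      obtain ⟨h3, h4⟩ := hy
      refine ⟨S₂.add_mem h1 h3, ?_⟩
      have : (⟨x + y, S₂.add_mem h1 h3⟩ : S₂) = ⟨x, h1⟩ + ⟨y, h3⟩ := rfl
      simp only [this, add_mul, map_add, Finset.sum_add_distrib]
      exact R.add_mem h2 h4
    | neg x _ hx =>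
      obtain ⟨h1, h2⟩ := hx
      refine ⟨S₂.neg_mem h1, ?_⟩
      have : (⟨-x, S₂.neg_mem h1⟩ : S₂) = -⟨x, h1⟩ := rfl
      simp only [this, neg_mul, map_neg, Finset.sum_neg_distrib]
      exact R.neg_mem h2
  refine ⟨y, hy0, fun ω hω κ hκ => ?_⟩
  obtain ⟨hωS, hωR⟩ := hT ω hω
  by_cases hD : algebraMap A K D = 0
  · refine ⟨0, ?_, by simp⟩
    rw [mul_zero]
    apply (algebraMap K Ω).injective
    rw [hκ, map_mul (algebraMap A K), hD, zero_mul, map_zero, zero_mul]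
  refine ⟨κ / algebraMap A K D, by field_simp, ?_⟩
  have hyK : algebraMap A K y ≠ 0 := by simpa using hy0
  convert hωR using 1
  have hinj := (algebraMap K Ω).injective
  have hne : algebraMap K Ω (algebraMap A K (D * y)) ≠ 0 := by
    simpa using ⟨fun h => hD (by rw [h, map_zero]), hy0⟩
  let ck : K → S₂ := fun c => algebraMap K₂ S₂ (algebraMap K K₂ c)
  have h5 : ck κ = ck (algebraMap A K (D * y)) * ⟨ω, hωS⟩ := Subtype.ext hκ
  have h6 : ck κ * ∑ σ, e σ ⟨i z, hm z⟩ =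
      ck (algebraMap A K (D * y)) * ∑ σ, e σ (⟨ω, hωS⟩ * ⟨i z, hm z⟩) := by
    rw [Finset.mul_sum, Finset.mul_sum]
    refine Finset.sum_congr rfl fun σ _ => ?_
    have h7 : ∀ c, e σ (ck c) = ck c := fun c => (e σ).commutes _
    rw [← h7 κ, ← map_mul, h5, mul_assoc, map_mul, h7]
  have h8 : ((∑ σ, e σ ⟨i z, hm z⟩ : S₂) : Ω) = algebraMap K Ω (algebraMap A K y) := by
    rw [← htrz, ← i.commutes, trace_eq_sum_automorphisms, map_sum, IntermediateField.coe_sum]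
    exact Finset.sum_congr rfl fun σ _ => he σ _
  have h9 := congrArg Subtype.val h6
  change algebraMap K Ω κ * ((∑ σ, e σ ⟨i z, hm z⟩ : S₂) : Ω) =
    algebraMap K Ω (algebraMap A K (D * y)) *
      ((∑ σ, e σ (⟨ω, hωS⟩ * ⟨i z, hm z⟩) : S₂) : Ω) at h9
  rw [h8] at h9
  apply mul_left_cancel₀ hne
  rw [← h9, ← map_mul, ← map_mul]
  congr 1
  rw [map_mul]
  field_simp

end PatchData

section PatchCore

open Polynomial

/-- An elementwise criterion for the primes over `p` to have trivial decomposition groups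
inside `N`. -/
def SplitElt (A : Type) {K M Δ : Type} [CommRing A] [Field K] [Field M] [Algebra A K]
    [Algebra K M] [Group Δ] (e : Δ →* (M ≃ₐ[K] M)) (N : Subgroup Δ) (p : Ideal A) : Prop :=
  ∃ a : M, (∀ i, ∃ c : A, (conjPoly fun δ => e δ a).coeff i = algebraMap K M (algebraMap A K c)) ∧
    (∃ i < Nat.card Δ, ∃ c ∉ p,
      (conjPoly fun δ => e δ a).coeff i = algebraMap K M (algebraMap A K c)) ∧
    ∀ σ ∈ N, σ ≠ 1 → ∀ i < Nat.card Δ, ∃ c ∈ p,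
      (conjPoly fun δ => e δ (a * e σ a)).coeff i = algebraMap K M (algebraMap A K c)

lemma conjPoly_coeff_fixed {K M Δ : Type} [Field K] [Field M] [Algebra K M] [Group Δ] [Finite Δ]
    (e : Δ →* (M ≃ₐ[K] M)) (hfix : ∀ x : M, (∀ γ, e γ x = x) → ∃ c : K, algebraMap K M c = x)
    (a : M) (n : ℕ) : ∃ c : K, algebraMap K M c = (conjPoly fun δ => e δ a).coeff n := by
  refine hfix _ fun γ => ?_
  have h : (conjPoly fun δ => e δ a).map (e γ : M →+* M) = conjPoly fun δ => e δ a := by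
    rw [map_conjPoly, ← conjPoly_comp_equiv (Equiv.mulLeft γ) (fun δ => e δ a)]
    congr 1
    ext δ
    simp
  conv_rhs => rw [← h]
  rw [coeff_map]; rfl

variable {A K Ω M : Type} [CommRing A] [IsDomain A] [IsIntegrallyClosed A] [Field K] [Field Ω]
  [Algebra A K] [IsFractionRing A K] [Algebra K Ω] [Field M] [Algebra K M]
  [IsGalois K M] [FiniteDimensional K M] {K₁ K₂ : IntermediateField K Ω} {R : Subring Ω} {D : A}
  {Γ : Type} [Group Γ] [Finite Γ] {H₁ H₂ : Subgroup Γ}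

lemma const_smul_mem_inducedRing {K₁ : IntermediateField K Ω} {S₁ : IntermediateField K₁ Ω}
    {H : Subgroup Γ} [MulSemiringAction H S₁]
    (hfix : ∀ (h : H) (c : K₁), h • algebraMap K₁ S₁ c = algebraMap K₁ S₁ c) {c : Ω}
    (hc : c ∈ K₁) {a : Γ → Ω} (ha : a ∈ inducedRing H (algebraMap S₁ Ω)) :
    c • a ∈ inducedRing H (algebraMap S₁ Ω) :=
  Subring.mul_mem _ (const_mem_inducedRing hfix hc) ha

/-- Approximation of an `H₂`-equivariant function by a glued function. -/
lemma exists_gluedRing_approx [Fintype Γ] (pd : PatchData A K₁ K₂ R D)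
    {S₁ : IntermediateField K₁ Ω} {S₂ : IntermediateField K₂ Ω}
    [MulSemiringAction H₁ S₁] [MulSemiringAction H₂ S₂] [FaithfulSMul H₁ S₁]
    (hfix₁ : ∀ (h : H₁) (c : K₁), h • algebraMap K₁ S₁ c = algebraMap K₁ S₁ c)
    (hfix₂ : ∀ (h : H₂) (c : K₂), h • algebraMap K₂ S₂ c = algebraMap K₂ S₂ c)
    (ε : Module.Basis Γ Ω (Γ → Ω)) (hε : ∀ x, ε x ∈ inducedRing H₂ (algebraMap S₂ Ω))
    {α : Γ → Ω} (hα : α ∈ inducedRing H₂ (algebraMap S₂ Ω)) {δ : A} (hδ : δ ≠ 0) :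
    ∃ r : Γ → Ω, (∀ x, r x ∈ R) ∧
      (fun θ => α θ - algebraMap K Ω (algebraMap A K δ) * ∑ x, r x * ε x θ) ∈
        gluedRing S₁ S₂ H₁ H₂ := by
  classical
  obtain ⟨b, hb⟩ := exists_basis_inducedRing (H := H₁) (algebraMap S₁ Ω)
    (algebraMap S₁ Ω).injective
  set d : Ω := algebraMap K Ω (algebraMap A K δ) with hd
  have hd0 : d ≠ 0 := by simpa [hd] using hδ
  let ε' := ε.isUnitSMul (fun _ => IsUnit.mk0 d hd0)
  have hε' : ∀ x, ε' x = d • ε x := fun x => Module.Basis.isUnitSMul_apply _ _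
  obtain ⟨a, r, ha, hr, h⟩ := pd.split Γ (ε'.toMatrix b)
    ((Matrix.isUnit_iff_isUnit_det _).1 (by
      letI := ε'.invertibleToMatrix b
      exact isUnit_of_invertible _))
    (fun x => ε'.repr α x)
  have key : α = ∑ y, a y • b y + d • ∑ x, r x • ε x := by
    have h1 : α = ∑ x, ε'.repr α x • ε' x := (ε'.sum_repr α).symm
    have h2 : ∀ x, ε'.repr α x = (ε'.toMatrix b).mulVec a x + r x := fun x => congrFun h x
    simp only [h2, add_smul, Finset.sum_add_distrib] at h1
    rw [h1]
    congr 1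
    · simp only [Matrix.mulVec, dotProduct, Finset.sum_smul]
      rw [Finset.sum_comm]
      refine Finset.sum_congr rfl fun y _ => ?_
      simp only [mul_comm _ (a y), mul_smul]
      rw [← Finset.smul_sum, ε'.sum_toMatrix_smul_self]
    · simp only [hε', Finset.smul_sum]
      exact Finset.sum_congr rfl fun x _ => smul_comm _ _ _
  have key2 : (fun θ => α θ - d * ∑ x, r x * ε x θ) = α - d • ∑ x, r x • ε x := by
    ext θ; simp [Finset.sum_apply]
  refine ⟨r, hr, ?_⟩
  rw [key2]
  constructor
  · rw [show α - d • ∑ x, r x • ε x = ∑ y, a y • b y from sub_eq_of_eq_add key]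
    exact Subring.sum_mem _ fun y _ => const_smul_mem_inducedRing hfix₁ (ha y) (hb y)
  · refine Subring.sub_mem _ hα (const_smul_mem_inducedRing hfix₂ (K₂.algebraMap_mem _) ?_)
    exact Subring.sum_mem _ fun x _ =>
      const_smul_mem_inducedRing hfix₂ (pd.mem_of_mem _ (hr x)) (hε x)

/-- A matrix congruent to `1` modulo a non-unit is invertible. -/
lemma det_one_sub_ne_zero [Fintype Γ] [DecidableEq Γ] (R : Subring Ω) {t : Ω} (ht : t ∈ R)
    (ht' : t⁻¹ ∉ R) (r : Matrix Γ Γ Ω) (hr : ∀ x y, r x y ∈ R) :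
    (1 - t • r : Matrix Γ Γ Ω).det ≠ 0 := by
  intro h0
  let t' : R := ⟨t, ht⟩
  let r' : Matrix Γ Γ R := Matrix.of fun x y => ⟨r x y, hr x y⟩
  let q := Ideal.Quotient.mk (Ideal.span {t'})
  have h1 : (1 - t' • r').det = 0 := by
    apply Subtype.val_injective
    have : (R.subtype.mapMatrix (1 - t' • r')) = 1 - t • r := by
      ext x y
      simp [r', t', Matrix.one_apply, apply_ite]
    have h2 := R.subtype.map_det (1 - t' • r')
    rw [this, h0] at h2
    exact h2
  have h2 : q 1 = 0 := by
    have h3 := q.map_det (1 - t' • r')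
    have h4 : q.mapMatrix (1 - t' • r') = 1 := by
      ext x y
      have : q t' = 0 := Ideal.Quotient.eq_zero_iff_mem.2 (Ideal.mem_span_singleton_self _)
      by_cases hxy : x = y <;> simp [Matrix.one_apply, hxy, this]
    rw [h4, h1, map_zero, Matrix.det_one] at h3
    rw [map_one, ← h3]
  rw [Ideal.Quotient.eq_zero_iff_mem, Ideal.mem_span_singleton] at h2
  obtain ⟨u, hu⟩ := h2
  have h5 : t * u = 1 := (congrArg Subtype.val hu).symm
  exact ht' (by rw [inv_eq_of_mul_eq_one_right h5]; exact u.2)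

end PatchCore

section PatchSplit

open Polynomial

lemma exists_common_denominator {A J : Type} [CommRing A] [Finite J] (p : Ideal A) [p.IsPrime]
    (P : J → A → Prop) (hmul : ∀ j s t, P j s → P j (s * t)) (h : ∀ j, ∃ s ∉ p, P j s) :
    ∃ s ∉ p, ∀ j, P j s := by
  classical
  cases nonempty_fintype J
  choose s hs hP using h
  refine ⟨∏ j, s j, ?_, fun j => ?_⟩
  · intro hmem
    obtain ⟨j, -, hj⟩ := (Ideal.IsPrime.prod_mem_iff (p := p)).1 hmem
    exact hs j hj
  · rw [← Finset.mul_prod_erase _ _ (Finset.mem_univ j)]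
    exact hmul _ _ _ (hP j)

variable {A K Ω M : Type} [CommRing A] [IsDomain A] [IsIntegrallyClosed A] [Field K] [Field Ω]
  [Algebra A K] [IsFractionRing A K] [Algebra K Ω] [Field M] [Algebra K M]
  {K₁ K₂ : IntermediateField K Ω} {R : Subring Ω} {D : A}
  {Γ : Type} [Group Γ] [Finite Γ] {H₂ : Subgroup Γ}

/-- The coefficients of the conjugate polynomials of congruent families are congruent. -/
lemma conjPoly_coeff_congr (pd : PatchData A K₁ K₂ R D) [Algebra A M] [IsScalarTower A K M]
    (i : M →ₐ[K] Ω) {δ : A}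
    (hδ : ∀ ω ∈ Subring.closure ((R : Set Ω) ∪ i '' {m | IsIntegral A m}), ∀ κ : K,
        algebraMap K Ω κ = algebraMap K Ω (algebraMap A K (D * δ)) * ω →
        ∃ ρ : K, κ = algebraMap A K D * ρ ∧ algebraMap K Ω ρ ∈ R)
    {p : Ideal A} (hp : p.IsPrime) (hDp : D ∈ p) (hmax : ¬ p.IsMaximal)
    (g ρ : Γ → Ω) (v : Γ → M) (hv : ∀ θ, IsIntegral A (v θ))
    (hρ : ∀ θ, ρ θ ∈ Subring.closure ((R : Set Ω) ∪ i '' {m | IsIntegral A m}))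
    (hg : ∀ θ, g θ = i (v θ) + algebraMap K Ω (algebraMap A K (D * δ)) * ρ θ) (n : ℕ) (κ : K)
    (hκ : (conjPoly g).coeff n = algebraMap K Ω κ) (c : A)
    (hc : (conjPoly v).coeff n = algebraMap K M (algebraMap A K c)) :
    ∃ s ∉ p, ∃ b ∈ p, algebraMap A K s * κ = algebraMap A K (b + s * c) := by
  obtain ⟨ω, hω, h⟩ := conjPoly_coeff_sub
    (Subring.closure ((R : Set Ω) ∪ i '' {m | IsIntegral A m}))
    (algebraMap K Ω (algebraMap A K (D * δ)))
    (Subring.subset_closure (Or.inl (pd.algebraMap_mem _))) g (fun θ => i (v θ)) ρ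
    (fun θ => Subring.subset_closure (Or.inr ⟨_, hv θ, rfl⟩)) hρ hg n
  have h1 : (conjPoly fun θ => i (v θ)).coeff n = algebraMap K Ω (algebraMap A K c) := by
    have := map_conjPoly (i : M →+* Ω) v
    rw [show (fun θ => i (v θ)) = fun θ => (i : M →+* Ω) (v θ) from rfl, ← this, coeff_map, hc]
    exact i.commutes _
  rw [hκ, h1] at h
  obtain ⟨r, hr, hrR⟩ := hδ ω hω (κ - algebraMap A K c) (by rw [map_sub, h]; ring)
  obtain ⟨s, hs, b, hb⟩ := pd.local_mem p hp hDp hmax r hrR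
  refine ⟨s, hs, D * b, p.mul_mem_right _ hDp, ?_⟩
  rw [sub_eq_iff_eq_add.1 hr, map_add, map_mul, map_mul, ← hb]
  ring

lemma conjPoly_coeff_of_supported (v : Γ → M) (u : H₂ → M) (hv : ∀ h : H₂, v h = u h)
    (hv0 : ∀ θ, θ ∉ H₂ → v θ = 0) (n : ℕ) :
    (conjPoly v).coeff (n + (Nat.card Γ - Nat.card H₂)) = (conjPoly u).coeff n ∧
    (n < Nat.card Γ - Nat.card H₂ → (conjPoly v).coeff n = 0) := by
  rw [conjPoly_extend_zero (Subtype.val : H₂ → Γ) Subtype.val_injective u v hv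
    (fun θ hθ => hv0 θ (by simpa using hθ))]
  exact ⟨coeff_X_pow_mul _ _ _, fun h => by rw [coeff_X_pow_mul', if_neg (by omega)]⟩

/-- The criterion `SplitElt` passes from `M` to the glued field. -/
lemma SplitElt.glue (pd : PatchData A K₁ K₂ R D) [Algebra A M] [IsScalarTower A K M]
    (i : M →ₐ[K] Ω) {δ : A}
    (hδ : ∀ ω ∈ Subring.closure ((R : Set Ω) ∪ i '' {m | IsIntegral A m}), ∀ κ : K,
        algebraMap K Ω κ = algebraMap K Ω (algebraMap A K (D * δ)) * ω →
        ∃ ρ : K, κ = algebraMap A K D * ρ ∧ algebraMap K Ω ρ ∈ R)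
    {p : Ideal A} (hp : p.IsPrime) (hDp : D ∈ p) (hmax : ¬ p.IsMaximal)
    (e₂ : H₂ →* (M ≃ₐ[K] M)) {N : Subgroup Γ}
    {F : IntermediateField K Ω} (φ : Γ →* (F ≃ₐ[K] F))
    (hφ : ∀ x : F, (∀ γ, φ γ x = x) → ∃ c : K, algebraMap K F c = x)
    (happ : ∀ v : Γ → M, (∀ θ, IsIntegral A (v θ)) → (∀ θ (h : H₂), v (θ * h) = e₂ h⁻¹ (v θ)) →
      ∃ x : F, ∃ ρ : Γ → Ω,
        (∀ θ, ρ θ ∈ Subring.closure ((R : Set Ω) ∪ i '' {m | IsIntegral A m})) ∧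
        ∀ γ, (φ γ x : Ω) = i (v γ⁻¹) + algebraMap K Ω (algebraMap A K (D * δ)) * ρ γ⁻¹)
    (hsplit : SplitElt A e₂ (N.subgroupOf H₂) p) : SplitElt A φ N p := by
  classical
  obtain ⟨a₂, ha₂, ⟨i₀, hi₀, c₀, hc₀, hc₀'⟩, hN⟩ := hsplit
  let v : Γ → M := fun θ => if h : θ ∈ H₂ then e₂ (⟨θ, h⟩ : H₂)⁻¹ a₂ else 0
  have vH : ∀ h : H₂, v h = e₂ h⁻¹ a₂ := fun h => dif_pos h.2
  have v0 : ∀ θ, θ ∉ H₂ → v θ = 0 := fun θ h => dif_neg h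
  have h_integral : ∀ h, IsIntegral A (e₂ h a₂) := by
    intro h
    choose c hc using ha₂
    have hl : (conjPoly fun δ => e₂ δ a₂) ∈ Polynomial.lifts (algebraMap A M) := by
      rw [Polynomial.lifts_iff_coeff_lifts]
      intro n
      exact ⟨c n, by rw [hc, IsScalarTower.algebraMap_apply A K M]⟩
    obtain ⟨q, hq, -, hqm⟩ := Polynomial.lifts_and_natDegree_eq_and_monic hl (conjPoly_monic _)
    refine ⟨q, hqm, ?_⟩
    rw [← eval_map, hq]
    exact conjPoly_eval (fun δ => e₂ δ a₂) h
  have hvint : ∀ θ, IsIntegral A (v θ) := fun θ => by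
    by_cases h : θ ∈ H₂
    · rw [vH ⟨θ, h⟩]; exact h_integral _
    · rw [v0 θ h]; exact isIntegral_zero
  have hveq : ∀ θ (h : H₂), v (θ * h) = e₂ h⁻¹ (v θ) := by
    intro θ h
    by_cases hθ : θ ∈ H₂
    · have := vH (⟨θ, hθ⟩ * h)
      rw [vH ⟨θ, hθ⟩, ← AlgEquiv.mul_apply, ← map_mul, ← mul_inv_rev, ← this]
      rfl
    · rw [v0 θ hθ, v0 _ (fun h' => hθ ((H₂.mul_mem_cancel_right h.2).1 h')), map_zero]
  obtain ⟨x, ρ, hρ, hx⟩ := happ v hvint hveq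
  set P := Subring.closure ((R : Set Ω) ∪ i '' {m | IsIntegral A m}) with hP
  set d := algebraMap K Ω (algebraMap A K (D * δ)) with hd
  have hdP : d ∈ P := Subring.subset_closure (Or.inl (pd.algebraMap_mem _))
  let g : Γ → Ω := fun θ => i (v θ) + d * ρ θ
  have hgx : ∀ γ, (φ γ x : Ω) = g γ⁻¹ := hx
  -- transfer of conjugate polynomials to `Ω`
  have toΩ : ∀ (y : F) (n : ℕ) (u : Γ → Ω), (∀ γ, (φ γ y : Ω) = u γ⁻¹) →
      ((conjPoly fun γ => φ γ y).coeff n : Ω) = (conjPoly u).coeff n := by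
    intro y n u hu
    rw [← conjPoly_comp_equiv (Equiv.inv Γ) u]
    have := map_conjPoly (algebraMap F Ω) (fun γ => φ γ y)
    have h2 : (fun γ => algebraMap F Ω (φ γ y)) = fun γ => u (Equiv.inv Γ γ) := funext hu
    rw [h2] at this
    rw [← this, coeff_map]; rfl
  have hfixed := fun (y : F) (n : ℕ) => conjPoly_coeff_fixed φ hφ y n
  choose κ hκ using hfixed
  have hκΩ : ∀ (y : F) (n : ℕ) (u : Γ → Ω), (∀ γ, (φ γ y : Ω) = u γ⁻¹) →
      (conjPoly u).coeff n = algebraMap K Ω (κ y n) := fun y n u hu => by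
    rw [← toΩ y n u hu, ← hκ]; rfl
  -- coefficients for `v`
  have e₂inv : ∀ (b : M), conjPoly (fun h : H₂ => e₂ h⁻¹ b) = conjPoly fun h => e₂ h b :=
    fun b => conjPoly_comp_equiv (Equiv.inv H₂) (fun h => e₂ h b)
  set m := Nat.card Γ - Nat.card H₂ with hm
  have hcard : Nat.card H₂ ≤ Nat.card Γ := Subgroup.card_le_card_group H₂
  have hcv : ∀ n, ∃ c : A, (conjPoly v).coeff n = algebraMap K M (algebraMap A K c) := by
    intro n
    by_cases hn : n < m
    · exact ⟨0, by rw [(conjPoly_coeff_of_supported v _ vH v0 n).2 hn]; simp⟩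
    · obtain ⟨n', rfl⟩ : ∃ n', n = n' + m := ⟨n - m, by omega⟩
      obtain ⟨c, hc⟩ := ha₂ n'
      exact ⟨c, by rw [(conjPoly_coeff_of_supported v _ vH v0 n').1, e₂inv, hc]⟩
  have hcσ : ∀ σ ∈ N, σ ≠ 1 → ∀ n < Nat.card Γ, ∃ c ∈ p,
      (conjPoly fun θ => v θ * v (σ⁻¹ * θ)).coeff n = algebraMap K M (algebraMap A K c) := by
    intro σ hσN hσ n hn
    by_cases hσH : σ ∈ H₂
    · have h1 : ∀ h : H₂, v h * v (σ⁻¹ * h) = e₂ h⁻¹ (a₂ * e₂ ⟨σ, hσH⟩ a₂) := by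
        intro h
        have := vH (⟨σ, hσH⟩⁻¹ * h)
        rw [show ((⟨σ, hσH⟩⁻¹ * h : H₂) : Γ) = σ⁻¹ * h from rfl] at this
        rw [this, vH, map_mul, mul_inv_rev, inv_inv, map_mul]
        rfl
      have h0 : ∀ θ, θ ∉ H₂ → v θ * v (σ⁻¹ * θ) = 0 := fun θ h => by rw [v0 θ h, zero_mul]
      by_cases hn' : n < m
      · exact ⟨0, p.zero_mem, by rw [(conjPoly_coeff_of_supported _ _ h1 h0 n).2 hn']; simp⟩
      · obtain ⟨n', rfl⟩ : ∃ n', n = n' + m := ⟨n - m, by omega⟩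
        obtain ⟨c, hc, hc'⟩ := hN ⟨σ, hσH⟩ hσN
          (fun h => hσ (congrArg Subtype.val h)) n' (by omega)
        refine ⟨c, hc, ?_⟩
        rw [(conjPoly_coeff_of_supported _ _ h1 h0 n').1, e₂inv, hc']
    · refine ⟨0, p.zero_mem, ?_⟩
      have : (fun θ => v θ * v (σ⁻¹ * θ)) = fun _ => 0 := by
        ext θ
        by_cases hθ : θ ∈ H₂
        · rw [v0 (σ⁻¹ * θ), mul_zero]
          intro h
          exact hσH (by simpa using (H₂.mul_mem_cancel_right hθ).1 h)
        · rw [v0 θ hθ, zero_mul]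
      rw [this, conjPoly_zero, coeff_X_pow, if_neg hn.ne]
      simp
  choose c hc using hcv
  have hσx : ∀ σ γ, (φ γ (x * φ σ x) : Ω) =
      (fun θ => g θ * g (σ⁻¹ * θ)) γ⁻¹ := by
    intro σ γ
    rw [map_mul, ← AlgEquiv.mul_apply, ← map_mul]
    change (φ γ x : Ω) * (φ (γ * σ) x : Ω) = _
    rw [hgx, hgx, mul_inv_rev]
  obtain ⟨s, hsp, hs⟩ := exists_common_denominator (J := Option Γ × Fin (Nat.card Γ)) p
    (fun j s => j.1.elim (∃ b ∈ p, algebraMap A K s * κ x j.2 = algebraMap A K (b + s * c j.2))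
      (fun σ => σ ∈ N → σ ≠ 1 → ∃ b ∈ p, algebraMap A K s * κ (x * φ σ x) j.2 = algebraMap A K b))
    (by
      rintro ⟨_ | σ, n⟩ s t
      · rintro ⟨b, hb, h⟩
        refine ⟨b * t, p.mul_mem_right _ hb, ?_⟩
        rw [map_mul, mul_right_comm, h, ← map_mul]
        congr 1; ring
      · intro h h1 h2
        obtain ⟨b, hb, h⟩ := h h1 h2
        refine ⟨b * t, p.mul_mem_right _ hb, ?_⟩
        rw [map_mul, mul_right_comm, h, ← map_mul])
    (by
      rintro ⟨_ | σ, n⟩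
      · exact conjPoly_coeff_congr pd i hδ hp hDp hmax g ρ v hvint hρ (fun _ => rfl) n _
          (hκΩ x n g hgx) _ (hc n)
      · by_cases h : σ ∈ N ∧ σ ≠ 1
        · obtain ⟨c', hc', hcc⟩ := hcσ σ h.1 h.2 n n.2
          have hiv : ∀ θ, i (v θ) ∈ P := fun θ => Subring.subset_closure (Or.inr ⟨_, hvint θ, rfl⟩)
          obtain ⟨s, hs, b, hb, hsb⟩ := conjPoly_coeff_congr pd i hδ hp hDp hmax
            (fun θ => g θ * g (σ⁻¹ * θ))
            (fun θ => i (v θ) * ρ (σ⁻¹ * θ) + ρ θ * i (v (σ⁻¹ * θ)) + d * (ρ θ * ρ (σ⁻¹ * θ)))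
            (fun θ => v θ * v (σ⁻¹ * θ)) (fun θ => (hvint _).mul (hvint _))
            (fun θ => P.add_mem (P.add_mem (P.mul_mem (hiv _) (hρ _)) (P.mul_mem (hρ _) (hiv _)))
              (P.mul_mem hdP (P.mul_mem (hρ _) (hρ _))))
            (fun θ => by simp only [g, map_mul i]; ring) n _ (hκΩ _ n _ (hσx σ)) c' hcc
          exact ⟨s, hs, fun _ _ => ⟨_, p.add_mem hb (p.mul_mem_left _ hc'), hsb⟩⟩
        · exact ⟨1, fun h1 => hp.ne_top ((Ideal.eq_top_iff_one _).2 h1),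
            fun h1 h2 => (h ⟨h1, h2⟩).elim⟩)
  have hs1 : ∀ n < Nat.card Γ, ∃ b ∈ p,
      algebraMap A K s * κ x n = algebraMap A K (b + s * c n) := fun n hn => hs (none, ⟨n, hn⟩)
  have hs2 : ∀ σ ∈ N, σ ≠ 1 → ∀ n < Nat.card Γ, ∃ b ∈ p,
      algebraMap A K s * κ (x * φ σ x) n = algebraMap A K b :=
    fun σ h1 h2 n hn => hs (some σ, ⟨n, hn⟩) h1 h2
  let s' : F := algebraMap K F (algebraMap A K s)
  have hs'φ : ∀ γ, φ γ s' = s' := fun γ => (φ γ).commutes _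
  have hcoef : ∀ n, (conjPoly fun γ => φ γ (s' * x)).coeff n =
      algebraMap K F (algebraMap A K s ^ (Nat.card Γ - n) * κ x n) := by
    intro n
    simp only [map_mul, hs'φ]
    rw [conjPoly_smul_coeff, ← hκ, map_pow]
  have hcoef2 : ∀ σ n, (conjPoly fun γ => φ γ (s' * x * φ σ (s' * x))).coeff n =
      algebraMap K F ((algebraMap A K s ^ 2) ^ (Nat.card Γ - n) * κ (x * φ σ x) n) := by
    intro σ n
    have : (fun γ => φ γ (s' * x * φ σ (s' * x))) = fun γ => s' ^ 2 * φ γ (x * φ σ x) := by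
      ext γ
      rw [map_mul (φ σ), hs'φ, show s' * x * (s' * φ σ x) = s' ^ 2 * (x * φ σ x) by ring,
        map_mul (φ γ), map_pow, hs'φ]
    rw [this, conjPoly_smul_coeff, ← hκ, map_mul, map_pow, map_pow]
  have hform : ∀ n < Nat.card Γ, ∃ b ∈ p, (conjPoly fun γ => φ γ (s' * x)).coeff n =
      algebraMap K F (algebraMap A K (s ^ (Nat.card Γ - n - 1) * (b + s * c n))) := by
    intro n hn
    obtain ⟨b, hb, h⟩ := hs1 n hn
    refine ⟨b, hb, ?_⟩
    rw [hcoef, map_mul (algebraMap A K), ← h, ← mul_assoc, map_pow, ← pow_succ,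
      show Nat.card Γ - n - 1 + 1 = Nat.card Γ - n by omega]
  refine ⟨s' * x, fun n => ?_, ⟨i₀ + m, by omega, ?_⟩, fun σ h1 h2 n hn => ?_⟩
  · rcases lt_trichotomy n (Nat.card Γ) with hn | hn | hn
    · obtain ⟨b, -, h⟩ := hform n hn
      exact ⟨_, h⟩
    · refine ⟨1, ?_⟩
      rw [hn, ← conjPoly_natDegree (fun γ => φ γ (s' * x)), (conjPoly_monic _).coeff_natDegree]
      simp
    · refine ⟨0, ?_⟩
      rw [coeff_eq_zero_of_natDegree_lt (by rwa [conjPoly_natDegree])]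
      simp
  · obtain ⟨b, hb, h⟩ := hform (i₀ + m) (by omega)
    refine ⟨_, fun hmem => ?_, h⟩
    have hcc : c (i₀ + m) = c₀ := by
      apply IsFractionRing.injective A K
      apply (algebraMap K M).injective
      rw [← hc, ← hc₀', ← e₂inv, (conjPoly_coeff_of_supported v _ vH v0 i₀).1]
    rcases hp.mem_or_mem hmem with h3 | h3
    · exact hsp (hp.mem_of_pow_mem _ h3)
    · rw [Ideal.add_mem_iff_right _ hb, hcc] at h3
      rcases hp.mem_or_mem h3 with h4 | h4
      · exact hsp h4
      · exact hc₀ h4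
  · obtain ⟨b, hb, h⟩ := hs2 σ h1 h2 n hn
    refine ⟨(s ^ 2) ^ (Nat.card Γ - n - 1) * (s * b), p.mul_mem_left _ (p.mul_mem_left _ hb), ?_⟩
    rw [hcoef2]
    congr 1
    rw [map_mul, map_mul, ← h, map_pow, map_pow]
    obtain ⟨q, hq⟩ : ∃ q, Nat.card Γ - n = q + 1 := ⟨Nat.card Γ - n - 1, by omega⟩
    rw [hq, Nat.add_sub_cancel]
    ring

end PatchSplit

section PatchCore

variable {A K Ω M : Type} [CommRing A] [IsDomain A] [IsIntegrallyClosed A] [Field K] [Field Ω]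
  [Algebra A K] [IsFractionRing A K] [Algebra K Ω] [Field M] [Algebra K M]
  {K₁ K₂ : IntermediateField K Ω} {R : Subring Ω} {D : A}
  {Γ : Type} [Group Γ] [Finite Γ] {H₁ H₂ : Subgroup Γ}

lemma exists_integral_basis [Fintype Γ] [Algebra A M] [IsScalarTower A K M] [Algebra.IsAlgebraic K M]
    (i : M →ₐ[K] Ω) (e₂ : H₂ →* (M ≃ₐ[K] M)) (he₂ : Function.Injective e₂) :
    ∃ ε : Module.Basis Γ Ω (Γ → Ω), ∀ x, ∃ v : Γ → M, (∀ θ, IsIntegral A (v θ)) ∧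
      (∀ θ (h : H₂), v (θ * h) = e₂ h⁻¹ (v θ)) ∧ ∀ θ, ε x θ = i (v θ) := by
  classical
  letI : MulSemiringAction H₂ M := MulSemiringAction.compHom M e₂
  have hsm : ∀ (h : H₂) (m : M), h • m = e₂ h m := fun _ _ => rfl
  haveI : FaithfulSMul H₂ M := ⟨fun {a b} h => he₂ (AlgEquiv.ext h)⟩
  obtain ⟨b, hb⟩ := exists_basis_inducedRing (H := H₂) (i : M →+* Ω) i.injective
  choose v hv1 hv2 using hb
  haveI : Algebra.IsAlgebraic A K :=
    (IsFractionRing.comap_isAlgebraic_iff (A := A) (K := K) (C := K)).2 inferInstance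
  haveI : Algebra.IsAlgebraic A M := Algebra.IsAlgebraic.trans A K M
  obtain ⟨y, hy0, hy⟩ := Algebra.IsAlgebraic.exists_integral_multiples (R := A)
    (Finset.univ.image fun q : Γ × Γ => v q.1 q.2)
  have hyΩ : algebraMap K Ω (algebraMap A K y) ≠ 0 := by simpa using hy0
  refine ⟨b.isUnitSMul fun _ => IsUnit.mk0 _ hyΩ, fun x => ⟨fun θ => y • v x θ, fun θ => ?_,
    fun θ h => ?_, fun θ => ?_⟩⟩
  · exact hy _ (Finset.mem_image.2 ⟨(x, θ), Finset.mem_univ _, rfl⟩)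
  · simp only [hv1, hsm]
    rw [← IsScalarTower.algebraMap_smul K y, ← IsScalarTower.algebraMap_smul K y, map_smul]
  · rw [Module.Basis.isUnitSMul_apply]
    simp only [Pi.smul_apply, smul_eq_mul, hv2]
    rw [← IsScalarTower.algebraMap_smul K y, map_smul, Algebra.smul_def]
    rfl

/-- Patching a Galois extension `S₁` of `K₁` with a Galois extension `M` of `K`. -/
theorem patch_core [IsGalois K M] [FiniteDimensional K M] (pd : PatchData A K₁ K₂ R D)
    (hD : D ≠ 0) (hH : H₁ ⊔ H₂ = ⊤)
    [Algebra A M] [IsScalarTower A K M] (i : M →ₐ[K] Ω) (hi : ∀ m, i m ∈ K₁)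
    (e₂ : H₂ ≃* (M ≃ₐ[K] M)) (S₁ : IntermediateField K₁ Ω) [IsGalois K₁ S₁]
    [FiniteDimensional K₁ S₁] (e₁ : H₁ ≃* (S₁ ≃ₐ[K₁] S₁)) (N : Subgroup Γ)
    {L G : Type} [Field L] [Algebra K L] [Group G] (iL : L →ₐ[K] M) (f : Γ →* G)
    (eG : G →* (L ≃ₐ[K] L)) (hcompat : ∀ (h : H₂) l, e₂ h (iL l) = iL (eG (f h) l))
    (hker : H₁ ≤ f.ker) :
    ∃ F : IntermediateField K Ω, IsGalois K F ∧ FiniteDimensional K F ∧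
      ∃ φ : Γ ≃* (F ≃ₐ[K] F),
        (∀ x ∈ F, x ∈ S₁ ∧ x ∈ IntermediateField.adjoin K₂ (Set.range i)) ∧
        (∃ j : L →ₐ[K] F, ∀ γ l, φ γ (j l) = j (eG (f γ) l)) ∧
        ∀ p : Ideal A, p.IsPrime → D ∈ p → ¬ p.IsMaximal →
          SplitElt A e₂.toMonoidHom (N.subgroupOf H₂) p → SplitElt A φ.toMonoidHom N p := by
  classical
  cases nonempty_fintype Γ
  set S₂ := IntermediateField.adjoin K₂ (Set.range i) with hS₂
  obtain ⟨_, _, hm, e, he⟩ := exists_baseChange_action pd.inf_eq i hi S₂ hS₂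
  obtain ⟨δ, hδ0, hδ⟩ := exists_trace_conductor pd i S₂ hm e he
  letI : MulSemiringAction H₁ S₁ := MulSemiringAction.compHom S₁ e₁.toMonoidHom
  letI : MulSemiringAction H₂ S₂ := MulSemiringAction.compHom S₂ (e.toMonoidHom.comp e₂.toMonoidHom)
  have sm₁ : ∀ (h : H₁) (x : S₁), h • x = e₁ h x := fun _ _ => rfl
  have sm₂ : ∀ (h : H₂) (x : S₂), h • x = e (e₂ h) x := fun _ _ => rfl
  haveI : FaithfulSMul H₁ S₁ := ⟨fun {a b} h => e₁.injective (AlgEquiv.ext h)⟩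
  have hfix₁ : ∀ (h : H₁) (c : K₁), h • algebraMap K₁ S₁ c = algebraMap K₁ S₁ c :=
    fun h c => (e₁ h).commutes c
  have hfix₂ : ∀ (h : H₂) (c : K₂), h • algebraMap K₂ S₂ c = algebraMap K₂ S₂ c :=
    fun h c => (e (e₂ h)).commutes c
  have hinv₁ : ∀ s : S₁, (∀ h : H₁, h • s = s) → (s : Ω) ∈ K₁ := by
    intro s hs
    have : s ∈ (⊥ : IntermediateField K₁ S₁) := by
      rw [IsGalois.mem_bot_iff_fixed]
      intro σ
      have := hs (e₁.symm σ)
      rwa [sm₁, e₁.apply_symm_apply] at this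
    obtain ⟨c, rfl⟩ := IntermediateField.mem_bot.1 this
    exact c.2
  have hinv₂ : ∀ s : S₂, (∀ h : H₂, h • s = s) → (s : Ω) ∈ K₂ := by
    intro s hs
    have : s ∈ (⊥ : IntermediateField K₂ S₂) := by
      rw [IsGalois.mem_bot_iff_fixed]
      intro σ
      have := hs (e₂.symm (e.symm σ))
      rwa [sm₂, e₂.apply_symm_apply, e.apply_symm_apply] at this
    obtain ⟨c, rfl⟩ := IntermediateField.mem_bot.1 this
    exact c.2
  have hmem₂ : ∀ v : Γ → M, (∀ θ (h : H₂), v (θ * h) = e₂ h⁻¹ (v θ)) →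
      (fun θ => i (v θ)) ∈ inducedRing H₂ (algebraMap S₂ Ω) := fun v hv =>
    ⟨fun θ => ⟨i (v θ), hm _⟩, fun θ h => Subtype.ext (by
      rw [sm₂, he, ← hv]), fun θ => rfl⟩
  obtain ⟨F, φ, hF, hFx, hFa, hFfix⟩ := exists_gluedField hH pd.inf_eq hfix₁ hfix₂ hinv₁ hinv₂
  obtain ⟨hgal, hfd, hsurj⟩ := isGalois_of_faithful_of_fixed φ hFfix
  obtain ⟨ε, hε⟩ := exists_integral_basis (A := A) i e₂.toMonoidHom e₂.injective
  choose v hvint hveq hvε using hε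
  have hεmem : ∀ x, ε x ∈ inducedRing H₂ (algebraMap S₂ Ω) := fun x => by
    rw [show ε x = fun θ => i (v x θ) from funext (hvε x)]
    exact hmem₂ _ (hveq x)
  have hinj : Function.Injective φ := by
    refine (injective_iff_map_eq_one _).2 fun γ hγ => ?_
    by_contra hne
    obtain ⟨τ, hτ0, hτ⟩ := pd.exists_nonunit
    choose r hr hrg using fun x => exists_gluedRing_approx pd hfix₁ hfix₂ ε hεmem (hεmem x) hτ0
    have hdet := det_one_sub_ne_zero R (pd.algebraMap_mem τ) hτ (Matrix.of r) (fun x y => hr x y)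
    have h1 : (1 - algebraMap K Ω (algebraMap A K τ) • Matrix.of r : Matrix Γ Γ Ω).mulVec
        (fun x => ε x γ⁻¹ - ε x 1) = 0 := by
      ext x
      obtain ⟨hx, hx'⟩ := hFa _ (hrg x)
      have h2 := hx' γ
      rw [hγ] at h2
      simp only [AlgEquiv.one_apply] at h2
      rw [Matrix.sub_mulVec, Matrix.one_mulVec, Matrix.smul_mulVec]
      simp only [Pi.sub_apply, Pi.smul_apply, Matrix.mulVec, dotProduct, Matrix.of_apply,
        mul_sub, Finset.sum_sub_distrib, smul_eq_mul, Pi.zero_apply]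
      linear_combination -h2
    have h3 : ∀ x, ε x γ⁻¹ = ε x 1 := fun x => by
      have := Matrix.eq_zero_of_mulVec_eq_zero hdet h1
      exact sub_eq_zero.1 (congrFun this x)
    have h4 : ∀ g : Γ → Ω, g γ⁻¹ = g 1 := fun g => by
      rw [← ε.sum_repr g]
      simp only [Finset.sum_apply, Pi.smul_apply, h3]
    have := h4 (Pi.single 1 1)
    rw [Pi.single_eq_same, Pi.single_eq_of_ne (by simpa using hne)] at this
    exact zero_ne_one this
  refine ⟨F, hgal, hfd, MulEquiv.ofBijective φ ⟨hinj, hsurj⟩, hF, ?_, fun p hp hDp hmax hsp => ?_⟩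
  · have hgl : ∀ l : L, (fun θ => i (iL (eG (f θ⁻¹) l))) ∈ gluedRing S₁ S₂ H₁ H₂ := by
      refine fun l => ⟨⟨fun θ => algebraMap K₁ S₁ ⟨_, hi (iL (eG (f θ⁻¹) l))⟩, fun θ h => ?_,
        fun θ => rfl⟩, hmem₂ _ fun θ h => ?_⟩
      · rw [hfix₁]
        have : f (θ * h)⁻¹ = f θ⁻¹ := by
          rw [mul_inv_rev, map_mul, hker (H₁.inv_mem h.2), one_mul]
        simp only [this]
      · rw [hcompat, ← AlgEquiv.mul_apply, ← map_mul, ← map_mul, mul_inv_rev]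
        rfl
    have hmemF : ∀ l : L, i (iL l) ∈ F := fun l => by
      obtain ⟨h1, -⟩ := hFa _ (hgl l)
      simpa using h1
    let j : L →ₐ[K] F :=
      { toFun := fun l => ⟨i (iL l), hmemF l⟩
        map_one' := Subtype.ext (by simp)
        map_mul' := fun x y => Subtype.ext (by simp)
        map_zero' := Subtype.ext (by simp)
        map_add' := fun x y => Subtype.ext (by simp)
        commutes' := fun r => Subtype.ext (by simp) }
    refine ⟨j, fun γ l => Subtype.ext ?_⟩
    obtain ⟨h1, h2⟩ := hFa _ (hgl l)
    have h3 : (⟨_, h1⟩ : F) = j l := Subtype.ext (by simp [j])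
    have h4 := h2 γ
    rw [h3, inv_inv] at h4
    exact h4
  · refine SplitElt.glue pd i hδ hp hDp hmax e₂.toMonoidHom φ hFfix (fun u hu hueq => ?_) hsp
    obtain ⟨r, hr, hg⟩ := exists_gluedRing_approx pd hfix₁ hfix₂ ε hεmem (hmem₂ u hueq)
      (mul_ne_zero hD hδ0)
    obtain ⟨h1, h2⟩ := hFa _ hg
    refine ⟨⟨_, h1⟩, fun θ => -∑ x, r x * ε x θ, fun θ => ?_, fun γ => ?_⟩
    · refine neg_mem (sum_mem fun x _ => mul_mem (Subring.subset_closure (Or.inl (hr x)))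
        (Subring.subset_closure (Or.inr ⟨_, hvint x θ, (hvε x θ).symm⟩)))
    · rw [h2]; ring

end PatchCore

section PatchStep

open Cardinal IntermediateField

/-- Existence of patching data into which `M` embeds, with a large family of cyclic extensions of
degree `n`. -/
def HasPatchFamily (A K M : Type) [CommRing A] [Field K] [Algebra A K] [Field M] [Algebra K M]
    (D : A) (n : ℕ) : Prop :=
  ∃ (Ω : Type) (_ : Field Ω) (_ : Algebra K Ω) (K₁ K₂ : IntermediateField K Ω) (R : Subring Ω)
    (D' : A) (i : M →ₐ[K] Ω) (I : Type) (S : I → IntermediateField K₁ Ω) (y : I → Ω),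
    D ∣ D' ∧ D' ≠ 0 ∧ PatchData A K₁ K₂ R D' ∧ (∀ m, i m ∈ K₁) ∧ #I = #K ∧
    (∀ c, IsGalois K₁ (S c) ∧ FiniteDimensional K₁ (S c) ∧ IsCyclic (S c ≃ₐ[K₁] S c) ∧
      Nat.card (S c ≃ₐ[K₁] S c) = n ∧ ∀ J ≤ S c, J ≠ ⊥ → y c ∈ J) ∧
    ∀ J : IntermediateField K₁ Ω, FiniteDimensional K₁ J → {c | y c ∈ J}.Finite

lemma fieldRange_eq_of_normal {K Λ Ω : Type} [Field K] [Field Λ] [Field Ω] [Algebra K Λ]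
    [Algebra K Ω] [Normal K Λ] (g g' : Λ →ₐ[K] Ω) : g.fieldRange = g'.fieldRange := by
  let e := AlgEquiv.ofInjectiveField g
  haveI : Normal K g.fieldRange := Normal.of_algEquiv e
  have h := AlgHom.fieldRange_of_normal (E := g.fieldRange) (g'.comp e.symm.toAlgHom)
  rw [← h]
  ext x
  constructor
  · rintro ⟨y, rfl⟩; exact ⟨e.symm y, rfl⟩
  · rintro ⟨y, rfl⟩; exact ⟨e y, congrArg g' (e.symm_apply_apply y)⟩

/-- A Galois extension inside both `K₁` and `K₂(M)` already lies in `M`. -/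
lemma le_fieldRange_of_le_inf {K Ω M : Type} [Field K] [Field Ω] [Algebra K Ω] [Field M]
    [Algebra K M] [IsGalois K M] [FiniteDimensional K M] {K₁ K₂ : IntermediateField K Ω}
    (hK : K₁ ⊓ K₂ = ⊥) (i : M →ₐ[K] Ω) (hi : ∀ m, i m ∈ K₁) (Λ : IntermediateField K Ω)
    [IsGalois K Λ] [FiniteDimensional K Λ] (h₁ : Λ ≤ K₁)
    (h₂ : ∀ x ∈ Λ, x ∈ adjoin K₂ (Set.range i)) : Λ ≤ i.fieldRange := by
  let e := AlgEquiv.ofInjectiveField i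
  haveI : IsGalois K i.fieldRange := IsGalois.of_algEquiv e
  haveI : FiniteDimensional K i.fieldRange := e.toLinearEquiv.finiteDimensional
  let X : IntermediateField K Ω := i.fieldRange ⊔ Λ
  haveI : IsGalois K X := inferInstanceAs (IsGalois K ↥(i.fieldRange ⊔ Λ))
  haveI : FiniteDimensional K X := inferInstanceAs (FiniteDimensional K ↥(i.fieldRange ⊔ Λ))
  have hX₁ : X ≤ K₁ := sup_le (by rintro _ ⟨m, rfl⟩; exact hi m) h₁
  have hX₂ : X ≤ (adjoin K₂ (Set.range i)).restrictScalars K :=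
    sup_le (by rintro _ ⟨m, rfl⟩; exact subset_adjoin K₂ _ ⟨m, rfl⟩) h₂
  have hS : adjoin K₂ (Set.range i) = adjoin K₂ (Set.range X.val) := by
    apply le_antisymm
    · refine adjoin.mono _ _ _ ?_
      rintro _ ⟨m, rfl⟩
      exact ⟨⟨i m, le_sup_left (a := i.fieldRange) ⟨m, rfl⟩⟩, rfl⟩
    · rw [adjoin_le_iff]
      rintro _ ⟨x, rfl⟩
      exact hX₂ x.2
  obtain ⟨-, -, -, e₁, -⟩ := exists_baseChange_action hK i hi _ rfl
  obtain ⟨-, -, -, e₂, -⟩ := exists_baseChange_action hK X.val (fun x => hX₁ x.2) _ hS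
  have hcard : Module.finrank K M = Module.finrank K X := by
    rw [← IsGalois.card_aut_eq_finrank, ← IsGalois.card_aut_eq_finrank]
    exact Nat.card_congr (e₁.trans e₂.symm).toEquiv
  have hEX : i.fieldRange = X := by
    apply eq_of_le_of_finrank_eq (le_sup_left : i.fieldRange ≤ i.fieldRange ⊔ Λ)
    change _ = Module.finrank K X
    rw [← hcard]
    exact e.toLinearEquiv.finrank_eq.symm
  rw [hEX]
  exact le_sup_right

variable {A K C G : Type} [CommRing A] [IsDomain A] [IsIntegrallyClosed A] [Field K]
  [Algebra A K] [IsFractionRing A K] [Field C] [Algebra K C] [IsAlgClosed C] [Normal K C] [Group G]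
  {L : IntermediateField K C}

/-- `M` is a Galois extension with group `Δ` solving the embedding problem, with the splitting
condition at the primes containing `D`. -/
def IsSplitSolution (A : Type) {K C G Δ : Type} [CommRing A] [Field K] [Algebra A K] [Field C]
    [Algebra K C] [Group G] [Group Δ] {L : IntermediateField K C} (D : A)
    (eG : G →* (L ≃ₐ[K] L)) (f : Δ →* G) (M : IntermediateField K C) : Prop :=
  IsGalois K M ∧ FiniteDimensional K M ∧ ∃ (hLM : L ≤ M) (e : Δ ≃* (M ≃ₐ[K] M)),
    (∀ δ l, e δ (inclusion hLM l) = inclusion hLM (eG (f δ) l)) ∧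
    ∀ p : Ideal A, p.IsPrime → D ∈ p → ¬ p.IsMaximal → SplitElt A e.toMonoidHom f.ker p

/-- There are solutions avoiding any small set of fields. -/
def HasAvoidingSolutions (A : Type) {K C G Δ : Type} [CommRing A] [Field K] [Algebra A K] [Field C]
    [Algebra K C] [Group G] [Group Δ] {L : IntermediateField K C} (D : A)
    (eG : G →* (L ≃ₐ[K] L)) (f : Δ →* G) : Prop :=
  ∀ 𝓛 : Set (IntermediateField K C), #𝓛 < #K → (∀ L' ∈ 𝓛, ¬ L' ≤ L) →
    ∃ M, IsSplitSolution A D eG f M ∧ ∀ L' ∈ 𝓛, ¬ L' ≤ M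

lemma HasAvoidingSolutions.step {Δ : Type} [Group Δ] [Finite Δ] {D : A}
    {eG : G →* (L ≃ₐ[K] L)} {f : Δ →* G} (hK : ℵ₀ < #K) {H : Subgroup Δ}
    (hP : HasAvoidingSolutions A D eG (f.comp H.subtype)) {c : Δ} (hc : c ∈ f.ker)
    (htop : Subgroup.zpowers c ⊔ H = ⊤)
    (hX : ∀ M : IntermediateField K C, IsGalois K M → FiniteDimensional K M →
      HasPatchFamily A K M D (orderOf c)) :
    HasAvoidingSolutions A D eG f := by
  classical
  intro 𝓛 h𝓛 h𝓛L
  obtain ⟨M, ⟨hgal, hfd, hLM, e₂, hcomp, hsplit⟩, hav⟩ := hP 𝓛 h𝓛 h𝓛L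
  obtain ⟨Ω, _, _, K₁, K₂, R, D', i, I, S, y, hDD', hD', pd, hi, hI, hS, hy⟩ := hX M hgal hfd
  letI : Algebra A M := ((algebraMap K M).comp (algebraMap A K)).toAlgebra
  haveI : IsScalarTower A K M := IsScalarTower.of_algebraMap_eq fun _ => rfl
  have main : ∀ x : I, ∃ (F : IntermediateField K Ω) (M' : IntermediateField K C)
      (ψ : F →ₐ[K] C), ψ.fieldRange = M' ∧ IsSplitSolution A D eG f M' ∧
      ∀ z ∈ F, z ∈ S x ∧ z ∈ adjoin K₂ (Set.range i) := by
    intro x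
    obtain ⟨hg, hf, hcyc, hcard, -⟩ := hS x
    obtain ⟨e₁⟩ : Nonempty (Subgroup.zpowers c ≃* (S x ≃ₐ[K₁] S x)) :=
      ⟨mulEquivOfCyclicCardEq (by rw [hcard, Nat.card_zpowers])⟩
    obtain ⟨F, hFg, hFf, φ, hF, ⟨j, hj⟩, hsp⟩ := patch_core pd hD' htop i hi e₂ (S x) e₁ f.ker
      (inclusion hLM) f eG (fun h l => hcomp h l) (Subgroup.zpowers_le.2 hc)
    letI : Algebra L F := j.toRingHom.toAlgebra
    haveI : IsScalarTower K L F := IsScalarTower.of_algebraMap_eq fun r => (j.commutes r).symm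
    haveI : Algebra.IsAlgebraic L F := Algebra.IsAlgebraic.tower_top (K := K) L
    haveI : Module.IsTorsionFree L C := ⟨fun r hr => by
      have h0 : (r : C) ≠ 0 := fun h => hr.ne_zero (Subtype.ext h)
      intro a b hab
      exact mul_left_cancel₀ h0 hab⟩
    let ψL : F →ₐ[L] C := IsAlgClosed.lift
    let ψ : F →ₐ[K] C := ψL.restrictScalars K
    have hψ : ∀ l : L, ψ (j l) = l := fun l => ψL.commutes l
    let ε : F ≃ₐ[K] ψ.fieldRange := AlgEquiv.ofInjectiveField ψ
    have hε : ∀ z, (ε z : C) = ψ z := fun _ => rfl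
    have hL : L ≤ ψ.fieldRange := fun l hl => ⟨j ⟨l, hl⟩, hψ ⟨l, hl⟩⟩
    have hεj : ∀ l, ε (j l) = inclusion hL l := fun l => Subtype.ext (hψ l)
    have hconj : ∀ δ z, (φ.trans ε.autCongr) δ (ε z) = ε (φ δ z) := fun δ z => by
      change ε (φ δ (ε.symm (ε z))) = _
      rw [ε.symm_apply_apply]
    refine ⟨F, ψ.fieldRange, ψ, rfl, ⟨IsGalois.of_algEquiv ε, ε.toLinearEquiv.finiteDimensional,
      hL, φ.trans ε.autCongr, fun δ l => ?_, fun p hp hDp hmax => ?_⟩, hF⟩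
    · rw [← hεj, ← hεj, hconj, hj]
    · obtain ⟨a, ha1, ⟨n, hn, b, hb, hb'⟩, ha3⟩ := hsp p hp (p.mem_of_dvd hDD' hDp) hmax
        (hsplit p hp hDp hmax)
      have key : ∀ z : F, (conjPoly fun δ => (φ.trans ε.autCongr).toMonoidHom δ (ε z)) =
          (conjPoly fun δ => φ.toMonoidHom δ z).map (ε : F →+* ψ.fieldRange) := by
        intro z
        rw [map_conjPoly]
        congr 1
        ext δ
        exact congrArg Subtype.val (hconj δ z)
      have hεc : ∀ k : K, (ε : F →+* ψ.fieldRange) (algebraMap K F k) =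
          algebraMap K ψ.fieldRange k := fun k => ε.commutes k
      refine ⟨ε a, fun n => ?_, ⟨n, hn, b, hb, ?_⟩, fun σ h1 h2 n hn => ?_⟩
      · obtain ⟨b, hb⟩ := ha1 n
        exact ⟨b, by rw [key, Polynomial.coeff_map, hb, hεc]⟩
      · rw [key, Polynomial.coeff_map, hb', hεc]
      · obtain ⟨b, hb, h⟩ := ha3 σ h1 h2 n hn
        refine ⟨b, hb, ?_⟩
        have : ε a * (φ.trans ε.autCongr).toMonoidHom σ (ε a) =
            ε (a * φ.toMonoidHom σ a) := by
          rw [map_mul]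
          exact congrArg _ (hconj σ a)
        rw [this, key, Polynomial.coeff_map, h, hεc]
  choose F M' ψ hψ hsol hF using main
  have hfin : ∀ L' ∈ 𝓛, {x | L' ≤ M' x}.Finite := by
    intro L' hL'
    rcases Set.eq_empty_or_nonempty {x | L' ≤ M' x} with h | ⟨x₀, hx₀⟩
    · rw [h]; exact Set.finite_empty
    have hx₀ : L' ≤ M' x₀ := hx₀
    obtain ⟨hg₀, hf₀, -⟩ := hsol x₀
    let Λ := normalClosure K L' C
    haveI : FiniteDimensional K L' :=
      Module.Finite.of_injective (inclusion hx₀).toLinearMap (inclusion hx₀).injective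
    have hΛ : ∀ x, L' ≤ M' x → Λ ≤ M' x := by
      intro x hx
      obtain ⟨hg, hf, -⟩ := hsol x
      exact normalClosure_le_iff_of_normal.2 hx
    have hLΛ : L' ≤ Λ := le_normalClosure L'
    haveI : Normal K Λ := normalClosure.normal K L' C
    haveI : FiniteDimensional K Λ :=
      Module.Finite.of_injective (inclusion (hΛ x₀ hx₀)).toLinearMap (inclusion (hΛ x₀ hx₀)).injective
    haveI : Algebra.IsSeparable K Λ := Algebra.IsSeparable.of_algHom K (M' x₀) (inclusion (hΛ x₀ hx₀))
    haveI : IsGalois K Λ := ⟨⟩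
    have hemb : ∀ x, L' ≤ M' x → ∃ g : Λ →ₐ[K] Ω, ∀ z, g z ∈ F x := by
      intro x hx
      let ε : F x ≃ₐ[K] (ψ x).fieldRange := AlgEquiv.ofInjectiveField (ψ x)
      exact ⟨(F x).val.comp (ε.symm.toAlgHom.comp (inclusion ((hΛ x hx).trans (hψ x).ge))),
        fun z => (ε.symm _).2⟩
    obtain ⟨g, hg⟩ := hemb x₀ hx₀
    have hgF : ∀ x, L' ≤ M' x → g.fieldRange ≤ F x := by
      intro x hx
      obtain ⟨g', hg'⟩ := hemb x hx
      rw [fieldRange_eq_of_normal g g']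
      rintro _ ⟨z, rfl⟩
      exact hg' z
    let εg := AlgEquiv.ofInjectiveField g
    haveI : IsGalois K g.fieldRange := IsGalois.of_algEquiv εg
    haveI : FiniteDimensional K g.fieldRange := εg.toLinearEquiv.finiteDimensional
    by_cases hcase : g.fieldRange ≤ K₁
    · exfalso
      have h1 := le_fieldRange_of_le_inf pd.inf_eq i hi g.fieldRange hcase
        fun z hz => (hF x₀ z (hgF x₀ hx₀ hz)).2
      let εi := AlgEquiv.ofInjectiveField i
      have h2 := AlgHom.fieldRange_of_normal (E := Λ)
        (M.val.comp (εi.symm.toAlgHom.comp ((inclusion h1).comp εg.toAlgHom)))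
      apply hav L' hL'
      refine hLΛ.trans ?_
      rw [← h2]
      rintro _ ⟨z, rfl⟩
      exact (εi.symm _).2
    · obtain ⟨α, hα⟩ := Field.exists_primitive_element K Λ
      let J : IntermediateField K₁ Ω := adjoin K₁ {g α}
      have hJ : FiniteDimensional K₁ J :=
        adjoin.finiteDimensional (((Algebra.IsIntegral.isIntegral (R := K) α).map g).tower_top)
      have hgJ : ∀ z, g z ∈ J := by
        have h1 : adjoin K {α} ≤ (J.restrictScalars K).comap g := by
          rw [adjoin_le_iff, Set.singleton_subset_iff]
          exact subset_adjoin K₁ {g α} rfl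
        intro z
        rw [hα] at h1
        exact h1 (mem_top (x := z))
      refine (hy J hJ).subset fun x hx => ?_
      refine (hS x).2.2.2.2 J ?_ ?_
      · rw [adjoin_le_iff]
        intro z hz
        rw [Set.mem_singleton_iff] at hz
        rw [hz]
        exact (hF x _ (hgF x hx ⟨α, rfl⟩)).1
      · intro hbot
        apply hcase
        rintro _ ⟨z, rfl⟩
        have := hgJ z
        rw [hbot] at this
        obtain ⟨w, hw⟩ := mem_bot.1 this
        change g z ∈ K₁
        rw [← hw]
        exact w.2
  have hex : ∃ x, ∀ L' ∈ 𝓛, ¬ L' ≤ M' x := by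
    by_contra! hcon
    have h1 : (Set.univ : Set I) ⊆ ⋃ L' : 𝓛, {x | (L' : IntermediateField K C) ≤ M' x} := by
      intro x _
      obtain ⟨L', h, h'⟩ := hcon x
      exact Set.mem_iUnion.2 ⟨⟨L', h⟩, h'⟩
    have h2 : #I ≤ #𝓛 * ℵ₀ := by
      rw [← mk_univ]
      refine (mk_le_mk_of_subset h1).trans ((mk_iUnion_le _).trans ?_)
      exact mul_le_mul_right (ciSup_le' fun L' => (hfin _ L'.2).lt_aleph0.le) _
    rw [hI] at h2
    exact absurd h2 (not_le.2 (mul_lt_of_lt hK.le h𝓛 hK))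
  obtain ⟨x, hx⟩ := hex
  exact ⟨M' x, hsol x, hx⟩

end PatchStep

section PatchInduction

open Cardinal IntermediateField

variable {A K C G : Type} [CommRing A] [IsDomain A] [IsIntegrallyClosed A] [Field K]
  [Algebra A K] [IsFractionRing A K] [Field C] [Algebra K C] [IsAlgClosed C] [Normal K C] [Group G]
  {L : IntermediateField K C} {D : A}

lemma IsSplitSolution.of_comp_equiv {Δ Δ' : Type} [Group Δ] [Group Δ'] [Finite Δ] [Finite Δ']
    {eG : G →* (L ≃ₐ[K] L)} (g : Δ ≃* Δ') {f : Δ' →* G} {f' : Δ →* G} (hf : ∀ δ, f' δ = f (g δ))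
    {M : IntermediateField K C} (h : IsSplitSolution A D eG f' M) :
    IsSplitSolution A D eG f M := by
  obtain ⟨h1, h2, hLM, e, he, hs⟩ := h
  refine ⟨h1, h2, hLM, g.symm.trans e, fun δ l => ?_, fun p hp hD hmax => ?_⟩
  · have := he (g.symm δ) l
    rw [hf, g.apply_symm_apply] at this
    exact this
  · obtain ⟨a, ha1, ⟨i, hi, c, hc, hc'⟩, ha3⟩ := hs p hp hD hmax
    have key : ∀ z : M, (conjPoly fun δ => (g.symm.trans e).toMonoidHom δ z) =
        conjPoly fun δ => e.toMonoidHom δ z := fun z =>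
      conjPoly_comp_equiv g.symm.toEquiv fun δ => e.toMonoidHom δ z
    have hcard : Nat.card Δ' = Nat.card Δ := Nat.card_congr g.symm.toEquiv
    refine ⟨a, fun i => by rw [key]; exact ha1 i, ⟨i, hcard ▸ hi, c, hc, by rw [key]; exact hc'⟩,
      fun σ h1 h2 i hi => ?_⟩
    obtain ⟨c, hc, h⟩ := ha3 (g.symm σ) (by
      rw [MonoidHom.mem_ker] at h1 ⊢
      rw [hf, g.apply_symm_apply, h1]) (by simpa using h2) i (hcard ▸ hi)
    exact ⟨c, hc, by rw [key]; exact h⟩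

lemma HasAvoidingSolutions.of_comp_equiv {Δ Δ' : Type} [Group Δ] [Group Δ'] [Finite Δ] [Finite Δ']
    {eG : G →* (L ≃ₐ[K] L)} (g : Δ ≃* Δ') {f : Δ' →* G} {f' : Δ →* G} (hf : ∀ δ, f' δ = f (g δ))
    (h : HasAvoidingSolutions A D eG f') : HasAvoidingSolutions A D eG f := fun 𝓛 h1 h2 =>
  let ⟨M, hM, hM'⟩ := h 𝓛 h1 h2
  ⟨M, hM.of_comp_equiv g hf, hM'⟩

lemma HasAvoidingSolutions.of_bijective {Δ : Type} [Group Δ] [Finite Δ] [IsGalois K L]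
    [FiniteDimensional K L] (eG : G ≃* (L ≃ₐ[K] L)) {f : Δ →* G} (hf : Function.Bijective f) :
    HasAvoidingSolutions A D eG.toMonoidHom f := by
  intro 𝓛 _ h𝓛
  refine ⟨L, ⟨inferInstance, inferInstance, le_rfl, (MulEquiv.ofBijective f hf).trans eG,
    fun δ l => rfl, fun p hp hDp hmax => ?_⟩, h𝓛⟩
  have h1 : (conjPoly fun δ => ((MulEquiv.ofBijective f hf).trans eG).toMonoidHom δ (1 : L)) =
      (conjPoly fun _ : Δ => (1 : A)).map ((algebraMap K L).comp (algebraMap A K)) := by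
    rw [map_conjPoly]
    congr 1
    ext δ
    simp
  refine ⟨1, fun i => ⟨_, by rw [h1, Polynomial.coeff_map]; rfl⟩,
    ⟨0, Nat.card_pos, (conjPoly fun _ : Δ => (1 : A)).coeff 0, ?_, by
      rw [h1, Polynomial.coeff_map]; rfl⟩, fun σ hσ hσ1 => ?_⟩
  · cases nonempty_fintype Δ
    rw [conjPoly_eq_prod, Polynomial.coeff_zero_eq_eval_zero]
    simp only [Finset.prod_const, Polynomial.eval_pow, Polynomial.eval_sub, Polynomial.eval_X,
      Polynomial.eval_C, zero_sub]
    intro h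
    have := hp.mem_of_pow_mem _ h
    rw [neg_mem_iff] at this
    exact hp.ne_top ((Ideal.eq_top_iff_one p).2 this)
  · exact absurd (hf.1 (hσ.trans (map_one f).symm)) hσ1

lemma subgroup_eq_top_of_primePow_mem {N : Type} [Group N] [Finite N] (H : Subgroup N)
    (h : ∀ g : N, IsPrimePow (orderOf g) → g ∈ H) : H = ⊤ := by
  rw [← Subgroup.index_eq_one]
  by_contra hne
  obtain ⟨p, hp, hpd⟩ := Nat.exists_prime_and_dvd hne
  haveI : Fact p.Prime := ⟨hp⟩
  obtain ⟨P⟩ : Nonempty (Sylow p N) := inferInstance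
  have hPH : (P : Subgroup N) ≤ H := by
    intro g hg
    obtain ⟨n, hn⟩ := P.2 ⟨g, hg⟩
    by_cases hg1 : g = 1
    · exact hg1 ▸ H.one_mem
    · apply h
      have hn' : g ^ p ^ n = 1 := congrArg Subtype.val hn
      obtain ⟨m, -, hm⟩ := (Nat.dvd_prime_pow hp).1 (orderOf_dvd_of_pow_eq_one hn')
      rw [hm]
      refine hp.isPrimePow.pow ?_
      rintro rfl
      exact hg1 (orderOf_eq_one_iff.1 (by simpa using hm))
  exact P.not_dvd_index (hpd.trans (Subgroup.index_dvd_of_le hPH))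

/-- Solutions of split embedding problems. -/
lemma HasAvoidingSolutions.of_split {Γ : Type} [Group Γ] [Finite Γ] [Finite G] [IsGalois K L]
    [FiniteDimensional K L] (hK : ℵ₀ < #K) (eG : G ≃* (L ≃ₐ[K] L)) (f : Γ →* G) (s : G →* Γ)
    (hs : f.comp s = MonoidHom.id G)
    (hX : ∀ n, IsPrimePow n → ∀ M : IntermediateField K C, IsGalois K M → FiniteDimensional K M →
      HasPatchFamily A K M D n) :
    HasAvoidingSolutions A D eG.toMonoidHom f := by
  have hs' : ∀ g, f (s g) = g := fun g => DFunLike.congr_fun hs g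
  let 𝓗 : Set (Subgroup Γ) :=
    {H | s.range ≤ H ∧ HasAvoidingSolutions A D eG.toMonoidHom (f.comp H.subtype)}
  have hne : 𝓗.Nonempty := by
    refine ⟨s.range, le_rfl, HasAvoidingSolutions.of_bijective eG ⟨?_, fun g => ?_⟩⟩
    · rintro ⟨_, g, rfl⟩ ⟨_, g', rfl⟩ h
      have : f (s g) = f (s g') := h
      rw [hs', hs'] at this
      rw [this]
    · exact ⟨⟨s g, g, rfl⟩, hs' g⟩
  obtain ⟨H, ⟨hsH, hH⟩, hmax⟩ := (Set.toFinite 𝓗).exists_maximal hne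
  have key : f.ker ≤ H := by
    rw [← Subgroup.subgroupOf_eq_top]
    refine subgroup_eq_top_of_primePow_mem _ fun c hc => ?_
    rw [Subgroup.mem_subgroupOf]
    let H' : Subgroup Γ := Subgroup.zpowers (c : Γ) ⊔ H
    have hHH' : H ≤ H' := le_sup_right
    have hcH' : (c : Γ) ∈ H' := (le_sup_left : _ ≤ H') (Subgroup.mem_zpowers _)
    refine hmax (y := H') ⟨hsH.trans hHH', ?_⟩ hHH' hcH'
    have hord : orderOf (⟨(c : Γ), hcH'⟩ : H') = orderOf c := by
      rw [← Subgroup.orderOf_coe, ← Subgroup.orderOf_coe]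
    refine HasAvoidingSolutions.step hK (H := H.subgroupOf H') (c := ⟨c, hcH'⟩)
      (hH.of_comp_equiv (Subgroup.subgroupOfEquivOfLe hHH').symm fun δ => rfl) c.2 ?_ ?_
    · have h1 : Subgroup.zpowers (⟨(c : Γ), hcH'⟩ : H') =
          (Subgroup.zpowers (c : Γ)).subgroupOf H' := by
        ext z
        rw [Subgroup.mem_subgroupOf, Subgroup.mem_zpowers_iff, Subgroup.mem_zpowers_iff]
        exact exists_congr fun n => by rw [Subtype.ext_iff]; rfl
      rw [h1, ← Subgroup.subgroupOf_sup le_sup_left le_sup_right, Subgroup.subgroupOf_self]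
    · rw [hord]
      exact hX _ hc
  have htop : H = ⊤ := by
    rw [eq_top_iff]
    intro γ _
    have h1 : γ * (s (f γ))⁻¹ ∈ H := key (by
      rw [MonoidHom.mem_ker, map_mul, map_inv, hs', mul_inv_cancel])
    have h2 := H.mul_mem h1 (hsH ⟨f γ, rfl⟩)
    rwa [inv_mul_cancel_right] at h2
  subst htop
  exact hH.of_comp_equiv Subgroup.topEquiv fun δ => rfl

end PatchInduction

section TComplete

open Polynomial

/-- `R` is a `t`-adically complete and separated subring of `Ω`. -/
structure TComplete {Ω : Type} [Field Ω] (t : Ω) (R : Subring Ω) : Prop where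
  mem : t ∈ R
  ne_zero : t ≠ 0
  sum : ∀ a : ℕ → Ω, (∀ n, a n ∈ R) →
    ∃ s : ℕ → Ω, (∀ n, s n ∈ R) ∧ ∀ n, s n = a n + t * s (n + 1)
  sep : ∀ x, (∀ n, ∃ r ∈ R, x = t ^ n * r) → x = 0

variable {Ω : Type} [Field Ω] {t : Ω} {R : Subring Ω}

/-- Contracting polynomial maps have fixed points. -/
lemma TComplete.exists_fixed (h : TComplete t R) (q : R[X]) :
    ∃ z : R, (z : Ω) = t * (q.eval z : R) := by
  let τ : R := ⟨t, h.mem⟩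
  let z : ℕ → R := fun n => Nat.rec 0 (fun _ y => τ * q.eval y) n
  have hz : ∀ n, z (n + 1) = τ * q.eval (z n) := fun n => rfl
  have hd : ∀ n, ∃ a : R, z (n + 1) = z n + τ ^ n * a := by
    intro n
    induction n with
    | zero => exact ⟨z 1 - z 0, by simp⟩
    | succ n ih =>
      obtain ⟨a, ha⟩ := ih
      obtain ⟨b, hb⟩ := sub_dvd_eval_sub (z (n + 1)) (z n) q
      refine ⟨a * b, ?_⟩
      have h1 : z (n + 1 + 1) - z (n + 1) = τ * (q.eval (z (n + 1)) - q.eval (z n)) := by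
        rw [hz (n + 1), mul_sub, hz n]
      have h2 : z (n + 1) - z n = τ ^ n * a := by rw [ha]; ring
      rw [hb, h2] at h1
      linear_combination h1
  choose a ha using hd
  obtain ⟨s, hs, hs'⟩ := h.sum (fun n => a n) fun n => (a n).2
  have hs2 : ∀ n, (⟨s 0, hs 0⟩ : R) = z n + τ ^ n * ⟨s n, hs n⟩ := by
    intro n
    induction n with
    | zero => simp [z]
    | succ n ih =>
      rw [ih, ha n]
      apply Subtype.ext
      change (z n).1 + t ^ n * s n = (z n).1 + t ^ n * (a n).1 + t ^ (n + 1) * s (n + 1)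
      rw [hs' n]; ring
  refine ⟨⟨s 0, hs 0⟩, ?_⟩
  rw [← sub_eq_zero]
  refine h.sep _ fun n => ?_
  obtain ⟨b, hb⟩ := sub_dvd_eval_sub (⟨s 0, hs 0⟩ : R) (z n) q
  let y : R := ⟨s 0, hs 0⟩ - τ * q.eval ⟨s 0, hs 0⟩
  have hy : y = τ ^ n * (⟨s n, hs n⟩ * (1 - τ * b) - a n) := by
    have h1 := hs2 n
    have h3 := ha n
    rw [hz] at h3
    have h2 : (⟨s 0, hs 0⟩ : R) - z n = τ ^ n * ⟨s n, hs n⟩ := by rw [h1]; ring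
    rw [h2] at hb
    simp only [y]
    linear_combination h1 - h3 - τ * hb
  exact ⟨_, (⟨s n, hs n⟩ * (1 - τ * b) - a n : R).2, congrArg Subtype.val hy⟩

lemma TComplete.exists_inv (h : TComplete t R) {r : Ω} (hr : r ∈ R) :
    ∃ z ∈ R, (1 - t * r) * z = 1 := by
  obtain ⟨z, hz⟩ := h.exists_fixed (C ⟨r, hr⟩ * (1 + X))
  simp only [eval_mul, eval_C, eval_add, eval_one, eval_X] at hz
  change (z : Ω) = t * (r * (1 + z)) at hz
  exact ⟨1 + z, R.add_mem R.one_mem z.2, by linear_combination hz⟩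

lemma TComplete.one_sub_ne_zero (h : TComplete t R) {r : Ω} (hr : r ∈ R) : 1 - t * r ≠ 0 := by
  obtain ⟨z, -, hz⟩ := h.exists_inv hr
  exact left_ne_zero_of_mul_eq_one hz

lemma TComplete.inv_mem (h : TComplete t R) {r : Ω} (hr : r ∈ R) : (1 - t * r)⁻¹ ∈ R := by
  obtain ⟨z, hzR, hz⟩ := h.exists_inv hr
  rwa [← eq_inv_of_mul_eq_one_right hz]

end TComplete

section HahnLex

/-- The field of iterated Laurent series in `t` and `v`. -/
abbrev LexField (k : Type) [Field k] : Type := HahnSeries (ℤ ×ₗ ℤ) k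

variable {k : Type} [Field k]

lemma LexField.exists_of_coeff (c : ℤ → ℤ → k) (N : ℤ) (h0 : ∀ n < N, ∀ i, c n i = 0)
    (hb : ∀ n, ∃ b, ∀ i < b, c n i = 0) :
    ∃ x : LexField k, ∀ n i, x.coeff (toLex (n, i)) = c n i := by
  have wf : ∀ (s : Set ℤ) (b : ℤ), (∀ i ∈ s, b ≤ i) → s.IsPWO := fun s b hs =>
    (BddBelow.isWF ⟨b, hs⟩).isPWO
  refine ⟨⟨fun p => c (ofLex p).1 (ofLex p).2, ?_⟩, fun n i => rfl⟩
  refine Set.PartiallyWellOrderedOn.subsetProdLex ?_ ?_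
  · refine wf _ N ?_
    rintro _ ⟨p, hp, rfl⟩
    by_contra hlt
    exact hp (h0 _ (not_le.1 hlt) _)
  · intro n
    obtain ⟨b, hb⟩ := hb n
    refine wf _ b fun i hi => ?_
    by_contra hlt
    exact hi (hb _ (not_le.1 hlt))

lemma LexField.exists_bound (x : LexField k) (n : ℤ) :
    ∃ b, ∀ i < b, x.coeff (toLex (n, i)) = 0 := by
  have h := (Set.PartiallyWellOrderedOn.fiberProdLex x.isPWO_support n)
  by_contra hcon
  push Not at hcon
  have hwf := Set.IsPWO.isWF h
  obtain ⟨i₀, -, hi₀⟩ := hcon 0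
  obtain ⟨j, hj, hj'⟩ := hcon (hwf.min ⟨i₀, hi₀⟩)
  exact hwf.not_lt_min ⟨i₀, hi₀⟩ (a := j) hj' hj

lemma LexField.exists_bound_fst (x : LexField k) :
    ∃ N, ∀ n < N, ∀ i, x.coeff (toLex (n, i)) = 0 := by
  by_cases hx : x = 0
  · exact ⟨0, fun n _ i => by rw [hx]; rfl⟩
  refine ⟨(ofLex x.order).1, fun n hn i => HahnSeries.coeff_eq_zero_of_lt_order ?_⟩
  rw [Prod.Lex.lt_iff]
  exact Or.inl hn

lemma LexField.ext {x y : LexField k} (h : ∀ n i, x.coeff (toLex (n, i)) = y.coeff (toLex (n, i))) :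
    x = y := by
  ext p
  exact h (ofLex p).1 (ofLex p).2

/-- Series supported in a submonoid. -/
def suppRing (k : Type) [Field k] (S : AddSubmonoid (ℤ ×ₗ ℤ)) : Subring (LexField k) where
  carrier := {x | x.support ⊆ S}
  mul_mem' {x y} hx hy := HahnSeries.support_mul_subset.trans fun _ ⟨a, ha, b, hb, h⟩ =>
    h ▸ S.add_mem (hx ha) (hy hb)
  one_mem' := by
    change (1 : LexField k).support ⊆ S
    rw [HahnSeries.support_one]
    simp [S.zero_mem]
  add_mem' {x y} hx hy := (HahnSeries.support_add_subset x y).trans (Set.union_subset hx hy)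
  zero_mem' := by
    change (0 : LexField k).support ⊆ S
    simp
  neg_mem' {x} hx := by
    change (-x).support ⊆ S
    rw [HahnSeries.support_neg]
    exact hx

lemma mem_suppRing {S : AddSubmonoid (ℤ ×ₗ ℤ)} {x : LexField k} :
    x ∈ suppRing k S ↔ ∀ n i, x.coeff (toLex (n, i)) ≠ 0 → toLex (n, i) ∈ S :=
  ⟨fun h n i hx => h hx, fun h p hp => h (ofLex p).1 (ofLex p).2 hp⟩

/-- The monomial `t ^ n * v ^ i`. -/
noncomputable def lexMono (k : Type) [Field k] (n i : ℤ) : LexField k :=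
  HahnSeries.single (toLex (n, i)) 1

lemma coeff_lexMono_mul (x : LexField k) (n i a b : ℤ) :
    (lexMono k n i * x).coeff (toLex (a, b)) = x.coeff (toLex (a - n, b - i)) := by
  have : toLex (a, b) = toLex (a - n, b - i) + toLex (n, i) := by
    rw [← toLex_add]; simp
  rw [this, lexMono, HahnSeries.coeff_single_mul_add, one_mul]

lemma lexMono_mul (n i n' i' : ℤ) :
    lexMono k n i * lexMono k n' i' = lexMono k (n + n') (i + i') := by
  rw [lexMono, lexMono, HahnSeries.single_mul_single, one_mul]
  rfl

lemma lexMono_zero : lexMono k 0 0 = 1 := rfl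

lemma lexMono_ne_zero (n i : ℤ) : lexMono k n i ≠ 0 :=
  HahnSeries.single_ne_zero one_ne_zero

lemma lexMono_inv (n i : ℤ) : (lexMono k n i)⁻¹ = lexMono k (-n) (-i) := by
  rw [inv_eq_iff_eq_inv, eq_comm, inv_eq_of_mul_eq_one_right]
  rw [lexMono_mul, neg_add_cancel, neg_add_cancel, lexMono_zero]

lemma lexMono_pow (n i : ℤ) (N : ℕ) : lexMono k n i ^ N = lexMono k (N * n) (N * i) := by
  induction N with
  | zero => simp [lexMono_zero]
  | succ N ih =>
    rw [pow_succ, ih, lexMono_mul]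
    congr 1 <;> push_cast <;> ring

lemma lexMono_mem {S : AddSubmonoid (ℤ ×ₗ ℤ)} {n i : ℤ} (h : toLex (n, i) ∈ S) :
    lexMono k n i ∈ suppRing k S := by
  change (lexMono k n i).support ⊆ S
  exact HahnSeries.support_single_subset.trans (Set.singleton_subset_iff.2 h)

lemma LexField.exists_tsum (a : ℕ → LexField k)
    (ha : ∀ N, ∀ n < 0, ∀ i, (a N).coeff (toLex (n, i)) = 0) :
    ∃ s : LexField k, ∀ n i, s.coeff (toLex (n, i)) =
      ∑ l ∈ Finset.range (n.toNat + 1), (a l).coeff (toLex (n - l, i)) := by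
  refine LexField.exists_of_coeff _ 0 (fun n hn i => ?_) fun n => ?_
  · exact Finset.sum_eq_zero fun l _ => ha _ _ (by omega) _
  · choose b hb using fun l : ℕ => (a l).exists_bound (n - l)
    obtain ⟨B, hB⟩ := (Finset.finite_toSet (Finset.image b (Finset.range (n.toNat + 1)))).bddBelow
    refine ⟨B, fun i hi => Finset.sum_eq_zero fun l hl => hb l i (hi.trans_le ?_)⟩
    exact hB (Finset.mem_coe.2 (Finset.mem_image_of_mem _ hl))

lemma tComplete_suppRing {S : AddSubmonoid (ℤ ×ₗ ℤ)} (h1 : toLex (1, 0) ∈ S)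
    (h0 : ∀ n i, toLex (n, i) ∈ S → 0 ≤ n) : TComplete (lexMono k 1 0) (suppRing k S) where
  mem := lexMono_mem h1
  ne_zero := lexMono_ne_zero _ _
  sum a ha := by
    have ha0 : ∀ N, ∀ n < 0, ∀ i, (a N).coeff (toLex (n, i)) = 0 := fun N n hn i => by
      by_contra hne
      exact absurd (h0 _ _ (mem_suppRing.1 (ha N) n i hne)) (not_le.2 hn)
    choose s hs using fun N => LexField.exists_tsum (fun l => a (N + l)) fun l => ha0 _
    refine ⟨s, fun N => mem_suppRing.2 fun n i hne => ?_, fun N => LexField.ext fun n i => ?_⟩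
    · rw [hs] at hne
      obtain ⟨l, -, hl⟩ := Finset.exists_ne_zero_of_sum_ne_zero hne
      have := mem_suppRing.1 (ha _) _ _ hl
      have h2 := S.add_mem this (S.nsmul_mem h1 l)
      convert h2 using 1
      change (n, i) = (n - (l : ℤ), i) + l • ((1 : ℤ), (0 : ℤ))
      simp
    · rw [HahnSeries.coeff_add, coeff_lexMono_mul, hs, hs]
      rcases lt_trichotomy n 0 with hn | rfl | hn
      · rw [ha0 N n hn, Finset.sum_eq_zero, Finset.sum_eq_zero, add_zero]
        · exact fun l _ => ha0 _ _ (by omega) _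
        · exact fun l _ => ha0 _ _ (by omega) _
      · rw [Finset.sum_eq_zero (s := Finset.range ((0 - 1 : ℤ).toNat + 1))]
        · simp
        · exact fun l _ => ha0 _ _ (by omega) _
      · rw [Finset.sum_range_succ']
        have : n.toNat = (n - 1).toNat + 1 := by omega
        rw [this, add_comm]
        congr 1
        · simp
        · refine Finset.sum_congr rfl fun l _ => ?_
          rw [show N + 1 + l = N + (l + 1) by ring, show n - 1 - (l : ℤ) = n - ((l + 1 : ℕ) : ℤ) by
            push_cast; ring, sub_zero]
  sep x hx := by
    refine LexField.ext fun n i => ?_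
    obtain ⟨r, hr, h⟩ := hx (n.toNat + 1)
    rw [h, lexMono_pow, coeff_lexMono_mul]
    by_contra hne
    have := h0 _ _ (mem_suppRing.1 hr _ _ hne)
    push_cast at this
    omega

end HahnLex

section PatchRings

variable {Ω : Type} [Field Ω] {t : Ω} {F : Subfield Ω} {R₀ R₁ R₂ : Subring Ω}

/-- Rings satisfying the hypotheses of formal patching: `R₀ = R₁ + R₂` inside a field `Ω`, all of
them `t`-adically complete, and `R₀` approximated by a subfield `F` containing `R₁`. -/
structure PatchRings (t : Ω) (F : Subfield Ω) (R₀ R₁ R₂ : Subring Ω) : Prop where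
  complete₀ : TComplete t R₀
  complete₁ : TComplete t R₁
  complete₂ : TComplete t R₂
  le₁ : R₁ ≤ R₀
  le₂ : R₂ ≤ R₀
  mem_of_mem : ∀ x ∈ R₁, x ∈ F
  exists_add : ∀ z ∈ R₀, ∃ a ∈ R₁, ∃ r ∈ R₂, z = a + r
  exists_pow_mul : ∀ x, ∃ N : ℕ, t ^ N * x ∈ R₀
  dense : ∀ z ∈ R₀, ∃ b ∈ F, ∃ z' ∈ R₀, z = b + t * z'

lemma Subring.pow_mul_mem_of_le {R : Subring Ω} (ht : t ∈ R) {x : Ω} {N M : ℕ} (hNM : N ≤ M)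
    (h : t ^ N * x ∈ R) : t ^ M * x ∈ R := by
  obtain ⟨l, rfl⟩ := Nat.exists_eq_add_of_le' hNM
  rw [pow_add, mul_assoc]
  exact R.mul_mem (R.pow_mem ht l) h

lemma PatchRings.approx (h : PatchRings t F R₀ R₁ R₂) (x : Ω) (N : ℕ) :
    ∃ b ∈ F, ∃ z ∈ R₀, x = b + t ^ N * z := by
  have ht : t ∈ F := h.mem_of_mem t h.complete₁.mem
  have key : ∀ N, ∀ z ∈ R₀, ∃ b ∈ F, ∃ z' ∈ R₀, z = b + t ^ N * z' := by
    intro N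
    induction N with
    | zero => exact fun z hz => ⟨0, F.zero_mem, z, hz, by simp⟩
    | succ N ih =>
      intro z hz
      obtain ⟨b, hb, z', hz', rfl⟩ := ih z hz
      obtain ⟨b', hb', z'', hz'', rfl⟩ := h.dense z' hz'
      exact ⟨b + t ^ N * b', F.add_mem hb (F.mul_mem (F.pow_mem ht N) hb'), z'', hz'', by ring⟩
  obtain ⟨M, hM⟩ := h.exists_pow_mul x
  obtain ⟨b, hb, z, hz, hx⟩ := key (M + N) _ hM
  have h0 : t ^ M ≠ 0 := pow_ne_zero _ h.complete₀.ne_zero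
  refine ⟨(t ^ M)⁻¹ * b, F.mul_mem (F.inv_mem (F.pow_mem ht M)) hb, z, hz, ?_⟩
  rw [← mul_right_inj' h0, hx]
  field_simp
  ring

lemma PatchRings.exists_split_one_add (h : PatchRings t F R₀ R₁ R₂) {ι : Type} [Fintype ι]
    [DecidableEq ι] (S : Matrix ι ι Ω) (hS : ∀ i j, S i j ∈ R₀) (w : ι → Ω) (hw : ∀ i, w i ∈ R₀) :
    ∃ a r : ι → Ω, (∀ i, a i ∈ R₁) ∧ (∀ i, r i ∈ R₂) ∧ w = a + t • S.mulVec a + r := by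
  have hadd : ∀ z : {z : ι → Ω // ∀ i, z i ∈ R₀}, ∃ a r : ι → Ω, (∀ i, a i ∈ R₁) ∧
      (∀ i, r i ∈ R₂) ∧ z.1 = a + r := fun z => by
    choose a ha r hr hz using fun i => h.exists_add _ (z.2 i)
    exact ⟨a, r, ha, hr, funext hz⟩
  choose α ρ hα hρ hαρ using hadd
  have hSv : ∀ a : ι → Ω, (∀ i, a i ∈ R₀) → ∀ i, S.mulVec a i ∈ R₀ := fun a ha i =>
    R₀.sum_mem fun j _ => R₀.mul_mem (hS i j) (ha j)
  let W : ℕ → {z : ι → Ω // ∀ i, z i ∈ R₀} := fun n => Nat.rec ⟨w, hw⟩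
    (fun _ z => ⟨-S.mulVec (α z), fun i => R₀.neg_mem (hSv _ (fun j => h.le₁ (hα z j)) i)⟩) n
  have hW : ∀ n, (W (n + 1)).1 = -S.mulVec (α (W n)) := fun n => rfl
  choose sa hsa hsa' using fun i => h.complete₁.sum (fun n => α (W n) i) fun n => hα _ _
  choose sr hsr hsr' using fun i => h.complete₂.sum (fun n => ρ (W n) i) fun n => hρ _ _
  let e : ℕ → ι → Ω := fun n =>
    (fun i => sa i n) + t • S.mulVec (fun i => sa i n) + (fun i => sr i n) - (W n).1
  have hsa2 : ∀ n, (fun i => sa i n) = α (W n) + t • fun i => sa i (n + 1) := fun n =>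
    funext fun i => hsa' i n
  have hsr2 : ∀ n, (fun i => sr i n) = ρ (W n) + t • fun i => sr i (n + 1) := fun n =>
    funext fun i => hsr' i n
  have he : ∀ n, e n = t • e (n + 1) := fun n => by
    simp only [e]
    rw [hsa2 n, hsr2 n, hW n, hαρ (W n), Matrix.mulVec_add, Matrix.mulVec_smul]
    simp only [smul_add, smul_sub, smul_neg]
    abel
  have heR : ∀ n i, e n i ∈ R₀ := fun n i =>
    R₀.sub_mem (R₀.add_mem (R₀.add_mem (h.le₁ (hsa i n)) (R₀.mul_mem h.complete₀.mem
      (hSv _ (fun j => h.le₁ (hsa j n)) i))) (h.le₂ (hsr i n))) ((W n).2 i)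
  have hen : ∀ n, e 0 = t ^ n • e n := fun n => by
    induction n with
    | zero => simp
    | succ n ih => rw [ih, he n, smul_smul, pow_succ]
  refine ⟨fun i => sa i 0, fun i => sr i 0, fun i => hsa i 0, fun i => hsr i 0, ?_⟩
  have h0 : e 0 = 0 := funext fun i => h.complete₀.sep _ fun n =>
    ⟨e n i, heR n i, congrFun (hen n) i⟩
  exact (sub_eq_zero.1 h0).symm

/-- Matrix factorization over patching rings. -/
lemma PatchRings.split (h : PatchRings t F R₀ R₁ R₂) {ι : Type} [Fintype ι]
    [DecidableEq ι] (T : Matrix ι ι Ω) (hT : IsUnit T.det) (w : ι → Ω) :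
    ∃ a r : ι → Ω, (∀ i, a i ∈ F) ∧ (∀ i, r i ∈ R₂) ∧ w = T.mulVec a + r := by
  have ht0 := h.complete₀.mem
  obtain ⟨M, hM⟩ : ∃ M : ℕ, ∀ i j, t ^ M * T i j ∈ R₀ := by
    choose M hM using fun p : ι × ι => h.exists_pow_mul (T p.1 p.2)
    exact ⟨Finset.univ.sup M, fun i j => Subring.pow_mul_mem_of_le ht0
      (Finset.le_sup (f := M) (Finset.mem_univ (i, j))) (hM (i, j))⟩
  choose B hB Z hZ hBZ using fun i j => h.approx (T⁻¹ i j) (M + 1)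
  choose b hb z hz hbz using fun i => h.approx ((T⁻¹).mulVec w i) M
  have hmem : ∀ (i : ι) (y : ι → Ω), (∀ j, y j ∈ R₀) → (t ^ M • T).mulVec y i ∈ R₀ :=
    fun i y hy => R₀.sum_mem fun j _ => R₀.mul_mem (hM i j) (hy j)
  have hT1 : T * T⁻¹ = 1 := Matrix.mul_nonsing_inv T hT
  have hB' : T⁻¹ = Matrix.of B + t ^ (M + 1) • Matrix.of Z := by
    ext i j; exact hBZ i j
  have hb' : (T⁻¹).mulVec w = b + t ^ M • z := funext hbz
  obtain ⟨a, r, ha, hr, har⟩ := h.exists_split_one_add (-((t ^ M • T) * Matrix.of Z))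
    (fun i j => R₀.neg_mem (R₀.sum_mem fun l _ => R₀.mul_mem (hM i l) (hZ l j)))
    ((t ^ M • T).mulVec z) (fun i => hmem i z hz)
  refine ⟨b + (Matrix.of B).mulVec a, r, fun i => F.add_mem (hb i) (F.sum_mem fun j _ =>
    F.mul_mem (hB i j) (h.mem_of_mem _ (ha j))), hr, ?_⟩
  have hw : w = T.mulVec b + (t ^ M • T).mulVec z := by
    have : T.mulVec ((T⁻¹).mulVec w) = w := by rw [Matrix.mulVec_mulVec, hT1, Matrix.one_mulVec]
    rw [← this, hb', Matrix.mulVec_add, Matrix.mulVec_smul, Matrix.smul_mulVec]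
  have hTB : (T * Matrix.of B) = 1 + t • (-((t ^ M • T) * Matrix.of Z)) := by
    rw [hB', mul_add, Matrix.mul_smul] at hT1
    rw [← hT1, Matrix.smul_mul, smul_neg, smul_smul, ← pow_succ']
    abel
  rw [hw, har, Matrix.mulVec_add, Matrix.mulVec_mulVec, hTB, Matrix.add_mulVec, Matrix.one_mulVec,
    Matrix.smul_mulVec]
  abel

/-- The special case of one-by-one matrices. -/
lemma PatchRings.exists_mul_eq (h : PatchRings t F R₀ R₁ R₂) {z : Ω} (hz : z ∈ R₀) :
    ∃ a ∈ R₁, ∃ r ∈ R₂, (1 - t * z) * (1 - t * a) = 1 - t * r := by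
  obtain ⟨a, r, ha, hr, har⟩ := h.exists_split_one_add (ι := Unit) (Matrix.of fun _ _ => -z)
    (fun _ _ => R₀.neg_mem hz) (fun _ => z) (fun _ => hz)
  refine ⟨-a (), R₁.neg_mem (ha _), r (), hr _, ?_⟩
  have := congrFun har ()
  simp [Matrix.mulVec, dotProduct] at this
  linear_combination (-t) * this

end PatchRings

section LexPatch

variable {k : Type} [Field k]

/-- The exponents with nonnegative power of `t`. -/
def cone₀ : AddSubmonoid (ℤ ×ₗ ℤ) where
  carrier := {p | 0 ≤ (ofLex p).1}
  add_mem' {p q} hp hq := add_nonneg (a := (ofLex p).1) hp hq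
  zero_mem' := le_refl (0 : ℤ)

/-- The exponents with nonnegative power of `t` and `v`. -/
def cone₁ : AddSubmonoid (ℤ ×ₗ ℤ) where
  carrier := {p | 0 ≤ (ofLex p).1 ∧ 0 ≤ (ofLex p).2}
  add_mem' {p q} hp hq := ⟨add_nonneg (a := (ofLex p).1) hp.1 hq.1,
    add_nonneg (a := (ofLex p).2) hp.2 hq.2⟩
  zero_mem' := ⟨le_refl (0 : ℤ), le_refl (0 : ℤ)⟩

/-- The exponents with nonnegative power of `t` dominating `m` times the power of `v`. -/
def cone₂ (m : ℕ) : AddSubmonoid (ℤ ×ₗ ℤ) where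
  carrier := {p | 0 ≤ (ofLex p).1 ∧ m * (ofLex p).2 ≤ (ofLex p).1}
  add_mem' {p q} hp hq := ⟨add_nonneg (a := (ofLex p).1) hp.1 hq.1, by
    change (m : ℤ) * ((ofLex p).2 + (ofLex q).2) ≤ (ofLex p).1 + (ofLex q).1
    rw [mul_add]; exact add_le_add hp.2 hq.2⟩
  zero_mem' := ⟨le_refl (0 : ℤ), by change (m : ℤ) * 0 ≤ 0; simp⟩

lemma mem_cone₀ {n i : ℤ} : toLex (n, i) ∈ cone₀ ↔ 0 ≤ n := Iff.rfl
lemma mem_cone₁ {n i : ℤ} : toLex (n, i) ∈ cone₁ ↔ 0 ≤ n ∧ 0 ≤ i := Iff.rfl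
lemma mem_cone₂ {m : ℕ} {n i : ℤ} : toLex (n, i) ∈ cone₂ m ↔ 0 ≤ n ∧ m * i ≤ n := Iff.rfl

variable (k) in
/-- The ring `k((v))[[t]]`. -/
abbrev lexRing₀ : Subring (LexField k) := suppRing k cone₀
variable (k) in
/-- The ring `k[[v, t]]`. -/
abbrev lexRing₁ : Subring (LexField k) := suppRing k cone₁
variable (k) in
/-- The ring `k[v⁻¹][[t, t ^ m * v]]`. -/
abbrev lexRing₂ (m : ℕ) : Subring (LexField k) := suppRing k (cone₂ m)
variable (k) in
/-- The fraction field of `k[[v, t]]`. -/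
noncomputable abbrev lexFrac₁ : Subfield (LexField k) := Subfield.closure (lexRing₁ k : Set (LexField k))
variable (k) in
/-- The fraction field of `lexRing₂`. -/
noncomputable abbrev lexFrac₂ (m : ℕ) : Subfield (LexField k) :=
  Subfield.closure (lexRing₂ k m : Set (LexField k))
variable (k) in
/-- The fraction field of `k[[t, t ^ m * v]]`. -/
noncomputable abbrev lexFrac (m : ℕ) : Subfield (LexField k) :=
  Subfield.closure ((lexRing₁ k ⊓ lexRing₂ k m : Subring _) : Set (LexField k))

lemma LexField.exists_restrict (x : LexField k) (P : ℤ → ℤ → Prop)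
    [∀ n i, Decidable (P n i)] :
    ∃ y : LexField k, ∀ n i, y.coeff (toLex (n, i)) = if P n i then x.coeff (toLex (n, i)) else 0 := by
  obtain ⟨N, hN⟩ := x.exists_bound_fst
  refine LexField.exists_of_coeff _ N (fun n hn i => ?_) fun n => ?_
  · rw [hN n hn i, ite_self]
  · obtain ⟨b, hb⟩ := x.exists_bound n
    exact ⟨b, fun i hi => by rw [hb i hi, ite_self]⟩

lemma mem_lexRing₁_of_coeff {x : LexField k}
    (h : ∀ n i, x.coeff (toLex (n, i)) ≠ 0 → 0 ≤ n ∧ 0 ≤ i) : x ∈ lexRing₁ k :=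
  mem_suppRing.2 h

lemma lexMono_mem_lexFrac₁ (n i : ℤ) : lexMono k n i ∈ lexFrac₁ k := by
  have key : ∀ n i : ℕ, lexMono k n i ∈ lexFrac₁ k := fun n i =>
    Subfield.subset_closure (lexMono_mem (mem_cone₁.2 ⟨by positivity, by positivity⟩))
  have : lexMono k n i = lexMono k n.toNat i.toNat * (lexMono k (-n).toNat (-i).toNat)⁻¹ := by
    rw [lexMono_inv, lexMono_mul]
    congr 1 <;> omega
  rw [this]
  exact Subfield.mul_mem _ (key _ _) (Subfield.inv_mem _ (key _ _))

lemma LexField.exists_pow_mul_mem_lexRing₀ (x : LexField k) :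
    ∃ N : ℕ, lexMono k 1 0 ^ N * x ∈ lexRing₀ k := by
  obtain ⟨N, hN⟩ := x.exists_bound_fst
  refine ⟨(-N).toNat, mem_suppRing.2 fun n i h => mem_cone₀.2 ?_⟩
  rw [lexMono_pow, coeff_lexMono_mul] at h
  by_contra hlt
  exact h (hN _ (by omega) _)

variable (k) in
lemma lex_patchRings (m : ℕ) :
    PatchRings (lexMono k 1 0) (lexFrac₁ k) (lexRing₀ k) (lexRing₁ k) (lexRing₂ k m) where
  complete₀ := tComplete_suppRing (mem_cone₀.2 zero_le_one) fun n i h => h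
  complete₁ := tComplete_suppRing (mem_cone₁.2 ⟨zero_le_one, le_refl _⟩) fun n i h => h.1
  complete₂ := tComplete_suppRing (mem_cone₂.2 ⟨zero_le_one, by simp⟩) fun n i h => h.1
  le₁ x hx p hp := (hx hp).1
  le₂ x hx p hp := (hx hp).1
  mem_of_mem x hx := Subfield.subset_closure hx
  exists_add z hz := by
    obtain ⟨a, ha⟩ := z.exists_restrict fun _ i => 0 ≤ i
    have hz := mem_suppRing.1 hz
    refine ⟨a, mem_suppRing.2 fun n i h => mem_cone₁.2 ?_, z - a, mem_suppRing.2 fun n i h =>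
      mem_cone₂.2 ?_, by ring⟩
    · rw [ha] at h
      split_ifs at h with hi
      · exact ⟨hz _ _ h, hi⟩
      · exact absurd rfl h
    · rw [HahnSeries.coeff_sub, ha] at h
      split_ifs at h with hi
      · simp at h
      · rw [sub_zero] at h
        have := mem_cone₀.1 (hz _ _ h)
        exact ⟨this, by nlinarith⟩
  exists_pow_mul := LexField.exists_pow_mul_mem_lexRing₀
  dense z hz := by
    have hz := mem_suppRing.1 hz
    obtain ⟨a, ha⟩ := z.exists_restrict fun n _ => n = 0
    obtain ⟨b, hb⟩ := z.exists_bound 0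
    refine ⟨a, ?_, lexMono k (-1) 0 * (z - a), mem_suppRing.2 fun n i h => mem_cone₀.2 ?_, ?_⟩
    · have h1 : lexMono k 0 (-b) * a ∈ lexRing₁ k := mem_lexRing₁_of_coeff fun n i h => by
        rw [coeff_lexMono_mul, ha] at h
        split_ifs at h with hn
        · refine ⟨by omega, ?_⟩
          by_contra hlt
          rw [hn] at h
          exact h (hb _ (by omega))
        · exact absurd rfl h
      have h2 : a = (lexMono k 0 (-b))⁻¹ * (lexMono k 0 (-b) * a) := by
        rw [inv_mul_cancel_left₀ (lexMono_ne_zero _ _)]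
      rw [h2]
      exact Subfield.mul_mem _ (Subfield.inv_mem _ (lexMono_mem_lexFrac₁ _ _))
        (Subfield.subset_closure h1)
    · rw [coeff_lexMono_mul, HahnSeries.coeff_sub, ha] at h
      split_ifs at h with hn
      · simp at h
      · rw [sub_zero] at h
        have := mem_cone₀.1 (hz _ _ h)
        omega
    · rw [← mul_assoc, lexMono_mul]
      simp [lexMono_zero]

/-- Power series in `v`. -/
noncomputable def lexOfPowerSeries (k : Type) [Field k] : PowerSeries k →+* LexField k :=
  (HahnSeries.embDomainRingHom (R := k) (Γ := ℕ) (Γ' := ℤ ×ₗ ℤ)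
    { toFun := fun i => toLex ((0 : ℤ), (i : ℤ))
      map_zero' := rfl
      map_add' := fun a b => by rw [← toLex_add]; simp }
    (fun a b h => by
      have := congrArg (fun p => (ofLex p).2) h
      exact Int.ofNat_inj.1 this)
    (fun a b => by
      change toLex ((0 : ℤ), (a : ℤ)) ≤ toLex ((0 : ℤ), (b : ℤ)) ↔ _
      rw [Prod.Lex.toLex_le_toLex]
      simp)).comp
  (HahnSeries.toPowerSeries (R := k)).symm.toRingHom

lemma coeff_lexOfPowerSeries_zero (w : PowerSeries k) (i : ℕ) :
    (lexOfPowerSeries k w).coeff (toLex (0, (i : ℤ))) = w.coeff i := by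
  refine (HahnSeries.embDomain_coeff (a := i)).trans ?_
  simp [HahnSeries.toPowerSeries]

lemma coeff_lexOfPowerSeries_of_ne (w : PowerSeries k) (n i : ℤ) (h : ¬ (n = 0 ∧ 0 ≤ i)) :
    (lexOfPowerSeries k w).coeff (toLex (n, i)) = 0 := by
  refine HahnSeries.embDomain_of_notMem_range ?_
  rintro ⟨j, hj⟩
  have h1 := congrArg (fun p => (ofLex p).1) hj
  have h2 := congrArg (fun p => (ofLex p).2) hj
  refine h ⟨h1.symm, ?_⟩
  have : ((j : ℕ) : ℤ) = i := h2
  omega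

lemma lexOfPowerSeries_mem (w : PowerSeries k) : lexOfPowerSeries k w ∈ lexRing₁ k :=
  mem_lexRing₁_of_coeff fun n i h => by
    by_contra hlt
    exact h (coeff_lexOfPowerSeries_of_ne w n i fun ⟨h1, h2⟩ => hlt ⟨h1.ge, h2⟩)

/-- Every nonzero element is a monomial times a unit of `k[[v, t]]` times a one-unit. -/
lemma LexField.exists_eq_lexMono_mul {b : LexField k} (hb : b ≠ 0) :
    ∃ n j : ℤ, ∃ u ∈ lexRing₁ k, u⁻¹ ∈ lexRing₁ k ∧ u ≠ 0 ∧ ∃ z ∈ lexRing₀ k,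
      b = lexMono k n j * u * (1 - lexMono k 1 0 * z) := by
  set n := (ofLex b.order).1 with hn
  set j := (ofLex b.order).2 with hj
  have hord : b.order = toLex (n, j) := rfl
  have hbj : b.coeff (toLex (n, j)) ≠ 0 := HahnSeries.coeff_order_eq_zero.not.2 hb
  have hlt : ∀ n' i', (n' < n ∨ n' = n ∧ i' < j) → b.coeff (toLex (n', i')) = 0 := fun n' i' h => by
    refine HahnSeries.coeff_eq_zero_of_lt_order ?_
    rw [hord, Prod.Lex.toLex_lt_toLex]
    exact h
  let w : PowerSeries k := PowerSeries.mk fun i => b.coeff (toLex (n, j + i))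
  have hw : PowerSeries.constantCoeff w ≠ 0 := by simpa [w] using hbj
  have hwi : w * w⁻¹ = 1 := PowerSeries.mul_inv_cancel w hw
  have hui : lexOfPowerSeries k w * lexOfPowerSeries k w⁻¹ = 1 := by rw [← map_mul, hwi, map_one]
  have hu0 : lexOfPowerSeries k w ≠ 0 := left_ne_zero_of_mul_eq_one hui
  have hu : (lexOfPowerSeries k w)⁻¹ = lexOfPowerSeries k w⁻¹ := inv_eq_of_mul_eq_one_right hui
  set u := lexOfPowerSeries k w with hudef
  have hx : lexMono k (-1) 0 * (u - lexMono k (-n) (-j) * b) ∈ lexRing₀ k := by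
    refine mem_suppRing.2 fun n' i h => mem_cone₀.2 ?_
    by_contra hneg
    apply h
    rw [coeff_lexMono_mul, HahnSeries.coeff_sub, coeff_lexMono_mul]
    by_cases h1 : n' = -1
    · subst h1
      by_cases h2 : 0 ≤ i
      · obtain ⟨i, rfl⟩ := Int.eq_ofNat_of_zero_le h2
        have := coeff_lexOfPowerSeries_zero w i
        simp only [PowerSeries.coeff_mk, w] at this
        simp only [sub_self, sub_zero, sub_neg_eq_add, zero_add, neg_add_cancel, hudef] at this ⊢
        rw [this, add_comm, sub_self]
      · rw [coeff_lexOfPowerSeries_of_ne _ _ _ (by omega), hlt _ _ (Or.inr ⟨by omega, by omega⟩),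
          sub_zero]
    · rw [coeff_lexOfPowerSeries_of_ne _ _ _ (by omega), hlt _ _ (Or.inl (by omega)), sub_zero]
  refine ⟨n, j, u, lexOfPowerSeries_mem _, hu ▸ lexOfPowerSeries_mem _, hu0,
    u⁻¹ * (lexMono k (-1) 0 * (u - lexMono k (-n) (-j) * b)), ?_, ?_⟩
  · exact (lexRing₀ k).mul_mem ((lex_patchRings k 0).le₁ (hu ▸ lexOfPowerSeries_mem _)) hx
  · have h1 : lexMono k 1 0 * lexMono k (-1) 0 = 1 := by rw [lexMono_mul]; simp [lexMono_zero]
    have h2 : lexMono k n j * lexMono k (-n) (-j) = 1 := by rw [lexMono_mul]; simp [lexMono_zero]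
    have h3 : u * u⁻¹ = 1 := mul_inv_cancel₀ hu0
    have h4 : lexMono k n j * u * (1 - lexMono k 1 0 *
        (u⁻¹ * (lexMono k (-1) 0 * (u - lexMono k (-n) (-j) * b)))) =
        lexMono k n j * u - lexMono k n j * (u * u⁻¹) * (lexMono k 1 0 * lexMono k (-1) 0) * u +
        (lexMono k n j * lexMono k (-n) (-j)) * (u * u⁻¹) * (lexMono k 1 0 * lexMono k (-1) 0) * b := by
      ring
    rw [h4, h1, h2, h3]
    ring

lemma LexField.exists_mul_eq {b : LexField k} (hb : b ≠ 0) (m : ℕ) :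
    ∃ n j : ℤ, ∃ ε ∈ lexRing₁ k, ε⁻¹ ∈ lexRing₁ k ∧ ε ≠ 0 ∧ ∃ r ∈ lexRing₂ k m,
      b * ε = lexMono k n j * (1 - lexMono k 1 0 * r) := by
  obtain ⟨n, j, u, hu, hu', hu0, z, hz, rfl⟩ := LexField.exists_eq_lexMono_mul hb
  have hp := lex_patchRings k m
  obtain ⟨a, ha, r, hr, h⟩ := hp.exists_mul_eq hz
  have h0 := hp.complete₁.one_sub_ne_zero ha
  refine ⟨n, j, u⁻¹ * (1 - lexMono k 1 0 * a), ?_, ?_, ?_, r, hr, ?_⟩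
  · exact Subring.mul_mem _ hu' (Subring.sub_mem _ (Subring.one_mem _)
      (Subring.mul_mem _ hp.complete₁.mem ha))
  · rw [mul_inv, inv_inv]
    exact Subring.mul_mem _ hu (hp.complete₁.inv_mem ha)
  · exact mul_ne_zero (inv_ne_zero hu0) h0
  · rw [← h]
    field_simp

end LexPatch

section LexPatch

variable {k : Type} [Field k]

lemma lexMono_mul_mem_lexRing₁ {n i n' i' : ℤ} (hn : n ≤ n') (hi : i ≤ i') {x : LexField k}
    (h : lexMono k n i * x ∈ lexRing₁ k) : lexMono k n' i' * x ∈ lexRing₁ k := by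
  have : lexMono k n' i' * x = lexMono k (n' - n) (i' - i) * (lexMono k n i * x) := by
    rw [← mul_assoc, lexMono_mul]; simp
  rw [this]
  exact Subring.mul_mem _ (lexMono_mem (mem_cone₁.2 ⟨by omega, by omega⟩)) h

lemma exists_lexMono_nat_mul_mem {n j : ℤ} {y : LexField k} (hy : y ∈ lexRing₁ k) :
    ∃ N : ℕ, lexMono k N N * (lexMono k n j * y) ∈ lexRing₁ k := by
  refine ⟨(max (-n) (-j)).toNat, ?_⟩
  rw [← mul_assoc, lexMono_mul]
  exact Subring.mul_mem _ (lexMono_mem (mem_cone₁.2 ⟨by omega, by omega⟩)) hy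

lemma lexMono_pow_mul_mem_inf {m N : ℕ} {x : LexField k} (hx : x ∈ lexRing₂ k m)
    (hN : lexMono k N N * x ∈ lexRing₁ k) :
    lexMono k m 1 ^ N * x ∈ (lexRing₁ k ⊓ lexRing₂ k m : Subring _) := by
  have hx := mem_suppRing.1 hx
  have hN := mem_suppRing.1 hN
  rw [lexMono_pow]
  refine ⟨mem_suppRing.2 fun n i h => mem_cone₁.2 ?_, mem_suppRing.2 fun n i h => mem_cone₂.2 ?_⟩
  · rw [coeff_lexMono_mul] at h
    have h1 := mem_cone₂.1 (hx _ _ h)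
    have h2 := hN (n - N * m + N) i (by
      rw [coeff_lexMono_mul]; simpa using h)
    have := mem_cone₁.1 h2
    refine ⟨?_, this.2⟩
    have : (0:ℤ) ≤ N * m := by positivity
    omega
  · rw [coeff_lexMono_mul] at h
    have h1 := mem_cone₂.1 (hx _ _ h)
    have h3 : (0:ℤ) ≤ N * m := by positivity
    refine ⟨by omega, ?_⟩
    nlinarith [h1.2]

lemma lexMono_mem_inf (m : ℕ) :
    lexMono k m 1 ∈ (lexRing₁ k ⊓ lexRing₂ k m : Subring _) :=
  ⟨lexMono_mem (mem_cone₁.2 ⟨by positivity, zero_le_one⟩),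
    lexMono_mem (mem_cone₂.2 ⟨by positivity, by simp⟩)⟩

lemma mem_lexFrac_of_mem_lexRing₂ {m N : ℕ} {x : LexField k} (hx : x ∈ lexRing₂ k m)
    (hN : lexMono k N N * x ∈ lexRing₁ k) : x ∈ lexFrac k m := by
  have h := lexMono_pow_mul_mem_inf hx hN
  have h0 : lexMono k m 1 ^ N ≠ 0 := pow_ne_zero _ (lexMono_ne_zero _ _)
  rw [← inv_mul_cancel_left₀ h0 x]
  exact Subfield.mul_mem _ (Subfield.inv_mem _ (Subfield.pow_mem _
    (Subfield.subset_closure (lexMono_mem_inf m)) _)) (Subfield.subset_closure h)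

lemma mem_closure_subring_iff {Ω : Type} [Field Ω] {R : Subring Ω} {x : Ω} :
    x ∈ Subfield.closure (R : Set Ω) ↔ ∃ a ∈ R, ∃ b ∈ R, b ≠ 0 ∧ x = a / b := by
  rw [Subfield.mem_closure_iff]
  rw [Subring.closure_eq]
  constructor
  · rintro ⟨a, ha, b, hb, rfl⟩
    by_cases h : b = 0
    · exact ⟨0, R.zero_mem, 1, R.one_mem, one_ne_zero, by simp [h]⟩
    · exact ⟨a, ha, b, hb, h, rfl⟩
  · rintro ⟨a, ha, b, hb, -, rfl⟩
    exact ⟨a, ha, b, hb, rfl⟩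

lemma exists_clear_of_mem_lexFrac₁ {c : LexField k} (hc : c ∈ lexFrac₁ k) (m : ℕ) :
    ∃ r ∈ lexRing₂ k m, ∃ N : ℕ, lexMono k N N * (1 - lexMono k 1 0 * r) ∈ lexRing₁ k ∧
      lexMono k N N * (c * (1 - lexMono k 1 0 * r)) ∈ lexRing₁ k := by
  obtain ⟨a, ha, b, hb, hb0, rfl⟩ := mem_closure_subring_iff.1 hc
  obtain ⟨n, j, ε, hε, -, -, r, hr, h⟩ := LexField.exists_mul_eq hb0 m
  have hρ : 1 - lexMono k 1 0 * r = lexMono k (-n) (-j) * (b * ε) := by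
    rw [h, ← mul_assoc, lexMono_mul]; simp [lexMono_zero]
  obtain ⟨N, hN⟩ := exists_lexMono_nat_mul_mem (n := -n) (j := -j) (Subring.mul_mem _ hb hε)
  obtain ⟨M, hM⟩ := exists_lexMono_nat_mul_mem (n := -n) (j := -j) (Subring.mul_mem _ ha hε)
  refine ⟨r, hr, N + M, ?_, ?_⟩
  · rw [hρ]
    exact lexMono_mul_mem_lexRing₁ (by simp) (by simp) hN
  · have : a / b * (1 - lexMono k 1 0 * r) = lexMono k (-n) (-j) * (a * ε) := by
      rw [hρ]; field_simp
    rw [this]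
    exact lexMono_mul_mem_lexRing₁ (by simp) (by simp) hM

lemma mem_lexFrac_of_mem_lexFrac₂ {m N : ℕ} {c : LexField k} (hc : c ∈ lexFrac₂ k m)
    (hN : lexMono k N N * c ∈ lexRing₁ k) : c ∈ lexFrac k m := by
  obtain ⟨a, ha, b, hb, hb0, rfl⟩ := mem_closure_subring_iff.1 hc
  obtain ⟨n, j, ε, hε, hε', hε0, r, hr, h⟩ := LexField.exists_mul_eq hb0 m
  have hp := lex_patchRings k m
  have hρ0 := hp.complete₂.one_sub_ne_zero hr
  have hρ := hp.complete₂.inv_mem hr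
  set ρ := 1 - lexMono k 1 0 * r with hρdef
  have hbρ : b * ρ⁻¹ = lexMono k n j * ε⁻¹ := by
    field_simp
    linear_combination h
  obtain ⟨M, hM⟩ := exists_lexMono_nat_mul_mem (n := n) (j := j) hε'
  rw [← hbρ] at hM
  have haM : lexMono k (N + M : ℕ) (N + M : ℕ) * (a * ρ⁻¹) ∈ lexRing₁ k := by
    have : lexMono k (N + M : ℕ) (N + M : ℕ) * (a * ρ⁻¹) =
        (lexMono k N N * (a / b)) * (lexMono k M M * (b * ρ⁻¹)) := by
      push_cast
      rw [← lexMono_mul]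
      field_simp
    rw [this]
    exact Subring.mul_mem _ hN hM
  have h1 := mem_lexFrac_of_mem_lexRing₂ (Subring.mul_mem _ ha hρ) haM
  have h2 := mem_lexFrac_of_mem_lexRing₂ (Subring.mul_mem _ hb hρ) hM
  have : a / b = (a * ρ⁻¹) / (b * ρ⁻¹) := by field_simp
  rw [this]
  exact Subfield.div_mem _ h1 h2

lemma lexFrac₁_inf_lexFrac₂ (m : ℕ) : lexFrac₁ k ⊓ lexFrac₂ k m = lexFrac k m := by
  apply le_antisymm
  · rintro c ⟨h1, h2⟩
    obtain ⟨r, hr, N, hρ, hc⟩ := exists_clear_of_mem_lexFrac₁ h1 m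
    have hp := lex_patchRings k m
    have hρ0 := hp.complete₂.one_sub_ne_zero hr
    have hρ2 : 1 - lexMono k 1 0 * r ∈ lexRing₂ k m :=
      Subring.sub_mem _ (Subring.one_mem _) (Subring.mul_mem _ hp.complete₂.mem hr)
    have h3 := mem_lexFrac_of_mem_lexRing₂ hρ2 hρ
    have h4 := mem_lexFrac_of_mem_lexFrac₂ (Subfield.mul_mem _ h2 (Subfield.subset_closure hρ2)) hc
    rw [← mul_div_cancel_right₀ c hρ0]
    exact Subfield.div_mem _ h4 h3
  · refine Subfield.closure_le.2 ?_
    rintro x ⟨h1, h2⟩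
    exact ⟨Subfield.subset_closure h1, Subfield.subset_closure h2⟩

/-- Elements of `lexRing₂` with bounded denominator in `v` are polynomials in `v⁻¹` over
`k[[t, t ^ m * v]]`. -/
lemma exists_eq_sum_of_mem_lexRing₂ {m N : ℕ} {x : LexField k} (hx : x ∈ lexRing₂ k m)
    (hN : lexMono k N N * x ∈ lexRing₁ k) :
    ∃ a : ℕ → LexField k, (∀ l, a l ∈ (lexRing₁ k ⊓ lexRing₂ k m : Subring _)) ∧
      lexMono k m 1 ^ N * x =
        ∑ l ∈ Finset.range (N + 1), (lexMono k 1 0 ^ m) ^ l * lexMono k m 1 ^ (N - l) * a l := by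
  induction N generalizing x with
  | zero =>
    refine ⟨fun _ => x, fun _ => ⟨?_, hx⟩, by simp⟩
    have : lexMono k ((0 : ℕ) : ℤ) ((0 : ℕ) : ℤ) = 1 := lexMono_zero
    rwa [this, one_mul] at hN
  | succ N ih =>
    obtain ⟨y, hy⟩ := x.exists_restrict fun _ i => i = -(N + 1 : ℕ)
    have hx' := mem_suppRing.1 hx
    have hN' := mem_suppRing.1 hN
    have hi : ∀ n i, x.coeff (toLex (n, i)) ≠ 0 → -(N + 1 : ℕ) ≤ i := fun n i h => by
      have := hN' (n + (N + 1 : ℕ)) (i + (N + 1 : ℕ)) (by rw [coeff_lexMono_mul]; simpa using h)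
      have := (mem_cone₁.1 this).2
      omega
    have hn : ∀ n i, x.coeff (toLex (n, i)) ≠ 0 → 0 ≤ n := fun n i h => (hx' _ _ h).1
    have hy2 : y ∈ lexRing₂ k m := mem_suppRing.2 fun n i h => by
      rw [hy] at h
      split_ifs at h
      · exact hx' _ _ h
      · exact absurd rfl h
    have hxy : x - y ∈ lexRing₂ k m := Subring.sub_mem _ hx hy2
    have hxyN : lexMono k N N * (x - y) ∈ lexRing₁ k := by
      refine mem_lexRing₁_of_coeff fun n i h => ?_
      rw [coeff_lexMono_mul, HahnSeries.coeff_sub, hy] at h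
      split_ifs at h with h1
      · simp at h
      · rw [sub_zero] at h
        have h2 := hi _ _ h
        have h3 := hn _ _ h
        omega
    obtain ⟨a, ha, hsum⟩ := ih hxy hxyN
    refine ⟨fun l => if l = N + 1 then lexMono k 0 (N + 1 : ℕ) * y else a l, fun l => ?_, ?_⟩
    · dsimp only
      split_ifs
      · constructor
        · refine mem_lexRing₁_of_coeff fun n i h => ?_
          rw [coeff_lexMono_mul, hy] at h
          split_ifs at h with h1
          · have h3 := hn _ _ h
            omega
          · exact absurd rfl h
        · refine mem_suppRing.2 fun n i h => mem_cone₂.2 ?_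
          rw [coeff_lexMono_mul, hy] at h
          split_ifs at h with h1
          · have h3 := hn _ _ h
            have : i = 0 := by omega
            subst this
            simp; omega
          · exact absurd rfl h
      · exact ha l
    · rw [Finset.sum_range_succ]
      dsimp only
      rw [if_pos rfl, Nat.sub_self, pow_zero, mul_one]
      have h1 : (lexMono k 1 0 ^ m) ^ (N + 1) * (lexMono k 0 (N + 1 : ℕ) * y) =
          lexMono k m 1 ^ (N + 1) * y := by
        rw [← mul_assoc, lexMono_pow, lexMono_pow, lexMono_pow, lexMono_mul]
        simp
      rw [h1]
      have h2 : ∑ l ∈ Finset.range (N + 1), (lexMono k 1 0 ^ m) ^ l * lexMono k m 1 ^ (N + 1 - l) *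
          (if l = N + 1 then lexMono k 0 (N + 1 : ℕ) * y else a l) =
          lexMono k m 1 * ∑ l ∈ Finset.range (N + 1),
            (lexMono k 1 0 ^ m) ^ l * lexMono k m 1 ^ (N - l) * a l := by
        rw [Finset.mul_sum]
        refine Finset.sum_congr rfl fun l hl => ?_
        have hl := Finset.mem_range.1 hl
        rw [if_neg (by omega), show N + 1 - l = (N - l) + 1 by omega]
        ring
      rw [h2, ← hsum]
      ring

lemma exists_denominator_of_mem_lexRing₂ {m : ℕ} {c : LexField k} (hc : c ∈ lexFrac₁ k)
    (hc2 : c ∈ lexRing₂ k m) :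
    ∃ N : ℕ, ∃ a : ℕ → LexField k, (∀ l, a l ∈ (lexRing₁ k ⊓ lexRing₂ k m : Subring _)) ∧
      (lexMono k m 1 ^ N - lexMono k 1 0 * ∑ l ∈ Finset.range (N + 1),
        (lexMono k 1 0 ^ m) ^ l * lexMono k m 1 ^ (N - l) * a l) * c ∈
        (lexRing₁ k ⊓ lexRing₂ k m : Subring _) := by
  obtain ⟨r, hr, N, hρ, hcN⟩ := exists_clear_of_mem_lexFrac₁ hc m
  have hp := lex_patchRings k m
  have hρ2 : 1 - lexMono k 1 0 * r ∈ lexRing₂ k m :=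
    Subring.sub_mem _ (Subring.one_mem _) (Subring.mul_mem _ hp.complete₂.mem hr)
  have hr1 : lexMono k (N + 1 : ℕ) (N + 1 : ℕ) * r ∈ lexRing₁ k := by
    have h1 : lexMono k N (N + 1 : ℕ) * (lexMono k 1 0 * r) ∈ lexRing₁ k := by
      have : lexMono k N (N + 1 : ℕ) * (lexMono k 1 0 * r) = lexMono k N (N + 1 : ℕ) -
        lexMono k N (N + 1 : ℕ) * (1 - lexMono k 1 0 * r) := by ring
      rw [this]
      exact Subring.sub_mem _ (lexMono_mem (mem_cone₁.2 ⟨by positivity, by positivity⟩))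
        (lexMono_mul_mem_lexRing₁ (by simp) (by simp) hρ)
    rw [← mul_assoc, lexMono_mul] at h1
    simpa using h1
  obtain ⟨a, ha, hsum⟩ := exists_eq_sum_of_mem_lexRing₂ hr hr1
  refine ⟨N + 1, a, ha, ?_⟩
  rw [← hsum]
  have : (lexMono k m 1 ^ (N + 1) - lexMono k 1 0 * (lexMono k m 1 ^ (N + 1) * r)) * c =
      lexMono k m 1 * (lexMono k m 1 ^ N * (c * (1 - lexMono k 1 0 * r))) := by ring
  rw [this]
  exact Subring.mul_mem _ (lexMono_mem_inf m)
    (lexMono_pow_mul_mem_inf (Subring.mul_mem _ hc2 hρ2) hcN)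

end LexPatch

section LexHom

variable {k : Type} [Field k]

lemma ite_eq_ite_of_iff {α : Type} {p q : Prop} {x y : α} {_ : Decidable p} {_ : Decidable q}
    (h : p ↔ q) : ite p x y = ite q x y := by
  simp only [h]

/-- The exponent of `X₀, X₁` corresponding to the exponent `t ^ n * v ^ i`. -/
noncomputable def lexIndex (m : ℕ) (n i : ℤ) : Fin 2 →₀ ℕ :=
  Finsupp.single 0 i.toNat + Finsupp.single 1 (n - m * i).toNat

lemma lexIndex_zero (m : ℕ) (n i : ℤ) : lexIndex m n i 0 = i.toNat := by
  simp [lexIndex]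

lemma lexIndex_one (m : ℕ) (n i : ℤ) : lexIndex m n i 1 = (n - m * i).toNat := by
  simp [lexIndex]

lemma lexIndex_eq (m : ℕ) (α : Fin 2 →₀ ℕ) : lexIndex m (m * α 0 + α 1) (α 0) = α := by
  ext j
  fin_cases j
  · exact (lexIndex_zero _ _ _).trans (by simp)
  · exact (lexIndex_one _ _ _).trans (by simp)

lemma exists_lexHom (m : ℕ) (a : MvPowerSeries (Fin 2) k) :
    ∃ x : LexField k, ∀ n i, x.coeff (toLex (n, i)) =
      if 0 ≤ i ∧ m * i ≤ n then a.coeff (lexIndex m n i) else 0 := by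
  refine LexField.exists_of_coeff _ 0 (fun n hn i => if_neg fun h => ?_) fun n => ⟨0, fun i hi =>
    if_neg fun h => ?_⟩
  · have : (0 : ℤ) ≤ m * i := mul_nonneg (by positivity) h.1
    omega
  · omega

/-- The embedding `X₀ ↦ t ^ m * v`, `X₁ ↦ t`. -/
noncomputable def lexHomFun (m : ℕ) (a : MvPowerSeries (Fin 2) k) : LexField k :=
  (exists_lexHom m a).choose

lemma coeff_lexHomFun (m : ℕ) (a : MvPowerSeries (Fin 2) k) (n i : ℤ) :
    (lexHomFun m a).coeff (toLex (n, i)) =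
      if 0 ≤ i ∧ m * i ≤ n then a.coeff (lexIndex m n i) else 0 :=
  (exists_lexHom m a).choose_spec n i

lemma coeff_lexHomFun_nat (m : ℕ) (a : MvPowerSeries (Fin 2) k) (α : Fin 2 →₀ ℕ) :
    (lexHomFun m a).coeff (toLex ((m * α 0 + α 1 : ℤ), (α 0 : ℤ))) = a.coeff α := by
  rw [coeff_lexHomFun, if_pos ⟨by positivity, by simp⟩, lexIndex_eq]

lemma lexHomFun_of_coeff {m : ℕ} {a : MvPowerSeries (Fin 2) k} {n i : ℤ}
    (h : (lexHomFun m a).coeff (toLex (n, i)) ≠ 0) : 0 ≤ i ∧ m * i ≤ n := by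
  rw [coeff_lexHomFun] at h
  by_contra hcon
  exact h (if_neg hcon)

lemma lexHomFun_eq_of_coeff {m : ℕ} {a : MvPowerSeries (Fin 2) k} {x : LexField k}
    (h0 : ∀ n i, x.coeff (toLex (n, i)) ≠ 0 → 0 ≤ i ∧ m * i ≤ n)
    (h : ∀ i j : ℕ, x.coeff (toLex ((m * i + j : ℤ), (i : ℤ))) =
      a.coeff (Finsupp.single 0 i + Finsupp.single 1 j)) : lexHomFun m a = x := by
  refine LexField.ext fun n i => ?_
  rw [coeff_lexHomFun]
  split_ifs with hc
  · rw [lexIndex, ← h]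
    congr 3
    · rw [Int.toNat_of_nonneg hc.1, Int.toNat_of_nonneg (by omega)]; ring
    · rw [Int.toNat_of_nonneg hc.1]
  · by_contra hne
    exact hc (h0 _ _ (Ne.symm hne))

lemma lexHomFun_mul (m : ℕ) (a b : MvPowerSeries (Fin 2) k) :
    lexHomFun m (a * b) = lexHomFun m a * lexHomFun m b := by
  have hmap : ∀ p : (ℤ ×ₗ ℤ), ∀ c : MvPowerSeries (Fin 2) k, (lexHomFun m c).coeff p ≠ 0 →
      0 ≤ (ofLex p).2 ∧ m * (ofLex p).2 ≤ (ofLex p).1 ∧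
      (lexHomFun m c).coeff p = c.coeff (lexIndex m (ofLex p).1 (ofLex p).2) := by
    intro p c hp
    have h1 : 0 ≤ (ofLex p).2 ∧ m * (ofLex p).2 ≤ (ofLex p).1 :=
      lexHomFun_of_coeff (n := (ofLex p).1) (i := (ofLex p).2) hp
    refine ⟨h1.1, h1.2, ?_⟩
    have := coeff_lexHomFun m c (ofLex p).1 (ofLex p).2
    rw [if_pos h1] at this
    exact this
  refine lexHomFun_eq_of_coeff (fun n i h => ?_) fun i j => ?_
  · obtain ⟨p, hp, q, hq, hpq⟩ := HahnSeries.support_mul_subset (Function.mem_support.2 h)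
    have h1 := hmap p a hp
    have h2 := hmap q b hq
    have e1 : (ofLex p).1 + (ofLex q).1 = n := congrArg (fun p => (ofLex p).1) hpq
    have e2 : (ofLex p).2 + (ofLex q).2 = i := congrArg (fun p => (ofLex p).2) hpq
    refine ⟨by omega, ?_⟩
    rw [← e1, ← e2, mul_add]
    exact add_le_add h1.2.1 h2.2.1
  · rw [HahnSeries.coeff_mul, MvPowerSeries.coeff_mul]
    refine Finset.sum_of_injOn (fun pq => (lexIndex m (ofLex pq.1).1 (ofLex pq.1).2,
      lexIndex m (ofLex pq.2).1 (ofLex pq.2).2)) ?_ ?_ ?_ ?_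
    · rintro ⟨p, q⟩ hpq ⟨p', q'⟩ hpq' heq
      obtain ⟨h1, h2, h3⟩ := Finset.mem_antidiagonal.1 (Finset.mem_coe.1 hpq)
      obtain ⟨h1', h2', h3'⟩ := Finset.mem_antidiagonal.1 (Finset.mem_coe.1 hpq')
      have key : ∀ c : MvPowerSeries (Fin 2) k, ∀ p p' : ℤ ×ₗ ℤ, (lexHomFun m c).coeff p ≠ 0 →
          (lexHomFun m c).coeff p' ≠ 0 → lexIndex m (ofLex p).1 (ofLex p).2 =
          lexIndex m (ofLex p').1 (ofLex p').2 → p = p' := by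
        intro c p p' hp hp' h
        have a1 := hmap p c hp
        have a2 := hmap p' c hp'
        have e0 := DFunLike.congr_fun h 0
        have e1 := DFunLike.congr_fun h 1
        rw [lexIndex_zero, lexIndex_zero] at e0
        rw [lexIndex_one, lexIndex_one] at e1
        have e2 : (ofLex p).2 = (ofLex p').2 := by omega
        have e3 : (ofLex p).1 = (ofLex p').1 := by
          rw [e2] at e1 a1; omega
        exact congrArg toLex (Prod.ext e3 e2)
      exact Prod.ext (key a p p' h1 h1' (congrArg Prod.fst heq))
        (key b q q' h2 h2' (congrArg Prod.snd heq))
    · rintro ⟨p, q⟩ hpq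
      obtain ⟨h1, h2, h3⟩ := Finset.mem_antidiagonal.1 (Finset.mem_coe.1 hpq)
      have a1 := hmap p a h1
      have a2 := hmap q b h2
      have e1 : (ofLex p).1 + (ofLex q).1 = m * i + j := congrArg (fun p => (ofLex p).1) h3
      have e2 : (ofLex p).2 + (ofLex q).2 = i := congrArg (fun p => (ofLex p).2) h3
      rw [Finset.mem_coe, Finset.HasAntidiagonal.mem_antidiagonal]
      ext l
      fin_cases l
      · change lexIndex m _ _ 0 + lexIndex m _ _ 0 = (_ : Fin 2 →₀ ℕ) 0
        rw [lexIndex_zero, lexIndex_zero]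
        simp; omega
      · change lexIndex m _ _ 1 + lexIndex m _ _ 1 = (_ : Fin 2 →₀ ℕ) 1
        rw [lexIndex_one, lexIndex_one]
        have e4 : (m : ℤ) * (ofLex p).2 + m * (ofLex q).2 = m * i := by rw [← mul_add, e2]
        simp
        omega
    · rintro ⟨α, β⟩ hαβ hnot
      rw [Finset.HasAntidiagonal.mem_antidiagonal] at hαβ
      by_contra hne
      apply hnot
      refine ⟨(toLex ((m * α 0 + α 1 : ℤ), (α 0 : ℤ)), toLex ((m * β 0 + β 1 : ℤ), (β 0 : ℤ))), ?_,
        Prod.ext (lexIndex_eq m α) (lexIndex_eq m β)⟩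
      rw [Finset.mem_coe, Finset.mem_antidiagonal]
      refine ⟨?_, ?_, ?_⟩
      · change (lexHomFun m a).coeff _ ≠ 0
        rw [coeff_lexHomFun_nat]
        exact left_ne_zero_of_mul hne
      · change (lexHomFun m b).coeff _ ≠ 0
        rw [coeff_lexHomFun_nat]
        exact right_ne_zero_of_mul hne
      · have e0 : α 0 + β 0 = i := by
          have := DFunLike.congr_fun hαβ 0
          simpa using this
        have e1 : α 1 + β 1 = j := by
          have := DFunLike.congr_fun hαβ 1
          simpa using this
        rw [← e0, ← e1, ← toLex_add]
        congr 1
        ext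
        · simp; ring
        · simp
    · rintro ⟨p, q⟩ hpq
      obtain ⟨h1, h2, h3⟩ := Finset.mem_antidiagonal.1 hpq
      exact congrArg₂ (· * ·) (hmap p a h1).2.2 (hmap q b h2).2.2

/-- The embedding `X₀ ↦ t ^ m * v`, `X₁ ↦ t`. -/
noncomputable def lexHom (k : Type) [Field k] (m : ℕ) :
    MvPowerSeries (Fin 2) k →+* LexField k where
  toFun := lexHomFun m
  map_one' := by
    refine lexHomFun_eq_of_coeff (fun n i h => ?_) fun i j => ?_
    · change (HahnSeries.single 0 (1:k)).coeff _ ≠ 0 at h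
      rw [HahnSeries.coeff_single] at h
      split_ifs at h with h1
      · have e1 : n = 0 := congrArg (fun p => (ofLex p).1) h1
        have e2 : i = 0 := congrArg (fun p => (ofLex p).2) h1
        simp [e1, e2]
      · exact absurd rfl h
    · change (HahnSeries.single 0 (1:k)).coeff _ = _
      rw [HahnSeries.coeff_single, MvPowerSeries.coeff_one]
      refine ite_eq_ite_of_iff ⟨fun h1 => ?_, fun h1 => ?_⟩
      · have e1 : (m * i + j : ℤ) = 0 := congrArg (fun p => (ofLex p).1) h1
        have e2 : (i : ℤ) = 0 := congrArg (fun p => (ofLex p).2) h1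
        rw [e2] at e1
        have : i = 0 := by omega
        have : j = 0 := by omega
        simp [*]
      · have e0 := DFunLike.congr_fun h1 0
        have e1 := DFunLike.congr_fun h1 1
        simp at e0 e1
        rw [e0, e1]
        simp
  map_mul' := lexHomFun_mul m
  map_zero' := lexHomFun_eq_of_coeff (fun n i h => absurd rfl h) fun i j => by simp
  map_add' a b := by
    refine LexField.ext fun n i => ?_
    rw [HahnSeries.coeff_add, coeff_lexHomFun, coeff_lexHomFun, coeff_lexHomFun]
    split_ifs <;> simp

lemma lexHom_X_zero (m : ℕ) : lexHom k m (MvPowerSeries.X 0) = lexMono k m 1 := by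
  refine lexHomFun_eq_of_coeff (fun n i h => ?_) fun i j => ?_
  · rw [lexMono, HahnSeries.coeff_single] at h
    split_ifs at h with h1
    · have e1 : n = m := congrArg (fun p => (ofLex p).1) h1
      have e2 : i = 1 := congrArg (fun p => (ofLex p).2) h1
      simp [e1, e2]
    · exact absurd rfl h
  · rw [lexMono, HahnSeries.coeff_single, MvPowerSeries.coeff_X]
    refine ite_eq_ite_of_iff ⟨fun h1 => ?_, fun h1 => ?_⟩
    · have e1 : (m * i + j : ℤ) = m := congrArg (fun p => (ofLex p).1) h1
      have e2 : (i : ℤ) = 1 := congrArg (fun p => (ofLex p).2) h1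
      rw [e2] at e1
      have : i = 1 := by omega
      have : j = 0 := by omega
      simp [*]
    · have e0 := DFunLike.congr_fun h1 0
      have e1 := DFunLike.congr_fun h1 1
      simp at e0 e1
      rw [e0, e1]
      simp

lemma lexHom_X_one (m : ℕ) : lexHom k m (MvPowerSeries.X 1) = lexMono k 1 0 := by
  refine lexHomFun_eq_of_coeff (fun n i h => ?_) fun i j => ?_
  · rw [lexMono, HahnSeries.coeff_single] at h
    split_ifs at h with h1
    · have e1 : n = 1 := congrArg (fun p => (ofLex p).1) h1
      have e2 : i = 0 := congrArg (fun p => (ofLex p).2) h1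
      simp [e1, e2]
    · exact absurd rfl h
  · rw [lexMono, HahnSeries.coeff_single, MvPowerSeries.coeff_X]
    refine ite_eq_ite_of_iff ⟨fun h1 => ?_, fun h1 => ?_⟩
    · have e1 : (m * i + j : ℤ) = 1 := congrArg (fun p => (ofLex p).1) h1
      have e2 : (i : ℤ) = 0 := congrArg (fun p => (ofLex p).2) h1
      rw [e2] at e1
      have : i = 0 := by omega
      have : j = 1 := by omega
      simp [*]
    · have e0 := DFunLike.congr_fun h1 0
      have e1 := DFunLike.congr_fun h1 1
      simp at e0 e1
      rw [e0, e1]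
      simp

lemma lexHom_injective (m : ℕ) : Function.Injective (lexHom k m) := by
  intro a b h
  refine MvPowerSeries.ext fun α => ?_
  rw [← coeff_lexHomFun_nat m a, ← coeff_lexHomFun_nat m b]
  exact congrArg (fun x : LexField k => x.coeff _) h

lemma lexHom_range (m : ℕ) :
    (lexHom k m).range = (lexRing₁ k ⊓ lexRing₂ k m : Subring (LexField k)) := by
  ext x
  constructor
  · rintro ⟨a, rfl⟩
    refine ⟨mem_suppRing.2 fun n i h => ?_, mem_suppRing.2 fun n i h => ?_⟩
    · have h1 := lexHomFun_of_coeff h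
      have : (0 : ℤ) ≤ m * i := mul_nonneg (by positivity) h1.1
      exact mem_cone₁.2 ⟨by omega, h1.1⟩
    · have h1 := lexHomFun_of_coeff h
      have : (0 : ℤ) ≤ m * i := mul_nonneg (by positivity) h1.1
      exact mem_cone₂.2 ⟨by omega, h1.2⟩
  · rintro ⟨h1, h2⟩
    have h1 := mem_suppRing.1 h1
    have h2 := mem_suppRing.1 h2
    refine ⟨fun α => x.coeff (toLex ((m * α 0 + α 1 : ℤ), (α 0 : ℤ))), ?_⟩
    refine lexHomFun_eq_of_coeff (fun n i h => ⟨(mem_cone₁.1 (h1 _ _ h)).2,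
      (mem_cone₂.1 (h2 _ _ h)).2⟩) fun i j => ?_
    refine Eq.trans ?_ (MvPowerSeries.coeff_apply _ _).symm
    simp

end LexHom

section PolyRing

open Polynomial

variable {E : Type} [Field E] {P : E[X]}

/-- The coordinates with respect to the power basis. -/
noncomputable def polyCoord (hP : P.Monic) (z : AdjoinRoot P) (i : ℕ) : E :=
  (AdjoinRoot.modByMonicHom hP z).coeff i

variable (hP : P.Monic)

lemma polyCoord_add (z w : AdjoinRoot P) (i : ℕ) :
    polyCoord hP (z + w) i = polyCoord hP z i + polyCoord hP w i := by
  simp [polyCoord]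

lemma polyCoord_smul (c : E) (z : AdjoinRoot P) (i : ℕ) :
    polyCoord hP (AdjoinRoot.of P c * z) i = c * polyCoord hP z i := by
  rw [← AdjoinRoot.algebraMap_eq, ← Algebra.smul_def]
  simp [polyCoord]

lemma polyCoord_mk (f : E[X]) (i : ℕ) :
    polyCoord hP (AdjoinRoot.mk P f) i = (f %ₘ P).coeff i := by
  rw [polyCoord, AdjoinRoot.modByMonicHom_mk]

lemma polyCoord_eq_zero (z : AdjoinRoot P) {i : ℕ} (hi : P.natDegree ≤ i) :
    polyCoord hP z i = 0 := by
  obtain ⟨f, rfl⟩ := AdjoinRoot.mk_surjective z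
  rw [polyCoord_mk]
  by_cases h1 : P = 1
  · simp [h1]
  · exact coeff_eq_zero_of_natDegree_lt ((natDegree_modByMonic_lt f hP h1).trans_le hi)

lemma polyCoord_ext {z w : AdjoinRoot P} (h : ∀ i < P.natDegree, polyCoord hP z i = polyCoord hP w i) :
    z = w := by
  rw [← AdjoinRoot.mk_leftInverse hP z, ← AdjoinRoot.mk_leftInverse hP w]
  congr 1
  ext i
  by_cases hi : i < P.natDegree
  · exact h i hi
  · exact (polyCoord_eq_zero hP z (not_lt.1 hi)).trans (polyCoord_eq_zero hP w (not_lt.1 hi)).symm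

lemma polyCoord_sum (f : ℕ → E) {i : ℕ} (hi : i < P.natDegree) :
    polyCoord hP (∑ i ∈ Finset.range P.natDegree,
      AdjoinRoot.of P (f i) * AdjoinRoot.root P ^ i) i = f i := by
  have h1 : ∑ i ∈ Finset.range P.natDegree, AdjoinRoot.of P (f i) * AdjoinRoot.root P ^ i =
      AdjoinRoot.mk P (∑ i ∈ Finset.range P.natDegree, C (f i) * X ^ i) := by
    simp [map_sum]
  rw [h1, polyCoord_mk, (modByMonic_eq_self_iff hP).2, finset_sum_coeff]
  · simp [coeff_C_mul, coeff_X_pow, hi]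
  · rw [degree_eq_natDegree hP.ne_zero]
    refine (degree_sum_le _ _).trans_lt ((Finset.sup_lt_iff (WithBot.bot_lt_coe _)).2 ?_)
    intro j hj
    exact (degree_C_mul_X_pow_le _ _).trans_lt (WithBot.coe_lt_coe.2 (Finset.mem_range.1 hj))

lemma polyCoord_eq_sum (z : AdjoinRoot P) : z = ∑ i ∈ Finset.range P.natDegree,
    AdjoinRoot.of P (polyCoord hP z i) * AdjoinRoot.root P ^ i :=
  polyCoord_ext hP fun _ hi => (polyCoord_sum hP _ hi).symm

lemma exists_polyCoord (f : ℕ → E) :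
    ∃ z : AdjoinRoot P, ∀ i < P.natDegree, polyCoord hP z i = f i :=
  ⟨_, fun _ hi => polyCoord_sum hP f hi⟩

/-- The elements with a representative over a subring. -/
noncomputable def polyRing (P : E[X]) (S : Subring E) : Subring (AdjoinRoot P) :=
  ((AdjoinRoot.mk P).comp (mapRingHom S.subtype)).range

lemma polyRing_mono {S T : Subring E} (h : S ≤ T) : polyRing P S ≤ polyRing P T := by
  rintro _ ⟨f, rfl⟩
  refine ⟨f.map (Subring.inclusion h), ?_⟩
  simp only [RingHom.comp_apply, coe_mapRingHom, Polynomial.map_map]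
  rfl

lemma of_mem_polyRing {S : Subring E} {c : E} (hc : c ∈ S) : AdjoinRoot.of P c ∈ polyRing P S :=
  ⟨C ⟨c, hc⟩, by simp⟩

lemma root_mem_polyRing {S : Subring E} : AdjoinRoot.root P ∈ polyRing P S :=
  ⟨X, by simp⟩

/-- A subring containing the constants and the root contains the whole polynomial ring. -/
lemma polyRing_le {S : Subring E} {T : Subring (AdjoinRoot P)}
    (h : ∀ c ∈ S, AdjoinRoot.of P c ∈ T) (hr : AdjoinRoot.root P ∈ T) : polyRing P S ≤ T := by
  rintro _ ⟨f, rfl⟩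
  induction f using Polynomial.induction_on' with
  | add p q hp hq => rw [map_add]; exact T.add_mem hp hq
  | monomial n a =>
    rw [← C_mul_X_pow_eq_monomial]
    simpa using T.mul_mem (h _ a.2) (T.pow_mem hr n)

variable {S : Subring E}

lemma mem_polyRing_iff (hS : ∀ i, P.coeff i ∈ S) {z : AdjoinRoot P} :
    z ∈ polyRing P S ↔ ∀ i < P.natDegree, polyCoord hP z i ∈ S := by
  constructor
  · rintro ⟨f, rfl⟩ i -
    have hsub : (↑P.coeffs : Set E) ⊆ S := fun c hc => by
      obtain ⟨n, -, rfl⟩ := mem_coeffs_iff.1 (Finset.mem_coe.1 hc)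
      exact hS n
    have h1 : (P.toSubring S hsub).map S.subtype = P := map_toSubring _ _ _
    have h2 : (P.toSubring S hsub).Monic := (monic_toSubring _ _ _).2 hP
    rw [RingHom.comp_apply, polyCoord_mk, coe_mapRingHom]
    rw [show f.map S.subtype %ₘ P = (f %ₘ P.toSubring S hsub).map S.subtype by
      rw [map_modByMonic _ h2, h1], coeff_map]
    exact Subtype.coe_prop _
  · intro h
    rw [polyCoord_eq_sum hP z]
    refine Subring.sum_mem _ fun i hi => Subring.mul_mem _ (of_mem_polyRing (h i
      (Finset.mem_range.1 hi))) (Subring.pow_mem _ root_mem_polyRing i)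

lemma TComplete.polyRing {t : E} {S : Subring E} [Fact (Irreducible P)] (h : TComplete t S)
    (hP : P.Monic) (hS : ∀ i, P.coeff i ∈ S) : TComplete (AdjoinRoot.of P t) (polyRing P S) where
  mem := of_mem_polyRing h.mem
  ne_zero := (_root_.map_ne_zero _).2 h.ne_zero
  sum a ha := by
    simp only [mem_polyRing_iff hP hS] at ha ⊢
    choose s hs hs' using fun i : Fin P.natDegree =>
      h.sum (fun n => polyCoord hP (a n) i) fun n => ha n i i.2
    choose z hz using fun n => exists_polyCoord hP
      fun i => if hi : i < P.natDegree then s ⟨i, hi⟩ n else 0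
    have hz' : ∀ n i (hi : i < P.natDegree), polyCoord hP (z n) i = s ⟨i, hi⟩ n := fun n i hi => by
      rw [hz n i hi, dif_pos hi]
    refine ⟨z, fun n i hi => hz' n i hi ▸ hs _ _, fun n => polyCoord_ext hP fun i hi => ?_⟩
    rw [polyCoord_add, polyCoord_smul, hz' n i hi, hz' _ i hi]
    exact hs' ⟨i, hi⟩ n
  sep x hx := polyCoord_ext hP fun i hi => by
    have h0 : polyCoord hP 0 i = 0 := by simp [polyCoord]
    rw [h0]
    refine h.sep _ fun n => ?_
    obtain ⟨r, hr, hxr⟩ := hx n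
    refine ⟨_, (mem_polyRing_iff hP hS).1 hr i hi, ?_⟩
    rw [hxr, ← map_pow, polyCoord_smul]

/-- The elements with a representative over a subfield. -/
noncomputable def polySubfield [Fact (Irreducible P)] (hP : P.Monic) (F : Subfield E)
    (hF : ∀ i, P.coeff i ∈ F) : Subfield (AdjoinRoot P) where
  toSubring := _root_.polyRing P F.toSubring
  inv_mem' z hz := by
    let A : Subalgebra F (AdjoinRoot P) :=
      { (_root_.polyRing P F.toSubring) with
        algebraMap_mem' := fun c => of_mem_polyRing (P := P) c.2 }
    have h_integral : IsIntegral F (AdjoinRoot.root P) := by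
      have hsub : (↑P.coeffs : Set E) ⊆ F.toSubring := fun c hc => by
        obtain ⟨n, -, rfl⟩ := mem_coeffs_iff.1 (Finset.mem_coe.1 hc)
        exact hF n
      have h1 : (P.toSubring F.toSubring hsub).map F.subtype = P := map_toSubring _ _ _
      refine ⟨P.toSubring F.toSubring hsub, (monic_toSubring _ _ _).2 hP, ?_⟩
      have h2 : algebraMap F (AdjoinRoot P) = (AdjoinRoot.of P).comp F.subtype := rfl
      rw [h2]
      change eval₂ ((AdjoinRoot.of P).comp F.subtype) _ _ = 0
      rw [← eval₂_map]
      exact (congrArg _ h1).trans (AdjoinRoot.eval₂_root P)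
    have hz' : z ∈ (integralClosure F (AdjoinRoot P)).toSubring :=
      polyRing_le (S := F.toSubring)
        (fun c hc => isIntegral_algebraMap (R := F) (A := AdjoinRoot P) (x := ⟨c, hc⟩)) h_integral hz
    exact IsIntegral.inv_mem (A := A) hz' hz

lemma mem_polySubfield [Fact (Irreducible P)] {hP : P.Monic} {F : Subfield E}
    {hF : ∀ i, P.coeff i ∈ F} {z : AdjoinRoot P} :
    z ∈ polySubfield hP F hF ↔ ∀ i < P.natDegree, polyCoord hP z i ∈ F :=
  mem_polyRing_iff hP (S := F.toSubring) hF

lemma PatchRings.polyRing [Fact (Irreducible P)] {t : E} {F : Subfield E} {R₀ R₁ R₂ : Subring E}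
    (h : PatchRings t F R₀ R₁ R₂) (hP : P.Monic) (h₁ : ∀ i, P.coeff i ∈ R₁)
    (h₂ : ∀ i, P.coeff i ∈ R₂) :
    PatchRings (AdjoinRoot.of P t) (polySubfield hP F fun i => h.mem_of_mem _ (h₁ i))
      (_root_.polyRing P R₀) (_root_.polyRing P R₁) (_root_.polyRing P R₂) where
  complete₀ := h.complete₀.polyRing hP fun i => h.le₁ (h₁ i)
  complete₁ := h.complete₁.polyRing hP h₁
  complete₂ := h.complete₂.polyRing hP h₂
  le₁ := polyRing_mono h.le₁
  le₂ := polyRing_mono h.le₂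
  mem_of_mem x hx := mem_polySubfield.2 fun i hi =>
    h.mem_of_mem _ ((mem_polyRing_iff hP h₁).1 hx i hi)
  exists_add z hz := by
    have hz := (mem_polyRing_iff hP fun i => h.le₁ (h₁ i)).1 hz
    choose a ha r hr har using fun i : {i // i < P.natDegree} => h.exists_add _ (hz i i.2)
    obtain ⟨y, hy⟩ := exists_polyCoord hP fun i => if hi : i < P.natDegree then a ⟨i, hi⟩ else 0
    have hy' : ∀ i (hi : i < P.natDegree), polyCoord hP y i = a ⟨i, hi⟩ := fun i hi => by
      rw [hy i hi, dif_pos hi]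
    obtain ⟨w, hw⟩ := exists_polyCoord hP fun i => if hi : i < P.natDegree then r ⟨i, hi⟩ else 0
    have hw' : ∀ i (hi : i < P.natDegree), polyCoord hP w i = r ⟨i, hi⟩ := fun i hi => by
      rw [hw i hi, dif_pos hi]
    refine ⟨y, (mem_polyRing_iff hP h₁).2 fun i hi => hy' i hi ▸ ha _, w,
      (mem_polyRing_iff hP h₂).2 fun i hi => hw' i hi ▸ hr _, polyCoord_ext hP fun i hi => ?_⟩
    rw [polyCoord_add, hy' i hi, hw' i hi]
    exact har ⟨i, hi⟩
  exists_pow_mul x := by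
    choose N hN using fun i => h.exists_pow_mul (polyCoord hP x i)
    refine ⟨(Finset.range P.natDegree).sup N,
      (mem_polyRing_iff hP fun i => h.le₁ (h₁ i)).2 fun i hi => ?_⟩
    rw [← map_pow, polyCoord_smul]
    exact Subring.pow_mul_mem_of_le h.complete₀.mem (Finset.le_sup (Finset.mem_range.2 hi)) (hN i)
  dense z hz := by
    have hz := (mem_polyRing_iff hP fun i => h.le₁ (h₁ i)).1 hz
    choose a ha r hr har using fun i : {i // i < P.natDegree} => h.dense _ (hz i i.2)
    obtain ⟨y, hy⟩ := exists_polyCoord hP fun i => if hi : i < P.natDegree then a ⟨i, hi⟩ else 0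
    have hy' : ∀ i (hi : i < P.natDegree), polyCoord hP y i = a ⟨i, hi⟩ := fun i hi => by
      rw [hy i hi, dif_pos hi]
    obtain ⟨w, hw⟩ := exists_polyCoord hP fun i => if hi : i < P.natDegree then r ⟨i, hi⟩ else 0
    have hw' : ∀ i (hi : i < P.natDegree), polyCoord hP w i = r ⟨i, hi⟩ := fun i hi => by
      rw [hw i hi, dif_pos hi]
    refine ⟨y, mem_polySubfield.2 fun i hi => hy' i hi ▸ ha _, w,
      (mem_polyRing_iff hP fun i => h.le₁ (h₁ i)).2 fun i hi => hw' i hi ▸ hr _,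
      polyCoord_ext hP fun i hi => ?_⟩
    rw [polyCoord_add, polyCoord_smul, hy' i hi, hw' i hi]
    exact har ⟨i, hi⟩

end PolyRing

section TwoVariables

variable (k : Type) [Field k]

/-- Power series in two variables as power series in `X₀` over the power series in `X₁`. -/
noncomputable def iterEquiv : MvPowerSeries (Fin 2) k ≃+* PowerSeries (PowerSeries k) :=
  (MvPowerSeries.finSuccEquiv k 1).toRingEquiv.trans <|
    let ρ : MvPowerSeries (Fin 1) k ≃+* PowerSeries k :=
      (MvPowerSeries.renameEquiv k (Equiv.equivPUnit (Fin 1))).toRingEquiv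
    RingEquiv.ofRingHom (PowerSeries.map (ρ : MvPowerSeries (Fin 1) k →+* PowerSeries k))
      (PowerSeries.map (ρ.symm : PowerSeries k →+* MvPowerSeries (Fin 1) k))
      (by ext a i : 2; simp) (by ext a i : 2; simp)

variable {k}

lemma coeff_iterEquiv (a : MvPowerSeries (Fin 2) k) (i j : ℕ) :
    PowerSeries.coeff j (PowerSeries.coeff i (iterEquiv k a)) =
      a.coeff (Finsupp.single 0 i + Finsupp.single 1 j) := by
  have h1 : PowerSeries.coeff i (iterEquiv k a) =
      MvPowerSeries.renameEquiv k (Equiv.equivPUnit (Fin 1))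
        (PowerSeries.coeff i (MvPowerSeries.finSuccEquiv k 1 a)) := by
    simp [iterEquiv]
  have h2 : (Finsupp.single () j : Unit →₀ ℕ) = Finsupp.embDomain
      (Equiv.equivPUnit (Fin 1)).toEmbedding (Finsupp.single 0 j) := by
    rw [Finsupp.embDomain_single]
  rw [h1, PowerSeries.coeff, h2]
  have h3 := MvPowerSeries.coeff_embDomain_rename (Equiv.equivPUnit (Fin 1)).toEmbedding
    (PowerSeries.coeff i (MvPowerSeries.finSuccEquiv k 1 a)) (Finsupp.single 0 j)
  refine h3.trans ?_
  rw [MvPowerSeries.coeff_coeff_finSuccEquiv]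
  have h4 : (Finsupp.cons i (Finsupp.single 0 j) : Fin 2 →₀ ℕ) =
      Finsupp.single 0 i + Finsupp.single 1 j := by
    ext l
    fin_cases l
    · simp [Finsupp.cons]
    · rw [show (⟨1, by omega⟩ : Fin 2) = Fin.succ 0 from rfl]
      simp [Finsupp.cons]
  exact congrArg (fun m => MvPowerSeries.coeff m a) h4

lemma iterEquiv_X_zero : iterEquiv k (MvPowerSeries.X 0) = PowerSeries.X := by
  simp [iterEquiv, MvPowerSeries.finSuccEquiv_X_zero]

lemma iterEquiv_X_one : iterEquiv k (MvPowerSeries.X 1) = PowerSeries.C PowerSeries.X := by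
  have := MvPowerSeries.finSuccEquiv_X_succ (R := k) (n := 1) 0
  rw [show (Fin.succ 0 : Fin 2) = 1 from rfl] at this
  simp [iterEquiv, this, MvPowerSeries.renameEquiv]
  rfl

lemma eq_zero_of_forall_X_one_pow_dvd {a : MvPowerSeries (Fin 2) k}
    (h : ∀ n : ℕ, MvPowerSeries.X 1 ^ n ∣ a) : a = 0 := by
  ext α
  exact MvPowerSeries.X_pow_dvd_iff.mp (h (α 1 + 1)) α (by omega)

/-- The substitution of a series without constant term for `X₀`. -/
theorem exists_substHom (U : PowerSeries (PowerSeries k))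
    (hU : PowerSeries.constantCoeff (PowerSeries.constantCoeff U) = 0) :
    ∃ θ : PowerSeries (PowerSeries k) →+* PowerSeries (PowerSeries k),
      (∀ o, θ (PowerSeries.C o) = PowerSeries.C o) ∧ θ PowerSeries.X = U := by
  let u := (iterEquiv k).symm U
  have hu : MvPowerSeries.constantCoeff u = 0 := by
    have := coeff_iterEquiv u 0 0
    simp [u] at this
    simpa [hU] using this.symm
  have hs : MvPowerSeries.HasSubst (![u, MvPowerSeries.X 1] : Fin 2 → MvPowerSeries (Fin 2) k) := by
    refine MvPowerSeries.hasSubst_of_constantCoeff_zero fun j => ?_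
    fin_cases j
    · exact hu
    · exact MvPowerSeries.constantCoeff_X 1
  let θ₀ : MvPowerSeries (Fin 2) k →ₐ[k] MvPowerSeries (Fin 2) k := MvPowerSeries.substAlgHom hs
  have h0 : θ₀ (MvPowerSeries.X 0) = u := MvPowerSeries.substAlgHom_X hs 0
  have h1 : θ₀ (MvPowerSeries.X 1) = MvPowerSeries.X 1 := MvPowerSeries.substAlgHom_X hs 1
  have hX1 : (iterEquiv k).symm (PowerSeries.C PowerSeries.X) = MvPowerSeries.X 1 := by
    rw [RingEquiv.symm_apply_eq, iterEquiv_X_one]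
  have hC : ∀ c : k, (iterEquiv k).symm (PowerSeries.C (PowerSeries.C c)) =
      algebraMap k (MvPowerSeries (Fin 2) k) c := by
    intro c
    rw [RingEquiv.symm_apply_eq]
    have : algebraMap k (MvPowerSeries (Fin 2) k) c = MvPowerSeries.C c := rfl
    rw [this]
    ext i j
    rw [coeff_iterEquiv, MvPowerSeries.coeff_C, PowerSeries.coeff_C]
    have : (Finsupp.single 0 i + Finsupp.single 1 j : Fin 2 →₀ ℕ) = 0 ↔ i = 0 ∧ j = 0 := by
      constructor
      · intro h
        exact ⟨by simpa using DFunLike.congr_fun h 0, by simpa using DFunLike.congr_fun h 1⟩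
      · rintro ⟨rfl, rfl⟩; simp
    by_cases hi : i = 0 <;> by_cases hj : j = 0 <;> simp [hi, hj, PowerSeries.coeff_C]
  let ι : PowerSeries k →+* MvPowerSeries (Fin 2) k :=
    ((iterEquiv k).symm : PowerSeries (PowerSeries k) →+* MvPowerSeries (Fin 2) k).comp
      PowerSeries.C
  have hι : ∀ o, θ₀ (ι o) = ι o := by
    intro o
    rw [← sub_eq_zero]
    refine eq_zero_of_forall_X_one_pow_dvd fun n => ?_
    have hpol : ∀ p : Polynomial k, θ₀ (ι p) = ι p := by
      intro p
      induction p using Polynomial.induction_on' with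
      | add p q hp hq => rw [Polynomial.coe_add, map_add, map_add, hp, hq]
      | monomial m c =>
        have : ι ((Polynomial.monomial m c : Polynomial k) : PowerSeries k) =
            algebraMap k _ c * MvPowerSeries.X 1 ^ m := by
          rw [← Polynomial.C_mul_X_pow_eq_monomial]
          simp only [Polynomial.coe_mul, Polynomial.coe_C, Polynomial.coe_pow, Polynomial.coe_X,
            map_mul, map_pow]
          congr 1
          · exact hC c
          · exact congrArg (· ^ m) hX1
        rw [this, map_mul, map_pow, h1, AlgHom.commutes]
    rw [PowerSeries.eq_X_pow_mul_shift_add_trunc n o]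
    simp only [map_add, hpol, map_mul, map_pow]
    rw [show ι PowerSeries.X = MvPowerSeries.X 1 from hX1, h1]
    exact ⟨θ₀ (ι (PowerSeries.mk fun i => PowerSeries.coeff (i + n) o)) -
      ι (PowerSeries.mk fun i => PowerSeries.coeff (i + n) o), by ring⟩
  refine ⟨((iterEquiv k : MvPowerSeries (Fin 2) k →+* PowerSeries (PowerSeries k)).comp
    θ₀.toRingHom).comp
    ((iterEquiv k).symm : PowerSeries (PowerSeries k) →+* MvPowerSeries (Fin 2) k),
    fun o => ?_, ?_⟩
  · have := hι o
    change iterEquiv k (θ₀ (ι o)) = _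
    rw [this]
    exact (iterEquiv k).apply_symm_apply _
  · change iterEquiv k (θ₀ ((iterEquiv k).symm PowerSeries.X)) = _
    rw [show (iterEquiv k).symm PowerSeries.X = MvPowerSeries.X 0 by
      rw [RingEquiv.symm_apply_eq, iterEquiv_X_zero], h0]
    exact (iterEquiv k).apply_symm_apply _

end TwoVariables

section Weierstrass

open Polynomial

variable {k : Type} [Field k]

instance isAdicComplete_maximalIdeal_powerSeries (k : Type) [Field k] :
    IsAdicComplete (IsLocalRing.maximalIdeal (PowerSeries k)) (PowerSeries k) := by
  rw [PowerSeries.maximalIdeal_eq_span_X]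
  infer_instance

/-- `U` is a distinguished polynomial for the maximal ideal of `k⟦t⟧`. -/
abbrev IsDist (U : (PowerSeries k)[X]) : Prop :=
  U.IsDistinguishedAt (IsLocalRing.maximalIdeal (PowerSeries k))

lemma IsDist.order {U : (PowerSeries k)[X]} (hU : IsDist U) :
    (((U : PowerSeries (PowerSeries k)).map
      (Ideal.Quotient.mk (IsLocalRing.maximalIdeal (PowerSeries k)))).order.toNat : ℕ) =
      U.natDegree := by
  have := hU.coe_natDegree_eq_order_map (U : PowerSeries (PowerSeries k)) 1
    (by simpa using (Ideal.ne_top_iff_one _).mp (IsLocalRing.maximalIdeal.isMaximal _).ne_top)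
    (by simp)
  rw [← this]; rfl

lemma IsDist.exists_div {U : (PowerSeries k)[X]} (hU : IsDist U)
    (f : PowerSeries (PowerSeries k)) :
    ∃ (q : PowerSeries (PowerSeries k)) (r : (PowerSeries k)[X]),
      r.degree < U.natDegree ∧ f = U * q + r := by
  have h := hU.isWeierstrassDivisorAt'.isWeierstrassDivisionAt_div_mod f
  exact ⟨_, _, hU.order ▸ h.degree_lt, h.eq_mul_add⟩

lemma IsDist.eq_zero {U : (PowerSeries k)[X]} (hU : IsDist U)
    {q : PowerSeries (PowerSeries k)} {r : (PowerSeries k)[X]} (hr : r.degree < U.natDegree)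
    (h : U * q + r = (0 : PowerSeries (PowerSeries k))) : q = 0 ∧ r = 0 := by
  have h2 := hU.isWeierstrassDivisorAt'.eq_zero_of_mul_eq (q := q) (r := -r)
    (by rwa [degree_neg, hU.order])
    (by rw [coe_neg]; exact eq_neg_of_add_eq_zero_left h)
  exact ⟨h2.1, neg_eq_zero.mp h2.2⟩

lemma IsDist.not_isUnit {U : (PowerSeries k)[X]} (hU : IsDist U) (hd : 0 < U.natDegree) :
    ¬ IsUnit (U : PowerSeries (PowerSeries k)) := by
  intro h
  rw [PowerSeries.isUnit_iff_constantCoeff] at h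
  have : PowerSeries.constantCoeff (U : PowerSeries (PowerSeries k)) = U.coeff 0 := by simp
  rw [this] at h
  exact (IsLocalRing.mem_maximalIdeal _).mp (hU.mem hd) h

lemma coe_eq_sum {r : (PowerSeries k)[X]} {d : ℕ} (hr : r.degree < d) :
    (r : PowerSeries (PowerSeries k)) =
      ∑ i ∈ Finset.range d, PowerSeries.C (r.coeff i) * PowerSeries.X ^ i := by
  have := (degree_lt_iff_coeff_zero r d).mp hr
  ext1 i
  rw [map_sum, coeff_coe]
  simp_rw [PowerSeries.coeff_C_mul, PowerSeries.coeff_X_pow]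
  by_cases hi : i < d
  · rw [Finset.sum_eq_single i] <;> simp +contextual [hi, eq_comm]
  · rw [this i (by omega), Finset.sum_eq_zero]
    intro j hj
    rw [if_neg (by simp at hj; omega), mul_zero]

section Theta

variable {U : (PowerSeries k)[X]}
  {θ : PowerSeries (PowerSeries k) →+* PowerSeries (PowerSeries k)}

/-- Every series is a combination of `1, X, …, X ^ (d - 1)` over the series in `U`. -/
theorem IsDist.exists_eq_sum (hU : IsDist U) (hd : 0 < U.natDegree)
    (hθC : ∀ o, θ (PowerSeries.C o) = PowerSeries.C o) (hθX : θ PowerSeries.X = U)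
    (f : PowerSeries (PowerSeries k)) :
    ∃ a : ℕ → PowerSeries (PowerSeries k),
      f = ∑ i ∈ Finset.range U.natDegree, θ (a i) * PowerSeries.X ^ i := by
  choose Q R hR hQR using hU.exists_div
  let q : PowerSeries (PowerSeries k) → ℕ → PowerSeries (PowerSeries k) := fun g l => Q^[l] g
  let a : PowerSeries (PowerSeries k) → ℕ → PowerSeries (PowerSeries k) :=
    fun g i => PowerSeries.mk fun l => (R (q g l)).coeff i
  have ha : ∀ g i, a g i = PowerSeries.C ((R g).coeff i) + PowerSeries.X * a (Q g) i := by
    intro g i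
    ext1 l
    rcases l with _ | l
    · simp [a, q]
    · simp [a, q, PowerSeries.coeff_succ_X_mul, PowerSeries.coeff_C]
  let Φ : PowerSeries (PowerSeries k) → PowerSeries (PowerSeries k) := fun g =>
    g - ∑ i ∈ Finset.range U.natDegree, θ (a g i) * PowerSeries.X ^ i
  have hΦ : ∀ g, Φ g = U * Φ (Q g) := by
    intro g
    simp only [Φ]
    have h1 : ∑ i ∈ Finset.range U.natDegree, θ (a g i) * PowerSeries.X ^ i =
        (R g : PowerSeries (PowerSeries k)) + U * ∑ i ∈ Finset.range U.natDegree, θ (a (Q g) i) * PowerSeries.X ^ i := by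
      rw [coe_eq_sum (hR g), Finset.mul_sum, ← Finset.sum_add_distrib]
      refine Finset.sum_congr rfl fun i _ => ?_
      rw [ha g i, map_add, map_mul, hθC, hθX]
      ring
    rw [h1]
    linear_combination hQR g
  have hdvd : ∀ n g, (U : PowerSeries (PowerSeries k)) ^ n ∣ Φ g := by
    intro n
    induction n with
    | zero => intro g; simp
    | succ n ih =>
      intro g
      rw [hΦ g, pow_succ']
      exact mul_dvd_mul_left _ (ih _)
  refine ⟨a f, ?_⟩
  rw [← sub_eq_zero]
  by_contra hne
  obtain ⟨n, hn⟩ := FiniteMultiplicity.of_not_isUnit (hU.not_isUnit hd) hne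
  exact hn (hdvd (n + 1) f)

theorem IsDist.eq_zero_of_sum (hU : IsDist U)
    (hθC : ∀ o, θ (PowerSeries.C o) = PowerSeries.C o) (hθX : θ PowerSeries.X = U)
    {a : ℕ → PowerSeries (PowerSeries k)}
    (h : ∑ i ∈ Finset.range U.natDegree, θ (a i) * PowerSeries.X ^ i = 0) :
    ∀ i < U.natDegree, a i = 0 := by
  suffices H : ∀ n, ∀ a : ℕ → PowerSeries (PowerSeries k),
      ∑ i ∈ Finset.range U.natDegree, θ (a i) * PowerSeries.X ^ i = 0 →
      ∀ i < U.natDegree, PowerSeries.coeff n (a i) = 0 by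
    intro i hi
    ext1 n
    rw [H n a h i hi, map_zero]
  have step : ∀ a : ℕ → PowerSeries (PowerSeries k),
      ∑ i ∈ Finset.range U.natDegree, θ (a i) * PowerSeries.X ^ i = 0 →
      (∀ i < U.natDegree, PowerSeries.coeff 0 (a i) = 0) ∧
      ∑ i ∈ Finset.range U.natDegree,
        θ (PowerSeries.mk fun l => PowerSeries.coeff (l + 1) (a i)) * PowerSeries.X ^ i = 0 := by
    intro a ha
    let r : (PowerSeries k)[X] := ∑ i ∈ Finset.range U.natDegree,
      Polynomial.C (PowerSeries.constantCoeff (a i)) * Polynomial.X ^ i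
    have hrc : ∀ i < U.natDegree, r.coeff i = PowerSeries.constantCoeff (a i) := by
      intro i hi
      simp [r, finset_sum_coeff, coeff_X_pow, hi]
    have hr : r.degree < U.natDegree := by
      refine (degree_lt_iff_coeff_zero r _).mpr fun i hi => ?_
      simp only [r, finset_sum_coeff, coeff_C_mul, coeff_X_pow]
      refine Finset.sum_eq_zero fun j hj => ?_
      rw [if_neg (by simp at hj; omega), mul_zero]
    have := hU.eq_zero hr (q := ∑ i ∈ Finset.range U.natDegree,
        θ (PowerSeries.mk fun l => PowerSeries.coeff (l + 1) (a i)) * PowerSeries.X ^ i) (by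
      rw [← ha, coe_eq_sum hr, Finset.mul_sum, ← Finset.sum_add_distrib]
      refine Finset.sum_congr rfl fun i hi => ?_
      conv_rhs => rw [PowerSeries.eq_X_mul_shift_add_const (a i)]
      rw [map_add, map_mul, hθC, hθX, hrc i (by simpa using hi)]
      ring)
    refine ⟨fun i hi => ?_, this.1⟩
    rw [PowerSeries.coeff_zero_eq_constantCoeff_apply, ← hrc i hi, this.2, Polynomial.coeff_zero]
  intro n
  induction n with
  | zero => exact fun a ha => (step a ha).1
  | succ n ih =>
    intro a ha i hi
    simpa using ih _ (step a ha).2 i hi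

/-- A ring homomorphism `g` extends along `θ` once the image of `X` is chosen as a root of
`U - g X`. -/
theorem IsDist.exists_lift {Ω : Type} [Field Ω] (hU : IsDist U) (hd : 0 < U.natDegree)
    (hθC : ∀ o, θ (PowerSeries.C o) = PowerSeries.C o) (hθX : θ PowerSeries.X = U)
    (g : PowerSeries (PowerSeries k) →+* Ω) (z : Ω)
    (hz : U.eval₂ (g.comp PowerSeries.C) z = g PowerSeries.X) :
    ∃ j : PowerSeries (PowerSeries k) →+* Ω, (∀ a, j (θ a) = g a) ∧ j PowerSeries.X = z := by
  let φ : (PowerSeries (PowerSeries k))[X] →+* PowerSeries (PowerSeries k) :=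
    eval₂RingHom θ PowerSeries.X
  have hφ : Function.Surjective φ := by
    intro f
    obtain ⟨a, ha⟩ := hU.exists_eq_sum hd hθC hθX f
    refine ⟨∑ i ∈ Finset.range U.natDegree, Polynomial.C (a i) * Polynomial.X ^ i, ?_⟩
    simp only [φ, map_sum, map_mul, map_pow, coe_eval₂RingHom, eval₂_C, eval₂_X]
    exact ha.symm
  let V : (PowerSeries (PowerSeries k))[X] := U.map PowerSeries.C - Polynomial.C PowerSeries.X
  have hVm : V.Monic := (hU.monic.map _).sub_of_left
    (lt_of_le_of_lt degree_C_le (by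
      rw [hU.monic.degree_map]; exact natDegree_pos_iff_degree_pos.mp hd))
  have hVd : V.natDegree = U.natDegree := by
    rw [natDegree_sub_C, hU.monic.natDegree_map]
  have hV : φ V = 0 := by
    simp only [φ, V, coe_eval₂RingHom, eval₂_sub, eval₂_C, hθX, eval₂_map]
    rw [sub_eq_zero]
    have : θ.comp PowerSeries.C = (PowerSeries.C : PowerSeries k →+* _) := RingHom.ext hθC
    rw [this, eval₂_eq_sum_range, coe_eq_sum (d := U.natDegree + 1)
      (degree_le_natDegree.trans_lt (by exact_mod_cast Nat.lt_succ_self _))]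
  have hker : RingHom.ker φ ≤ RingHom.ker (eval₂RingHom g z) := by
    intro p hp
    rw [RingHom.mem_ker] at hp ⊢
    have hr : p %ₘ V = 0 := by
      have h1 : φ (p %ₘ V) = 0 := by
        rw [modByMonic_eq_sub_mul_div, map_sub, map_mul, hp, hV]; simp
      have hdeg : (p %ₘ V).degree < U.natDegree := by
        rw [← hVd, ← degree_eq_natDegree hVm.ne_zero]
        exact degree_modByMonic_lt _ hVm
      have h2 := hU.eq_zero_of_sum hθC hθX (a := (p %ₘ V).coeff) (by
        rw [← h1]
        simp only [φ, coe_eval₂RingHom]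
        rw [eval₂_eq_sum_range' θ (n := U.natDegree)]
        exact lt_of_le_of_lt (natDegree_le_natDegree le_rfl) (by
          by_cases h0 : p %ₘ V = 0
          · rw [h0]; simpa using hd
          · exact (natDegree_lt_iff_degree_lt h0).mpr hdeg))
      ext1 i
      by_cases hi : i < U.natDegree
      · simpa using h2 i hi
      · rw [(degree_lt_iff_coeff_zero _ _).mp hdeg i (by omega), Polynomial.coeff_zero]
    rw [← modByMonic_add_div p V, hr, zero_add, map_mul]
    have : eval₂RingHom g z V = 0 := by
      simp only [V, coe_eval₂RingHom, eval₂_sub, eval₂_C, eval₂_map, hz, sub_self]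
    rw [this, zero_mul]
  refine ⟨RingHom.liftOfSurjective φ hφ ⟨eval₂RingHom g z, hker⟩, fun a => ?_, ?_⟩
  · have := RingHom.liftOfRightInverse_comp_apply φ _ (Function.rightInverse_surjInv hφ)
      ⟨eval₂RingHom g z, hker⟩ (Polynomial.C a)
    simpa [φ] using this
  · have := RingHom.liftOfRightInverse_comp_apply φ _ (Function.rightInverse_surjInv hφ)
      ⟨eval₂RingHom g z, hker⟩ Polynomial.X
    simpa [φ] using this

end Theta

end Weierstrass

section RootFactor

open Polynomial

variable {k : Type} [Field k]

/-- The parameter `t`, viewed in `k⟦t⟧⟦X⟧`. -/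
noncomputable abbrev tPar (k : Type) [Field k] : PowerSeries (PowerSeries k) :=
  PowerSeries.C PowerSeries.X

lemma IsDist.dvd_of_coe_dvd {U r : (PowerSeries k)[X]} (hU : IsDist U)
    (hr : r.degree < U.natDegree) (h : (U : PowerSeries (PowerSeries k)) ∣ r) : r = 0 := by
  obtain ⟨q, hq⟩ := h
  have := hU.eq_zero (q := -q) hr (by rw [hq]; ring)
  exact this.2

lemma exists_unit_mul_X_pow {e : PowerSeries k} (he : e ≠ 0) :
    ∃ m e', e * e' = PowerSeries.X ^ m := by
  obtain ⟨m, u, hu⟩ := IsDiscreteValuationRing.eq_unit_mul_pow_irreducible he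
    (PowerSeries.X_prime (R := k)).irreducible
  refine ⟨m, (↑u⁻¹ : PowerSeries k), ?_⟩
  rw [hu, mul_comm, ← mul_assoc, Units.inv_mul, one_mul]

lemma isDist_X_sub_C {c : PowerSeries k} (hc : PowerSeries.X ∣ c) :
    IsDist (X - Polynomial.C c) where
  mem := by
    intro n hn
    rw [natDegree_X_sub_C] at hn
    obtain rfl : n = 0 := by omega
    rw [PowerSeries.maximalIdeal_eq_span_X, Ideal.mem_span_singleton]
    simpa using hc
  monic := monic_X_sub_C c

lemma exists_X_sub_C_not_dvd {D : PowerSeries (PowerSeries k)} (hD : D ≠ 0) :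
    ∃ r : ℕ, 0 < r ∧ ¬ (PowerSeries.X - PowerSeries.C (PowerSeries.X ^ r) :
      PowerSeries (PowerSeries k)) ∣ D := by
  obtain ⟨n, hn⟩ : FiniteMultiplicity (PowerSeries.X : PowerSeries (PowerSeries k)) D :=
    FiniteMultiplicity.of_not_isUnit PowerSeries.X_prime.not_unit hD
  obtain ⟨i, D', hXD', rfl⟩ : ∃ i D', ¬ (PowerSeries.X : PowerSeries (PowerSeries k)) ∣ D' ∧
      D = PowerSeries.X ^ i * D' := by
    obtain ⟨D', h1, h2⟩ := (FiniteMultiplicity.of_not_isUnit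
      (PowerSeries.X_prime (R := PowerSeries k)).not_unit hD).exists_eq_pow_mul_and_not_dvd
    exact ⟨_, D', h2, h1⟩
  have h0 : PowerSeries.constantCoeff D' ≠ 0 := fun h => hXD' (PowerSeries.X_dvd_iff.mpr h)
  obtain ⟨r, hr⟩ : FiniteMultiplicity (PowerSeries.X : PowerSeries k)
      (PowerSeries.constantCoeff D') :=
    FiniteMultiplicity.of_not_isUnit PowerSeries.X_prime.not_unit h0
  refine ⟨r + 1, by omega, ?_⟩
  rintro ⟨q, hq⟩
  have hX : ¬ (PowerSeries.X : PowerSeries (PowerSeries k)) ∣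
      PowerSeries.X - PowerSeries.C (PowerSeries.X ^ (r + 1)) := by
    rw [PowerSeries.X_dvd_iff]
    simp
  obtain ⟨q', rfl⟩ : (PowerSeries.X : PowerSeries (PowerSeries k)) ^ i ∣ q :=
    PowerSeries.X_prime.pow_dvd_of_dvd_mul_left i hX ⟨D', hq.symm⟩
  have h1 : D' = (PowerSeries.X - PowerSeries.C (PowerSeries.X ^ (r + 1))) * q' := by
    apply mul_left_cancel₀ (pow_ne_zero i (PowerSeries.X_prime (R := PowerSeries k)).ne_zero)
    rw [hq]; ring
  apply hr
  rw [h1]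
  refine ⟨-PowerSeries.constantCoeff q', ?_⟩
  simp

lemma exists_irreducible_isDist_dvd {W : (PowerSeries k)[X]} (hW : IsDist W)
    (hd : 0 < W.natDegree) :
    ∃ U : (PowerSeries k)[X], IsDist U ∧ 0 < U.natDegree ∧ Irreducible U ∧ U ∣ W := by
  have hnu : ¬ IsUnit W := fun h => by
    have := hW.monic.eq_one_of_isUnit h
    simp [this] at hd
  obtain ⟨V, hV, V', hVW⟩ := WfDvdMonoid.exists_irreducible_factor hnu hW.monic.ne_zero
  have hlc : IsUnit V.leadingCoeff := by
    have := hW.monic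
    rw [hVW] at this
    rw [Monic, leadingCoeff_mul] at this
    exact IsUnit.of_mul_eq_one _ this
  obtain ⟨u, hu⟩ := hlc
  let U : (PowerSeries k)[X] := Polynomial.C (↑u⁻¹ : PowerSeries k) * V
  have hassoc : Associated V U := by
    refine ⟨Units.map (Polynomial.C : PowerSeries k →+* _).toMonoidHom u⁻¹, ?_⟩
    rw [mul_comm]; rfl
  have hUm : U.Monic := by
    rw [Monic, leadingCoeff_mul, leadingCoeff_C, ← hu, Units.inv_mul]
  have hUW : U ∣ W := hassoc.symm.dvd.trans ⟨V', hVW⟩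
  have hUi : Irreducible U := hassoc.irreducible hV
  have hUd : 0 < U.natDegree := by
    by_contra h
    have := hUm.natDegree_eq_zero.mp (by omega)
    exact hUi.not_isUnit (this ▸ isUnit_one)
  refine ⟨U, ⟨⟨fun {n} hn => ?_⟩, hUm⟩, hUd, hUi, hUW⟩
  let π := Ideal.Quotient.mk (IsLocalRing.maximalIdeal (PowerSeries k))
  have h1 : U.map π ∣ X ^ W.natDegree := by
    have := Polynomial.map_dvd π hUW
    rwa [hW.map_eq_X_pow] at this
  letI : Field (PowerSeries k ⧸ IsLocalRing.maximalIdeal (PowerSeries k)) :=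
    Ideal.Quotient.field _
  obtain ⟨i, hi, hi2⟩ := (dvd_prime_pow prime_X _).mp h1
  have h2 : U.map π = X ^ i := eq_of_monic_of_associated (hUm.map _) (monic_X_pow i) hi2
  have h3 : i = U.natDegree := by
    have := congrArg natDegree h2
    rw [natDegree_X_pow, hUm.natDegree_map] at this
    exact this.symm
  have h4 := congrArg (fun p => p.coeff n) h2
  simp only [coeff_map, coeff_X_pow] at h4
  rw [if_neg (by omega)] at h4
  exact Ideal.Quotient.eq_zero_iff_mem.mp h4

lemma exists_mul_add_mul_eq_X_pow {U ρ : (PowerSeries k)[X]} (hU : Irreducible U) (hUm : U.Monic)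
    (hρ : ¬ U ∣ ρ) : ∃ m a b, U * a + ρ * b = Polynomial.C (PowerSeries.X ^ m) := by
  have : Fact (Irreducible U) := ⟨hU⟩
  have hp : Prime U := hU.prime
  have : (Ideal.span {U}).IsPrime := (Ideal.span_singleton_prime hp.ne_zero).mpr hp
  have : IsDomain (AdjoinRoot U) := Ideal.Quotient.isDomain _
  have : Module.Finite (PowerSeries k) (AdjoinRoot U) := hUm.finite_adjoinRoot
  have h0 : AdjoinRoot.mk U ρ ≠ 0 := fun h => hρ (AdjoinRoot.mk_eq_zero.mp h)
  have hinj : Function.Injective (algebraMap (PowerSeries k) (AdjoinRoot U)) :=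
    AdjoinRoot.of.injective_of_degree_ne_zero (by
      intro h
      have := hUm.natDegree_eq_zero.mp (natDegree_eq_zero_iff_degree_le_zero.mpr h.le)
      exact hU.not_isUnit (this ▸ isUnit_one))
  obtain ⟨e, he, s, hs⟩ := IsAlgebraic.exists_nonzero_dvd (R := PowerSeries k)
    (s := AdjoinRoot.mk U ρ) (Algebra.IsIntegral.isIntegral _).isAlgebraic
    (mem_nonZeroDivisors_of_ne_zero h0)
  obtain ⟨b, rfl⟩ := AdjoinRoot.mk_surjective s
  obtain ⟨m, e', he'⟩ := exists_unit_mul_X_pow he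
  have h1 : U ∣ Polynomial.C e - ρ * b := by
    rw [← AdjoinRoot.mk_eq_zero, map_sub, map_mul, ← hs, AdjoinRoot.mk_C]
    exact sub_self _
  obtain ⟨a, ha⟩ := h1
  refine ⟨m, a * Polynomial.C e', b * Polynomial.C e', ?_⟩
  rw [← he', map_mul]
  linear_combination -(Polynomial.C e') * ha

/-- A prime factor `U` at which the homogenisation of `f` at `(x, D)` vanishes. -/
theorem exists_root_factor {D : PowerSeries (PowerSeries k)} (hD : D ≠ 0) (htD : tPar k ∣ D)
    {f : (PowerSeries (PowerSeries k))[X]} (hf : f.Monic) (hn : 0 < f.natDegree) :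
    ∃ (x : PowerSeries (PowerSeries k)) (U : (PowerSeries k)[X]), IsDist U ∧ 0 < U.natDegree ∧
      Irreducible U ∧
      (U : PowerSeries (PowerSeries k)) ∣
        ∑ i ∈ Finset.range (f.natDegree + 1), f.coeff i * x ^ i * D ^ (f.natDegree - i) ∧
      ∃ m a b, U * a + D * b = tPar k ^ m := by
  obtain ⟨r, hr, hrD⟩ := exists_X_sub_C_not_dvd hD
  let x : PowerSeries (PowerSeries k) := PowerSeries.X - PowerSeries.C (PowerSeries.X ^ r)
  let V : (PowerSeries k)[X] := X - Polynomial.C (PowerSeries.X ^ r)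
  have hV : IsDist V := isDist_X_sub_C (dvd_pow_self _ hr.ne')
  have hVx : (V : PowerSeries (PowerSeries k)) = x := by simp [V, x]
  have hVd : V.natDegree = 1 := natDegree_X_sub_C _
  obtain ⟨m₁, a₁, b₁, h₁⟩ : ∃ m a b, x * a + D * b = tPar k ^ m := by
    obtain ⟨q, ρ, hρ, hq⟩ := hV.exists_div D
    rw [hVd, hVx] at *
    have h0 : ρ = Polynomial.C (ρ.coeff 0) := eq_C_of_degree_le_zero (by
      rw [← Order.lt_succ_iff]; exact hρ)
    have hne : ρ.coeff 0 ≠ 0 := fun h => hrD ⟨q, by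
      rw [hq, h0, h]; simp [x]⟩
    obtain ⟨m, e', he'⟩ := exists_unit_mul_X_pow hne
    refine ⟨m, -(q * PowerSeries.C e'), PowerSeries.C e', ?_⟩
    have : (ρ : PowerSeries (PowerSeries k)) * PowerSeries.C e' = tPar k ^ m := by
      rw [h0, coe_C, ← map_mul, he', map_pow]
    rw [← this]
    linear_combination (PowerSeries.C e') * hq
  let n := f.natDegree
  let Y := ∑ i ∈ Finset.range (n + 1), f.coeff i * x ^ i * D ^ (n - i)
  obtain ⟨g, hg⟩ : D ∣ Y - x ^ n := by
    simp only [Y]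
    rw [Finset.sum_range_succ, hf.coeff_natDegree]
    simp only [one_mul, Nat.sub_self, pow_zero, mul_one, add_sub_cancel_right]
    refine Finset.dvd_sum fun i hi => dvd_mul_of_dvd_right (dvd_pow_self _ ?_) _
    have := Finset.mem_range.mp hi
    omega
  let π := IsLocalRing.residue (PowerSeries k)
  have hπX : π PowerSeries.X = 0 := by
    rw [IsLocalRing.residue_eq_zero_iff, PowerSeries.maximalIdeal_eq_span_X]
    exact Ideal.mem_span_singleton_self _
  have hYπ : Y.map π = PowerSeries.X ^ n := by
    obtain ⟨D', hD'⟩ := htD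
    have : Y = x ^ n + D * g := by linear_combination hg
    rw [this, hD']
    simp only [map_add, map_mul, map_pow, x, map_sub, PowerSeries.map_C, PowerSeries.map_X, hπX]
    rw [map_zero, zero_pow hr.ne']
    simp
  have hY0 : Y.map π ≠ 0 := by
    rw [hYπ]; exact pow_ne_zero _ (PowerSeries.X_prime).ne_zero
  obtain ⟨W, h, hWh⟩ := PowerSeries.exists_isWeierstrassFactorization hY0
  have hW : IsDist W := hWh.isDistinguishedAt
  have hWd : 0 < W.natDegree := by
    rw [hWh.natDegree_eq_toNat_order_map]
    change 0 < (PowerSeries.order (Y.map π)).toNat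
    rw [hYπ, PowerSeries.order_X_pow]
    exact hn
  obtain ⟨U, hU, hUd, hUi, hUW⟩ := exists_irreducible_isDist_dvd hW hWd
  have hUY : (U : PowerSeries (PowerSeries k)) ∣ Y := by
    rw [hWh.eq_mul]
    obtain ⟨U', rfl⟩ := hUW
    rw [coe_mul]
    exact Dvd.dvd.mul_right (Dvd.intro _ rfl) _
  have hUt : ∀ m, ¬ (U : PowerSeries (PowerSeries k)) ∣ tPar k ^ m := by
    intro m hm
    have := hU.dvd_of_coe_dvd (r := Polynomial.C (PowerSeries.X ^ m))
      (lt_of_le_of_lt degree_C_le (by exact_mod_cast hUd)) (by simpa using hm)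
    rw [C_eq_zero] at this
    exact pow_ne_zero m (PowerSeries.X_prime (R := k)).ne_zero this
  have hUD : ¬ (U : PowerSeries (PowerSeries k)) ∣ D := by
    intro h
    have h2 : (U : PowerSeries (PowerSeries k)) ∣ x ^ n := by
      have : x ^ n = Y - D * g := by linear_combination -hg
      rw [this]
      exact dvd_sub hUY (h.mul_right _)
    apply hUt (m₁ * n)
    rw [pow_mul, ← h₁]
    have h3 : D ∣ (x * a₁ + D * b₁) ^ n - (x * a₁) ^ n := by
      refine dvd_trans ?_ (sub_dvd_pow_sub_pow _ _ n)
      exact ⟨b₁, by ring⟩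
    have h4 := dvd_add (h.trans h3) (h2.trans (show x ^ n ∣ (x * a₁) ^ n from
      ⟨a₁ ^ n, mul_pow _ _ _⟩))
    simpa using h4
  obtain ⟨q, ρ, hρ, hq⟩ := hU.exists_div D
  obtain ⟨m, a, b, hab⟩ := exists_mul_add_mul_eq_X_pow hUi hU.monic (ρ := ρ) (by
    intro hdiv
    apply hUD
    rw [hq]
    obtain ⟨c, rfl⟩ := hdiv
    rw [coe_mul]
    exact dvd_add (Dvd.intro _ rfl) (Dvd.intro _ rfl))
  refine ⟨x, U, hU, hUd, hUi, hUY, m, a - q * b, b, ?_⟩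
  have h5 := congrArg (fun p : (PowerSeries k)[X] => (p : PowerSeries (PowerSeries k))) hab
  simp only [coe_add, coe_mul, coe_C, map_pow, coe_pow] at h5
  rw [← h5]
  linear_combination (b : PowerSeries (PowerSeries k)) * hq

end RootFactor

section BaseField

open Polynomial

variable {k : Type} [Field k]

variable (k) in
/-- The inclusion `k⟦t⟧ → k((v))((t))`. -/
noncomputable def lexBase : PowerSeries k →+* LexField k :=
  ((lexHom k 0).comp (iterEquiv k).symm.toRingHom).comp PowerSeries.C

lemma coeff_lexHom_C (m : ℕ) (o : PowerSeries k) (n i : ℤ) :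
    (lexHom k m ((iterEquiv k).symm (PowerSeries.C o))).coeff (toLex (n, i)) =
      if i = 0 ∧ 0 ≤ n then PowerSeries.coeff n.toNat o else 0 := by
  have h := coeff_lexHomFun m ((iterEquiv k).symm (PowerSeries.C o)) n i
  change (lexHomFun m _).coeff _ = _
  rw [h, lexIndex, ← coeff_iterEquiv, RingEquiv.apply_symm_apply, PowerSeries.coeff_C]
  by_cases h0 : i = 0
  · subst h0; simp
  · have h1 : (if i = 0 ∧ 0 ≤ n then PowerSeries.coeff n.toNat o else 0) = 0 :=
      if_neg fun h => h0 h.1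
    rw [h1]
    by_cases h2 : 0 ≤ i ∧ m * i ≤ n
    · rw [if_pos h2, if_neg (by simpa using (by omega)), map_zero]
    · rw [if_neg h2]

lemma coeff_lexBase (o : PowerSeries k) (n i : ℤ) :
    (lexBase k o).coeff (toLex (n, i)) =
      if i = 0 ∧ 0 ≤ n then PowerSeries.coeff n.toNat o else 0 :=
  coeff_lexHom_C 0 o n i

lemma lexHom_C (m : ℕ) (o : PowerSeries k) :
    lexHom k m ((iterEquiv k).symm (PowerSeries.C o)) = lexBase k o :=
  LexField.ext fun n i => by rw [coeff_lexHom_C, coeff_lexBase]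

lemma lexBase_X : lexBase k PowerSeries.X = lexMono k 1 0 := by
  rw [← lexHom_C 0, ← iterEquiv_X_one, RingEquiv.symm_apply_apply, lexHom_X_one]

lemma lexBase_injective : Function.Injective (lexBase k) :=
  (lexHom_injective 0).comp ((iterEquiv k).symm.injective.comp (fun a b h => by
    simpa using congrArg (PowerSeries.coeff 0) h))

lemma lexBase_mem (m : ℕ) (o : PowerSeries k) : lexBase k o ∈ lexRing₁ k ⊓ lexRing₂ k m := by
  rw [← lexHom_range, ← lexHom_C m]; exact ⟨_, rfl⟩

/-- The substitution `v ↦ v ^ j` on `k((v))((t))`. -/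
noncomputable def lexScale (j : ℕ) (hj : 0 < j) : LexField k →+* LexField k :=
  HahnSeries.embDomainRingHom
    (AddMonoidHom.mk' (fun p : ℤ ×ₗ ℤ => toLex ((ofLex p).1, (j : ℤ) * (ofLex p).2))
      (fun a b => by
        apply ofLex.injective
        exact Prod.ext rfl (mul_add (j : ℤ) (ofLex a).2 (ofLex b).2)))
    (fun a b h => by
      have h1 : (ofLex a).1 = (ofLex b).1 := congrArg (fun p => (ofLex p).1) h
      have h2 : (j : ℤ) * (ofLex a).2 = j * (ofLex b).2 := congrArg (fun p => (ofLex p).2) h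
      exact ofLex.injective (Prod.ext h1 (mul_left_cancel₀ (by positivity) h2)))
    (fun a b => by
      have hj' : (0 : ℤ) < j := by exact_mod_cast hj
      rw [Prod.Lex.le_iff, Prod.Lex.le_iff]
      refine or_congr Iff.rfl (and_congr Iff.rfl ?_)
      exact mul_le_mul_iff_right₀ hj')

lemma coeff_lexScale {j : ℕ} (hj : 0 < j) (x : LexField k) (n i : ℤ) :
    (lexScale j hj x).coeff (toLex (n, j * i)) = x.coeff (toLex (n, i)) :=
  HahnSeries.embDomain_coeff (a := toLex (n, i))

lemma coeff_lexScale_ne_zero {j : ℕ} (hj : 0 < j) (x : LexField k) {n i : ℤ}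
    (h : (lexScale j hj x).coeff (toLex (n, i)) ≠ 0) : ∃ i', i = j * i' ∧
      x.coeff (toLex (n, i')) ≠ 0 := by
  obtain ⟨p, hp, he⟩ := HahnSeries.support_embDomain_subset h
  have h1 : (ofLex p).1 = n := congrArg (fun p => (ofLex p).1) he
  have h2 : (j : ℤ) * (ofLex p).2 = i := congrArg (fun p => (ofLex p).2) he
  refine ⟨(ofLex p).2, h2.symm, ?_⟩
  rw [← h1]
  exact hp

lemma lexScale_lexBase {j : ℕ} (hj : 0 < j) (o : PowerSeries k) :
    lexScale j hj (lexBase k o) = lexBase k o := by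
  refine LexField.ext fun n i => ?_
  by_cases h0 : i = 0
  · subst h0
    have := coeff_lexScale hj (lexBase k o) n 0
    rwa [mul_zero] at this
  · rw [coeff_lexBase, if_neg (fun h => h0 h.1)]
    by_contra h
    obtain ⟨i', hi, h'⟩ := coeff_lexScale_ne_zero hj _ h
    rw [coeff_lexBase, if_neg] at h'
    · exact h' rfl
    · rintro ⟨rfl, -⟩
      exact h0 (by simpa using hi)

lemma coeff_eq_zero_of_isIntegral {c : LexField k} (hc : (lexBase k).IsIntegralElem c) (n i : ℤ)
    (hi : i ≠ 0) : c.coeff (toLex (n, i)) = 0 := by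
  by_contra hne
  classical
  obtain ⟨p, hp, hpc⟩ := hc
  have hex : ∃ d : ℕ, ∃ i : ℤ, i ≠ 0 ∧ c.coeff (toLex (n, i)) ≠ 0 ∧ i.natAbs = d :=
    ⟨_, i, hi, hne, rfl⟩
  obtain ⟨i₀, hi₀, hne₀, hd⟩ := Nat.find_spec hex
  have hmin : ∀ i : ℤ, i ≠ 0 → c.coeff (toLex (n, i)) ≠ 0 → i₀.natAbs ≤ i.natAbs := fun i h1 h2 => by
    rw [hd]; exact Nat.find_min' hex ⟨i, h1, h2, rfl⟩
  have key : ∀ a b : ℕ, lexScale (a + 1) a.succ_pos c = lexScale (b + 1) b.succ_pos c → a < b →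
      False := by
    intro a b h hab
    have h1 : (lexScale (b + 1) b.succ_pos c).coeff (toLex (n, ((a + 1 : ℕ) : ℤ) * i₀)) ≠ 0 := by
      rw [← h, coeff_lexScale]; exact hne₀
    obtain ⟨i', he, hi'⟩ := coeff_lexScale_ne_zero _ _ h1
    have hz : i' ≠ 0 := by
      rintro rfl
      rw [mul_zero] at he
      exact (mul_ne_zero (by positivity) hi₀) he
    have h2 := hmin i' hz hi'
    have h3 := congrArg Int.natAbs he
    rw [Int.natAbs_mul, Int.natAbs_mul, Int.natAbs_natCast, Int.natAbs_natCast] at h3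
    have h4 : 0 < i₀.natAbs := Int.natAbs_pos.2 hi₀
    nlinarith
  have hinj : Function.Injective fun a : ℕ => lexScale (a + 1) a.succ_pos c := by
    intro a b h
    rcases lt_trichotomy a b with h' | h' | h'
    · exact (key a b h h').elim
    · exact h'
    · exact (key b a h.symm h').elim
  refine Set.infinite_range_of_injective hinj
    (Set.Finite.subset (p.map (lexBase k)).roots.toFinset.finite_toSet ?_)
  rintro _ ⟨a, rfl⟩
  rw [Finset.mem_coe, Multiset.mem_toFinset, mem_roots (hp.map _).ne_zero, IsRoot.def, eval_map]
  have h1 := congrArg (lexScale (a + 1) a.succ_pos) hpc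
  rw [map_zero, hom_eval₂] at h1
  rwa [show (lexScale (a + 1) a.succ_pos).comp (lexBase k) = lexBase k from
    RingHom.ext (lexScale_lexBase a.succ_pos)] at h1

lemma exists_lexBase_of_isIntegral {c : LexField k} (hc : (lexBase k).IsIntegralElem c) :
    ∃ o, lexBase k o = c := by
  obtain ⟨N, hN⟩ := LexField.exists_pow_mul_mem_lexRing₀ c
  obtain ⟨o, ho⟩ : ∃ o, lexBase k o = lexMono k 1 0 ^ N * c := by
    refine ⟨PowerSeries.mk fun n => (lexMono k 1 0 ^ N * c).coeff (toLex (n, 0)), ?_⟩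
    have hci : (lexBase k).IsIntegralElem (lexMono k 1 0 ^ N * c) := by
      letI := (lexBase k).toAlgebra
      refine IsIntegral.mul (R := PowerSeries k) (IsIntegral.pow ?_ N) hc
      rw [← lexBase_X]
      exact isIntegral_algebraMap (R := PowerSeries k)
    refine LexField.ext fun n i => ?_
    rw [coeff_lexBase, PowerSeries.coeff_mk]
    by_cases h0 : i = 0
    · subst h0
      by_cases hn : 0 ≤ n
      · rw [if_pos ⟨rfl, hn⟩, Int.toNat_of_nonneg hn]
      · rw [if_neg (fun h => hn h.2)]
        by_contra h
        exact hn (mem_suppRing.1 hN n 0 (Ne.symm h))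
    · rw [if_neg (fun h => h0 h.1), coeff_eq_zero_of_isIntegral hci n i h0]
  letI := (lexBase k).toAlgebra
  let F := FractionRing (PowerSeries k)
  let g : F →ₐ[PowerSeries k] LexField k :=
    IsFractionRing.liftAlgHom (g := Algebra.ofId (PowerSeries k) (LexField k))
      (lexBase_injective (k := k))
  let z : F := algebraMap (PowerSeries k) F o / algebraMap (PowerSeries k) F (PowerSeries.X ^ N)
  have hz : g z = c := by
    have h1 : g (algebraMap (PowerSeries k) F o) = lexBase k o := g.commutes o
    have h2 : g (algebraMap (PowerSeries k) F (PowerSeries.X ^ N)) = lexBase k (PowerSeries.X ^ N) := g.commutes _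
    rw [map_div₀, h1, h2, ho, map_pow, lexBase_X, mul_div_cancel_left₀]
    exact pow_ne_zero _ (lexMono_ne_zero _ _)
  have hzi : IsIntegral (PowerSeries k) z := by
    rw [← isIntegral_algHom_iff g g.toRingHom.injective, hz]
    exact hc
  obtain ⟨y, hy⟩ := IsIntegrallyClosed.algebraMap_eq_of_integral hzi
  refine ⟨y, ?_⟩
  rw [← hz, ← hy]
  exact (g.commutes y).symm

theorem irreducible_map_lexBase {U : (PowerSeries k)[X]} (hU : U.Monic) (hirr : Irreducible U) :
    Irreducible (U.map (lexBase k)) := by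
  rw [(hU.map _).irreducible_iff_natDegree']
  rw [hU.irreducible_iff_natDegree'] at hirr
  have key : ∀ f : (LexField k)[X], f.Monic → f ∣ U.map (lexBase k) →
      ∃ f' : (PowerSeries k)[X], f'.map (lexBase k) = f ∧ f'.natDegree = f.natDegree ∧ f'.Monic := by
    intro f hf hd
    refine lifts_and_natDegree_eq_and_monic ((lifts_iff_coeff_lifts f).2 fun i => ?_) hf
    letI := (lexBase k).toAlgebra
    exact exists_lexBase_of_isIntegral (isIntegral_coeff_of_dvd U f hU hf hd i)
  refine ⟨fun h => hirr.1 (map_injective (lexBase k) lexBase_injective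
    (by rw [h, Polynomial.map_one])), fun f g hf hg h => ?_⟩
  · obtain ⟨f', rfl, hf1, hf2⟩ := key f hf (Dvd.intro g h)
    obtain ⟨g', rfl, hg1, hg2⟩ := key g hg (Dvd.intro_left _ h)
    rw [← Polynomial.map_mul] at h
    have := hirr.2 f' g' hf2 hg2 (map_injective _ lexBase_injective h)
    rwa [hg1, ← hU.natDegree_map (lexBase k)] at this

end BaseField

section NormBound

open Polynomial

lemma exists_norm_bound {F : Type} [NontriviallyNormedField F] [CompleteSpace F]
    [IsUltrametricDist F] {P : F[X]} [Fact (Irreducible P)] (hP : P.Monic) :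
    ∃ N : AdjoinRoot P → ℝ, (∀ z w, N (z * w) = N z * N w) ∧ (∀ c, N (AdjoinRoot.of P c) = ‖c‖) ∧
      ∃ B : ℝ, 0 ≤ B ∧ ∀ G : F[X], G.Monic → G.natDegree < P.natDegree →
        1 ≤ B * N (AdjoinRoot.mk P G) := by
  haveI : FiniteDimensional F (AdjoinRoot P) := (AdjoinRoot.powerBasis' hP).finite
  letI := spectralNorm.normedField F (AdjoinRoot P)
  letI := spectralNorm.normedAlgebra F (AdjoinRoot P)
  refine ⟨fun z => ‖z‖, norm_mul, fun c => ?_, ?_⟩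
  · rw [← AdjoinRoot.algebraMap_eq]
    exact norm_algebraMap' (AdjoinRoot P) c
  · let φ : ℕ → (AdjoinRoot P →L[F] F) := fun i => LinearMap.toContinuousLinearMap
      { toFun := fun z => polyCoord hP z i
        map_add' := fun z w => polyCoord_add hP z w i
        map_smul' := fun c z => by
          rw [Algebra.smul_def, AdjoinRoot.algebraMap_eq, polyCoord_smul]; rfl }
    refine ⟨∑ i ∈ Finset.range P.natDegree, ‖φ i‖, Finset.sum_nonneg fun i _ => norm_nonneg _,
      fun G hG hd => ?_⟩
    have h1 : φ G.natDegree (AdjoinRoot.mk P G) = 1 := by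
      change polyCoord hP (AdjoinRoot.mk P G) G.natDegree = 1
      rw [polyCoord_mk, (modByMonic_eq_self_iff hP).2 (degree_lt_degree hd)]
      exact hG
    have h2 := (φ G.natDegree).le_opNorm (AdjoinRoot.mk P G)
    rw [h1, norm_one] at h2
    refine h2.trans (mul_le_mul_of_nonneg_right ?_ (norm_nonneg _))
    exact Finset.single_le_sum (f := fun i => ‖φ i‖) (fun i _ => norm_nonneg _)
      (Finset.mem_range.2 hd)

lemma irreducible_sub_C_of_norm_lt {F : Type} [NontriviallyNormedField F] [CompleteSpace F]
    [IsUltrametricDist F] {P : F[X]} (hirr : Irreducible P) (hP : P.Monic) :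
    ∃ ε : ℝ, 0 < ε ∧ ∀ c : F, ‖c‖ < ε → Irreducible (P - C c) := by
  haveI := Fact.mk hirr
  obtain ⟨N, hN, hNc, B, hB, hb⟩ := exists_norm_bound hP
  have hd0 : 0 < P.natDegree := hirr.natDegree_pos
  refine ⟨1 / (B * B + 1), by positivity, fun c hc => ?_⟩
  have hlt : (C c).degree < P.degree :=
    degree_C_le.trans_lt (natDegree_pos_iff_degree_pos.1 hd0)
  have hQ : (P - C c).Monic := hP.sub_of_left hlt
  have hQd : (P - C c).natDegree = P.natDegree := natDegree_sub_C
  rw [hQ.irreducible_iff_natDegree']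
  refine ⟨fun h => ?_, fun f g hf hg h hmem => ?_⟩
  · rw [h, natDegree_one] at hQd; omega
  · rw [hQd, Finset.mem_Ioc] at hmem
    have hs : f.natDegree + g.natDegree = P.natDegree := by
      rw [← hQd, ← h, hf.natDegree_mul hg]
    have hf1 := hb f hf (by omega)
    have hg1 := hb g hg (by omega)
    have he : N (AdjoinRoot.mk P f) * N (AdjoinRoot.mk P g) = ‖c‖ := by
      rw [← hN, ← map_mul, h, map_sub, AdjoinRoot.mk_self, zero_sub, AdjoinRoot.mk_C, ← map_neg, hNc,
        norm_neg]
    rw [lt_div_iff₀ (by positivity)] at hc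
    have hmul := mul_le_mul hf1 hg1 zero_le_one (zero_le_one.trans hf1)
    have : B * N (AdjoinRoot.mk P f) * (B * N (AdjoinRoot.mk P g)) = B * B * ‖c‖ := by
      rw [← he]; ring
    rw [this] at hmul
    nlinarith [norm_nonneg c]

end NormBound

section LexNorm

open Polynomial

variable {k : Type} [Field k]

/-- The exponent of the leading power of `t`. -/
noncomputable def lexOrder (x : LexField k) : ℤ := (ofLex x.order).1

lemma lexOrder_mul {x y : LexField k} (hx : x ≠ 0) (hy : y ≠ 0) :
    lexOrder (x * y) = lexOrder x + lexOrder y := by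
  rw [lexOrder, HahnSeries.order_mul hx hy]; rfl

lemma le_lexOrder_iff {x : LexField k} (hx : x ≠ 0) (N : ℤ) :
    N ≤ lexOrder x ↔ ∀ n < N, ∀ i, x.coeff (toLex (n, i)) = 0 := by
  constructor
  · intro h n hn i
    refine HahnSeries.coeff_eq_zero_of_lt_order ?_
    rw [Prod.Lex.lt_iff]
    exact Or.inl (hn.trans_le h)
  · intro h
    by_contra hlt
    exact HahnSeries.coeff_order_eq_zero.not.2 hx (h _ (not_le.1 hlt) (ofLex x.order).2)

lemma min_le_lexOrder_add {x y : LexField k} (hx : x ≠ 0) (hy : y ≠ 0) (h : x + y ≠ 0) :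
    min (lexOrder x) (lexOrder y) ≤ lexOrder (x + y) := by
  rw [le_lexOrder_iff h]
  intro n hn i
  rw [HahnSeries.coeff_add, (le_lexOrder_iff hx _).1 le_rfl n (lt_min_iff.1 hn).1,
    (le_lexOrder_iff hy _).1 le_rfl n (lt_min_iff.1 hn).2, add_zero]

open Classical in
/-- The `t`-adic absolute value. -/
noncomputable def lexAbs (x : LexField k) : ℝ := if x = 0 then 0 else (2 : ℝ) ^ (-lexOrder x)

lemma lexAbs_add_le (x y : LexField k) : lexAbs (x + y) ≤ max (lexAbs x) (lexAbs y) := by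
  have hpos : ∀ x : LexField k, 0 ≤ lexAbs x := fun x => by unfold lexAbs; split_ifs <;> positivity
  by_cases h : x + y = 0
  · rw [h]
    refine le_max_of_le_left ?_
    rw [lexAbs, if_pos rfl]; exact hpos x
  by_cases hx : x = 0
  · simp [hx]
  by_cases hy : y = 0
  · simp [hy]
  rw [lexAbs, lexAbs, lexAbs, if_neg h, if_neg hx, if_neg hy]
  have := min_le_lexOrder_add hx hy h
  rcases min_le_iff.1 this with h1 | h1
  · exact le_max_of_le_left (zpow_le_zpow_right₀ one_le_two (neg_le_neg h1))
  · exact le_max_of_le_right (zpow_le_zpow_right₀ one_le_two (neg_le_neg h1))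

variable (k) in
/-- The `t`-adic absolute value. -/
noncomputable def lexAbsoluteValue : AbsoluteValue (LexField k) ℝ where
  toFun := lexAbs
  map_mul' x y := by
    by_cases hx : x = 0
    · simp [lexAbs, hx]
    by_cases hy : y = 0
    · simp [lexAbs, hy]
    simp only [lexAbs]
    rw [if_neg hx, if_neg hy, if_neg (mul_ne_zero hx hy), lexOrder_mul hx hy, neg_add,
      zpow_add₀ two_ne_zero]
  nonneg' x := by simp only [lexAbs]; split_ifs <;> positivity
  eq_zero' x := by
    simp only [lexAbs]
    constructor
    · intro h
      by_contra hx
      rw [if_neg hx] at h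
      exact (zpow_pos two_pos _).ne' h
    · intro h; rw [if_pos h]
  add_le' x y := (lexAbs_add_le x y).trans (max_le_add_of_nonneg
    (by simp only [lexAbs]; split_ifs <;> positivity)
    (by simp only [lexAbs]; split_ifs <;> positivity))

lemma lexAbs_le_iff {x : LexField k} {N : ℤ} :
    lexAbs x ≤ (2 : ℝ) ^ (-N) ↔ ∀ n < N, ∀ i, x.coeff (toLex (n, i)) = 0 := by
  by_cases hx : x = 0
  · simp [lexAbs, hx, zpow_nonneg]
  · rw [lexAbs, if_neg hx, zpow_le_zpow_iff_right₀ one_lt_two, neg_le_neg_iff, le_lexOrder_iff hx]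

lemma lexAbs_le_iff_mem {x : LexField k} {N : ℕ} :
    lexAbs x ≤ (2 : ℝ) ^ (-(N : ℤ)) ↔ ∃ r ∈ lexRing₀ k, x = lexMono k 1 0 ^ N * r := by
  rw [lexAbs_le_iff]
  constructor
  · intro h
    refine ⟨(lexMono k 1 0 ^ N)⁻¹ * x, mem_suppRing.2 fun n i hne => ?_, ?_⟩
    · rw [lexMono_pow, lexMono_inv, coeff_lexMono_mul] at hne
      rw [mem_cone₀]
      by_contra hn
      exact hne (h _ (by omega) _)
    · rw [mul_inv_cancel_left₀ (pow_ne_zero _ (lexMono_ne_zero _ _))]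
  · rintro ⟨r, hr, rfl⟩ n hn i
    rw [lexMono_pow, coeff_lexMono_mul]
    by_contra hne
    have := mem_cone₀.1 (mem_suppRing.1 hr _ _ hne)
    omega

theorem exists_irreducible_sub_lexMono {U : (PowerSeries k)[X]} (hU : U.Monic) (hirr : Irreducible U) :
    ∃ m₁, ∀ m : ℕ, m₁ ≤ m → Irreducible (U.map (lexBase k) - C (lexMono k m 1)) := by
  letI := (lexAbsoluteValue k).toNormedField
  have hnorm : ∀ x : LexField k, ‖x‖ = lexAbs x := fun x => rfl
  letI := NontriviallyNormedField.ofNormNeOne (𝕜 := LexField k)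
    ⟨lexMono k 1 0, lexMono_ne_zero _ _, by
      intro h
      have h1 := (lexAbs_le_iff_mem (x := lexMono k 1 0) (N := 1)).2 ⟨1, one_mem _, by simp⟩
      rw [← hnorm, h] at h1
      norm_num at h1⟩
  haveI : IsUltrametricDist (LexField k) :=
    IsUltrametricDist.isUltrametricDist_of_forall_norm_add_le_max_norm lexAbs_add_le
  have hT : TComplete (lexMono k 1 0) (lexRing₀ k) := (lex_patchRings k 0).complete₀
  haveI : CompleteSpace (LexField k) := by
    refine Metric.complete_of_convergent_controlled_sequences (fun N => (2 : ℝ) ^ (-(N : ℤ)))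
      (fun N => by positivity) fun u hu => ?_
    have h1 : ∀ n, ∃ r ∈ lexRing₀ k, u (n + 1) - u n = lexMono k 1 0 ^ n * r := fun n => by
      rw [← lexAbs_le_iff_mem, ← hnorm, ← dist_eq_norm]
      exact (hu n (n + 1) n (by omega) le_rfl).le
    choose a ha hua using h1
    obtain ⟨s, hs, hsa⟩ := hT.sum a ha
    have h2 : ∀ n, u 0 + s 0 - u n = lexMono k 1 0 ^ n * s n := by
      intro n
      induction n with
      | zero => simp
      | succ n ih =>
        have := hua n
        have h3 := hsa n
        linear_combination ih - this + lexMono k 1 0 ^ n * h3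
    refine ⟨u 0 + s 0, tendsto_iff_dist_tendsto_zero.2 (squeeze_zero (fun _ => dist_nonneg)
      (g := fun n : ℕ => ((1 : ℝ) / 2) ^ n) (fun n => ?_)
      (tendsto_pow_atTop_nhds_zero_of_lt_one (by norm_num) (by norm_num)))⟩
    rw [dist_comm, dist_eq_norm, hnorm]
    refine ((lexAbs_le_iff_mem (N := n)).2 ⟨s n, hs n, h2 n⟩).trans_eq ?_
    rw [zpow_neg, zpow_natCast, one_div, inv_pow]
  obtain ⟨ε, hε, h⟩ := irreducible_sub_C_of_norm_lt (irreducible_map_lexBase hU hirr) (hU.map _)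
  obtain ⟨m₁, hm₁⟩ := exists_pow_lt_of_lt_one hε (show (1 : ℝ) / 2 < 1 by norm_num)
  refine ⟨m₁, fun m hm => h _ (lt_of_le_of_lt ?_ hm₁)⟩
  rw [hnorm]
  refine ((lexAbs_le_iff_mem (N := m₁)).2 ⟨lexMono k (m - m₁) 1, ?_, ?_⟩).trans_eq ?_
  · exact lexMono_mem (mem_cone₀.2 (by omega))
  · rw [lexMono_pow, lexMono_mul]; congr 1 <;> ring
  · rw [zpow_neg, zpow_natCast, one_div, inv_pow]

end LexNorm

section PatchEmbedding

open Polynomial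

variable {k : Type} [Field k]

/-- The polynomial adjoining a root of `U(X) = t ^ m * v`. -/
noncomputable def lexPoly (U : (PowerSeries k)[X]) (m : ℕ) : (LexField k)[X] :=
  U.map (lexBase k) - C (lexMono k m 1)

lemma lexPoly_monic {U : (PowerSeries k)[X]} (hU : U.Monic) (hd : 0 < U.natDegree) (m : ℕ) :
    (lexPoly U m).Monic := by
  refine (hU.map _).sub_of_left (degree_C_le.trans_lt ?_)
  rw [hU.degree_map, degree_eq_natDegree hU.ne_zero]
  exact_mod_cast hd

lemma natDegree_lexPoly {U : (PowerSeries k)[X]} (hU : U.Monic) (m : ℕ) :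
    (lexPoly U m).natDegree = U.natDegree := by
  rw [lexPoly, natDegree_sub_C, hU.natDegree_map]

lemma coeff_lexPoly_mem (U : (PowerSeries k)[X]) (m i : ℕ) :
    (lexPoly U m).coeff i ∈ (lexRing₁ k ⊓ lexRing₂ k m : Subring _) := by
  rw [lexPoly, coeff_sub, coeff_map, coeff_C]
  refine Subring.sub_mem _ (lexBase_mem m _) ?_
  split_ifs
  · exact lexMono_mem_inf m
  · exact zero_mem _

theorem exists_patchEmbedding {U : (PowerSeries k)[X]} (hU : IsDist U) (hd : 0 < U.natDegree)
    (m : ℕ) [Fact (Irreducible (lexPoly U m))] :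
    ∃ j : MvPowerSeries (Fin 2) k →+* AdjoinRoot (lexPoly U m), Function.Injective j ∧
      j.range = polyRing (lexPoly U m) (lexRing₁ k ⊓ lexRing₂ k m) ∧
      (∀ o, j ((iterEquiv k).symm (PowerSeries.C o)) = AdjoinRoot.of _ (lexBase k o)) ∧
      j (MvPowerSeries.X 0) = AdjoinRoot.root _ := by
  have hP := lexPoly_monic hU.monic hd m
  have hPd := natDegree_lexPoly hU.monic m
  obtain ⟨θ, hθC, hθX⟩ := exists_substHom (U : PowerSeries (PowerSeries k)) (by
    have h := hU.mem hd
    rw [PowerSeries.maximalIdeal_eq_span_X, Ideal.mem_span_singleton, PowerSeries.X_dvd_iff] at h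
    have h1 : PowerSeries.constantCoeff (U : PowerSeries (PowerSeries k)) = U.coeff 0 := by simp
    rw [h1, h])
  let h₀ : PowerSeries (PowerSeries k) →+* LexField k := (lexHom k m).comp (iterEquiv k).symm.toRingHom
  have hinj₀ : Function.Injective h₀ := (lexHom_injective m).comp (iterEquiv k).symm.injective
  have h₀C : ∀ o, h₀ (PowerSeries.C o) = lexBase k o := fun o => lexHom_C m o
  have h₀X : h₀ PowerSeries.X = lexMono k m 1 := by
    change lexHom k m ((iterEquiv k).symm PowerSeries.X) = _
    rw [← iterEquiv_X_zero, RingEquiv.symm_apply_apply, lexHom_X_zero]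
  obtain ⟨j, hj, hjX⟩ := hU.exists_lift (Ω := AdjoinRoot (lexPoly U m)) hd hθC hθX
    ((AdjoinRoot.of (lexPoly U m)).comp h₀) (AdjoinRoot.root _) (by
      have h1 : ((AdjoinRoot.of (lexPoly U m)).comp h₀).comp PowerSeries.C =
          (AdjoinRoot.of (lexPoly U m)).comp (lexBase k) := RingHom.ext fun o =>
        congrArg (AdjoinRoot.of (lexPoly U m)) (h₀C o)
      rw [h1, RingHom.comp_apply, h₀X, ← eval₂_map]
      have h2 := AdjoinRoot.eval₂_root (lexPoly U m)
      rw [lexPoly, eval₂_sub, eval₂_C] at h2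
      exact sub_eq_zero.1 h2)
  have hmem : ∀ a, h₀ a ∈ (lexRing₁ k ⊓ lexRing₂ k m : Subring _) := fun a => by
    rw [← lexHom_range]; exact ⟨_, rfl⟩
  have hsum : ∀ a : ℕ → PowerSeries (PowerSeries k),
      j (∑ i ∈ Finset.range U.natDegree, θ (a i) * PowerSeries.X ^ i) =
      ∑ i ∈ Finset.range (lexPoly U m).natDegree,
        AdjoinRoot.of (lexPoly U m) (h₀ (a i)) * AdjoinRoot.root (lexPoly U m) ^ i := fun a => by
    rw [map_sum, hPd]
    refine Finset.sum_congr rfl fun i _ => ?_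
    rw [map_mul, map_pow, hj, hjX]; rfl
  have hjinj : Function.Injective j := by
    rw [injective_iff_map_eq_zero]
    intro f hf
    obtain ⟨a, rfl⟩ := hU.exists_eq_sum hd hθC hθX f
    rw [hsum] at hf
    refine Finset.sum_eq_zero fun i hi => ?_
    have h1 := polyCoord_sum hP (fun i => h₀ (a i)) (i := i) (by rw [hPd]; exact Finset.mem_range.1 hi)
    rw [hf] at h1
    have h2 : h₀ (a i) = 0 := h1.symm.trans (by simp [polyCoord])
    rw [(map_eq_zero_iff h₀ hinj₀).1 h2, map_zero, zero_mul]
  have hjrange : j.range = polyRing (lexPoly U m) (lexRing₁ k ⊓ lexRing₂ k m) := by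
    apply le_antisymm
    · rintro _ ⟨f, rfl⟩
      obtain ⟨a, rfl⟩ := hU.exists_eq_sum hd hθC hθX f
      rw [hsum]
      exact Subring.sum_mem _ fun i _ => Subring.mul_mem _ (of_mem_polyRing (hmem _))
        (Subring.pow_mem _ root_mem_polyRing i)
    · refine polyRing_le (fun c hc => ?_) ⟨_, hjX⟩
      rw [← lexHom_range] at hc
      obtain ⟨w, rfl⟩ := hc
      refine ⟨θ (iterEquiv k w), ?_⟩
      rw [hj]
      change AdjoinRoot.of _ (lexHom k m ((iterEquiv k).symm (iterEquiv k w))) = _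
      rw [RingEquiv.symm_apply_apply]
  refine ⟨j.comp (iterEquiv k).toRingHom, hjinj.comp (iterEquiv k).injective, ?_, fun o => ?_, ?_⟩
  · rw [← hjrange]
    ext z
    constructor
    · rintro ⟨a, rfl⟩; exact ⟨_, rfl⟩
    · rintro ⟨a, rfl⟩
      exact ⟨(iterEquiv k).symm a, congrArg j ((iterEquiv k).apply_symm_apply a)⟩
  · change j (iterEquiv k ((iterEquiv k).symm _)) = _
    rw [RingEquiv.apply_symm_apply, ← hθC, hj]
    exact congrArg (AdjoinRoot.of (lexPoly U m)) (h₀C o)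
  · change j (iterEquiv k _) = _
    rw [iterEquiv_X_zero, hjX]

end PatchEmbedding

section PatchLocal

open Polynomial

variable {k : Type} [Field k]

lemma isMaximal_of_X_mem {p : Ideal (MvPowerSeries (Fin 2) k)} (hp : p.IsPrime)
    (h0 : MvPowerSeries.X 0 ∈ p) (h1 : MvPowerSeries.X 1 ∈ p) : p.IsMaximal := by
  have hle : IsLocalRing.maximalIdeal (MvPowerSeries (Fin 2) k) ≤ p := by
    intro x hx
    rw [IsLocalRing.mem_maximalIdeal, mem_nonunits_iff, MvPowerSeries.isUnit_iff_constantCoeff,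
      isUnit_iff_ne_zero, not_not] at hx
    have hc : PowerSeries.constantCoeff (PowerSeries.constantCoeff (iterEquiv k x)) = 0 := by
      rw [← PowerSeries.coeff_zero_eq_constantCoeff_apply,
        ← PowerSeries.coeff_zero_eq_constantCoeff_apply, coeff_iterEquiv]
      simpa using hx
    obtain ⟨o, ho⟩ := PowerSeries.X_dvd_iff.2 hc
    have hd : PowerSeries.X ∣ iterEquiv k x - PowerSeries.C (PowerSeries.constantCoeff (iterEquiv k x)) :=
      PowerSeries.X_dvd_iff.2 (by simp)
    obtain ⟨g, hg⟩ := hd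
    have hx' : x = MvPowerSeries.X 0 * (iterEquiv k).symm g +
        MvPowerSeries.X 1 * (iterEquiv k).symm (PowerSeries.C o) := by
      apply (iterEquiv k).injective
      rw [map_add, map_mul, map_mul, iterEquiv_X_zero, iterEquiv_X_one, RingEquiv.apply_symm_apply,
        RingEquiv.apply_symm_apply, ← hg, ← map_mul, ← ho, sub_add_cancel]
    rw [hx']
    exact p.add_mem (p.mul_mem_right _ h0) (p.mul_mem_right _ h1)
  rw [← (IsLocalRing.maximalIdeal.isMaximal _).eq_of_le hp.ne_top hle]
  exact IsLocalRing.maximalIdeal.isMaximal _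

/-- The power series of a distinguished polynomial. -/
noncomputable def polySeries (U : (PowerSeries k)[X]) : MvPowerSeries (Fin 2) k :=
  (iterEquiv k).symm (U : PowerSeries (PowerSeries k))

lemma polySeries_eq_sum (U : (PowerSeries k)[X]) : polySeries U =
    ∑ i ∈ Finset.range (U.natDegree + 1), (iterEquiv k).symm (PowerSeries.C (U.coeff i)) *
      MvPowerSeries.X 0 ^ i := by
  apply (iterEquiv k).injective
  rw [polySeries, RingEquiv.apply_symm_apply, map_sum]
  conv_lhs => rw [U.as_sum_range_C_mul_X_pow]
  have : ∀ f : (PowerSeries k)[X], (f : PowerSeries (PowerSeries k)) =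
    Polynomial.coeToPowerSeries.ringHom f := fun _ => rfl
  rw [this, map_sum]
  refine Finset.sum_congr rfl fun i _ => ?_
  rw [map_mul (iterEquiv k), map_pow (iterEquiv k), iterEquiv_X_zero, RingEquiv.apply_symm_apply, map_mul, map_pow]
  simp

lemma X_zero_mem_of_polySeries_mem {U : (PowerSeries k)[X]} (hU : IsDist U)
    {p : Ideal (MvPowerSeries (Fin 2) k)} (hp : p.IsPrime)
    (h : polySeries U ∈ p) (h1 : MvPowerSeries.X 1 ∈ p) : MvPowerSeries.X 0 ∈ p := by
  rw [polySeries_eq_sum, Finset.sum_range_succ, coeff_natDegree, hU.monic.leadingCoeff, map_one,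
    map_one, one_mul] at h
  refine hp.mem_of_pow_mem U.natDegree ((Ideal.add_mem_iff_right p ?_).1 h)
  refine p.sum_mem fun i hi => p.mul_mem_right _ ?_
  have h2 := hU.mem (Finset.mem_range.1 hi)
  rw [PowerSeries.maximalIdeal_eq_span_X, Ideal.mem_span_singleton] at h2
  obtain ⟨o, ho⟩ := h2
  rw [ho, map_mul, map_mul]
  refine p.mul_mem_right _ ?_
  rwa [← iterEquiv_X_one, RingEquiv.symm_apply_apply]

lemma sub_sum_notMem {A : Type} [CommRing A] [IsLocalRing A] {p : Ideal A} (hp : p.IsPrime)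
    {t u D a b : A} {m₀ m : ℕ} (hD : D ∈ p) (hm : m₀ ≤ m) (h : u * a + D * b = t ^ m₀)
    (ht : t ∈ IsLocalRing.maximalIdeal A) (hu : u ∉ p) (N : ℕ) (c : ℕ → A) :
    u ^ N - t * ∑ l ∈ Finset.range (N + 1), (t ^ m) ^ l * u ^ (N - l) * c l ∉ p := by
  intro hmem
  have htm : t ^ m - u * (t ^ (m - m₀) * a) ∈ p := by
    have : t ^ m = t ^ (m - m₀) * t ^ m₀ := by rw [← pow_add, Nat.sub_add_cancel hm]
    rw [this, ← h]
    have : t ^ (m - m₀) * (u * a + D * b) - u * (t ^ (m - m₀) * a) = D * (t ^ (m - m₀) * b) := by ring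
    rw [this]
    exact p.mul_mem_right _ hD
  have hq : Ideal.Quotient.mk p (t ^ m) =
      Ideal.Quotient.mk p u * Ideal.Quotient.mk p (t ^ (m - m₀) * a) := by
    rw [← map_mul]; exact Ideal.Quotient.eq.2 htm
  set w := t ^ (m - m₀) * a
  have h2 : Ideal.Quotient.mk p (u ^ N * (1 - t * ∑ l ∈ Finset.range (N + 1), w ^ l * c l)) = 0 := by
    rw [← Ideal.Quotient.eq_zero_iff_mem.2 hmem]
    simp only [map_mul, map_sub, map_sum, map_pow, map_one] at hq ⊢
    rw [mul_sub, mul_one, mul_left_comm, Finset.mul_sum]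
    congr 2
    refine Finset.sum_congr rfl fun l hl => ?_
    have hl' : l ≤ N := Nat.lt_succ_iff.1 (Finset.mem_range.1 hl)
    rw [hq, mul_pow]
    conv_lhs => rw [← Nat.sub_add_cancel hl', pow_add]
    ring
  rw [Ideal.Quotient.eq_zero_iff_mem] at h2
  rcases hp.mem_or_mem h2 with h3 | h3
  · exact hu (hp.mem_of_pow_mem N h3)
  · refine hp.ne_top (p.eq_top_of_isUnit_mem h3 ?_)
    by_contra hnu
    have h4 : 1 - t * ∑ l ∈ Finset.range (N + 1), w ^ l * c l ∈ IsLocalRing.maximalIdeal A := hnu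
    refine (Ideal.ne_top_iff_one _).1 (IsLocalRing.maximalIdeal.isMaximal A).ne_top ?_
    have h5 := Ideal.add_mem _ h4 (Ideal.mul_mem_right
      (∑ l ∈ Finset.range (N + 1), w ^ l * c l) _ ht)
    rwa [sub_add_cancel] at h5

variable {K : Type} [Field K] [Algebra (MvPowerSeries (Fin 2) k) K]
  [IsFractionRing (MvPowerSeries (Fin 2) k) K]

variable {U : (PowerSeries k)[X]} {m : ℕ} [Fact (Irreducible (lexPoly U m))]
  [Algebra K (AdjoinRoot (lexPoly U m))]
  {j : MvPowerSeries (Fin 2) k →+* AdjoinRoot (lexPoly U m)}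

lemma patch_X_one (hjC : ∀ o, j ((iterEquiv k).symm (PowerSeries.C o)) = AdjoinRoot.of _ (lexBase k o)) :
    j (MvPowerSeries.X 1) = AdjoinRoot.of _ (lexMono k 1 0) := by
  rw [← lexBase_X, ← hjC, ← iterEquiv_X_one, RingEquiv.symm_apply_apply]

lemma patch_polySeries (hU : U.Monic)
    (hjC : ∀ o, j ((iterEquiv k).symm (PowerSeries.C o)) = AdjoinRoot.of _ (lexBase k o))
    (hjX : j (MvPowerSeries.X 0) = AdjoinRoot.root _) :
    j (polySeries U) = AdjoinRoot.of _ (lexMono k m 1) := by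
  have h2 := AdjoinRoot.eval₂_root (lexPoly U m)
  rw [lexPoly, eval₂_sub, eval₂_C, eval₂_eq_sum_range, hU.natDegree_map] at h2
  rw [polySeries_eq_sum, map_sum]
  refine Eq.trans (Finset.sum_congr rfl fun i _ => ?_) (sub_eq_zero.1 h2)
  rw [map_mul, map_pow, hjC, hjX, coeff_map]; rfl

lemma polySubfield_le_fieldRange (hP : (lexPoly U m).Monic)
    (hjr : j.range = polyRing (lexPoly U m) (lexRing₁ k ⊓ lexRing₂ k m))
    (hjX : j (MvPowerSeries.X 0) = AdjoinRoot.root _)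
    (hj : ∀ a, algebraMap K _ (algebraMap _ K a) = j a) (hF) :
    polySubfield hP (lexFrac k m) hF ≤ (algebraMap K (AdjoinRoot (lexPoly U m))).fieldRange := by
  intro z hz
  rw [polyCoord_eq_sum hP z]
  have hle : lexFrac k m ≤ Subfield.comap (L := AdjoinRoot (lexPoly U m))
      (AdjoinRoot.of (lexPoly U m) : LexField k →+* AdjoinRoot (lexPoly U m))
      (algebraMap K (AdjoinRoot (lexPoly U m))).fieldRange := by
    rw [lexFrac, Subfield.closure_le]
    intro c hc
    have : AdjoinRoot.of (lexPoly U m) c ∈ j.range := by rw [hjr]; exact of_mem_polyRing hc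
    obtain ⟨a, ha⟩ := this
    exact ⟨algebraMap _ K a, (hj a).trans ha⟩
  refine Subfield.sum_mem _ fun i hi => Subfield.mul_mem _
    (hle (mem_polySubfield.1 hz i (Finset.mem_range.1 hi))) (Subfield.pow_mem _ ?_ i)
  exact ⟨algebraMap _ K (MvPowerSeries.X 0), (hj _).trans hjX⟩

lemma algebraMap_mem_polySubfield (hP : (lexPoly U m).Monic)
    (hjr : j.range = polyRing (lexPoly U m) (lexRing₁ k ⊓ lexRing₂ k m))
    (hj : ∀ a, algebraMap K _ (algebraMap _ K a) = j a) {F : Subfield (LexField k)}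
    (hS : ∀ c ∈ (lexRing₁ k ⊓ lexRing₂ k m : Subring _), c ∈ F) (hF) (x : K) :
    algebraMap K _ x ∈ polySubfield hP F hF := by
  obtain ⟨a, b, -, rfl⟩ := IsFractionRing.div_surjective (A := MvPowerSeries (Fin 2) k) x
  have h : ∀ a, j a ∈ polySubfield hP F hF := fun a => by
    have h1 : j a ∈ polyRing (lexPoly U m) (lexRing₁ k ⊓ lexRing₂ k m) := by rw [← hjr]; exact ⟨a, rfl⟩
    exact mem_polySubfield.2 fun i hi => hS _ ((mem_polyRing_iff hP (coeff_lexPoly_mem U m)).1 h1 i hi)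
  rw [map_div₀, hj, hj]
  exact Subfield.div_mem _ (h a) (h b)

theorem patchData_of_embedding (hU : IsDist U) (hd : 0 < U.natDegree)
    (hP : (lexPoly U m).Monic) (hjinj : Function.Injective j)
    (hjr : j.range = polyRing (lexPoly U m) (lexRing₁ k ⊓ lexRing₂ k m))
    (hjC : ∀ o, j ((iterEquiv k).symm (PowerSeries.C o)) = AdjoinRoot.of _ (lexBase k o))
    (hjX : j (MvPowerSeries.X 0) = AdjoinRoot.root _)
    (hj : ∀ a, algebraMap K _ (algebraMap _ K a) = j a)
    {D a b : MvPowerSeries (Fin 2) k} {m₀ : ℕ} (hm : m₀ ≤ m)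
    (hD : polySeries U * a + D * b = MvPowerSeries.X 1 ^ m₀)
    (K₁ K₂ : IntermediateField K (AdjoinRoot (lexPoly U m))) (hF₁) (hF₂)
    (hK₁ : ∀ z, z ∈ K₁ ↔ z ∈ polySubfield hP (lexFrac₁ k) hF₁)
    (hK₂ : ∀ z, z ∈ K₂ ↔ z ∈ polySubfield hP (lexFrac₂ k m) hF₂) :
    PatchData (MvPowerSeries (Fin 2) k) K₁ K₂ (polyRing (lexPoly U m) (lexRing₂ k m)) D where
  inf_eq := by
    rw [eq_bot_iff]
    rintro z ⟨h1, h2⟩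
    have h1 := mem_polySubfield.1 ((hK₁ z).1 h1)
    have h2 := mem_polySubfield.1 ((hK₂ z).1 h2)
    refine IntermediateField.mem_bot.2 (polySubfield_le_fieldRange hP hjr hjX hj
      (fun i => Subfield.subset_closure (coeff_lexPoly_mem U m i)) (mem_polySubfield.2 fun i hi => ?_))
    rw [← lexFrac₁_inf_lexFrac₂]
    exact ⟨h1 i hi, h2 i hi⟩
  mem_of_mem r hr := (hK₂ r).2 (mem_polySubfield.2 fun i hi => Subfield.subset_closure
    ((mem_polyRing_iff hP fun i => (coeff_lexPoly_mem U m i).2).1 hr i hi))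
  algebraMap_mem a := by
    rw [hj]
    have h1 : j a ∈ polyRing (lexPoly U m) (lexRing₁ k ⊓ lexRing₂ k m) := by rw [← hjr]; exact ⟨a, rfl⟩
    exact polyRing_mono inf_le_right h1
  split ι _ _ T hT w := by
    obtain ⟨a, r, ha, hr, h⟩ := ((lex_patchRings k m).polyRing hP
      (fun i => (coeff_lexPoly_mem U m i).1) fun i => (coeff_lexPoly_mem U m i).2).split T hT w
    exact ⟨a, r, fun x => (hK₁ _).2 (ha x), hr, h⟩
  exists_nonunit := by
    refine ⟨MvPowerSeries.X 1, fun h0 => ?_, fun h => ?_⟩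
    · have h1 := patch_X_one hjC
      rw [h0, map_zero] at h1
      exact lexMono_ne_zero 1 0 ((AdjoinRoot.of (lexPoly U m)).injective (by rw [← h1, map_zero]))
    rw [hj, patch_X_one hjC, ← map_inv₀, lexMono_inv, neg_zero] at h
    have h1 := (mem_polyRing_iff hP fun i => (coeff_lexPoly_mem U m i).2).1 h 0
      (by rw [natDegree_lexPoly hU.monic]; exact hd)
    have h2 := polyCoord_smul hP (lexMono k (-1) 0) 1 0
    rw [mul_one] at h2
    have h3 : polyCoord hP (1 : AdjoinRoot (lexPoly U m)) 0 = 1 := by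
      rw [← map_one (AdjoinRoot.mk (lexPoly U m)), polyCoord_mk, (modByMonic_eq_self_iff hP).2]
      · simp
      · rw [degree_one, ← natDegree_pos_iff_degree_pos, natDegree_lexPoly hU.monic]; exact hd
    rw [h2, h3, mul_one] at h1
    have h4 := mem_suppRing.1 h1 (-1) 0 (by simp [lexMono])
    have := (mem_cone₂.1 h4).1
    omega
  local_mem p hp hDp hmax c hc := by
    have hu : polySeries U ∉ p := fun hu => by
      have ht : MvPowerSeries.X 1 ∈ p := by
        refine hp.mem_of_pow_mem m₀ ?_
        rw [← hD]
        exact p.add_mem (p.mul_mem_right _ hu) (p.mul_mem_right _ hDp)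
      exact hmax (isMaximal_of_X_mem hp (X_zero_mem_of_polySeries_mem hU hp hu ht) ht)
    have ht : MvPowerSeries.X 1 ∈ IsLocalRing.maximalIdeal (MvPowerSeries (Fin 2) k) := by
      rw [IsLocalRing.mem_maximalIdeal, mem_nonunits_iff, MvPowerSeries.isUnit_iff_constantCoeff]
      simp
    have hlift : ∀ c ∈ (lexRing₁ k ⊓ lexRing₂ k m : Subring _), ∃ w, j w = AdjoinRoot.of _ c :=
      fun c hc => by
        have : AdjoinRoot.of (lexPoly U m) c ∈ j.range := by rw [hjr]; exact of_mem_polyRing hc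
        exact this
    have hc1 : ∀ i < (lexPoly U m).natDegree, polyCoord hP (algebraMap K _ c) i ∈ lexFrac₁ k :=
      mem_polySubfield.1 (algebraMap_mem_polySubfield hP hjr hj
        (fun c hc => Subfield.subset_closure hc.1) hF₁ c)
    have hc2 := (mem_polyRing_iff hP fun i => (coeff_lexPoly_mem U m i).2).1 hc
    have key : ∀ i < (lexPoly U m).natDegree, ∃ s ∉ p, ∃ s₀ ∈ (lexRing₁ k ⊓ lexRing₂ k m : Subring _),
        j s = AdjoinRoot.of _ s₀ ∧
        s₀ * polyCoord hP (algebraMap K _ c) i ∈ (lexRing₁ k ⊓ lexRing₂ k m : Subring _) := by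
      intro i hi
      obtain ⟨N, a', ha', h⟩ := exists_denominator_of_mem_lexRing₂ (hc1 i hi) (hc2 i hi)
      choose w hw using fun l => hlift _ (ha' l)
      refine ⟨_, sub_sum_notMem hp hDp hm hD ht hu N w, _, ?_, ?_, h⟩
      · refine Subring.sub_mem _ (Subring.pow_mem _ (lexMono_mem_inf m) N) ?_
        have ht' : lexMono k 1 0 ∈ (lexRing₁ k ⊓ lexRing₂ k m : Subring _) := by
          rw [← lexBase_X]; exact lexBase_mem m _
        exact Subring.mul_mem _ ht' (Subring.sum_mem _ fun l _ => Subring.mul_mem _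
          (Subring.mul_mem _ (Subring.pow_mem _ (Subring.pow_mem _ ht' m) l)
            (Subring.pow_mem _ (lexMono_mem_inf m) _)) (ha' l))
      · simp only [map_sub, map_mul, map_pow, map_sum, patch_X_one hjC,
          patch_polySeries hU.monic hjC hjX, hw]
    choose s hsp s₀ hs₀ hsj hsc using key
    let d := (lexPoly U m).natDegree
    refine ⟨∏ i : Fin d, s i i.2, ?_, ?_⟩
    · intro h
      obtain ⟨i, -, hi⟩ := (Ideal.IsPrime.prod_mem_iff (hp := hp)).1 h
      exact hsp _ _ hi
    · have hmem : j (∏ i : Fin d, s i i.2) * algebraMap K _ c ∈ j.range := by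
        rw [hjr, mem_polyRing_iff hP (coeff_lexPoly_mem U m)]
        intro i hi
        rw [map_prod, Finset.prod_congr rfl fun (i : Fin d) _ => hsj i i.2, ← map_prod, polyCoord_smul,
          ← Finset.mul_prod_erase _ _ (Finset.mem_univ (⟨i, hi⟩ : Fin d)), mul_right_comm]
        exact Subring.mul_mem _ (hsc i hi) (Subring.prod_mem _ fun i _ => hs₀ _ _)
      obtain ⟨b', hb'⟩ := hmem
      refine ⟨b', (algebraMap K (AdjoinRoot (lexPoly U m))).injective ?_⟩
      rw [map_mul, hj, hj, hb']

end PatchLocal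

section Newton

open Polynomial

variable {Ω : Type} [Field Ω] {t : Ω} {R : Subring Ω}

lemma Subring.pow_mul_eval_mem (ht : t ∈ R) {q : Polynomial Ω} (hq : ∀ i, q.coeff i ∈ R) {c n : ℕ} {b : Ω}
    (hb : t ^ c * b ∈ R) (hn : q.natDegree ≤ n) : t ^ (c * n) * q.eval b ∈ R := by
  rw [eval_eq_sum_range, Finset.mul_sum]
  refine R.sum_mem fun i hi => ?_
  have hi' : i ≤ n := (Nat.lt_succ_iff.1 (Finset.mem_range.1 hi)).trans hn
  have : t ^ (c * n) * (q.coeff i * b ^ i) = t ^ (c * (n - i)) * q.coeff i * (t ^ c * b) ^ i := by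
    obtain ⟨j, rfl⟩ := Nat.exists_eq_add_of_le hi'
    rw [Nat.add_sub_cancel_left]; ring
  rw [this]
  exact R.mul_mem (R.mul_mem (R.pow_mem ht _) (hq i)) (R.pow_mem hb _)

lemma taylor_coeff_mem {F : Polynomial Ω} (hF : ∀ i, F.coeff i ∈ R) (i l : ℕ) :
    (hasseDeriv i F).coeff l ∈ R := by
  rw [hasseDeriv_coeff]
  exact R.mul_mem (natCast_mem R _) (hF _)

/-- Newton approximation in a complete ring, with poles allowed. -/
theorem TComplete.exists_root (h : TComplete t R) {F a b : Polynomial Ω} (hF : ∀ i, F.coeff i ∈ R)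
    (ha : ∀ i, a.coeff i ∈ R) (hb : ∀ i, b.coeff i ∈ R) {n c d : ℕ} (hnF : F.natDegree ≤ n)
    (hna : a.natDegree ≤ n) (hnb : b.natDegree ≤ n) {Δ : Ω} (hΔ : Δ ≠ 0)
    (hbez : a * F + b * derivative F = C Δ) (hd : t ^ d * Δ⁻¹ ∈ R) {b₀ : Ω}
    (hb₀ : t ^ c * b₀ ∈ R) {N : ℕ} {r : Ω} (hr : r ∈ R) (hr' : F.eval b₀ = t ^ N * r)
    (hN : 3 * (c * n + d) + 2 ≤ N) : ∃ y, F.IsRoot y ∧ t ^ c * y ∈ R := by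
  have ht := h.ne_zero
  have htR := h.mem
  have hcn : ∃ w ∈ R, t ^ (c * n) * a.eval b₀ = w := ⟨_, R.pow_mul_eval_mem htR ha hb₀ hna, rfl⟩
  obtain ⟨w, hw, hw'⟩ := hcn
  obtain ⟨l, rfl⟩ := Nat.exists_eq_add_of_le hN
  obtain ⟨g, hg, hg'⟩ : ∃ g ∈ R, t ^ d * Δ⁻¹ = g := ⟨_, hd, rfl⟩
  have hev := congrArg (eval b₀) hbez
  rw [eval_add, eval_mul, eval_mul, eval_C, hr'] at hev
  set D₁ := (derivative F).eval b₀ with hD₁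
  let r₁ := t ^ (2 * c * n + 2 * d + 1 + l) * w * r * g
  have hr₁ : r₁ ∈ R := R.mul_mem (R.mul_mem (R.mul_mem (R.pow_mem htR _) hw) hr) hg
  have hΔ' : Δ * g = t ^ d := by rw [← hg']; field_simp
  have hbD : b.eval b₀ * D₁ = Δ * (1 - t * r₁) := by
    have h1 : t ^ (c * n) * (b.eval b₀ * D₁) = t ^ (c * n) * (Δ * (1 - t * r₁)) := by
      simp only [r₁]
      linear_combination t ^ (c * n) * hev - t ^ (3 * (c * n + d) + 2 + l) * r * hw'
        + t ^ (c * n) * t * t ^ (2 * c * n + 2 * d + 1 + l) * w * r * hΔ'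
    exact mul_left_cancel₀ (pow_ne_zero _ ht) h1
  have h1r := h.one_sub_ne_zero hr₁
  have hD₁0 : D₁ ≠ 0 := by
    rintro h0
    rw [h0, mul_zero] at hbD
    exact mul_ne_zero hΔ h1r hbD.symm
  have hDinv : t ^ (c * n + d) * D₁⁻¹ ∈ R := by
    have : t ^ (c * n + d) * D₁⁻¹ = (t ^ (c * n) * b.eval b₀) * g * (1 - t * r₁)⁻¹ := by
      field_simp
      linear_combination -t ^ (c * n) * g * hbD - t ^ (c * n) * (1 - t * r₁) * hΔ'
    rw [this]
    exact R.mul_mem (R.mul_mem (R.pow_mul_eval_mem htR hb hb₀ hnb) hg) (h.inv_mem hr₁)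
  let s := 2 * c * n + d + 1
  let T := taylor b₀ F
  have hT : ∀ i, t ^ (c * n) * T.coeff i ∈ R := fun i => by
    rw [taylor_coeff]
    exact R.pow_mul_eval_mem htR (taylor_coeff_mem hF i) hb₀
      ((natDegree_hasseDeriv_le F i).trans ((Nat.sub_le _ _).trans hnF))
  have hTn : T.natDegree = F.natDegree := natDegree_taylor _ _
  have hc : ∀ i, ∃ x ∈ R, (i ≠ 1 → t ^ (s + 1) * x = -D₁⁻¹ * T.coeff i * t ^ (s * i)) ∧
      (i = 1 → x = 0) := by
    intro i
    rcases i with _ | _ | i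
    · refine ⟨-(t ^ (c * n + d) * D₁⁻¹) * (t ^ l * t ^ d * r), R.mul_mem (R.neg_mem hDinv)
        (R.mul_mem (R.mul_mem (R.pow_mem htR _) (R.pow_mem htR _)) hr), fun _ => ?_, by simp⟩
      simp only [T, taylor_coeff_zero, hr', s]
      ring
    · exact ⟨0, R.zero_mem, by simp, by simp⟩
    · refine ⟨-(t ^ (c * n + d) * D₁⁻¹) * (t ^ (c * n) * T.coeff (i + 2)) * t ^ (s * i),
        R.mul_mem (R.mul_mem (R.neg_mem hDinv) (hT _)) (R.pow_mem htR _), fun _ => ?_, by simp⟩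
      simp only [s]
      ring
  choose x hx hx' hx1 using hc
  obtain ⟨z, hz⟩ := h.exists_fixed (∑ i ∈ Finset.range (F.natDegree + 1), C ⟨x i, hx i⟩ * X ^ i)
  have hz' : (z : Ω) = t * ∑ i ∈ Finset.range (F.natDegree + 1), x i * (z : Ω) ^ i := by
    refine hz.trans ?_
    simp [eval_finset_sum]
  refine ⟨t ^ s * z + b₀, ?_, ?_⟩
  · by_cases hF0 : F.natDegree = 0
    · rw [natDegree_eq_zero] at hF0
      obtain ⟨e, rfl⟩ := hF0
      exact absurd (by rw [hD₁]; simp) hD₁0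
    rw [IsRoot, ← taylor_eval, eval_eq_sum_range, natDegree_taylor]
    have h1 : T.coeff 1 = D₁ := taylor_coeff_one b₀ F
    have h2 : ∀ i ∈ Finset.range (F.natDegree + 1), D₁⁻¹ * ((taylor b₀ F).coeff i * (t ^ s * z) ^ i) =
        (if i = 1 then t ^ s * z else 0) - t ^ (s + 1) * (x i * (z : Ω) ^ i) := by
      intro i _
      split_ifs with hi
      · subst hi
        change D₁⁻¹ * (T.coeff 1 * _) = _
        rw [h1, hx1 1 rfl]; field_simp; ring
      · rw [← mul_assoc (t ^ (s + 1)), hx' i hi]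
        simp only [T]; ring
    have h3 : D₁⁻¹ * ∑ i ∈ Finset.range (F.natDegree + 1), (taylor b₀ F).coeff i * (t ^ s * z) ^ i = 0 := by
      rw [Finset.mul_sum, Finset.sum_congr rfl h2, Finset.sum_sub_distrib, Finset.sum_ite_eq',
        if_pos (by simp; omega), ← Finset.mul_sum]
      linear_combination t ^ s * hz'
    exact (mul_eq_zero.1 h3).resolve_left (inv_ne_zero hD₁0)
  · rw [mul_add]
    exact R.add_mem (R.mul_mem (R.pow_mem htR _) (R.mul_mem (R.pow_mem htR _) z.2)) hb₀

end Newton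

section Laurent

open Polynomial

variable {F Λ : Type} [Field F] [Field Λ] [Algebra (PowerSeries F) Λ] [IsFractionRing (PowerSeries F) Λ]

/-- A monic polynomial over a power series ring whose reduction is separable splits. -/
lemma splits_of_separable_constantCoeff [IsAlgClosed F] {h : Polynomial (PowerSeries F)} (hm : h.Monic)
    (hs : (h.map PowerSeries.constantCoeff).Separable) :
    (h.map (algebraMap (PowerSeries F) Λ)).Splits := by
  classical
  set h₀ := h.map PowerSeries.constantCoeff with hh₀
  have key : ∀ r : h₀.roots.toFinset, ∃ a : PowerSeries F, h.IsRoot a ∧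
      PowerSeries.constantCoeff a = r.1 := by
    intro r
    have hr : h₀.IsRoot r.1 := isRoot_of_mem_roots (Multiset.mem_toFinset.1 r.2)
    have hc : ∀ g : Polynomial (PowerSeries F),
        PowerSeries.constantCoeff (g.eval (PowerSeries.C r.1)) =
        (g.map PowerSeries.constantCoeff).eval r.1 := fun g => by
      rw [eval_map, ← eval₂_hom, PowerSeries.constantCoeff_C]
    have h1 : h.eval (PowerSeries.C r.1) ∈ Ideal.span {(PowerSeries.X : PowerSeries F)} := by
      rw [Ideal.mem_span_singleton, PowerSeries.X_dvd_iff, hc]; exact hr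
    have h2 : IsUnit (h.derivative.eval (PowerSeries.C r.1)) := by
      rw [PowerSeries.isUnit_iff_constantCoeff, hc, ← derivative_map, isUnit_iff_ne_zero]
      exact hs.eval₂_derivative_ne_zero (RingHom.id F) (by simpa using hr)
    obtain ⟨a, ha, ha'⟩ := HenselianRing.is_henselian (I := Ideal.span {(PowerSeries.X : PowerSeries F)})
      h hm _ h1 (h2.map _)
    rw [Ideal.mem_span_singleton, PowerSeries.X_dvd_iff, map_sub, PowerSeries.constantCoeff_C,
      sub_eq_zero] at ha'
    exact ⟨a, ha, ha'⟩
  choose a ha ha' using key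
  have hne : h.map (algebraMap (PowerSeries F) Λ) ≠ 0 := (hm.map _).ne_zero
  rw [splits_iff_card_roots]
  refine le_antisymm (card_roots' _) ?_
  have h3 : (Finset.univ.image fun r => algebraMap (PowerSeries F) Λ (a r)) ⊆
      (h.map (algebraMap (PowerSeries F) Λ)).roots.toFinset := by
    intro z hz
    obtain ⟨r, -, rfl⟩ := Finset.mem_image.1 hz
    rw [Multiset.mem_toFinset, mem_roots hne]
    exact (ha r).map
  refine le_trans ?_ ((Finset.card_le_card h3).trans (Multiset.toFinset_card_le _))
  rw [Finset.card_image_of_injective _ fun r s hrs => Subtype.ext (by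
    rw [← ha', ← ha', IsFractionRing.injective (PowerSeries F) Λ hrs]), Finset.card_univ, Fintype.card_coe,
    Multiset.toFinset_card_of_nodup (nodup_roots hs), splits_iff_card_roots.1 (IsAlgClosed.splits h₀),
    hm.natDegree_map, hm.natDegree_map]

lemma exists_mul_X_eq_of_pow_mem {q : ℕ} {y : Λ} {g : Polynomial (PowerSeries F)} (hg : g.Monic)
    (hy : aeval (algebraMap (PowerSeries F) Λ PowerSeries.X * y) g = 0) :
    ∃ a, algebraMap (PowerSeries F) Λ a = algebraMap (PowerSeries F) Λ PowerSeries.X * y :=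
  IsIntegrallyClosed.isIntegral_iff.1 ⟨g, hg, hy⟩

lemma artinSchreier_ne {q : ℕ} (hq : 2 ≤ q) {u : F} (hu : u ≠ 0) (y : Λ) :
    y ^ q - y ≠ algebraMap (PowerSeries F) Λ (PowerSeries.C u) / algebraMap (PowerSeries F) Λ PowerSeries.X := by
  intro h
  set Z := algebraMap (PowerSeries F) Λ PowerSeries.X with hZ
  have hZ0 : Z ≠ 0 := by
    rw [hZ, Ne, map_eq_zero_iff _ (IsFractionRing.injective (PowerSeries F) Λ)]
    exact PowerSeries.X_ne_zero
  obtain ⟨l, rfl⟩ := Nat.exists_eq_add_of_le hq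
  have h1 : (Z * y) ^ (2 + l) - Z ^ (1 + l) * (Z * y) =
      Z ^ (1 + l) * algebraMap (PowerSeries F) Λ (PowerSeries.C u) := by
    have h' : (y ^ (2 + l) - y) * Z = algebraMap (PowerSeries F) Λ (PowerSeries.C u) := by
      rw [h, div_mul_cancel₀ _ hZ0]
    rw [← h']; ring
  obtain ⟨a, ha⟩ := exists_mul_X_eq_of_pow_mem (q := 0) (F := F) (Λ := Λ) (y := y)
    (g := X ^ (2 + l) - (C ((PowerSeries.X : PowerSeries F) ^ (1 + l)) * X + C (PowerSeries.X ^ (1 + l) * PowerSeries.C u)))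
    (monic_X_pow_sub (by
      refine lt_of_le_of_lt degree_linear_le ?_
      exact_mod_cast (by omega : 1 < 2 + l))) (by
      simp only [map_sub, map_pow, map_add, map_mul, aeval_X, aeval_C, ← hZ]
      linear_combination h1)
  rw [← hZ] at ha
  have h2 : a ^ (2 + l) = PowerSeries.X ^ (1 + l) * (a + PowerSeries.C u) := by
    apply IsFractionRing.injective (PowerSeries F) Λ
    rw [map_pow, map_mul, map_add, map_pow, ha, ← hZ]
    linear_combination h1
  obtain ⟨b, rfl⟩ := PowerSeries.X_prime.dvd_of_dvd_pow
    (show PowerSeries.X ∣ a ^ (2 + l) from h2 ▸ Dvd.intro _ (by rw [pow_add, pow_one, mul_assoc]))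
  have h3 : PowerSeries.X * b ^ (2 + l) = PowerSeries.X * b + PowerSeries.C u :=
    mul_left_cancel₀ (pow_ne_zero (1 + l) (PowerSeries.X_ne_zero (R := F)))
      (by rw [← h2]; ring)
  have h4 := congrArg PowerSeries.constantCoeff h3
  simp at h4
  exact hu h4.symm

lemma kummer_ne {q : ℕ} (hq : 2 ≤ q) {u : F} (hu : u ≠ 0) (y : Λ) :
    y ^ q ≠ 1 + algebraMap (PowerSeries F) Λ (PowerSeries.C u) / algebraMap (PowerSeries F) Λ PowerSeries.X := by
  intro h
  set Z := algebraMap (PowerSeries F) Λ PowerSeries.X with hZ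
  have hZ0 : Z ≠ 0 := by
    rw [hZ, Ne, map_eq_zero_iff _ (IsFractionRing.injective (PowerSeries F) Λ)]
    exact PowerSeries.X_ne_zero
  obtain ⟨l, rfl⟩ := Nat.exists_eq_add_of_le hq
  have h1 : (Z * y) ^ (2 + l) =
      Z ^ (1 + l) * (Z + algebraMap (PowerSeries F) Λ (PowerSeries.C u)) := by
    have h' : y ^ (2 + l) * Z = Z + algebraMap (PowerSeries F) Λ (PowerSeries.C u) := by
      rw [h, add_mul, div_mul_cancel₀ _ hZ0, one_mul]
    rw [← h']; ring
  obtain ⟨a, ha⟩ := exists_mul_X_eq_of_pow_mem (q := 0) (F := F) (Λ := Λ) (y := y)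
    (g := X ^ (2 + l) - C (PowerSeries.X ^ (1 + l) * (PowerSeries.X + PowerSeries.C u)))
    (monic_X_pow_sub_C _ (by omega)) (by
      simp only [map_sub, map_pow, map_add, map_mul, aeval_X, aeval_C, ← hZ]
      linear_combination h1)
  rw [← hZ] at ha
  have h2 : a ^ (2 + l) = PowerSeries.X ^ (1 + l) * (PowerSeries.X + PowerSeries.C u) := by
    apply IsFractionRing.injective (PowerSeries F) Λ
    rw [map_pow, map_mul, map_add, map_pow, ha, ← hZ]
    linear_combination h1
  obtain ⟨b, rfl⟩ := PowerSeries.X_prime.dvd_of_dvd_pow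
    (show PowerSeries.X ∣ a ^ (2 + l) from h2 ▸ Dvd.intro _ (by rw [pow_add, pow_one, mul_assoc]))
  have h3 : PowerSeries.X * b ^ (2 + l) = PowerSeries.X + PowerSeries.C u :=
    mul_left_cancel₀ (pow_ne_zero (1 + l) (PowerSeries.X_ne_zero (R := F)))
      (by rw [← h2]; ring)
  have h4 := congrArg PowerSeries.constantCoeff h3
  simp at h4
  exact hu h4.symm

end Laurent

section Family

open Polynomial

/-- A field-theoretic criterion for independence of roots. -/
lemma notMem_adjoin_of_splits {E Ω Λ : Type} [Field E] [Field Ω] [Field Λ] [Algebra E Ω] (τ : E →+* Λ)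
    {g g' : Polynomial E} (hg' : g'.Monic) {y y' : Ω} (hy : aeval y g = 0) (hy' : aeval y' g' = 0)
    (hs : (g'.map τ).Splits) (hr : ∀ z, (g.map τ).eval z ≠ 0) :
    y ∉ IntermediateField.adjoin E {y'} := by
  intro hmem
  letI : Algebra E Λ := τ.toAlgebra
  have h_integral : IsIntegral E y' := ⟨g', hg', hy'⟩
  obtain ⟨φ⟩ := IntermediateField.nonempty_algHom_adjoin_of_splits (F := E) (K := Λ) (S := {y'})
    (fun s hs' => by
      rw [Set.mem_singleton_iff.1 hs']
      exact ⟨h_integral, hs.of_dvd (hg'.map _).ne_zero (map_dvd τ (minpoly.dvd E y' hy'))⟩)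
  refine hr (φ ⟨y, hmem⟩) ?_
  rw [eval_map]
  have h1 : aeval (⟨y, hmem⟩ : IntermediateField.adjoin E {y'}) g = 0 := Subtype.ext (by
    refine Eq.trans ?_ hy
    exact (aeval_algHom_apply (IntermediateField.adjoin E {y'}).val _ g).symm)
  have h2 := aeval_algHom_apply φ ⟨y, hmem⟩ g
  rw [h1, map_zero] at h2
  exact h2

variable {k : Type} [Field k]

lemma lexRing₁_inf_lexRing₂_zero : lexRing₁ k ⊓ lexRing₂ k 0 = lexRing₁ k := by
  refine inf_eq_left.2 fun x hx => ?_
  refine mem_suppRing.2 fun n i h => ?_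
  have := mem_cone₁.1 (mem_suppRing.1 hx n i h)
  exact mem_cone₂.2 ⟨this.1, by simpa using this.1⟩

lemma substHom_injective {a : PowerSeries k} {θ : PowerSeries (PowerSeries k) →+* PowerSeries (PowerSeries k)}
    (h0 : PowerSeries.constantCoeff a = 0)
    (hC : ∀ o, θ (PowerSeries.C o) = PowerSeries.C o)
    (hX : θ PowerSeries.X = PowerSeries.X + PowerSeries.C a) : Function.Injective θ := by
  obtain ⟨θ', hC', hX'⟩ := exists_substHom (PowerSeries.X - PowerSeries.C a) (by simp [h0])
  suffices h : ∀ b, θ' (θ b) = b from Function.LeftInverse.injective h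
  intro b
  have hp : ∀ p : Polynomial (PowerSeries k), θ' (θ (p : PowerSeries (PowerSeries k))) = p := by
    intro p
    induction p using Polynomial.induction_on' with
    | add p q hp hq => rw [Polynomial.coe_add, map_add, map_add, hp, hq]
    | monomial n o =>
      rw [← C_mul_X_pow_eq_monomial, Polynomial.coe_mul, Polynomial.coe_pow, Polynomial.coe_C,
        Polynomial.coe_X, map_mul, map_pow, hC, hX, map_mul, map_pow, hC', map_add, hX', hC',
        sub_add_cancel]
  ext1 n
  have h1 : (PowerSeries.X : PowerSeries (PowerSeries k)) ^ (n + 1) ∣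
      b - (PowerSeries.trunc (n + 1) b : PowerSeries (PowerSeries k)) := by
    rw [PowerSeries.X_pow_dvd_iff]
    intro l hl
    rw [map_sub, Polynomial.coeff_coe, PowerSeries.coeff_trunc, if_pos hl, sub_self]
  obtain ⟨c, hc⟩ := h1
  have h2 : θ' (θ b) - b = PowerSeries.X ^ (n + 1) * (θ' (θ c) - c) := by
    rw [sub_eq_iff_eq_add'] at hc
    conv_lhs => rw [hc]
    rw [map_add, map_add, hp, map_mul, map_pow, map_mul, map_pow, hX, map_add, hX', hC',
      sub_add_cancel]
    ring
  have h3 := (PowerSeries.X_pow_dvd_iff.1 (Dvd.intro _ h2.symm)) n n.lt_succ_self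
  rwa [map_sub, sub_eq_zero] at h3

/-- The element `t² / (v - t³c)`. -/
noncomputable def lexRho (c : PowerSeries k) : LexField k :=
  lexBase k (PowerSeries.X ^ 2) / (lexMono k 0 1 - lexBase k (PowerSeries.X ^ 3 * c))

lemma lexBase_mem_lexRing₁ (o : PowerSeries k) : lexBase k o ∈ lexRing₁ k := (lexBase_mem 0 o).1

lemma lexMono_zero_one_mem : lexMono k 0 1 ∈ lexRing₁ k := by
  have := (lexMono_mem_inf (k := k) 0).1
  simpa using this

lemma lexRho_mem (c : PowerSeries k) : lexRho c ∈ lexFrac₁ k :=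
  Subfield.div_mem _ (Subfield.subset_closure (lexBase_mem_lexRing₁ _))
    (Subfield.subset_closure (Subring.sub_mem _ lexMono_zero_one_mem (lexBase_mem_lexRing₁ _)))

lemma exists_lexRho_eq (c : PowerSeries k) :
    ∃ r ∈ lexRing₀ k, lexRho c = lexMono k 1 0 ^ 2 * r := by
  have hp := lex_patchRings k 0
  have hv : lexMono k 0 (-1) ∈ lexRing₀ k := lexMono_mem (by exact mem_cone₀.2 le_rfl)
  have ht : lexMono k 1 0 ∈ lexRing₀ k := hp.complete₀.mem
  let b := lexMono k 0 (-1) * lexMono k 1 0 ^ 2 * lexBase k c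
  have hb : b ∈ lexRing₀ k := Subring.mul_mem _ (Subring.mul_mem _ hv (Subring.pow_mem _ ht 2))
    (hp.le₁ (lexBase_mem_lexRing₁ c))
  have hvv : lexMono k 0 1 * lexMono k 0 (-1) = 1 := by rw [lexMono_mul]; simp [lexMono_zero]
  refine ⟨lexMono k 0 (-1) * (1 - lexMono k 1 0 * b)⁻¹, Subring.mul_mem _ hv (hp.complete₀.inv_mem hb), ?_⟩
  have h1 := hp.complete₀.one_sub_ne_zero hb
  have h2 : lexMono k 0 1 - lexBase k (PowerSeries.X ^ 3 * c) =
      lexMono k 0 1 * (1 - lexMono k 1 0 * b) := by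
    simp only [b, map_mul, map_pow, lexBase_X]
    linear_combination lexMono k 1 0 ^ 3 * lexBase k c * hvv
  rw [lexRho, h2, map_pow, lexBase_X, div_eq_iff (mul_ne_zero (lexMono_ne_zero _ _) h1)]
  field_simp
  linear_combination -lexMono k 1 0 ^ 2 * hvv

/-- Expansion of the fraction field of `k⟦t, v⟧` around `v = t³c`. -/
theorem exists_expansion (F : Type) [Field F] [Algebra (PowerSeries k) F] [FaithfulSMul (PowerSeries k) F]
    (Λ : Type) [Field Λ] [Algebra (PowerSeries F) Λ] [IsFractionRing (PowerSeries F) Λ] (c : PowerSeries k) :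
    ∃ τ : lexFrac₁ k →+* Λ, ∀ c', τ ⟨lexRho c', lexRho_mem c'⟩ =
      algebraMap (PowerSeries F) Λ (PowerSeries.C (algebraMap (PowerSeries k) F (PowerSeries.X ^ 2))) /
      algebraMap (PowerSeries F) Λ (PowerSeries.X + PowerSeries.C (algebraMap (PowerSeries k) F
        (PowerSeries.X ^ 3 * (c - c')))) := by
  obtain ⟨θ, hC, hX⟩ := exists_substHom (k := k) (PowerSeries.X + PowerSeries.C (PowerSeries.X ^ 3 * c))
    (by simp)
  have hθ := substHom_injective (by simp) hC hX
  let e : MvPowerSeries (Fin 2) k ≃+* lexRing₁ k :=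
    (RingEquiv.ofBijective (lexHom k 0).rangeRestrict
      ⟨fun a b h => lexHom_injective 0 (congrArg Subtype.val h), (lexHom k 0).rangeRestrict_surjective⟩).trans
      (RingEquiv.subringCongr ((lexHom_range 0).trans lexRing₁_inf_lexRing₂_zero))
  have he : ∀ a, (e a : LexField k) = lexHom k 0 a := fun _ => rfl
  let φ : lexRing₁ k →+* PowerSeries F := (PowerSeries.map (algebraMap (PowerSeries k) F)).comp
    (θ.comp ((iterEquiv k).toRingHom.comp e.symm.toRingHom))
  have hφ : Function.Injective φ :=
    (PowerSeries.map_injective _ (FaithfulSMul.algebraMap_injective _ _)).comp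
      (hθ.comp ((iterEquiv k).injective.comp e.symm.injective))
  have hφC : ∀ o, φ ⟨lexBase k o, lexBase_mem_lexRing₁ o⟩ = PowerSeries.C (algebraMap _ F o) := by
    intro o
    have : e ((iterEquiv k).symm (PowerSeries.C o)) = ⟨lexBase k o, lexBase_mem_lexRing₁ o⟩ :=
      Subtype.ext ((he _).trans (lexHom_C 0 o))
    rw [← this]
    simp [φ, hC]
  have hφv : φ ⟨lexMono k 0 1, lexMono_zero_one_mem⟩ = PowerSeries.X +
      PowerSeries.C (algebraMap (PowerSeries k) F (PowerSeries.X ^ 3 * c)) := by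
    have : e (MvPowerSeries.X 0) = ⟨lexMono k 0 1, lexMono_zero_one_mem⟩ :=
      Subtype.ext ((he _).trans (by rw [lexHom_X_zero]; simp))
    rw [← this]
    simp only [φ, RingHom.comp_apply, RingEquiv.toRingHom_eq_coe, RingHom.coe_coe,
      RingEquiv.symm_apply_apply, iterEquiv_X_zero, hX, map_add, PowerSeries.map_X, PowerSeries.map_C]
  letI : Algebra (lexRing₁ k) (lexFrac₁ k) :=
    (Subring.inclusion (T := (lexFrac₁ k).toSubring) fun x hx => Subfield.subset_closure hx).toAlgebra
  have halg : ∀ x : lexRing₁ k, (algebraMap (lexRing₁ k) (lexFrac₁ k) x : LexField k) = x := fun _ => rfl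
  haveI : FaithfulSMul (lexRing₁ k) (lexFrac₁ k) := (faithfulSMul_iff_algebraMap_injective _ _).2
    fun x y h => Subtype.ext (congrArg (Subtype.val : lexFrac₁ k → LexField k) h)
  haveI : IsFractionRing (lexRing₁ k) (lexFrac₁ k) := IsFractionRing.of_field _ _ fun z => by
    obtain ⟨a, ha, b, hb, -, h⟩ := mem_closure_subring_iff.1 z.2
    exact ⟨⟨a, ha⟩, ⟨b, hb⟩, Subtype.ext h⟩
  let τ : lexFrac₁ k →+* Λ := IsFractionRing.lift (A := lexRing₁ k)
    (g := (algebraMap (PowerSeries F) Λ).comp φ) ((IsFractionRing.injective _ _).comp hφ)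
  have hτ : ∀ x : lexRing₁ k, τ (algebraMap _ _ x) = algebraMap (PowerSeries F) Λ (φ x) :=
    fun x => IsFractionRing.lift_algebraMap _ _
  refine ⟨τ, fun c' => ?_⟩
  have h1 : (⟨lexRho c', lexRho_mem c'⟩ : lexFrac₁ k) =
      algebraMap _ _ (⟨_, lexBase_mem_lexRing₁ (PowerSeries.X ^ 2)⟩ : lexRing₁ k) /
      algebraMap _ _ ((⟨_, lexMono_zero_one_mem⟩ : lexRing₁ k) -
        ⟨_, lexBase_mem_lexRing₁ (PowerSeries.X ^ 3 * c')⟩) := rfl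
  rw [h1, map_div₀, hτ, hτ, map_sub, hφC, hφC, hφv, add_sub_assoc, ← map_sub, ← map_sub, ← mul_sub]

end Family

section Family

open Polynomial

lemma monic_X_pow_sub_X_sub_C {R : Type} [CommRing R] [Nontrivial R] {q : ℕ} (hq : 2 ≤ q) (r : R) :
    (X ^ q - X - C r : Polynomial R).Monic := by
  rw [sub_sub]
  refine monic_X_pow_sub ?_
  rw [← one_mul X, ← C_1]
  refine lt_of_le_of_lt degree_linear_le ?_
  exact_mod_cast (by omega : 1 < q)

lemma separable_X_pow_sub_X_sub_C {F : Type} [Field F] {q : ℕ} (hq : (q : F) = 0) (r : F) :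
    (X ^ q - X - C r : Polynomial F).Separable := by
  rw [separable_def]
  have : derivative (X ^ q - X - C r : Polynomial F) = -1 := by
    simp [derivative_X_pow, hq]
  rw [this]
  exact isCoprime_one_right.neg_right

variable {k : Type} [Field k]

/-- The element `t² / (v - t³c)` of the fraction field of `k⟦t, v⟧`. -/
noncomputable def fracRho (c : PowerSeries k) : lexFrac₁ k := ⟨lexRho c, lexRho_mem c⟩

/-- Data separating `c` from `c'`. -/
lemma exists_expansion_pair {c c' : PowerSeries k} (hc : c ≠ c') :
    ∃ (F : Type) (_ : Field F) (_ : IsAlgClosed F) (_ : Algebra k F) (u : F) (r : PowerSeries F)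
      (τ : lexFrac₁ k →+* FractionRing (PowerSeries F)), u ≠ 0 ∧
      1 + PowerSeries.constantCoeff r ≠ 0 ∧
      τ (fracRho c) = algebraMap (PowerSeries F) _ (PowerSeries.C u) /
        algebraMap (PowerSeries F) _ PowerSeries.X ∧
      τ (fracRho c') = algebraMap (PowerSeries F) _ r := by
  let F := AlgebraicClosure (FractionRing (PowerSeries k))
  have hinj : Function.Injective (algebraMap (PowerSeries k) F) := by
    rw [IsScalarTower.algebraMap_eq (PowerSeries k) (FractionRing (PowerSeries k)) F]
    exact (algebraMap (FractionRing (PowerSeries k)) F).injective.comp (IsFractionRing.injective _ _)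
  haveI : FaithfulSMul (PowerSeries k) F := (faithfulSMul_iff_algebraMap_injective _ _).2 hinj
  letI : Algebra k F := ((algebraMap (PowerSeries k) F).comp PowerSeries.C).toAlgebra
  obtain ⟨τ, hτ⟩ := exists_expansion F (FractionRing (PowerSeries F)) c
  have hne : ∀ a : PowerSeries k, a ≠ 0 → algebraMap _ F a ≠ 0 := fun a ha => by
    rwa [Ne, map_eq_zero_iff _ hinj]
  let d := algebraMap (PowerSeries k) F (PowerSeries.X ^ 3 * (c - c'))
  have hd : d ≠ 0 := hne _ (mul_ne_zero (pow_ne_zero _ PowerSeries.X_ne_zero) (sub_ne_zero.2 hc))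
  let u := algebraMap (PowerSeries k) F (PowerSeries.X ^ 2)
  have hu : u ≠ 0 := hne _ (pow_ne_zero _ PowerSeries.X_ne_zero)
  have hunit : IsUnit (PowerSeries.X + PowerSeries.C d) := by
    rw [PowerSeries.isUnit_iff_constantCoeff, map_add, PowerSeries.constantCoeff_X,
      PowerSeries.constantCoeff_C, zero_add]
    exact isUnit_iff_ne_zero.2 hd
  obtain ⟨w, hw⟩ := hunit.exists_right_inv
  refine ⟨F, inferInstance, inferInstance, inferInstance, u, PowerSeries.C u * w, τ, hu, ?_, ?_, ?_⟩
  · have h1 := congrArg PowerSeries.constantCoeff hw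
    simp only [map_mul, map_add, PowerSeries.constantCoeff_X, PowerSeries.constantCoeff_C, zero_add,
      map_one] at h1 ⊢
    intro h
    have h2 : d + u = 0 := by linear_combination d * h - u * h1
    have h3 : d + u = algebraMap (PowerSeries k) F
        (PowerSeries.X ^ 2 * (1 + PowerSeries.X * (c - c'))) := by
      simp only [d, u, ← map_add]; congr 1; ring
    refine hne _ (mul_ne_zero (pow_ne_zero _ PowerSeries.X_ne_zero) fun h4 => ?_) (h3.symm.trans h2)
    have h5 := congrArg PowerSeries.constantCoeff h4
    simp at h5
  · refine (hτ c).trans ?_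
    simp [u]
  · refine (hτ c').trans ?_
    have h0 : algebraMap (PowerSeries F) (FractionRing (PowerSeries F))
        (PowerSeries.X + PowerSeries.C d) ≠ 0 := by
      rw [Ne, map_eq_zero_iff _ (IsFractionRing.injective (PowerSeries F) (FractionRing (PowerSeries F)))]
      exact hunit.ne_zero
    rw [div_eq_iff h0, ← map_mul]
    congr 1
    linear_combination -PowerSeries.C u * hw

variable {Ω : Type} [Field Ω] [Algebra (lexFrac₁ k) Ω]

lemma natCast_eq_zero_lexFrac₁ {q : ℕ} (hq : (q : k) = 0) : (q : lexFrac₁ k) = 0 := by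
  have h := map_natCast ((lexBase k).comp PowerSeries.C) q
  rw [hq, map_zero] at h
  exact Subtype.ext h.symm

lemma natCast_ne_zero_lexFrac₁ {q : ℕ} (hq : (q : k) ≠ 0) : (q : lexFrac₁ k) ≠ 0 := by
  intro h
  have h1 := map_natCast ((lexBase k).comp PowerSeries.C) q
  have h2 : (q : LexField k) = 0 := congrArg (Subtype.val : lexFrac₁ k → LexField k) h
  rw [h2] at h1
  exact hq ((map_eq_zero _).1 h1)

lemma artinSchreier_notMem {q : ℕ} (hq : 2 ≤ q) (hqk : (q : k) = 0) {c c' : PowerSeries k} (hc : c ≠ c')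
    {y y' : Ω} (hy : y ^ q - y = algebraMap (lexFrac₁ k) Ω (fracRho c))
    (hy' : y' ^ q - y' = algebraMap (lexFrac₁ k) Ω (fracRho c')) :
    y ∉ IntermediateField.adjoin (lexFrac₁ k) {y'} := by
  obtain ⟨F, _, _, _, u, r, τ, hu, -, h1, h2⟩ := exists_expansion_pair hc
  refine notMem_adjoin_of_splits (g := X ^ q - X - C (fracRho c)) (g' := X ^ q - X - C (fracRho c')) τ
    (monic_X_pow_sub_X_sub_C hq _) (by simp [hy]) (by simp [hy']) ?_ fun z hz => ?_
  · have h3 : (X ^ q - X - C (fracRho c')).map τ = (X ^ q - X - C r).map (algebraMap (PowerSeries F) _) := by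
      simp [h2]
    rw [h3]
    refine splits_of_separable_constantCoeff (monic_X_pow_sub_X_sub_C hq _) ?_
    have h4 : (X ^ q - X - C r).map PowerSeries.constantCoeff =
      (X ^ q - X - C (PowerSeries.constantCoeff r) : Polynomial F) := by simp
    rw [h4]
    refine separable_X_pow_sub_X_sub_C ?_ _
    rw [← map_natCast (algebraMap k F), hqk, map_zero]
  · simp only [Polynomial.map_sub, Polynomial.map_pow, map_X, map_C, h1, eval_sub, eval_pow, eval_X,
      eval_C, sub_eq_zero] at hz
    exact artinSchreier_ne hq hu z hz

lemma kummer_notMem {q : ℕ} (hq : 2 ≤ q) (hqk : (q : k) ≠ 0) {c c' : PowerSeries k} (hc : c ≠ c')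
    {y y' : Ω} (hy : y ^ q = 1 + algebraMap (lexFrac₁ k) Ω (fracRho c))
    (hy' : y' ^ q = 1 + algebraMap (lexFrac₁ k) Ω (fracRho c')) :
    y ∉ IntermediateField.adjoin (lexFrac₁ k) {y'} := by
  obtain ⟨F, _, _, _, u, r, τ, hu, hr, h1, h2⟩ := exists_expansion_pair hc
  refine notMem_adjoin_of_splits (g := X ^ q - C (1 + fracRho c)) (g' := X ^ q - C (1 + fracRho c')) τ
    (monic_X_pow_sub_C _ (by omega)) (by simp [hy]) (by simp [hy']) ?_ fun z hz => ?_
  · have h3 : (X ^ q - C (1 + fracRho c')).map τ = (X ^ q - C (1 + r)).map (algebraMap (PowerSeries F) _) := by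
      simp [h2]
    rw [h3]
    refine splits_of_separable_constantCoeff (monic_X_pow_sub_C _ (by omega)) ?_
    have h4 : (X ^ q - C (1 + r)).map PowerSeries.constantCoeff =
      (X ^ q - C (1 + PowerSeries.constantCoeff r) : Polynomial F) := by simp
    rw [h4]
    refine separable_X_pow_sub_C _ ?_ hr
    rwa [← map_natCast (algebraMap k F), Ne, map_eq_zero]
  · simp only [Polynomial.map_sub, Polynomial.map_pow, map_X, map_C, map_add, map_one, h1, eval_sub,
      eval_pow, eval_X, eval_C, eval_add, eval_one, sub_eq_zero, Polynomial.map_add, Polynomial.map_one] at hz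
    exact kummer_ne hq hu z hz

end Family

section Finite

open Polynomial

/-- A finite extension contains only finitely many members of a family of independent
separable elements. -/
theorem finite_setOf_mem_of_notMem_adjoin {E Ω I : Type} [Field E] [Field Ω] [Algebra E Ω] (y : I → Ω)
    (hs : ∀ c, IsSeparable E (y c))
    (hy : ∀ c c', c ≠ c' → y c ∉ IntermediateField.adjoin E {y c'})
    (J : IntermediateField E Ω) [FiniteDimensional E J] : {c | y c ∈ J}.Finite := by
  let J₀ : IntermediateField E Ω := IntermediateField.adjoin E (y '' {c | y c ∈ J})
  have hle : J₀ ≤ J := IntermediateField.adjoin_le_iff.2 (by rintro _ ⟨c, hc, rfl⟩; exact hc)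
  haveI : FiniteDimensional E J₀ := Module.Finite.of_injective (IntermediateField.inclusion hle).toLinearMap
    (IntermediateField.inclusion hle).injective
  haveI : Algebra.IsSeparable E J₀ := IntermediateField.isSeparable_adjoin_iff_isSeparable _ _ |>.2 (by
    rintro _ ⟨c, -, rfl⟩; exact hs c)
  haveI : Finite (IntermediateField E J₀) := Field.finite_intermediateField_of_exists_primitive_element E J₀
    (Field.exists_primitive_element E J₀)
  have hmem : ∀ c : {c | y c ∈ J}, y c ∈ J₀ := fun c =>
    IntermediateField.subset_adjoin _ _ ⟨c, c.2, rfl⟩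
  rw [← Set.finite_coe_iff]
  refine Finite.of_injective (β := IntermediateField E J₀)
    (fun c : {c | y c ∈ J} => IntermediateField.adjoin E {(⟨y c, hmem c⟩ : J₀)}) fun c c' h => ?_
  by_contra hne
  refine hy c c' (fun h => hne (Subtype.ext h)) ?_
  have h1 : (⟨y c, hmem c⟩ : J₀) ∈ IntermediateField.adjoin E {(⟨y c', hmem c'⟩ : J₀)} := by
    have h' := h
    dsimp only at h'
    rw [← h']; exact IntermediateField.mem_adjoin_simple_self E _
  have h2 : y c ∈ (IntermediateField.adjoin E {(⟨y c', hmem c'⟩ : J₀)}).map J₀.val := ⟨_, h1, rfl⟩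
  rwa [IntermediateField.adjoin_map, Set.image_singleton] at h2

end Finite

section Cyclic

open Polynomial IntermediateField

/-- In a cyclic extension of prime power degree, an element fixed by all `q`-th powers of
automorphisms lies in every nontrivial intermediate field. -/
lemma mem_of_ne_bot_of_pow_fixed {K T : Type} [Field K] [Field T] [Algebra K T] [IsGalois K T]
    [FiniteDimensional K T] {q n : ℕ} (hq : q.Prime) (hc : IsCyclic (T ≃ₐ[K] T))
    (hn : Nat.card (T ≃ₐ[K] T) = q ^ n) {y : T} (hy : ∀ σ : T ≃ₐ[K] T, (σ ^ q) y = y)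
    {J : IntermediateField K T} (hJ : J ≠ ⊥) : y ∈ J := by
  obtain ⟨g, hg⟩ := hc.exists_generator
  have hgc : orderOf g = q ^ n := by rw [orderOf_eq_card_of_forall_mem_zpowers hg, hn]
  rw [← IsGalois.fixedField_fixingSubgroup J]
  rintro ⟨σ, hσ⟩
  obtain ⟨i, hi⟩ := Submonoid.mem_powers_iff _ _ |>.1 (mem_powers_iff_mem_zpowers.2 (hg σ))
  rw [show (⟨σ, hσ⟩ : J.fixingSubgroup) • y = σ y from rfl]
  by_cases hqi : q ∣ i
  · obtain ⟨l, rfl⟩ := hqi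
    rw [← hi, mul_comm, pow_mul]
    exact hy _
  · exfalso
    apply hJ
    have hcop : Nat.Coprime (orderOf g) i := by
      rw [hgc]
      exact Nat.Coprime.pow_left _ ((Nat.Prime.coprime_iff_not_dvd hq).2 hqi)
    have htop : J.fixingSubgroup = ⊤ := by
      rw [eq_top_iff]
      have h1 : g ∈ Subgroup.zpowers σ := by
        obtain ⟨m, hm⟩ := exists_pow_eq_self_of_coprime hcop.symm
        have hm' : σ ^ m = g := by rw [← hi]; exact hm
        exact hm' ▸ Subgroup.pow_mem _ (Subgroup.mem_zpowers σ) m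
      intro τ _
      obtain ⟨z, rfl⟩ := hg τ
      have h2 : Subgroup.zpowers σ ≤ J.fixingSubgroup := Subgroup.zpowers_le.2 hσ
      exact Subgroup.zpow_mem _ (h2 h1) z
    rw [← IsGalois.fixedField_fixingSubgroup J, htop, IsGalois.fixedField_top]

lemma isGalois_of_orderOf {K T : Type} [Field K] [Field T] [Algebra K T]
    [FiniteDimensional K T] {n : ℕ} (σ : T ≃ₐ[K] T) (hσ : orderOf σ = n)
    (hT : Module.finrank K T ≤ n) :
    IsGalois K T ∧ IsCyclic (T ≃ₐ[K] T) ∧ Nat.card (T ≃ₐ[K] T) = n := by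
  have h1 : orderOf σ ≤ Nat.card (T ≃ₐ[K] T) := orderOf_le_card
  have h2 : Nat.card (T ≃ₐ[K] T) ≤ Module.finrank K T := by
    rw [Nat.card_eq_fintype_card]
    exact AlgEquiv.card_le
  have h3 : Nat.card (T ≃ₐ[K] T) = n := by omega
  exact ⟨IsGalois.of_card_aut_eq_finrank K T (by omega),
    isCyclic_of_orderOf_eq_card σ (by omega), h3⟩

lemma exists_algEquiv_of_mem_fieldRange {K T N : Type} [Field K] [Field T] [Field N] [Algebra K T]
    [Algebra K N] [FiniteDimensional K T] (ι φ : T →ₐ[K] N) (h : ∀ x, φ x ∈ ι.fieldRange) :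
    ∃ σ : T ≃ₐ[K] T, ∀ x, ι (σ x) = φ x := by
  let e := AlgEquiv.ofInjectiveField ι
  let ψ : T →ₐ[K] T := e.symm.toAlgHom.comp
    (φ.codRestrict ι.fieldRange.toSubalgebra h : T →ₐ[K] ι.fieldRange)
  refine ⟨AlgEquiv.ofBijective ψ (Algebra.IsAlgebraic.algHom_bijective ψ), fun x => ?_⟩
  exact congrArg Subtype.val (e.apply_symm_apply ⟨φ x, h x⟩)

lemma exists_ringHom_extend {S T N : Type} [Field S] [Field T] [Field N] [IsAlgClosed N]
    [Algebra S T] [Algebra.IsAlgebraic S T] (f : S →+* N) :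
    ∃ g : T →+* N, ∀ s, g (algebraMap S T s) = f s := by
  letI := f.toAlgebra
  exact ⟨(IsAlgClosed.lift : T →ₐ[S] N).toRingHom, fun s => AlgHom.commutes _ s⟩

/-- Data of a cyclic extension of prime power degree whose minimal layer contains `y`. -/
structure IsCyclicTower (K T : Type) [Field K] [Field T] [Algebra K T] (q n : ℕ) (y : T) :
    Prop where
  isGalois : IsGalois K T
  finite : FiniteDimensional K T
  isCyclic : IsCyclic (T ≃ₐ[K] T)
  card : Nat.card (T ≃ₐ[K] T) = n
  fixed : ∀ σ : T ≃ₐ[K] T, (σ ^ q) y = y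

lemma IsCyclicTower.mem {K Ω : Type} [Field K] [Field Ω] [Algebra K Ω] {S : IntermediateField K Ω}
    {q n : ℕ} {y : S} (h : IsCyclicTower K S q (q ^ n) y) (hq : q.Prime)
    {J : IntermediateField K Ω} (hJS : J ≤ S) (hJ : J ≠ ⊥) : (y : Ω) ∈ J := by
  haveI := h.isGalois
  haveI := h.finite
  have := mem_of_ne_bot_of_pow_fixed hq h.isCyclic h.card h.fixed (J := IntermediateField.restrict hJS)
    (by
      intro hb
      apply hJ
      rw [← lift_restrict hJS, hb, lift_bot])
  rwa [mem_restrict] at this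

lemma pow_apply_of_apply_mul {K T : Type} [Field K] [Field T] [Algebra K T] (σ : T ≃ₐ[K] T) {w : T}
    {c : K} (h : σ w = algebraMap K T c * w) (j : ℕ) : (σ ^ j) w = algebraMap K T (c ^ j) * w := by
  induction j with
  | zero => simp
  | succ j ih =>
    rw [pow_succ', AlgEquiv.mul_apply, ih, map_mul, AlgEquiv.commutes, h, pow_succ, map_mul]
    ring

lemma pow_apply_of_apply_add {K T : Type} [Field K] [Field T] [Algebra K T] (σ : T ≃ₐ[K] T) {w : T}
    {c : K} (h : σ w = w + algebraMap K T c) (j : ℕ) : (σ ^ j) w = w + algebraMap K T (j * c) := by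
  induction j with
  | zero => simp
  | succ j ih =>
    rw [pow_succ', AlgEquiv.mul_apply, ih, map_add, AlgEquiv.commutes, h]
    push_cast
    simp only [add_mul, one_mul, map_add]
    ring

lemma isSplittingField_of_root {K T : Type} [Field K] [Field T] [Algebra K T] {F : Polynomial K}
    (hF : F.Monic) (hs : (F.map (algebraMap K T)).Splits) {w : T} (hw : aeval w F = 0)
    (hwT : K⟮w⟯ = ⊤) : IsSplittingField K T F := by
  refine ⟨hs, ?_⟩
  have h_integral : IsIntegral K w := ⟨F, hF, by simpa [aeval_def] using hw⟩
  have h : Algebra.adjoin K {w} = ⊤ := by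
    rw [← adjoin_simple_toSubalgebra_of_isAlgebraic h_integral.isAlgebraic, hwT, top_toSubalgebra]
  rw [eq_top_iff, ← h]
  refine Algebra.adjoin_mono ?_
  rw [Set.singleton_subset_iff, mem_rootSet]
  exact ⟨hF.ne_zero, hw⟩

/-- Kummer extensions. -/
lemma isCyclicTower_kummer {K T : Type} [Field K] [Field T] [Algebra K T] {q e : ℕ} (hq : q.Prime)
    {ζ : K} (hζ : IsPrimitiveRoot ζ (q ^ (e + 1))) {w : T} {a : K}
    (hw : w ^ (q ^ (e + 1)) = algebraMap K T a) (hwT : K⟮w⟯ = ⊤)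
    (hy : w ^ (q ^ e) ∉ Set.range (algebraMap K T)) (hqK : (q : K) ≠ 0) :
    IsCyclicTower K T q (q ^ (e + 1)) (w ^ (q ^ e)) := by
  have hpos : 0 < q ^ (e + 1) := pow_pos hq.pos _
  have hnz : ((q ^ (e + 1) : ℕ) : K) ≠ 0 := by push_cast; exact pow_ne_zero _ hqK
  have hqe : q ^ e * q = q ^ (e + 1) := (pow_succ _ _).symm
  have hord' : ∀ σ : T ≃ₐ[K] T, ¬ σ ^ q ^ e = 1 → σ ^ q ^ (e + 1) = 1 → orderOf σ = q ^ (e + 1) := by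
    intro σ h h'
    haveI : Fact q.Prime := ⟨hq⟩
    exact orderOf_eq_prime_pow h h'
  generalize q ^ (e + 1) = n at *
  have hw0 : w ≠ 0 := by
    rintro rfl
    apply hy
    exact ⟨0, by rw [map_zero, zero_pow (pow_pos hq.pos _).ne']⟩
  have hmonic : (X ^ n - C a : Polynomial K).Monic := monic_X_pow_sub_C a hpos.ne'
  have hroot : aeval w (X ^ n - C a : Polynomial K) = 0 := by simp [hw]
  have h_integral : IsIntegral K w := ⟨_, hmonic, by simpa [aeval_def] using hroot⟩
  haveI hfd : FiniteDimensional K T := by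
    have := adjoin.finiteDimensional h_integral
    rw [hwT] at this
    exact (topEquiv (F := K) (E := T)).toLinearEquiv.finiteDimensional
  have hfin : Module.finrank K T ≤ n := by
    rw [← finrank_top' (F := K) (E := T), ← hwT, adjoin.finrank h_integral]
    calc _ ≤ (X ^ n - C a : Polynomial K).natDegree :=
          natDegree_le_of_dvd (minpoly.dvd _ _ hroot) hmonic.ne_zero
      _ = _ := natDegree_X_pow_sub_C
  have hdeg : (X ^ n - C a : Polynomial K).natDegree = n := natDegree_X_pow_sub_C
  have hsplit : IsSplittingField K T (X ^ n - C a) := by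
    refine isSplittingField_of_root hmonic ?_ hroot hwT
    rw [Polynomial.map_sub, Polynomial.map_pow, map_C, map_X]
    exact X_pow_sub_C_splits_of_isPrimitiveRoot (hζ.map_of_injective (algebraMap K _).injective) hw
  have hz : ∀ σ : T ≃ₐ[K] T, ∃ c : K, c ^ n = 1 ∧ σ w = algebraMap K T c * w := by
    intro σ
    have h1 : (σ w / w) ^ n = 1 := by
      rw [div_pow, ← map_pow, hw, AlgEquiv.commutes, div_self]
      rw [← hw]; exact pow_ne_zero _ hw0
    haveI : NeZero n := ⟨hpos.ne'⟩
    obtain ⟨i, -, hi⟩ := (hζ.map_of_injective (algebraMap K T).injective).eq_pow_of_pow_eq_one h1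
    refine ⟨ζ ^ i, by rw [← pow_mul, mul_comm, pow_mul, hζ.pow_eq_one, one_pow], ?_⟩
    rw [map_pow, hi, div_mul_cancel₀ _ hw0]
  have ha : a ≠ 0 := by
    rintro rfl
    rw [map_zero] at hw
    exact hw0 (pow_eq_zero_iff hpos.ne' |>.1 hw)
  haveI hgal : IsGalois K T := IsGalois.of_separable_splitting_field
    (separable_X_pow_sub_C a hnz ha)
  have hfix : ∀ σ : T ≃ₐ[K] T, (σ ^ q) (w ^ q ^ e) = w ^ q ^ e := by
    intro σ
    obtain ⟨c, hc, h⟩ := hz σ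
    rw [map_pow, pow_apply_of_apply_mul σ h, mul_pow, ← map_pow, ← pow_mul, mul_comm q, hqe, hc,
      map_one, one_mul]
  obtain ⟨σ, hσ⟩ : ∃ σ : T ≃ₐ[K] T, σ (w ^ q ^ e) ≠ w ^ q ^ e := by
    by_contra! h
    exact hy ((IsGalois.mem_range_algebraMap_iff_fixed _).2 h)
  obtain ⟨c, hc, h⟩ := hz σ
  have hord : orderOf σ = n := by
    refine hord' σ ?_ ?_
    · intro h1
      have h2 := pow_apply_of_apply_mul σ h (q ^ e)
      rw [h1, AlgEquiv.one_apply] at h2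
      have h3 : algebraMap K T (c ^ q ^ e) = 1 := by
        apply mul_right_cancel₀ hw0
        rw [← h2, one_mul]
      apply hσ
      rw [map_pow, h, mul_pow, ← map_pow, h3, one_mul]
    · ext1 x
      have hx : x ∈ K⟮w⟯ := hwT ▸ mem_top
      rw [AlgEquiv.one_apply]
      induction hx using adjoin_induction with
      | mem x hx =>
        obtain rfl := hx
        rw [pow_apply_of_apply_mul σ h, hc, map_one, one_mul]
      | algebraMap x => simp
      | add x y _ _ hx hy => rw [map_add, hx, hy]
      | inv x _ hx => rw [map_inv₀, hx]
      | mul x y _ _ hx hy => rw [map_mul, hx, hy]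
  obtain ⟨h1, h2, h3⟩ := isGalois_of_orderOf σ hord hfin
  exact ⟨h1, hfd, h2, h3, hfix⟩

end Cyclic

section ArtinSchreierTower

open Polynomial IntermediateField

lemma eq_intCast_of_pow_eq_self {F : Type} [Field F] {p : ℕ} [Fact p.Prime] [CharP F p] {c : F}
    (hc : c ^ p = c) : ∃ i : ℤ, c = i := by
  obtain ⟨i, hi⟩ := (mem_bot_iff_intCast p F).1 ((Subfield.mem_bot_iff_pow_eq_self F p).2 hc)
  exact ⟨i, hi.symm⟩

lemma sub_pow_sub_sub {F : Type} [Field F] {p : ℕ} [Fact p.Prime] [CharP F p] (x y : F) :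
    (x - y) ^ p - (x - y) = (x ^ p - x) - (y ^ p - y) := by
  rw [sub_pow_char]; ring

lemma splits_X_pow_char_sub_X (F : Type) [Field F] (p : ℕ) [Fact p.Prime] [CharP F p] :
    (X ^ p - X : Polynomial F).Splits := by
  have := (Subfield.splits_bot F p).map (Subfield.subtype _)
  simpa using this

lemma finrank_le_of_root {K T : Type} [Field K] [Field T] [Algebra K T] {F : Polynomial K}
    (hF : F.Monic) {w : T} (hw : aeval w F = 0) (hwT : K⟮w⟯ = ⊤) :
    FiniteDimensional K T ∧ Module.finrank K T ≤ F.natDegree := by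
  have h_integral : IsIntegral K w := ⟨F, hF, by simpa [aeval_def] using hw⟩
  constructor
  · have := adjoin.finiteDimensional h_integral
    rw [hwT] at this
    exact (topEquiv (F := K) (E := T)).toLinearEquiv.finiteDimensional
  · rw [← finrank_top' (F := K) (E := T), ← hwT, adjoin.finrank h_integral]
    exact natDegree_le_of_dvd (minpoly.dvd _ _ hw) hF.ne_zero

lemma algEquiv_pow_eq_one_of_adjoin {K T : Type} [Field K] [Field T] [Algebra K T] {σ : T ≃ₐ[K] T}
    {s : Set T} (hs : adjoin K s = ⊤) (h : ∀ x ∈ s, σ x = x) : σ = 1 := by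
  ext1 x
  have hx : x ∈ adjoin K s := hs ▸ mem_top
  rw [AlgEquiv.one_apply]
  induction hx using adjoin_induction with
  | mem x hx => exact h x hx
  | algebraMap x => simp
  | add x y _ _ hx hy => rw [map_add, hx, hy]
  | inv x _ hx => rw [map_inv₀, hx]
  | mul x y _ _ hx hy => rw [map_mul, hx, hy]

/-- Artin–Schreier extensions. -/
lemma isCyclicTower_artinSchreier {K T : Type} [Field K] [Field T] [Algebra K T] {p : ℕ}
    [hp : Fact p.Prime] [CharP K p] {y : T} {a : K} (hy : y ^ p - y = algebraMap K T a)
    (hyT : K⟮y⟯ = ⊤) (hyK : y ∉ Set.range (algebraMap K T)) : IsCyclicTower K T p p y := by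
  haveI : CharP T p := charP_of_injective_algebraMap (algebraMap K T).injective p
  have hpK : (p : K) = 0 := CharP.cast_eq_zero K p
  have hmonic := monic_X_pow_sub_X_sub_C (R := K) hp.out.two_le a
  have hroot : aeval y (X ^ p - X - C a : Polynomial K) = 0 := by simp [hy]
  obtain ⟨hfd, hfin⟩ := finrank_le_of_root hmonic hroot hyT
  have hdeg : (X ^ p - X - C a : Polynomial K).natDegree = p := by
    have h1 : (X ^ p - X - C a : Polynomial K) = X ^ p - (X + C a) := by ring
    rw [h1, natDegree_sub_eq_left_of_natDegree_lt]
    · exact natDegree_X_pow p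
    · rw [natDegree_X_pow, natDegree_X_add_C]
      exact hp.out.one_lt
  rw [hdeg] at hfin
  have hsplit : IsSplittingField K T (X ^ p - X - C a) := by
    refine isSplittingField_of_root hmonic ?_ hroot hyT
    have := (splits_X_pow_char_sub_X T p).comp_X_sub_C y
    have he : (X ^ p - X - C a : Polynomial K).map (algebraMap K T) =
        (X ^ p - X : Polynomial T).comp (X - C y) := by
      rw [sub_comp, pow_comp, X_comp, sub_pow_char]
      simp only [Polynomial.map_sub, Polynomial.map_pow, map_C, map_X, ← hy, C_sub, C_pow]
      ring
    rwa [he]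
  haveI hgal : IsGalois K T := IsGalois.of_separable_splitting_field
    (separable_X_pow_sub_X_sub_C hpK a)
  have hz : ∀ σ : T ≃ₐ[K] T, ∃ i : ℤ, σ y = y + algebraMap K T i := by
    intro σ
    obtain ⟨i, hi⟩ := eq_intCast_of_pow_eq_self (p := p) (c := σ y - y) (by
      have := sub_pow_sub_sub (p := p) (σ y) y
      rwa [← map_pow, ← map_sub, hy, AlgEquiv.commutes, sub_self, sub_eq_zero] at this)
    exact ⟨i, by rw [map_intCast, ← hi]; ring⟩
  have hfix : ∀ σ : T ≃ₐ[K] T, (σ ^ p) y = y := by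
    intro σ
    obtain ⟨i, hi⟩ := hz σ
    rw [pow_apply_of_apply_add σ hi, hpK, zero_mul, map_zero, add_zero]
  obtain ⟨σ, hσ⟩ : ∃ σ : T ≃ₐ[K] T, σ y ≠ y := by
    by_contra! h
    exact hyK ((IsGalois.mem_range_algebraMap_iff_fixed _).2 h)
  have hord : orderOf σ = p := by
    refine orderOf_eq_prime ?_ ?_
    · refine algEquiv_pow_eq_one_of_adjoin hyT ?_
      rintro _ rfl
      exact hfix σ
    · rintro rfl
      exact hσ rfl
  obtain ⟨h1, h2, h3⟩ := isGalois_of_orderOf σ hord hfin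
  exact ⟨h1, hfd, h2, h3, hfix⟩

lemma exists_apply_sub_eq {K S : Type} [Field K] [Field S] [Algebra K S] (σ : S ≃ₐ[K] S) {n : ℕ}
    {β x : S} (hσ : σ ^ n = 1) (hβ : ∑ j ∈ Finset.range n, (σ ^ j) β = 1)
    (hx : ∑ j ∈ Finset.range n, (σ ^ j) x = 0) : ∃ α, σ α - α = x := by
  set s : ℕ → S := fun j => ∑ i ∈ Finset.range j, (σ ^ i) x with hs
  have hσs : ∀ j, σ (s j) = s (j + 1) - x := by
    intro j
    simp only [hs, map_sum]
    rw [Finset.sum_range_succ']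
    simp only [← AlgEquiv.mul_apply, ← pow_succ', pow_zero, AlgEquiv.one_apply]
    ring
  have hshift : ∀ g : ℕ → S, ∑ j ∈ Finset.range n, g (j + 1) = ∑ j ∈ Finset.range n, g j + g n - g 0 := by
    intro g
    rw [← Finset.sum_range_succ, Finset.sum_range_succ']
    ring
  refine ⟨-∑ j ∈ Finset.range n, s j * (σ ^ j) β, ?_⟩
  have h1 : σ (∑ j ∈ Finset.range n, s j * (σ ^ j) β) =
      ∑ j ∈ Finset.range n, s (j + 1) * (σ ^ (j + 1)) β - x * ∑ j ∈ Finset.range n, (σ ^ (j + 1)) β := by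
    rw [map_sum, Finset.mul_sum, ← Finset.sum_sub_distrib]
    refine Finset.sum_congr rfl fun j _ => ?_
    rw [map_mul, hσs, ← AlgEquiv.mul_apply, ← pow_succ']
    ring
  have h0 : s 0 = 0 := by simp [hs]
  have hn : s n = 0 := hx
  rw [map_neg, h1, hshift fun j => s j * (σ ^ j) β, hshift fun j => (σ ^ j) β, hβ, h0, hn, hσ]
  simp

lemma sum_range_pow_eq_trace {K S : Type} [Field K] [Field S] [Algebra K S] [IsGalois K S]
    [FiniteDimensional K S] {σ : S ≃ₐ[K] S} (hσ : ∀ τ, τ ∈ Subgroup.zpowers σ) (β : S) :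
    ∑ j ∈ Finset.range (orderOf σ), (σ ^ j) β = algebraMap K S (Algebra.trace K S β) := by
  classical
  rw [trace_eq_sum_automorphisms, ← IsCyclic.image_range_orderOf hσ, Finset.sum_image]
  intro i hi j hj hij
  exact pow_injOn_Iio_orderOf (by simpa using hi) (by simpa using hj) hij

/-- Albert's construction: the data needed to enlarge a cyclic extension of degree `p ^ (e + 1)`. -/
lemma exists_albert {K S : Type} [Field K] [Field S] [Algebra K S] [IsGalois K S]
    [FiniteDimensional K S] {p : ℕ} [Fact p.Prime] [CharP K p] {n : ℕ}
    (hc : IsCyclic (S ≃ₐ[K] S)) (hn : Nat.card (S ≃ₐ[K] S) = n) :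
    ∃ (σ : S ≃ₐ[K] S) (α β : S), σ ^ n = 1 ∧ ∑ j ∈ Finset.range n, (σ ^ j) β = 1 ∧
      σ α - α = β ^ p - β := by
  obtain ⟨σ, hσ⟩ := hc.exists_generator
  haveI : CharP S p := charP_of_injective_algebraMap (algebraMap K S).injective p
  have hord : orderOf σ = n := by rw [orderOf_eq_card_of_forall_mem_zpowers hσ, hn]
  obtain ⟨β, hβ⟩ := Algebra.trace_surjective K S 1
  have h1 : ∑ j ∈ Finset.range n, (σ ^ j) β = 1 := by
    rw [← hord, sum_range_pow_eq_trace hσ, hβ, map_one]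
  have h2 : ∑ j ∈ Finset.range n, (σ ^ j) (β ^ p - β) = 0 := by
    simp only [map_sub, map_pow, Finset.sum_sub_distrib]
    rw [← sum_pow_char, h1, one_pow, sub_self]
  have h3 : σ ^ n = 1 := by rw [← hord, pow_orderOf_eq_one]
  obtain ⟨α, hα⟩ := exists_apply_sub_eq σ h3 h1 h2
  exact ⟨σ, α, β, h3, h1, hα⟩

/-- Albert's theorem: the enlarged cyclic extension. -/
lemma isCyclicTower_albert {K S T : Type} [Field K] [Field S] [Field T] [Algebra K S] [Algebra K T]
    [Algebra S T] [IsScalarTower K S T] {p e : ℕ} [hp : Fact p.Prime] [CharP K p] {y : S}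
    (h : IsCyclicTower K S p (p ^ (e + 1)) y) {σ : S ≃ₐ[K] S} {α β : S} (hσ : σ ^ p ^ (e + 1) = 1)
    (hβ : ∑ j ∈ Finset.range (p ^ (e + 1)), (σ ^ j) β = 1) (hα : σ α - α = β ^ p - β) {b : K}
    {θ : T} (hθ : θ ^ p - θ = algebraMap S T α + algebraMap K T b) (hT : S⟮θ⟯ = ⊤) :
    IsCyclicTower K T p (p ^ (e + 2)) (algebraMap S T y) := by
  haveI := h.isGalois
  haveI := h.finite
  haveI : CharP S p := charP_of_injective_algebraMap (algebraMap K S).injective p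
  haveI : CharP T p := charP_of_injective_algebraMap (algebraMap K T).injective p
  have hpT : (p : T) = 0 := CharP.cast_eq_zero T p
  have hmonic := monic_X_pow_sub_X_sub_C (R := S) hp.out.two_le (α + algebraMap K S b)
  have hroot : aeval θ (X ^ p - X - C (α + algebraMap K S b) : Polynomial S) = 0 := by
    simp [hθ, ← IsScalarTower.algebraMap_apply]
  obtain ⟨hfd', hfin'⟩ := finrank_le_of_root hmonic hroot hT
  have hdeg : (X ^ p - X - C (α + algebraMap K S b) : Polynomial S).natDegree = p := by
    rw [sub_sub, natDegree_sub_eq_left_of_natDegree_lt]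
    · exact natDegree_X_pow p
    · rw [natDegree_X_pow, natDegree_X_add_C]
      exact hp.out.one_lt
  rw [hdeg] at hfin'
  haveI hfd : FiniteDimensional K T := FiniteDimensional.trans K S T
  have hfinS : Module.finrank K S = p ^ (e + 1) := by
    rw [← IsGalois.card_aut_eq_finrank, h.card]
  have hfin : Module.finrank K T ≤ p ^ (e + 2) := by
    rw [← Module.finrank_mul_finrank K S T, hfinS, pow_succ p (e + 1)]
    exact Nat.mul_le_mul_left _ hfin'
  let N := AlgebraicClosure T
  haveI : CharP N p := charP_of_injective_algebraMap (algebraMap T N).injective p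
  let ι : T →ₐ[K] N := IsScalarTower.toAlgHom K T N
  obtain ⟨g, hg⟩ := exists_ringHom_extend (S := S) (T := T) (N := N)
    (((ι : T →+* N).comp (algebraMap S T)).comp (σ : S →+* S))
  have hg' : ∀ s, g (algebraMap S T s) = ι (algebraMap S T (σ s)) := hg
  let φ : T →ₐ[K] N := { g with
    commutes' := fun r => by
      change g (algebraMap K T r) = _
      rw [IsScalarTower.algebraMap_apply K S T, hg', AlgEquiv.commutes,
        ← IsScalarTower.algebraMap_apply, ι.commutes] }
  have hφ : ∀ s, φ (algebraMap S T s) = ι (algebraMap S T (σ s)) := hg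
  have hφb : φ (algebraMap K T b) = ι (algebraMap K T b) := by rw [φ.commutes, ι.commutes]
  obtain ⟨i, hi⟩ : ∃ i : ℤ, φ θ - ι (θ + algebraMap S T β) = i := by
    refine eq_intCast_of_pow_eq_self (p := p) ?_
    rw [← sub_eq_zero, sub_pow_sub_sub, ← map_pow, ← map_pow, ← map_sub, ← map_sub, add_pow_char,
      add_sub_add_comm, hθ, ← map_pow, ← map_sub, ← hα, map_add, hφb, hφ]
    simp only [map_add, map_sub]
    ring
  have hφθ : φ θ = ι (θ + algebraMap S T β + i) := by
    rw [map_add ι _ (i : T), map_intCast, ← hi]; ring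
  have hrange : ∀ x, φ x ∈ ι.fieldRange := by
    intro x
    have hx : x ∈ S⟮θ⟯ := hT ▸ mem_top
    induction hx using adjoin_induction with
    | mem x hx =>
      obtain rfl := hx
      exact ⟨_, hφθ.symm⟩
    | algebraMap s => exact ⟨_, (hφ s).symm⟩
    | add x y _ _ hx hy => rw [map_add]; exact add_mem hx hy
    | inv x _ hx => rw [map_inv₀]; exact inv_mem hx
    | mul x y _ _ hx hy => rw [map_mul]; exact mul_mem hx hy
  obtain ⟨τ, hτ⟩ := exists_algEquiv_of_mem_fieldRange ι φ hrange
  have hτS : ∀ s, τ (algebraMap S T s) = algebraMap S T (σ s) := fun s =>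
    ι.toRingHom.injective ((hτ _).trans (hφ s))
  have hτθ : τ θ = θ + algebraMap S T β + i := ι.toRingHom.injective ((hτ _).trans hφθ)
  have hτSj : ∀ (j : ℕ) s, (τ ^ j) (algebraMap S T s) = algebraMap S T ((σ ^ j) s) := by
    intro j
    induction j with
    | zero => intro s; rfl
    | succ j ih => intro s; rw [pow_succ, AlgEquiv.mul_apply, hτS, ih, pow_succ, AlgEquiv.mul_apply]
  have hτθj : ∀ j : ℕ, (τ ^ j) θ = θ + algebraMap S T (∑ l ∈ Finset.range j, (σ ^ l) β) + j * i := by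
    intro j
    induction j with
    | zero => simp
    | succ j ih =>
      rw [pow_succ, AlgEquiv.mul_apply, hτθ, map_add, map_add, ih, map_intCast, hτSj,
        Finset.sum_range_succ, map_add]
      push_cast
      ring
  have hone : (τ ^ p ^ (e + 1)) θ = θ + algebraMap K T 1 := by
    rw [hτθj, hβ, Nat.cast_pow, hpT, zero_pow (Nat.succ_ne_zero e)]
    simp
  have hord : orderOf τ = p ^ (e + 1 + 1) := by
    refine orderOf_eq_prime_pow ?_ ?_
    · intro h1
      rw [h1, AlgEquiv.one_apply] at hone
      simp at hone
    · have h2 := pow_apply_of_apply_add _ hone p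
      rw [CharP.cast_eq_zero K p, zero_mul, map_zero, add_zero, ← pow_mul, ← pow_succ] at h2
      ext1 x
      have hx : x ∈ S⟮θ⟯ := hT ▸ mem_top
      rw [AlgEquiv.one_apply]
      induction hx using adjoin_induction with
      | mem x hx =>
        obtain rfl := hx
        exact h2
      | algebraMap s => rw [hτSj, pow_succ p (e + 1), pow_mul, hσ, one_pow, AlgEquiv.one_apply]
      | add x y _ _ hx hy => rw [map_add, hx, hy]
      | inv x _ hx => rw [map_inv₀, hx]
      | mul x y _ _ hx hy => rw [map_mul, hx, hy]
  obtain ⟨h1, h2, h3⟩ := isGalois_of_orderOf τ hord hfin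
  refine ⟨h1, hfd, h2, h3, fun ρ => ?_⟩
  have h4 := AlgEquiv.restrictNormal_commutes (ρ ^ p) S y
  rw [← h4]
  congr 1
  have h5 := h.fixed (AlgEquiv.restrictNormal ρ S)
  rwa [show (ρ ^ p).restrictNormal S = (ρ.restrictNormal S) ^ p from
    map_pow (AlgEquiv.restrictNormalHom S) ρ p]

end ArtinSchreierTower

section Tower

open Polynomial IntermediateField

lemma adjoin_gen_eq_top {F E : Type} [Field F] [Field E] [Algebra F E] (α : E) :
    F⟮AdjoinSimple.gen F α⟯ = (⊤ : IntermediateField F F⟮α⟯) := by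
  apply map_injective (F⟮α⟯).val
  rw [adjoin_map, Set.image_singleton, coe_val, AdjoinSimple.coe_gen, ← AlgHom.fieldRange_eq_map,
    fieldRange_val]

lemma mem_range_of_mem_range_val {K Ω : Type} [Field K] [Field Ω] [Algebra K Ω]
    {S : IntermediateField K Ω} {y : S} (hy : (y : Ω) ∉ Set.range (algebraMap K Ω)) :
    y ∉ Set.range (algebraMap K S) := by
  rintro ⟨a, rfl⟩
  exact hy ⟨a, rfl⟩

theorem exists_kummerTower {K Ω : Type} [Field K] [Field Ω] [Algebra K Ω] {q e : ℕ} (hq : q.Prime)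
    {ζ : K} (hζ : IsPrimitiveRoot ζ (q ^ (e + 1))) (hqK : (q : K) ≠ 0) {w : Ω} {a : K}
    (hw : w ^ (q ^ (e + 1)) = algebraMap K Ω a)
    (hy : w ^ (q ^ e) ∉ Set.range (algebraMap K Ω)) :
    ∃ (S : IntermediateField K Ω) (y : S), (y : Ω) = w ^ (q ^ e) ∧
      IsCyclicTower K S q (q ^ (e + 1)) y :=
  ⟨K⟮w⟯, (AdjoinSimple.gen K w) ^ (q ^ e), rfl, isCyclicTower_kummer hq hζ (a := a)
    (Subtype.ext hw) (adjoin_gen_eq_top w) (mem_range_of_mem_range_val hy) hqK⟩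

theorem exists_artinSchreierTower {K Ω : Type} [Field K] [Field Ω] [Algebra K Ω] {p : ℕ}
    [hp : Fact p.Prime] [CharP K p]
    (H : ∀ α : Ω, ∃ (b : K) (θ : Ω), θ ^ p - θ = α + algebraMap K Ω b) {y : Ω} {a : K}
    (hy : y ^ p - y = algebraMap K Ω a) (hyK : y ∉ Set.range (algebraMap K Ω)) (e : ℕ) :
    ∃ (S : IntermediateField K Ω) (y' : S), (y' : Ω) = y ∧ IsCyclicTower K S p (p ^ (e + 1)) y' := by
  induction e with
  | zero =>
    refine ⟨K⟮y⟯, AdjoinSimple.gen K y, rfl, ?_⟩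
    rw [zero_add, pow_one]
    exact isCyclicTower_artinSchreier (a := a) (Subtype.ext hy) (adjoin_gen_eq_top y)
      (mem_range_of_mem_range_val hyK)
  | succ e ih =>
    obtain ⟨S, y', rfl, hS⟩ := ih
    haveI := hS.isGalois
    haveI := hS.finite
    obtain ⟨σ, α, β, hσ, hβ, hα⟩ := exists_albert (p := p) hS.isCyclic hS.card
    obtain ⟨b, θ, hθ⟩ := H α
    have h := isCyclicTower_albert (T := S⟮θ⟯) hS hσ hβ hα (b := b) (θ := AdjoinSimple.gen S θ)
      (Subtype.ext hθ) (adjoin_gen_eq_top θ)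
    exact ⟨(S⟮θ⟯).restrictScalars K, algebraMap S S⟮θ⟯ y', rfl, h⟩

end Tower

section PatchFamily

open Polynomial IntermediateField Cardinal

variable {k : Type} [Field k]

lemma TComplete.exists_artinSchreier_root {Ω : Type} [Field Ω] {t : Ω} {R : Subring Ω}
    (h : TComplete t R) {q : ℕ} (hq : 2 ≤ q) (hqΩ : (q : Ω) = 0) {x r : Ω} (hr : r ∈ R)
    (hx : x = t ^ 2 * r) : ∃ θ, θ ^ q - θ = x := by
  have hxR : x ∈ R := hx ▸ R.mul_mem (R.pow_mem h.mem 2) hr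
  have hdeg : (X ^ q - X - C x : Polynomial Ω).natDegree ≤ q := by
    rw [sub_sub]
    refine (natDegree_sub_le _ _).trans (max_le (natDegree_X_pow_le q) ?_)
    rw [natDegree_X_add_C]; omega
  have hder : derivative (X ^ q - X - C x : Polynomial Ω) = -1 := by
    rw [derivative_sub, derivative_sub, derivative_X_pow, hqΩ]; simp
  have hC : ∀ y ∈ R, ∀ i, (C y : Polynomial Ω).coeff i ∈ R := fun y hy i => by
    rw [coeff_C]; split_ifs; exacts [hy, R.zero_mem]
  have hXn : ∀ n i, (X ^ n : Polynomial Ω).coeff i ∈ R := fun n i => by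
    rw [coeff_X_pow]; split_ifs; exacts [R.one_mem, R.zero_mem]
  obtain ⟨y, hy, -⟩ := h.exists_root (F := X ^ q - X - C x) (a := 0) (b := C (-1)) (n := q) (c := 0)
    (d := 0) (Δ := 1) (b₀ := 0) (N := 2) (r := -r)
    (fun i => by
      rw [coeff_sub, coeff_sub]
      exact R.sub_mem (R.sub_mem (hXn q i) (by simpa using hXn 1 i)) (hC x hxR i))
    (fun i => by simp [R.zero_mem]) (hC _ (R.neg_mem R.one_mem)) hdeg (by simp) (by simp)
    one_ne_zero (by rw [hder]; simp) (by simp [R.one_mem]) (by simp [R.zero_mem])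
    (R.neg_mem hr) (by simp [hx, show q ≠ 0 by omega]) (by omega)
  refine ⟨y, ?_⟩
  simpa [IsRoot, sub_eq_zero] using hy

lemma TComplete.exists_kummer_root {Ω : Type} [Field Ω] {t : Ω} {R : Subring Ω}
    (h : TComplete t R) {q : ℕ} (hq : 2 ≤ q) (hqΩ : (q : Ω) ≠ 0) (hqR : (q : Ω)⁻¹ ∈ R) {x r : Ω}
    (hr : r ∈ R) (hx : x = t ^ 2 * r) : ∃ w, w ^ q = 1 + x := by
  have hxR : x ∈ R := hx ▸ R.mul_mem (R.pow_mem h.mem 2) hr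
  have hdeg : (X ^ q - C (1 + x) : Polynomial Ω).natDegree ≤ q := by
    rw [natDegree_X_pow_sub_C]
  have hC : ∀ y ∈ R, ∀ i, (C y : Polynomial Ω).coeff i ∈ R := fun y hy i => by
    rw [coeff_C]; split_ifs; exacts [hy, R.zero_mem]
  have hXn : ∀ n i, (X ^ n : Polynomial Ω).coeff i ∈ R := fun n i => by
    rw [coeff_X_pow]; split_ifs; exacts [R.one_mem, R.zero_mem]
  have hunit : 1 + x = 1 - t * (-(t * r)) := by rw [hx]; ring
  have htr : -(t * r) ∈ R := R.neg_mem (R.mul_mem h.mem hr)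
  have hne : 1 + x ≠ 0 := hunit ▸ h.one_sub_ne_zero htr
  have hinv : (1 + x)⁻¹ ∈ R := hunit ▸ h.inv_mem htr
  obtain ⟨y, hy, -⟩ := h.exists_root (F := X ^ q - C (1 + x)) (a := C (-(q : Ω))) (b := X) (n := q) (c := 0)
    (d := 0) (Δ := q * (1 + x)) (b₀ := 1) (N := 2) (r := -r)
    (fun i => by
      rw [coeff_sub]
      exact R.sub_mem (hXn q i) (hC _ (R.add_mem R.one_mem hxR) i))
    (hC _ (R.neg_mem (natCast_mem R _))) (by simpa using hXn 1) hdeg (by rw [natDegree_C]; omega)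
    (natDegree_X_le.trans (by omega)) (mul_ne_zero hqΩ hne) (by
      rw [derivative_sub, derivative_C, derivative_X_pow, sub_zero]
      have : (X : Polynomial Ω) * (C (q : Ω) * X ^ (q - 1)) = C (q : Ω) * X ^ q := by
        rw [mul_left_comm, ← pow_succ', Nat.sub_add_cancel (by omega)]
      rw [this, C_mul, C_neg]
      ring) (by rw [pow_zero, one_mul, mul_inv]; exact R.mul_mem hqR hinv) (by simp [R.one_mem])
    (R.neg_mem hr) (by simp [hx]) (by omega)
  refine ⟨y, ?_⟩
  simpa [IsRoot, sub_eq_zero] using hy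

lemma mk_powerSeries (k : Type) [Field k] : #(PowerSeries k) = #k ^ ℵ₀ := by
  have h : #((Unit →₀ ℕ) → k) = #k ^ #(Unit →₀ ℕ) := by simp
  have h2 : #(Unit →₀ ℕ) = ℵ₀ := mk_eq_aleph0 _
  exact h.trans (by rw [h2])

lemma mk_mvPowerSeries (k : Type) [Field k] : #(MvPowerSeries (Fin 2) k) = #k ^ ℵ₀ := by
  have h : #((Fin 2 →₀ ℕ) → k) = #k ^ #(Fin 2 →₀ ℕ) := by simp
  have h2 : #(Fin 2 →₀ ℕ) = ℵ₀ := mk_eq_aleph0 _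
  exact h.trans (by rw [h2])

lemma aleph0_lt_mk_powerSeries (k : Type) [Field k] : ℵ₀ < #(PowerSeries k) := by
  rw [mk_powerSeries]
  refine (cantor ℵ₀).trans_le (power_le_power_right ?_)
  exact two_le_iff.2 ⟨0, 1, zero_ne_one⟩

lemma exists_finite_restrict {K Ω : Type} [Field K] [Field Ω] [Algebra K Ω] (E : Type) [Field E]
    [Algebra E Ω] (K₁ : IntermediateField K Ω) (hE : ∀ c : E, algebraMap E Ω c ∈ K₁) (x : Ω) (d : ℕ)
    (hd : ∀ u ∈ K₁, ∃ c : ℕ → E, u = ∑ i ∈ Finset.range d, algebraMap E Ω (c i) * x ^ i)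
    (J : IntermediateField K₁ Ω) (hJ : FiniteDimensional K₁ J) :
    ∃ J' : IntermediateField E Ω, FiniteDimensional E J' ∧ ∀ z, z ∈ J' ↔ z ∈ J := by
  let J' : IntermediateField E Ω := { J.toSubfield with
    algebraMap_mem' := fun c => J.algebraMap_mem ⟨_, hE c⟩ }
  refine ⟨J', ?_, fun z => Iff.rfl⟩
  haveI : Module.Free K₁ J := Module.Free.of_divisionRing K₁ J
  let b := Module.finBasis K₁ J
  let g : Fin d × Fin (Module.finrank K₁ J) → Ω := fun i => x ^ (i.1 : ℕ) * (b i.2 : Ω)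
  let W : Submodule E Ω := Submodule.span E (Set.range g)
  haveI : FiniteDimensional E W := FiniteDimensional.span_of_finite E (Set.finite_range g)
  have hle : ∀ z ∈ J, z ∈ W := by
    intro z hz
    have h1 := congrArg (Subtype.val : J → Ω) (b.sum_repr ⟨z, hz⟩)
    simp only [AddSubmonoidClass.coe_finset_sum, IntermediateField.coe_smul] at h1
    rw [← h1]
    refine W.sum_mem fun l _ => ?_
    generalize b.repr ⟨z, hz⟩ l = u
    obtain ⟨c, hc⟩ := hd u.1 u.2
    have h3 : u • (b l : Ω) = (u : Ω) * (b l : Ω) := rfl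
    rw [h3, hc, Finset.sum_mul]
    refine W.sum_mem fun i hi => ?_
    have h2 : c i • g (⟨i, Finset.mem_range.1 hi⟩, l) ∈ W :=
      W.smul_mem _ (Submodule.subset_span ⟨_, rfl⟩)
    rwa [Algebra.smul_def, ← mul_assoc] at h2
  exact Submodule.finiteDimensional_of_le (S₁ := Subalgebra.toSubmodule J'.toSubalgebra) (S₂ := W)
    (fun z hz => hle z hz)

lemma exists_family_of_tower {K₁ Ω C : Type} [Field K₁] [Field Ω] [Algebra K₁ Ω] (hC : ℵ₀ < #C)
    {q n : ℕ} (hq : q.Prime) (e : ℕ) (hn : n = q ^ (e + 1)) (y : C → Ω)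
    (hfin : ∀ J : IntermediateField K₁ Ω, FiniteDimensional K₁ J → {c | y c ∈ J}.Finite)
    (hS : ∀ c, y c ∉ Set.range (algebraMap K₁ Ω) →
      ∃ (S : IntermediateField K₁ Ω) (y' : S), (y' : Ω) = y c ∧ IsCyclicTower K₁ S q n y') :
    ∃ (I : Type) (S : I → IntermediateField K₁ Ω) (y : I → Ω), #I = #C ∧
      (∀ c, IsGalois K₁ (S c) ∧ FiniteDimensional K₁ (S c) ∧ IsCyclic (S c ≃ₐ[K₁] S c) ∧
        Nat.card (S c ≃ₐ[K₁] S c) = n ∧ ∀ J ≤ S c, J ≠ ⊥ → y c ∈ J) ∧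
      ∀ J : IntermediateField K₁ Ω, FiniteDimensional K₁ J → {c | y c ∈ J}.Finite := by
  subst hn
  have hbot := hfin ⊥ inferInstance
  choose S y' hy' hT using hS
  refine ⟨↥({c | y c ∈ (⊥ : IntermediateField K₁ Ω)}ᶜ),
    fun c => S c fun h => c.2 (mem_bot.2 h), fun c => y c, ?_, fun c => ?_, fun J hJ => ?_⟩
  · haveI : Infinite C := infinite_iff.2 hC.le
    exact mk_compl_of_infinite _ (hbot.lt_aleph0.trans_le hC.le)
  · have hc := fun h => c.2 (mem_bot.2 h)
    have h := hT c hc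
    refine ⟨h.isGalois, h.finite, h.isCyclic, h.card, fun J hJ hJ' => ?_⟩
    have h1 := h.mem hq hJ hJ'
    rwa [hy' c hc] at h1
  · exact Set.Finite.preimage (f := Subtype.val) Subtype.val_injective.injOn (hfin J hJ)

/-- A large family of cyclic extensions of the patched field `K₁`. -/
theorem exists_cyclic_family {K Ω : Type} [Field K] [Field Ω] [Algebra K Ω] [Algebra (lexFrac₁ k) Ω]
    (K₁ : IntermediateField K Ω) (hE : ∀ c : lexFrac₁ k, algebraMap (lexFrac₁ k) Ω c ∈ K₁) (x : Ω)
    (d : ℕ) (hd : ∀ u ∈ K₁, ∃ c : ℕ → lexFrac₁ k,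
      u = ∑ i ∈ Finset.range d, algebraMap (lexFrac₁ k) Ω (c i) * x ^ i)
    {t : Ω} {R : Subring Ω} (hR : TComplete t R)
    (hrho : ∀ c : PowerSeries k, ∃ r ∈ R, algebraMap (lexFrac₁ k) Ω (fracRho c) = t ^ 2 * r)
    (hinv : ∀ l : ℕ, (l : k) ≠ 0 → (l : Ω)⁻¹ ∈ R)
    (happ : ∀ α, ∃ b ∈ K₁, ∃ r ∈ R, α + b = t ^ 2 * r)
    {n : ℕ} (hn : IsPrimePow n) (hζ : (n : k) ≠ 0 → ∃ ζ : K₁, IsPrimitiveRoot ζ n) :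
    ∃ (I : Type) (S : I → IntermediateField K₁ Ω) (y : I → Ω),
    #I = #(PowerSeries k) ∧
    (∀ c, IsGalois K₁ (S c) ∧ FiniteDimensional K₁ (S c) ∧ IsCyclic (S c ≃ₐ[K₁] S c) ∧
      Nat.card (S c ≃ₐ[K₁] S c) = n ∧ ∀ J ≤ S c, J ≠ ⊥ → y c ∈ J) ∧
    ∀ J : IntermediateField K₁ Ω, FiniteDimensional K₁ J → {c | y c ∈ J}.Finite := by
  obtain ⟨q, e, hq, he, rfl⟩ := (isPrimePow_nat_iff _).1 hn
  obtain ⟨e, rfl⟩ := Nat.exists_eq_succ_of_ne_zero he.ne'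
  have hfin : ∀ y : PowerSeries k → Ω, (∀ c, IsSeparable (lexFrac₁ k) (y c)) →
      (∀ c c', c ≠ c' → y c ∉ IntermediateField.adjoin (lexFrac₁ k) {y c'}) →
      ∀ J : IntermediateField K₁ Ω, FiniteDimensional K₁ J → {c | y c ∈ J}.Finite := by
    intro y hs hy J hJ
    obtain ⟨J', hJ', h⟩ := exists_finite_restrict (lexFrac₁ k) K₁ hE x d hd J hJ
    have := finite_setOf_mem_of_notMem_adjoin y hs hy J'
    simpa only [h] using this
  have hC := aleph0_lt_mk_powerSeries k
  have hE' : ∀ c, ∃ a : K₁, algebraMap (lexFrac₁ k) Ω c = algebraMap K₁ Ω a :=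
    fun c => ⟨⟨_, hE c⟩, rfl⟩
  by_cases hqk : (q : k) = 0
  · haveI : Fact q.Prime := ⟨hq⟩
    have hchar : (q : Ω) = 0 := by
      rw [← map_natCast (algebraMap (lexFrac₁ k) Ω), natCast_eq_zero_lexFrac₁ hqk, map_zero]
    haveI : CharP K₁ q := (CharP.charP_iff_prime_eq_zero hq).2 (Subtype.ext hchar)
    have hroot : ∀ c, ∃ y : Ω, y ^ q - y = algebraMap (lexFrac₁ k) Ω (fracRho c) := by
      intro c
      obtain ⟨r, hr, h⟩ := hrho c
      exact hR.exists_artinSchreier_root hq.two_le hchar hr h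
    choose y hy using hroot
    refine exists_family_of_tower hC hq e rfl y (hfin y (fun c => ?_)
      fun c c' hc => artinSchreier_notMem hq.two_le hqk hc (hy c) (hy c')) fun c hc => ?_
    · exact (separable_X_pow_sub_X_sub_C (natCast_eq_zero_lexFrac₁ hqk) (fracRho c)).of_dvd
        (minpoly.dvd _ _ (by simp [hy]))
    · obtain ⟨a, ha⟩ := hE' (fracRho c)
      refine exists_artinSchreierTower (a := a) (fun α => ?_) ((hy c).trans ha) hc e
      obtain ⟨b, hb, r, hr, h⟩ := happ α
      obtain ⟨θ, hθ⟩ := hR.exists_artinSchreier_root hq.two_le hchar hr h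
      exact ⟨⟨b, hb⟩, θ, hθ⟩
  · have hqn : ((q ^ (e + 1) : ℕ) : k) ≠ 0 := by push_cast; exact pow_ne_zero _ hqk
    have hne : ∀ l : ℕ, (l : k) ≠ 0 → (l : Ω) ≠ 0 := fun l hl => by
      rw [← map_natCast (algebraMap (lexFrac₁ k) Ω)]
      exact (_root_.map_ne_zero _).2 (natCast_ne_zero_lexFrac₁ hl)
    obtain ⟨ζ, hζ⟩ := hζ hqn
    have hroot : ∀ c, ∃ w : Ω, w ^ (q ^ (e + 1)) = 1 + algebraMap (lexFrac₁ k) Ω (fracRho c) := by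
      intro c
      obtain ⟨r, hr, h⟩ := hrho c
      exact hR.exists_kummer_root (hq.two_le.trans (Nat.le_self_pow (by omega) q)) (hne _ hqn)
        (hinv _ hqn) hr h
    choose w hw using hroot
    have hy : ∀ c, (w c ^ q ^ e) ^ q = 1 + algebraMap (lexFrac₁ k) Ω (fracRho c) := fun c => by
      rw [← pow_mul, ← pow_succ, hw]
    have hy' : ∀ c, (w c ^ q ^ e) ^ q = algebraMap (lexFrac₁ k) Ω (1 + fracRho c) := fun c => by
      rw [hy, map_add, map_one]
    have hnm := fun c c' hc => kummer_notMem (Ω := Ω) (c := c) (c' := c') hq.two_le hqk hc (hy c) (hy c')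
    have hrho : ∀ c, 1 + fracRho (k := k) c ≠ 0 := fun c h => by
      have h1 := hy' c
      rw [h, map_zero, pow_eq_zero_iff hq.ne_zero] at h1
      exact hnm c (c + 1) (by simp) (by rw [h1]; exact zero_mem _)
    refine exists_family_of_tower hC hq e rfl (fun c => w c ^ q ^ e) (hfin _ (fun c => ?_)
      hnm) fun c hc => ?_
    · exact (separable_X_pow_sub_C (1 + fracRho c) (natCast_ne_zero_lexFrac₁ hqk) (hrho c)).of_dvd
        (minpoly.dvd _ _ (by simp [hy']))
    · obtain ⟨a, ha⟩ := hE' (1 + fracRho c)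
      refine exists_kummerTower (a := a) hq hζ (fun h => ?_) ?_ hc
      · exact hne q hqk (congrArg (Subtype.val : K₁ → Ω) h)
      · rw [hw, ← ha, map_add, map_one]

end PatchFamily

section PatchFrame

open Polynomial IntermediateField Cardinal

/-- Patching data at `D`, with a large supply of cyclic extensions of `K₁`, and an approximate
root `b₀` of `f` in the complete ring `R₁ ⊆ K₁`. -/
structure PatchFrame {A K Ω : Type} [CommRing A] [Field K] [Algebra A K] [Field Ω] [Algebra K Ω]
    (k : Type) [Field k] (K₁ K₂ : IntermediateField K Ω) (R₁ R₂ : Subring Ω) (t : Ω) (D : A)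
    (f : Polynomial A) (l m N : ℕ) (b₀ r₀ : Ω) : Prop where
  patchData : PatchData A K₁ K₂ R₂ D
  complete : TComplete t R₁
  mem₁ : ∀ r ∈ R₁, r ∈ K₁
  algebraMap_mem : ∀ a, algebraMap K Ω (algebraMap A K a) ∈ R₁
  inv_mem : t ^ m * (algebraMap K Ω (algebraMap A K D))⁻¹ ∈ R₁
  approx_mem : t ^ m * b₀ ∈ R₁
  rem_mem : r₀ ∈ R₁
  eval_eq : (f.map ((algebraMap K Ω).comp (algebraMap A K))).eval b₀ = t ^ N * r₀
  le : 3 * (m * l + m) + 2 ≤ N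
  exists_family : ∀ n : ℕ, IsPrimePow n → ((n : k) ≠ 0 → ∃ ζ : K₁, IsPrimitiveRoot ζ n) →
    ∃ (I : Type) (S : I → IntermediateField K₁ Ω) (y : I → Ω), #I = #(PowerSeries k) ∧
    (∀ c, IsGalois K₁ (S c) ∧ FiniteDimensional K₁ (S c) ∧ IsCyclic (S c ≃ₐ[K₁] S c) ∧
      Nat.card (S c ≃ₐ[K₁] S c) = n ∧ ∀ J ≤ S c, J ≠ ⊥ → y c ∈ J) ∧
    ∀ J : IntermediateField K₁ Ω, FiniteDimensional K₁ J → {c | y c ∈ J}.Finite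

/-- The approximation `x / D` to a root of `f`. -/
lemma exists_approx_root {A Ω : Type} [CommRing A] [Field Ω] (j : A →+* Ω) {t v : Ω}
    {R : Subring Ω} (h : TComplete t R) (hj : ∀ a, j a ∈ R) (hv : v ∈ R) {D U x w a b τ : A}
    (hDj : j D ≠ 0) (hτ : j τ = t)
    {m m₀ : ℕ} (hm : m₀ + 1 ≤ m) (hU : j U = t ^ m * v) (hD : U * a + D * b = τ ^ m₀)
    {f : Polynomial A} (hm' : m₀ * f.natDegree ≤ m)
    (hw : ∑ i ∈ Finset.range (f.natDegree + 1), f.coeff i * x ^ i * D ^ (f.natDegree - i) = U * w) :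
    t ^ m₀ * (j D)⁻¹ ∈ R ∧ t ^ m₀ * (j x / j D) ∈ R ∧
      ∃ r ∈ R, (f.map j).eval (j x / j D) = t ^ (m - m₀ * f.natDegree) * r := by
  have ht := h.ne_zero
  have hinv : t ^ m₀ * (j D)⁻¹ ∈ R := by
    obtain ⟨l, rfl⟩ := Nat.exists_eq_add_of_le hm
    have hr : t ^ l * v * j a ∈ R := R.mul_mem (R.mul_mem (R.pow_mem h.mem _) hv) (hj _)
    have h1 := congrArg j hD
    rw [map_add, map_mul, map_mul, map_pow, hU, hτ] at h1
    have h2 : j D * j b = t ^ m₀ * (1 - t * (t ^ l * v * j a)) := by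
      rw [← sub_eq_iff_eq_add'.2 h1.symm]; ring
    have h3 := h.one_sub_ne_zero hr
    have h4 : t ^ m₀ * (j D)⁻¹ = j b * (1 - t * (t ^ l * v * j a))⁻¹ := by
      rw [eq_mul_inv_iff_mul_eq₀ h3, mul_right_comm, ← h2, mul_comm (j D), mul_assoc,
        mul_inv_cancel₀ hDj, mul_one]
    rw [h4]
    exact R.mul_mem (hj _) (h.inv_mem hr)
  refine ⟨hinv, ?_, v * j w * (t ^ m₀ * (j D)⁻¹) ^ f.natDegree,
    R.mul_mem (R.mul_mem hv (hj _)) (R.pow_mem hinv _), ?_⟩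
  · rw [div_eq_mul_inv, mul_left_comm]
    exact R.mul_mem (hj _) hinv
  · have h1 := congrArg j hw
    rw [map_sum, map_mul, hU] at h1
    have h2 : (f.map j).eval (j x / j D) * j D ^ f.natDegree = t ^ m * v * j w := by
      rw [← h1, eval_map, eval₂_eq_sum_range, Finset.sum_mul]
      refine Finset.sum_congr rfl fun i hi => ?_
      have hi' : i ≤ f.natDegree := Nat.lt_succ_iff.1 (Finset.mem_range.1 hi)
      obtain ⟨l, hl⟩ := Nat.exists_eq_add_of_le hi'
      rw [hl, Nat.add_sub_cancel_left, map_mul, map_mul, map_pow, map_pow, div_pow, pow_add]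
      field_simp
    have h3 : t ^ m = t ^ (m - m₀ * f.natDegree) * (t ^ m₀) ^ f.natDegree := by
      rw [← pow_mul, ← pow_add, Nat.sub_add_cancel hm']
    rw [eq_div_of_mul_eq (pow_ne_zero _ hDj) h2, h3, mul_pow, inv_pow]
    field_simp

variable {k : Type} [Field k]

theorem exists_patchFrame {K : Type} [Field K] [Algebra (MvPowerSeries (Fin 2) k) K]
    [IsFractionRing (MvPowerSeries (Fin 2) k) K] {D : MvPowerSeries (Fin 2) k} (hD0 : D ≠ 0)
    (htD : MvPowerSeries.X 1 ∣ D) {f : Polynomial (MvPowerSeries (Fin 2) k)} (hf : f.Monic)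
    (hn : 0 < f.natDegree) (l : ℕ) :
    ∃ (Ω : Type) (_ : Field Ω) (_ : Algebra K Ω) (K₁ K₂ : IntermediateField K Ω)
      (R₁ R₂ : Subring Ω) (t : Ω) (m N : ℕ) (b₀ r₀ : Ω),
      PatchFrame k K₁ K₂ R₁ R₂ t D f l m N b₀ r₀ := by
  obtain ⟨x, U, hU, hd, hirr, hdvd, m₀, a, b, hab⟩ : ∃ (x : MvPowerSeries (Fin 2) k)
      (U : (PowerSeries k)[X]), IsDist U ∧ 0 < U.natDegree ∧ Irreducible U ∧
      polySeries U ∣ ∑ i ∈ Finset.range (f.natDegree + 1),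
        f.coeff i * x ^ i * D ^ (f.natDegree - i) ∧
      ∃ m a b, polySeries U * a + D * b = MvPowerSeries.X 1 ^ m := by
    have htD' : tPar k ∣ iterEquiv k D := by
      rw [tPar, ← iterEquiv_X_one]; exact map_dvd _ htD
    have hnd := hf.natDegree_map (iterEquiv k).toRingHom
    obtain ⟨x, U, hU, hd, hirr, hdvd, m, a, b, hab⟩ := exists_root_factor
      ((map_ne_zero_iff _ (iterEquiv k).injective).2 hD0) htD'
      (hf.map (iterEquiv k).toRingHom) (hnd.symm ▸ hn)
    refine ⟨(iterEquiv k).symm x, U, hU, hd, hirr, ?_, m, (iterEquiv k).symm a, (iterEquiv k).symm b, ?_⟩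
    · have h1 := map_dvd (iterEquiv k).symm hdvd
      rw [hnd, map_sum] at h1
      refine h1.trans (dvd_of_eq (Finset.sum_congr rfl fun i _ => ?_))
      rw [map_mul, map_mul, map_pow, map_pow, coeff_map]
      simp
    · apply (iterEquiv k).injective
      rw [map_add, map_mul, map_mul, map_pow, polySeries, iterEquiv_X_one]
      simpa using hab
  obtain ⟨w, hw⟩ := hdvd
  obtain ⟨m₁, hm₁⟩ := exists_irreducible_sub_lexMono hU.monic hirr
  obtain ⟨m, hmm₁, hmm₀, hmf, hmN⟩ : ∃ m, m₁ ≤ m ∧ m₀ + 1 ≤ m ∧ m₀ * f.natDegree ≤ m ∧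
      3 * (m₀ * l + m₀) + 2 ≤ m - m₀ * f.natDegree :=
    ⟨m₁ + (m₀ + 1) + m₀ * f.natDegree + (3 * (m₀ * l + m₀) + 2), by omega, by omega, by omega, by omega⟩
  haveI : Fact (Irreducible (lexPoly U m)) := ⟨hm₁ m hmm₁⟩
  have hP := lexPoly_monic hU.monic hd m
  obtain ⟨j, hjinj, hjr, hjC, hjX⟩ := exists_patchEmbedding hU hd m
  letI : Algebra K (AdjoinRoot (lexPoly U m)) := (IsFractionRing.lift hjinj).toAlgebra
  have hj : ∀ a, algebraMap K (AdjoinRoot (lexPoly U m)) (algebraMap _ K a) = j a := fun a =>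
    IsFractionRing.lift_algebraMap hjinj a
  have hF₁ : ∀ i, (lexPoly U m).coeff i ∈ lexFrac₁ k := fun i =>
    Subfield.subset_closure (coeff_lexPoly_mem U m i).1
  have hF₂ : ∀ i, (lexPoly U m).coeff i ∈ lexFrac₂ k m := fun i =>
    Subfield.subset_closure (coeff_lexPoly_mem U m i).2
  let K₁ : IntermediateField K (AdjoinRoot (lexPoly U m)) :=
    { polySubfield hP (lexFrac₁ k) hF₁ with
      algebraMap_mem' := algebraMap_mem_polySubfield hP hjr hj
        (fun c hc => Subfield.subset_closure hc.1) hF₁ }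
  let K₂ : IntermediateField K (AdjoinRoot (lexPoly U m)) :=
    { polySubfield hP (lexFrac₂ k m) hF₂ with
      algebraMap_mem' := algebraMap_mem_polySubfield hP hjr hj
        (fun c hc => Subfield.subset_closure hc.2) hF₂ }
  have hpr := (lex_patchRings k m).polyRing hP
    (fun i => (coeff_lexPoly_mem U m i).1) fun i => (coeff_lexPoly_mem U m i).2
  have ht := patch_X_one hjC
  have hjR : ∀ a, j a ∈ polyRing (lexPoly U m) (lexRing₁ k) := fun a => by
    have h1 : j a ∈ polyRing (lexPoly U m) (lexRing₁ k ⊓ lexRing₂ k m) := by rw [← hjr]; exact ⟨a, rfl⟩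
    exact polyRing_mono inf_le_left h1
  have hUj : j (polySeries U) = AdjoinRoot.of (lexPoly U m) (lexMono k 1 0) ^ m *
      AdjoinRoot.of (lexPoly U m) (lexMono k 0 1) := by
    rw [patch_polySeries hU.monic hjC hjX, ← map_pow, ← map_mul, lexMono_pow, lexMono_mul]
    simp
  obtain ⟨hinv, happrox, r₀, hr₀, hev⟩ := exists_approx_root j hpr.complete₁ hjR
    (of_mem_polyRing lexMono_zero_one_mem) ((map_ne_zero_iff _ hjinj).2 hD0) ht hmm₀ hUj hab hmf hw
  refine ⟨AdjoinRoot (lexPoly U m), inferInstance, inferInstance, K₁, K₂,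
    polyRing (lexPoly U m) (lexRing₁ k), polyRing (lexPoly U m) (lexRing₂ k m),
    AdjoinRoot.of (lexPoly U m) (lexMono k 1 0), m₀, m - m₀ * f.natDegree, j x / j D, r₀,
    patchData_of_embedding hU hd hP hjinj hjr hjC hjX hj (Nat.le_of_succ_le hmm₀) hab K₁ K₂ hF₁ hF₂
      (fun _ => Iff.rfl) (fun _ => Iff.rfl), hpr.complete₁, hpr.mem_of_mem, fun a => ?_, ?_, happrox,
    hr₀, ?_, hmN, fun n hn hζ => ?_⟩
  · rw [hj]; exact hjR a
  · rw [hj]; exact hinv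
  · rw [← hev]
    congr 2
    exact RingHom.ext hj
  · refine exists_cyclic_family (k := k) K₁ (fun c => ?_) (AdjoinRoot.root (lexPoly U m))
      (lexPoly U m).natDegree (fun u hu => ?_) hpr.complete₀ (fun c => ?_) (fun l hl => ?_)
      (fun α => ?_) hn hζ
    · exact of_mem_polyRing (P := lexPoly U m) (S := (lexFrac₁ k).toSubring) c.2
    · have hu' := mem_polySubfield.1 (show u ∈ polySubfield hP (lexFrac₁ k) hF₁ from hu)
      refine ⟨fun i => if h : i < (lexPoly U m).natDegree then ⟨_, hu' i h⟩ else 0, ?_⟩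
      conv_lhs => rw [polyCoord_eq_sum hP u]
      refine Finset.sum_congr rfl fun i hi => ?_
      dsimp only
      rw [dif_pos (Finset.mem_range.1 hi)]
      rfl
    · obtain ⟨r, hr, h⟩ := exists_lexRho_eq c
      refine ⟨_, of_mem_polyRing (P := lexPoly U m) hr, ?_⟩
      rw [← map_pow, ← map_mul, ← h]
      rfl
    · have h1 : (l : AdjoinRoot (lexPoly U m)) *
          AdjoinRoot.of (lexPoly U m) (lexBase k (PowerSeries.C (l : k)⁻¹)) = 1 := by
        have h2 : lexBase k (PowerSeries.C (l : k)) = (l : LexField k) := by simp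
        rw [← map_natCast (AdjoinRoot.of (lexPoly U m)), ← h2, ← map_mul, ← map_mul, ← map_mul,
          mul_inv_cancel₀ hl, map_one, map_one, map_one]
      rw [← eq_inv_of_mul_eq_one_right h1]
      exact of_mem_polyRing ((lex_patchRings k 0).le₁ (lexBase_mem 0 _).1)
    · obtain ⟨b, hb, z, hz, h⟩ := hpr.approx α 2
      exact ⟨-b, K₁.neg_mem hb, z, hz, by rw [h]; ring⟩

end PatchFrame

section IntegrallyClosed

open nonZeroDivisors

/-- A power series over the fraction field all of whose powers have denominator `r` has
coefficients in the base ring. -/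
lemma PowerSeries.coeff_mem_of_mul_pow_mem {S F : Type} [CommRing S] [IsDomain S]
    [IsIntegrallyClosed S] [IsNoetherianRing S] [Field F] [Algebra S F] [IsFractionRing S F]
    {r : PowerSeries S} (hr : r ≠ 0) {h : PowerSeries F}
    (H : ∀ n, ∃ s, PowerSeries.map (algebraMap S F) r * h ^ n = PowerSeries.map (algebraMap S F) s)
    (i : ℕ) : ∃ c : S, PowerSeries.coeff i h = algebraMap S F c := by
  set φ := PowerSeries.map (algebraMap S F) with hφ
  induction i using Nat.strong_induction_on with
  | _ i ih =>
    choose! c hc using ih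
    let l : PowerSeries S := PowerSeries.mk fun j => if j < i then c j else 0
    obtain ⟨u, hu⟩ : PowerSeries.X ^ i ∣ h - φ l := PowerSeries.X_pow_dvd_iff.2 fun j hj => by
      rw [map_sub, hφ, PowerSeries.coeff_map, PowerSeries.coeff_mk, if_pos hj, hc j hj, sub_self]
    have h1 : ∀ n, ∃ s, φ r * (h - φ l) ^ n = φ s := fun n => by
      rw [sub_eq_add_neg, add_pow, Finset.mul_sum]
      choose s hs using H
      refine ⟨∑ m ∈ Finset.range (n + 1), s m * (-l) ^ (n - m) * (n.choose m : PowerSeries S), ?_⟩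
      rw [map_sum]
      refine Finset.sum_congr rfl fun m _ => ?_
      rw [map_mul, map_mul, map_pow, map_neg, map_natCast, ← hs]
      ring
    have hcoeff : PowerSeries.coeff i h = PowerSeries.constantCoeff u := by
      have h2 := congrArg (PowerSeries.coeff i) hu
      have h3 := PowerSeries.coeff_X_pow_mul u i 0
      rw [zero_add] at h3
      rw [map_sub, hφ, PowerSeries.coeff_map, PowerSeries.coeff_mk, if_neg (lt_irrefl i), map_zero,
        sub_zero, h3] at h2
      rw [h2, PowerSeries.coeff_zero_eq_constantCoeff_apply]
    have hr' := PowerSeries.X_pow_order_mul_divXPowOrder (f := r)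
    have hr0 : PowerSeries.constantCoeff r.divXPowOrder ≠ 0 := by
      rwa [Ne, PowerSeries.constantCoeff_divXPowOrder_eq_zero_iff]
    have h4 : IsAlmostIntegral S (PowerSeries.constantCoeff u) := by
      refine ⟨_, mem_nonZeroDivisors_of_ne_zero hr0, fun n => ?_⟩
      obtain ⟨s, hs⟩ := h1 n
      have h5 : φ r * (h - φ l) ^ n =
          PowerSeries.X ^ (r.order.toNat + i * n) * (φ r.divXPowOrder * u ^ n) := by
        conv_lhs => rw [← hr']
        rw [hu, map_mul, map_pow, hφ, PowerSeries.map_X]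
        ring
      have h6 := congrArg (PowerSeries.coeff (0 + (r.order.toNat + i * n))) (h5.symm.trans hs)
      rw [PowerSeries.coeff_X_pow_mul, hφ, PowerSeries.coeff_map,
        PowerSeries.coeff_zero_eq_constantCoeff_apply, map_mul, map_pow,
        ← PowerSeries.coeff_zero_eq_constantCoeff_apply, PowerSeries.coeff_map,
        PowerSeries.coeff_zero_eq_constantCoeff_apply] at h6
      exact ⟨_, by rw [Algebra.smul_def, h6]⟩
    obtain ⟨c, hc⟩ := (isIntegrallyClosed_iff F).1 inferInstance h4.isIntegral
    exact ⟨c, hcoeff.trans hc.symm⟩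

theorem PowerSeries.isIntegrallyClosed_of_isNoetherianRing (S : Type) [CommRing S] [IsDomain S]
    [IsIntegrallyClosed S] [IsNoetherianRing S] : IsIntegrallyClosed (PowerSeries S) := by
  let F := FractionRing S
  let φ := PowerSeries.map (algebraMap S F)
  have hφ : Function.Injective φ := PowerSeries.map_injective _ (IsFractionRing.injective S F)
  let Λ := FractionRing (PowerSeries F)
  let ψ : PowerSeries S →+* Λ := (algebraMap (PowerSeries F) Λ).comp φ
  have hψ : Function.Injective ψ :=
    (IsFractionRing.injective (PowerSeries F) Λ).comp hφ
  let Φ : FractionRing (PowerSeries S) →+* Λ := IsFractionRing.lift hψ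
  have hΦ : ∀ a, Φ (algebraMap _ _ a) = algebraMap _ Λ (φ a) := IsFractionRing.lift_algebraMap hψ
  refine (isIntegrallyClosed_iff (FractionRing (PowerSeries S))).2 fun {x} hx => ?_
  have hx' : IsIntegral (PowerSeries F) (Φ x) := by
    obtain ⟨p, hp, h⟩ := hx
    refine ⟨p.map φ, hp.map φ, ?_⟩
    rw [Polynomial.eval₂_map]
    have h1 := congrArg Φ h
    rw [map_zero, Polynomial.hom_eval₂] at h1
    rwa [show (algebraMap (PowerSeries F) Λ).comp φ = Φ.comp (algebraMap _ _) from
      RingHom.ext fun a => (hΦ a).symm]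
  obtain ⟨h, hh⟩ := (isIntegrallyClosed_iff Λ).1 inferInstance hx'
  obtain ⟨r, hr, hr'⟩ := hx.isAlmostIntegral
  have H : ∀ n, ∃ s, φ r * h ^ n = φ s := fun n => by
    obtain ⟨s, hs⟩ := hr' n
    refine ⟨s, IsFractionRing.injective (PowerSeries F) Λ ?_⟩
    rw [map_mul, map_pow, hh, ← hΦ, ← hΦ, hs, Algebra.smul_def, map_mul, map_pow]
  choose c hc using PowerSeries.coeff_mem_of_mul_pow_mem (F := F) (nonZeroDivisors.ne_zero hr) H
  refine ⟨PowerSeries.mk c, Φ.injective ?_⟩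
  rw [hΦ, ← hh]
  congr 1
  ext i
  rw [PowerSeries.coeff_map, PowerSeries.coeff_mk, hc]

instance (k : Type) [Field k] : IsIntegrallyClosed (MvPowerSeries (Fin 2) k) :=
  haveI := PowerSeries.isIntegrallyClosed_of_isNoetherianRing (PowerSeries k)
  IsIntegrallyClosed.of_equiv (iterEquiv k).symm

end IntegrallyClosed

section PatchFamily

open Polynomial IntermediateField Cardinal

lemma HasPatchFamily.of_algHom {A K M L : Type} [CommRing A] [Field K] [Algebra A K] [Field M]
    [Algebra K M] [Field L] [Algebra K L] (e : M →ₐ[K] L) {D : A} {n : ℕ}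
    (h : HasPatchFamily A K L D n) : HasPatchFamily A K M D n := by
  obtain ⟨Ω, _, _, K₁, K₂, R, D', i, I, S, y, h1, h2, h3, h4, h5⟩ := h
  exact ⟨Ω, _, _, K₁, K₂, R, D', i.comp e, I, S, y, h1, h2, h3, fun m => h4 _, h5⟩

lemma exists_separable_extension_with_root (K M : Type) [Field K] [Field M] [Algebra K M]
    [FiniteDimensional K M] [Algebra.IsSeparable K M] (n : ℕ) :
    ∃ (L : Type) (_ : Field L) (_ : Algebra K L) (_ : M →ₐ[K] L),
      FiniteDimensional K L ∧ Algebra.IsSeparable K L ∧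
      ((n : M) ≠ 0 → ∃ ζ : L, IsPrimitiveRoot ζ n) := by
  by_cases hn : (n : M) = 0
  · exact ⟨M, _, _, AlgHom.id K M, inferInstance, inferInstance, fun h => (h hn).elim⟩
  · haveI : NeZero (n : M) := ⟨hn⟩
    haveI : NeZero n := ⟨fun h => hn (by simp [h])⟩
    obtain ⟨L, _, _, _, _, h⟩ : ∃ (L : Type) (_ : Field L) (_ : Algebra M L),
        FiniteDimensional M L ∧ Algebra.IsSeparable M L ∧ ∃ ζ : L, IsPrimitiveRoot ζ n :=
      ⟨CyclotomicField n M, inferInstance, inferInstance,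
        IsCyclotomicExtension.finiteDimensional {n} M _, IsCyclotomicExtension.isSeparable {n} M _,
        _, IsCyclotomicExtension.zeta_spec n M _⟩
    letI : Algebra K L := ((algebraMap M L).comp (algebraMap K M)).toAlgebra
    haveI : IsScalarTower K M L := IsScalarTower.of_algebraMap_eq fun _ => rfl
    exact ⟨L, inferInstance, inferInstance, IsScalarTower.toAlgHom K M L,
      FiniteDimensional.trans K M L, Algebra.IsSeparable.trans K M L, fun _ => h⟩

end PatchFamily

section PatchFamilyExistence

open Polynomial IntermediateField Cardinal

/-- A Bézout identity with cleared denominators. -/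
lemma exists_bezout_of_separable_map {A K : Type} [CommRing A] [IsDomain A] [Field K] [Algebra A K]
    [IsFractionRing A K] {f : A[X]} (hf : (f.map (algebraMap A K)).Separable) :
    ∃ (a b : A[X]) (Δ : A), Δ ≠ 0 ∧ a * f + b * derivative f = C Δ := by
  obtain ⟨u, v, h⟩ := hf
  obtain ⟨c, hc⟩ := IsLocalization.integerNormalization_map_to_map (nonZeroDivisors A) u
  obtain ⟨d, hd⟩ := IsLocalization.integerNormalization_map_to_map (nonZeroDivisors A) v
  refine ⟨C d.1 * IsLocalization.integerNormalization (nonZeroDivisors A) u,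
    C c.1 * IsLocalization.integerNormalization (nonZeroDivisors A) v, c.1 * d.1,
    mul_ne_zero (nonZeroDivisors.ne_zero c.2) (nonZeroDivisors.ne_zero d.2),
    Polynomial.map_injective _ (IsFractionRing.injective A K) ?_⟩
  have hs : ∀ (c : A) (p : K[X]), c • p = C (algebraMap A K c) * p := fun c p => by
    rw [← algebraMap_smul K c p, Polynomial.smul_eq_C_mul]
  rw [hs] at hc hd
  simp only [Polynomial.map_add, Polynomial.map_mul, Polynomial.map_C, map_mul, hc, hd,
    ← Polynomial.derivative_map]
  linear_combination (C (algebraMap A K c.1) * C (algebraMap A K d.1)) * h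

/-- A finite separable extension has an integral primitive element. -/
lemma exists_integral_primitive_element (A K M : Type) [CommRing A] [IsDomain A] [Field K]
    [Algebra A K] [IsFractionRing A K] [Field M] [Algebra K M] [Algebra A M] [IsScalarTower A K M]
    [FiniteDimensional K M] [Algebra.IsSeparable K M] :
    ∃ β : M, IsIntegral A β ∧ K⟮β⟯ = ⊤ := by
  obtain ⟨α, hα⟩ := Field.exists_primitive_element K M
  have h : IsAlgebraic A α :=
    (IsFractionRing.isAlgebraic_iff A K M).2 (Algebra.IsAlgebraic.isAlgebraic α)
  obtain ⟨y, hy, h_integral⟩ := h.exists_integral_multiple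
  refine ⟨y • α, h_integral, ?_⟩
  have hy' : algebraMap A K y ≠ 0 := by
    rwa [Ne, FaithfulSMul.algebraMap_eq_zero_iff]
  have h1 := mem_adjoin_simple_self K (y • α)
  rw [eq_top_iff, ← hα, adjoin_simple_le_iff]
  have h2 := IntermediateField.smul_mem _ (x := (algebraMap A K y)⁻¹) h1
  rw [← algebraMap_smul K y α] at h2 ⊢
  rwa [inv_smul_smul₀ hy'] at h2

/-- Roots of the minimal polynomial of a primitive element give embeddings. -/
lemma exists_algHom_of_root {K M Ω : Type} [Field K] [Field M] [Algebra K M] [Field Ω] [Algebra K Ω]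
    [FiniteDimensional K M] {β : M} (hβ : K⟮β⟯ = ⊤) {K₁ : IntermediateField K Ω} {y : Ω}
    (hy : aeval y (minpoly K β) = 0) (hy₁ : y ∈ K₁) : ∃ i : M →ₐ[K] Ω, ∀ m, i m ∈ K₁ := by
  have h_integral : IsIntegral K β := Algebra.IsIntegral.isIntegral β
  obtain ⟨j, hj⟩ : ∃ j : K⟮β⟯ →ₐ[K] Ω, j (AdjoinSimple.gen K β) = y :=
    ⟨_, adjoin.powerBasis h_integral |>.lift_gen y (by rwa [adjoin.powerBasis_gen, minpoly_gen])⟩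
  let e : M ≃ₐ[K] K⟮β⟯ := (topEquiv.symm.trans (equivOfEq hβ.symm))
  refine ⟨j.comp e.toAlgHom, fun m => ?_⟩
  have h : K⟮β⟯ ≤ (K₁.comap (j.comp e.toAlgHom)) := by
    rw [adjoin_simple_le_iff]
    change j (e β) ∈ K₁
    rwa [show e β = AdjoinSimple.gen K β from rfl, hj]
  exact h (hβ.symm ▸ mem_top (x := m))

lemma exists_integral_primitive_bezout (A K M : Type) [CommRing A] [IsDomain A]
    [IsIntegrallyClosed A] [Field K] [Algebra A K] [IsFractionRing A K] [Field M] [Algebra K M]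
    [FiniteDimensional K M] [Algebra.IsSeparable K M] :
    ∃ (β : M) (f a b : A[X]) (Δ : A), K⟮β⟯ = ⊤ ∧ minpoly K β = f.map (algebraMap A K) ∧ f.Monic ∧
      0 < f.natDegree ∧ Δ ≠ 0 ∧ a * f + b * derivative f = C Δ := by
  letI : Algebra A M := ((algebraMap K M).comp (algebraMap A K)).toAlgebra
  haveI : IsScalarTower A K M := IsScalarTower.of_algebraMap_eq fun _ => rfl
  obtain ⟨β, hβ, htop⟩ := exists_integral_primitive_element A K M
  have hmin : minpoly K β = (minpoly A β).map (algebraMap A K) :=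
    minpoly.isIntegrallyClosed_eq_field_fractions' K hβ
  obtain ⟨a, b, Δ, hΔ, h⟩ := exists_bezout_of_separable_map
    (hmin ▸ Algebra.IsSeparable.isSeparable K β : ((minpoly A β).map (algebraMap A K)).Separable)
  exact ⟨β, minpoly A β, a, b, Δ, htop, hmin, minpoly.monic hβ, minpoly.natDegree_pos hβ, hΔ, h⟩

/-- Patching data with a large supply of cyclic extensions over a neighbourhood on which `M`
splits. -/
lemma PatchFrame.hasPatchFamily {k A K M Ω : Type} [Field k] [CommRing A] [IsDomain A] [Field K]
    [Algebra A K] [IsFractionRing A K] [Field M] [Algebra K M] [FiniteDimensional K M] [Field Ω]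
    [Algebra K Ω]
    {K₁ K₂ : IntermediateField K Ω} {R₁ R₂ : Subring Ω} {t : Ω} {τ D Δ : A} {f a b : A[X]}
    {l m N : ℕ} {b₀ r₀ : Ω} (h : PatchFrame k K₁ K₂ R₁ R₂ t (τ * Δ * D) f l m N b₀ r₀)
    (hD : τ * Δ * D ≠ 0) {β : M} (hβ : K⟮β⟯ = ⊤) (hmin : minpoly K β = f.map (algebraMap A K))
    (hbez : a * f + b * derivative f = C Δ) (hfl : f.natDegree ≤ l) (hal : a.natDegree ≤ l)
    (hbl : b.natDegree ≤ l) (hcard : #(PowerSeries k) = #K) {n : ℕ} (hn : IsPrimePow n)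
    (hζ : (n : k) ≠ 0 → ∃ ζ : M, IsPrimitiveRoot ζ n) : HasPatchFamily A K M D n := by
  let j : A →+* Ω := (algebraMap K Ω).comp (algebraMap A K)
  have hj : ∀ a, j a ∈ R₁ := h.algebraMap_mem
  have hj0 : ∀ {a}, a ≠ 0 → j a ≠ 0 := fun {a} ha => by
    have h1 : algebraMap A K a ≠ 0 := by rwa [Ne, FaithfulSMul.algebraMap_eq_zero_iff]
    exact (_root_.map_ne_zero (algebraMap K Ω)).2 h1
  have hc : ∀ (p : A[X]) i, (p.map j).coeff i ∈ R₁ := fun p i => by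
    rw [coeff_map]; exact hj _
  have hΔ0 : Δ ≠ 0 := fun h0 => hD (by simp [h0])
  have hτD : τ * D ≠ 0 := fun h0 => hD (by rw [mul_right_comm, h0, zero_mul])
  have hinv : t ^ m * (j Δ)⁻¹ ∈ R₁ := by
    have h1 : t ^ m * (j Δ)⁻¹ = t ^ m * (j (τ * Δ * D))⁻¹ * j (τ * D) := by
      rw [mul_right_comm τ, map_mul j (τ * D), mul_inv_rev, mul_assoc, mul_assoc,
        inv_mul_cancel₀ (hj0 hτD), mul_one]
    rw [h1]
    exact R₁.mul_mem h.inv_mem (hj _)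
  obtain ⟨y, hy, hyR⟩ := h.complete.exists_root (hc f) (hc a) (hc b)
    ((natDegree_map_le).trans hfl) (natDegree_map_le.trans hal) (natDegree_map_le.trans hbl)
    (hj0 hΔ0) (by
      have := congrArg (Polynomial.map j) hbez
      rwa [Polynomial.map_add, Polynomial.map_mul, Polynomial.map_mul, Polynomial.map_C,
        ← derivative_map] at this) hinv h.approx_mem h.rem_mem h.eval_eq h.le
  have hyK : y ∈ K₁ := by
    have h1 := K₁.mul_mem (K₁.inv_mem (pow_mem (h.mem₁ _ h.complete.mem) m)) (h.mem₁ _ hyR)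
    rwa [inv_mul_cancel_left₀ (pow_ne_zero _ h.complete.ne_zero)] at h1
  obtain ⟨i, hi⟩ := exists_algHom_of_root hβ (y := y) (by
    rw [hmin, aeval_def, ← eval_map, Polynomial.map_map]; exact hy) hyK
  obtain ⟨I, S, z, hI, hS, hz⟩ := h.exists_family n hn fun hn0 => by
    obtain ⟨ζ, hζ⟩ := hζ hn0
    have h1 : IsPrimitiveRoot (i ζ) n := hζ.map_of_injective i.injective
    exact ⟨⟨i ζ, hi ζ⟩, IsPrimitiveRoot.of_map_of_injective (f := K₁.val) h1 K₁.val.injective⟩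
  exact ⟨Ω, _, _, K₁, K₂, R₂, τ * Δ * D, i, I, S, z, Dvd.intro_left _ rfl, hD, h.patchData, hi,
    hI.trans hcard, hS, hz⟩

theorem hasPatchFamily {k K M : Type} [Field k] [Field K] [Algebra (MvPowerSeries (Fin 2) k) K]
    [IsFractionRing (MvPowerSeries (Fin 2) k) K] [Field M] [Algebra K M] [FiniteDimensional K M]
    [Algebra.IsSeparable K M] {D : MvPowerSeries (Fin 2) k} (hD : D ≠ 0) {n : ℕ}
    (hn : IsPrimePow n) : HasPatchFamily (MvPowerSeries (Fin 2) k) K M D n := by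
  haveI : IsDomain (MvPowerSeries (Fin 2) k) := NoZeroDivisors.to_isDomain _
  obtain ⟨L, _, _, e, _, _, hζ⟩ := exists_separable_extension_with_root K M n
  refine HasPatchFamily.of_algHom e ?_
  obtain ⟨β, f, a, b, Δ, hβ, hmin, hf, hf0, hΔ, hbez⟩ :=
    exists_integral_primitive_bezout (MvPowerSeries (Fin 2) k) K L
  have hX : (MvPowerSeries.X 1 : MvPowerSeries (Fin 2) k) ≠ 0 := fun h0 => by
    have := congrArg (MvPowerSeries.coeff (Finsupp.single 1 1)) h0
    rw [MvPowerSeries.coeff_X] at this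
    simp at this
  have hD' := mul_ne_zero (mul_ne_zero hX hΔ) hD
  obtain ⟨Ω, _, _, K₁, K₂, R₁, R₂, t, m, N, b₀, r₀, h⟩ := exists_patchFrame (K := K) hD'
    (Dvd.intro _ (mul_assoc _ _ _).symm) hf hf0 (f.natDegree ⊔ (a.natDegree ⊔ b.natDegree))
  refine h.hasPatchFamily hD' hβ hmin hbez le_sup_left (le_sup_left.trans le_sup_right)
    (le_sup_right.trans le_sup_right) ?_ hn fun hn0 => hζ ?_
  · rw [mk_powerSeries, ← mk_mvPowerSeries]
    exact (IsFractionRing.cardinalMk (MvPowerSeries (Fin 2) k) K).symm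
  · let g : k →+* M := ((algebraMap K M).comp (algebraMap (MvPowerSeries (Fin 2) k) K)).comp
      (MvPowerSeries.C)
    rw [← map_natCast g]
    exact (_root_.map_ne_zero g).2 hn0

end PatchFamilyExistence

section PrimesOver

open scoped Pointwise
open Polynomial

variable {B C N : Type} [CommRing B] [CommRing C] [Algebra B C] [Group N] [Finite N]
  [MulSemiringAction N C] [SMulCommClass N B C] [Algebra.IsInvariant B C N]

lemma Ideal.card_primes_over_of_stabilizer_trivial (hinj : Function.Injective (algebraMap B C))
    (q : Ideal B) [q.IsPrime]
    (h : ∀ Q : Ideal C, Q.IsPrime → Q.under B = q → ∀ σ : N, σ • Q = Q → σ = 1) :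
    Nat.card {Q : Ideal C // Q.IsPrime ∧ Q.under B = q} = Nat.card N := by
  haveI : Algebra.IsIntegral B C := Algebra.IsInvariant.isIntegral B C N
  obtain ⟨Q₀, -, hQ₀, hQ₀q⟩ := Ideal.exists_ideal_over_prime_of_isIntegral q (⊥ : Ideal C)
    (((RingHom.injective_iff_ker_eq_bot _).1 hinj).le.trans bot_le)
  refine (Nat.card_congr (Equiv.ofBijective (fun σ : N => (⟨σ • Q₀, inferInstance,
    (Ideal.under_smul B Q₀ σ).trans hQ₀q⟩ : {Q : Ideal C // Q.IsPrime ∧ Q.under B = q}))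
    ⟨fun σ τ hστ => ?_, fun ⟨Q, hQ, hQq⟩ => ?_⟩)).symm
  · have h1 : σ • Q₀ = τ • Q₀ := congrArg Subtype.val hστ
    exact inv_mul_eq_one.1 (h Q₀ hQ₀ hQ₀q _ (by rw [mul_smul, h1, inv_smul_smul])) |>.symm
  · obtain ⟨g, hg⟩ := Algebra.IsInvariant.exists_smul_of_under_eq B C N Q₀ Q (hQ₀q.trans hQq.symm)
    exact ⟨g, Subtype.ext hg.symm⟩

/-- A prime of height at most one does not lie over a maximal ideal of height at least two. -/
lemma Ideal.not_isMaximal_under (N : Type) [Group N] [Finite N]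
    [MulSemiringAction N C] [SMulCommClass N B C] [Algebra.IsInvariant B C N]
    (hinj : Function.Injective (algebraMap B C))
    (hB : ∀ m : Ideal B, m.IsMaximal → ∃ p, p.IsPrime ∧ p ≠ ⊥ ∧ p < m)
    (q : Ideal C) [q.IsPrime] (hq : ∀ p : Ideal C, p.IsPrime → p < q → p = ⊥) :
    ¬ (q.under B).IsMaximal := by
  intro hmax
  haveI : Algebra.IsIntegral B C := Algebra.IsInvariant.isIntegral B C N
  have hker := (RingHom.injective_iff_ker_eq_bot _).1 hinj
  obtain ⟨p, hp, hp0, hpm⟩ := hB _ hmax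
  obtain ⟨q₀, -, hq₀, hq₀p⟩ := Ideal.exists_ideal_over_prime_of_isIntegral p (⊥ : Ideal C)
    (hker.le.trans bot_le)
  obtain ⟨q₁, hle, hq₁, hq₁m⟩ := Ideal.exists_ideal_over_prime_of_isIntegral (q.under B) q₀
    (by rw [hq₀p]; exact hpm.le)
  obtain ⟨g, hg⟩ := Algebra.IsInvariant.exists_smul_of_under_eq B C N q₁ q hq₁m
  have h1 : (g • q₀).under B = p := (Ideal.under_smul B q₀ g).trans hq₀p
  have h2 : g • q₀ ≤ q := by rw [hg]; exact Ideal.pointwise_smul_le_pointwise_smul_iff.2 hle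
  have h3 : g • q₀ = ⊥ := by
    refine hq _ inferInstance (lt_of_le_of_ne h2 fun h => ?_)
    rw [h] at h1
    exact hpm.ne h1.symm
  rw [h3] at h1
  exact hp0 (h1.symm.trans hker)

lemma mem_of_conjPoly_coeff_mem {Δ : Type} [Finite Δ] {Q : Ideal C} [Q.IsPrime] {u : Δ → C}
    (h : ∀ i < Nat.card Δ, (conjPoly u).coeff i ∈ Q) (δ : Δ) : u δ ∈ Q := by
  haveI : Nontrivial C := ⟨⟨0, 1, fun h0 => ‹Q.IsPrime›.ne_top
    ((Ideal.eq_top_iff_one Q).2 (h0 ▸ Q.zero_mem))⟩⟩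
  have h1 := conjPoly_eval u δ
  rw [(conjPoly_monic u).as_sum, eval_add, eval_pow, eval_X, eval_finset_sum,
    conjPoly_natDegree] at h1
  refine ‹Q.IsPrime›.mem_of_pow_mem (Nat.card Δ) ?_
  rw [eq_neg_of_add_eq_zero_left h1]
  refine Q.neg_mem (Q.sum_mem fun i hi => ?_)
  rw [eval_mul, eval_C]
  exact Q.mul_mem_right _ (h i (Finset.mem_range.1 hi))

lemma conjPoly_coeff_mem_of_mem {Δ : Type} [Finite Δ] {Q : Ideal C} [Q.IsPrime] {u : Δ → C}
    (h : ∀ δ, u δ ∈ Q) {i : ℕ} (hi : i < Nat.card Δ) : (conjPoly u).coeff i ∈ Q := by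
  rw [← Ideal.Quotient.eq_zero_iff_mem, ← coeff_map, map_conjPoly]
  simp only [fun δ => Ideal.Quotient.eq_zero_iff_mem.2 (h δ)]
  rw [conjPoly_zero, coeff_X_pow, if_neg hi.ne]

end PrimesOver

section Split

open scoped Pointwise
open Polynomial

variable {A K M B Δ : Type} [CommRing A] [Field K] [Algebra A K] [Field M] [Algebra K M]
  [Group Δ] [Finite Δ] [CommRing B] [Algebra A B] [Algebra B M] [Algebra A M]
  [IsScalarTower A K M] [IsScalarTower A B M] [IsIntegralClosure B A M] [MulSemiringAction Δ B]
  {e : Δ →* (M ≃ₐ[K] M)}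

/-- Elements of `N` fixing a prime over `p` are trivial. -/
lemma SplitElt.eq_one_of_smul_eq (he : ∀ δ (b : B), algebraMap B M (δ • b) = e δ (algebraMap B M b))
    {N : Subgroup Δ} [hN : N.Normal] {p : Ideal A} (h : SplitElt A e N p) {Q : Ideal B} [Q.IsPrime]
    (hQ : Q.under A = p) {σ : Δ} (hσ : σ ∈ N) (hσQ : σ • Q = Q) : σ = 1 := by
  obtain ⟨a₀, h1, ⟨i, hi, c, hc, hic⟩, h3⟩ := h
  have hinj : Function.Injective (algebraMap B M) := IsIntegralClosure.algebraMap_injective B A M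
  have hA : ∀ x, algebraMap K M (algebraMap A K x) = algebraMap B M (algebraMap A B x) := fun x => by
    rw [← IsScalarTower.algebraMap_apply, ← IsScalarTower.algebraMap_apply]
  have hmem : ∀ x ∈ p, algebraMap A B x ∈ Q := fun x hx => by rw [← hQ] at hx; exact hx
  have h_integral : IsIntegral A a₀ := by
    obtain ⟨q, hq, -, hmon⟩ := lifts_and_natDegree_eq_and_monic (f := algebraMap A M)
      ((lifts_iff_coeff_lifts _).2 fun n => by
        obtain ⟨c, hc⟩ := h1 n
        exact ⟨c, by rw [hc, ← IsScalarTower.algebraMap_apply]⟩)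
      (conjPoly_monic fun δ => e δ a₀)
    refine ⟨q, hmon, ?_⟩
    have h4 := conjPoly_eval (fun δ => e δ a₀) 1
    rw [map_one, AlgEquiv.one_apply, ← hq, eval_map] at h4
    exact h4
  obtain ⟨a, rfl⟩ := IsIntegralClosure.isIntegral_iff (A := B) |>.1 h_integral
  have hcoeff : ∀ (b : B) n x, (conjPoly fun δ => e δ (algebraMap B M b)).coeff n =
      algebraMap K M (algebraMap A K x) →
      (conjPoly fun δ : Δ => δ • b).coeff n = algebraMap A B x := fun b n x hx => by
    apply hinj
    rw [← hA, ← hx, ← coeff_map, map_conjPoly]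
    simp only [he]
  obtain ⟨γ, hγ⟩ : ∃ γ : Δ, γ • a ∉ Q := by
    by_contra! hall
    refine hc ?_
    rw [← hQ, Ideal.mem_comap, ← hcoeff a i c hic]
    exact conjPoly_coeff_mem_of_mem hall hi
  by_contra hσ1
  have hτ : γ⁻¹ * σ * γ ∈ N := by simpa using hN.conj_mem σ hσ γ⁻¹
  have hτ1 : γ⁻¹ * σ * γ ≠ 1 := fun h => hσ1 (by simpa using (conj_eq_one_iff (a := γ⁻¹)).1 (by
    simpa using h))
  have h5 : γ • (a * (γ⁻¹ * σ * γ) • a) ∈ Q :=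
    mem_of_conjPoly_coeff_mem (u := fun δ : Δ => δ • (a * (γ⁻¹ * σ * γ) • a)) (fun i hi => by
      obtain ⟨x, hx, hx'⟩ := h3 _ hτ hτ1 i hi
      rw [hcoeff _ i x (by rw [map_mul, he]; exact hx')]
      exact hmem x hx) γ
  rw [smul_mul', smul_smul, ← mul_assoc, mul_inv_cancel_left] at h5
  rcases ‹Q.IsPrime›.mem_or_mem h5 with h6 | h6
  · exact hγ h6
  · rw [← hσQ, mul_smul, Ideal.smul_mem_pointwise_smul_iff] at h6
    exact hγ h6

end Split

section Ramification

open scoped Pointwise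
open Polynomial IntermediateField

/-- The primes of the integral closure with non-trivial inertia all contain some nonzero element
of the base ring. -/
lemma exists_mem_of_inertia_ne_bot (A K L : Type) [CommRing A] [IsDomain A] [Field K] [Algebra A K]
    [IsFractionRing A K] [Field L] [Algebra K L] [Algebra A L] [IsScalarTower A K L]
    [FiniteDimensional K L] [Algebra.IsSeparable K L] :
    ∃ D : A, D ≠ 0 ∧ ∀ q : Ideal (integralClosure A L), (∃ σ : L ≃ₐ[K] L, σ ≠ 1 ∧
      ∀ b ∈ integralClosure A L, σ b - b ∈ Subtype.val '' (q : Set (integralClosure A L))) →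
      D ∈ q.under A := by
  classical
  obtain ⟨β, hβ, htop⟩ := exists_integral_primitive_element A K L
  let δ : (L ≃ₐ[K] L) → integralClosure A L := fun σ =>
    ⟨σ β - β, ((hβ.map (σ.restrictScalars A))).sub hβ⟩
  have hδ : ∏ σ ∈ Finset.univ.erase (1 : L ≃ₐ[K] L), δ σ ≠ 0 := by
    rw [Finset.prod_ne_zero_iff]
    intro σ hσ h0
    refine Finset.ne_of_mem_erase hσ ?_
    have h1 : σ β = β := sub_eq_zero.1 (congrArg Subtype.val h0)
    have h2 : K⟮β⟯ ≤ fixedField (Subgroup.zpowers σ) := by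
      rw [adjoin_simple_le_iff]
      rintro ⟨τ, n, rfl⟩
      change (σ ^ n) β = β
      exact (MulAction.stabilizer (L ≃ₐ[K] L) β).zpow_mem h1 n
    ext x
    have h3 : x ∈ fixedField (Subgroup.zpowers σ) := h2 (htop.symm ▸ mem_top)
    exact h3 ⟨σ, Subgroup.mem_zpowers σ⟩
  have halg : IsAlgebraic A (∏ σ ∈ Finset.univ.erase (1 : L ≃ₐ[K] L), δ σ) :=
    (Algebra.IsIntegral.isIntegral _).isAlgebraic
  obtain ⟨D, hD, hdvd⟩ := halg.exists_nonzero_dvd (mem_nonZeroDivisors_of_ne_zero hδ)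
  refine ⟨D, hD, fun q ⟨σ, hσ, h⟩ => ?_⟩
  obtain ⟨x, hx, hx'⟩ := h β hβ
  have h1 : δ σ ∈ q := by rwa [show δ σ = x from Subtype.ext hx'.symm]
  exact q.mem_of_dvd ((Finset.dvd_prod_of_mem δ
    (Finset.mem_erase.2 ⟨hσ, Finset.mem_univ σ⟩)).trans hdvd) h1

variable {A K : Type} [CommRing A] [IsDomain A] [IsIntegrallyClosed A] [Field K] [Algebra A K]
  [IsFractionRing A K]

/-- A prime of height at most one in an integral closure does not lie over a maximal ideal of
height at least two. -/
lemma not_isMaximal_under_integralClosure {L : Type} [Field L] [Algebra K L] [Algebra A L]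
    [IsScalarTower A K L] [FiniteDimensional K L] [IsGalois K L]
    (hA : ∀ m : Ideal A, m.IsMaximal → ∃ p, p.IsPrime ∧ p ≠ ⊥ ∧ p < m)
    (q : Ideal (integralClosure A L)) [q.IsPrime]
    (hq : ∀ p : Ideal (integralClosure A L), p.IsPrime → p < q → p = ⊥) :
    ¬ (q.under A).IsMaximal := by
  haveI : IsFractionRing (integralClosure A L) L :=
    integralClosure.isFractionRing_of_finite_extension K L
  letI := IsIntegralClosure.MulSemiringAction A K L (integralClosure A L)
  haveI := Algebra.isInvariant_of_isGalois A K L (integralClosure A L)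
  haveI : SMulCommClass (L ≃ₐ[K] L) A (integralClosure A L) :=
    ⟨fun σ a b => map_smul (galRestrict A K L (integralClosure A L) σ) a b⟩
  refine Ideal.not_isMaximal_under (L ≃ₐ[K] L) ?_ hA q hq
  have h1 : Function.Injective (algebraMap A L) := by
    rw [IsScalarTower.algebraMap_eq A K L]
    exact (algebraMap K L).injective.comp (IsFractionRing.injective A K)
  exact Function.Injective.of_comp (f := algebraMap (integralClosure A L) L) h1

variable {C : Type} [Field C] [Algebra K C] {L M : IntermediateField K C} [Algebra A L]
  [IsScalarTower A K L] [Algebra A M] [IsScalarTower A K M]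

/-- Primes of `L` at which the splitting condition holds are totally split in `M`. -/
lemma card_primes_over_eq_relfinrank {Γ G : Type} [Group Γ] [Group G] [Finite Γ] [IsGalois K M]
    [FiniteDimensional K M] [IsGalois K L] {f : Γ →* G} (hf : Function.Surjective f)
    (eG : G ≃* (L ≃ₐ[K] L)) (hLM : L ≤ M) (e : Γ ≃* (M ≃ₐ[K] M))
    (he : ∀ δ l, e δ (inclusion hLM l) = inclusion hLM (eG (f δ) l))
    (q : Ideal (integralClosure A L)) [q.IsPrime]
    (hq : SplitElt A e.toMonoidHom f.ker (q.under A)) :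
    Nat.card {Q : Ideal (integralClosure A M) // Q.IsPrime ∧
      ((fun c : integralClosure A M => ((c : M) : C)) '' (Q : Set (integralClosure A M))) ∩
        Set.range (fun b : integralClosure A L => ((b : L) : C)) =
      (fun b : integralClosure A L => ((b : L) : C)) '' (q : Set (integralClosure A L))} =
    relfinrank L M := by
  haveI : FiniteDimensional K L :=
    Module.Finite.of_injective (inclusion hLM).toLinearMap (inclusion hLM).injective
  let ι : L →ₐ[A] M := (inclusion hLM).restrictScalars A
  have hι : ∀ l, ((ι l : M) : C) = l := fun _ => rfl
  letI alg : Algebra (integralClosure A L) (integralClosure A M) :=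
    (ι.mapIntegralClosure : integralClosure A L →+* integralClosure A M).toAlgebra
  have halg : ∀ b : integralClosure A L, ((algebraMap (integralClosure A L) (integralClosure A M) b :
    M) : C) = (b : L) := fun _ => rfl
  haveI : IsScalarTower A (integralClosure A L) (integralClosure A M) :=
    IsScalarTower.of_algebraMap_eq fun a => (ι.mapIntegralClosure.commutes a).symm
  haveI : IsFractionRing (integralClosure A M) M :=
    integralClosure.isFractionRing_of_finite_extension K M
  letI act₀ := IsIntegralClosure.MulSemiringAction A K M (integralClosure A M)
  letI act : MulSemiringAction Γ (integralClosure A M) :=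
    MulSemiringAction.compHom _ e.toMonoidHom
  have hact : ∀ δ (b : integralClosure A M), algebraMap (integralClosure A M) M (δ • b) =
      e.toMonoidHom δ (algebraMap (integralClosure A M) M b) :=
    fun δ b => algebraMap_galRestrict_apply A (e δ) b
  have hfix : ∀ σ : Γ, (σ ∈ f.ker ↔ ∀ l, e σ (inclusion hLM l) = inclusion hLM l) := fun σ => by
    simp only [he, MonoidHom.mem_ker]
    rw [← map_eq_one_iff eG eG.injective]
    exact ⟨fun h l => by rw [h]; rfl, fun h => AlgEquiv.ext fun l => (inclusion hLM).injective (h l)⟩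
  have hinjC : Function.Injective (fun c : integralClosure A M => ((c : M) : C)) :=
    Subtype.val_injective.comp Subtype.val_injective
  haveI : SMulCommClass f.ker (integralClosure A L) (integralClosure A M) := ⟨fun σ b c => by
    rw [Algebra.smul_def, Algebra.smul_def, smul_mul']
    congr 1
    refine Subtype.ext ((hact σ _).trans ?_)
    exact (hfix σ).1 σ.2 b⟩
  haveI : Algebra.IsInvariant (integralClosure A L) (integralClosure A M) f.ker := ⟨fun b hb => by
    have h1 : (b : M) ∈ fixedField (fixingSubgroup (restrict hLM)) := by
      rintro ⟨τ, hτ⟩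
      obtain ⟨σ, rfl⟩ := e.surjective τ
      have hσ : σ ∈ f.ker := (hfix σ).2 fun l => hτ ⟨inclusion hLM l, (mem_restrict hLM _).2 l.2⟩
      exact (hact σ b).symm.trans (congrArg Subtype.val (hb ⟨σ, hσ⟩))
    rw [IsGalois.fixedField_fixingSubgroup] at h1
    have h2 : ((b : M) : C) ∈ L := (mem_restrict hLM _).1 h1
    refine ⟨⟨⟨_, h2⟩, ?_⟩, hinjC rfl⟩
    exact (isIntegral_algHom_iff ι (inclusion hLM).injective).1 b.2⟩
  have hcard : Nat.card f.ker = relfinrank L M := by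
    have h1 := relfinrank_mul_relfinrank (bot_le : ⊥ ≤ L) hLM
    rw [relfinrank_bot_left, relfinrank_bot_left, ← IsGalois.card_aut_eq_finrank K M,
      ← IsGalois.card_aut_eq_finrank K L, ← Nat.card_congr e.toEquiv, ← Nat.card_congr eG.toEquiv,
      ← f.ker.card_mul_index, Subgroup.index_ker, f.range_eq_top.2 hf, Subgroup.card_top, mul_comm] at h1
    haveI : Finite G := Finite.of_surjective f hf
    exact (Nat.eq_of_mul_eq_mul_right Nat.card_pos h1).symm
  rw [← hcard, ← Ideal.card_primes_over_of_stabilizer_trivial (C := integralClosure A M)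
    (N := f.ker) (fun x y hxy => ?_) q fun Q hQ hQq σ hσ => ?_]
  · refine Nat.card_congr (Equiv.subtypeEquivRight fun Q => and_congr_right fun hQ => ?_)
    constructor
    · intro h
      ext b
      rw [Ideal.mem_comap]
      have h1 : ((b : L) : C) ∈ (fun b : integralClosure A L => ((b : L) : C)) ''
          (q : Set (integralClosure A L)) ↔ b ∈ q :=
        (Subtype.val_injective.comp Subtype.val_injective).mem_set_image
      rw [← h1, ← h]
      constructor
      · exact fun hb => ⟨⟨_, hb, rfl⟩, ⟨b, rfl⟩⟩
      · rintro ⟨⟨c, hc, hcb⟩, -⟩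
        rwa [show algebraMap _ _ b = c from hinjC hcb.symm]
    · rintro rfl
      ext x
      constructor
      · rintro ⟨⟨c, hc, hcb⟩, ⟨b, rfl⟩⟩
        refine ⟨b, ?_, rfl⟩
        change algebraMap _ _ b ∈ Q
        rwa [show algebraMap _ _ b = c from hinjC hcb.symm]
      · rintro ⟨b, hb, rfl⟩
        exact ⟨⟨_, hb, rfl⟩, ⟨b, rfl⟩⟩
  · exact Subtype.ext (Subtype.ext (congrArg (fun c : integralClosure A M => ((c : M) : C)) hxy))
  · refine Subtype.ext (hq.eq_one_of_smul_eq hact (Q := Q) ?_ σ.2 hσ)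
    rw [← hQq, Ideal.under_under]

end Ramification

section Cardinality

open Cardinal IntermediateField

variable {K C : Type} [Field K] [Field C] [Algebra K C]

lemma mk_finite_galois_le [Algebra.IsAlgebraic K C] (hK : ℵ₀ ≤ #K)
    {P : IntermediateField K C → Prop} (hP : ∀ M, P M → IsGalois K M ∧ FiniteDimensional K M) :
    #{M // P M} ≤ #K := by
  have h : ∀ M : {M // P M}, ∃ a : C, K⟮a⟯ = M.1 := fun M => by
    haveI := (hP M.1 M.2).1
    haveI := (hP M.1 M.2).2
    obtain ⟨α, hα⟩ := Field.exists_primitive_element K M.1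
    refine ⟨α, ?_⟩
    have := congrArg IntermediateField.lift hα
    rwa [lift_adjoin_simple, lift_top] at this
  choose a ha using h
  refine (mk_le_of_injective (f := a) fun M M' h => Subtype.ext ?_).trans
    ((Algebra.IsAlgebraic.cardinalMk_le_max K C).trans (max_le le_rfl hK))
  rw [← ha, ← ha, h]

/-- If the fields with property `P` avoid any given small set of fields, then there are as many
pairwise independent ones as there are elements of the base field. -/
lemma exists_independent_family [Algebra.IsAlgebraic K C] (hK : ℵ₀ < #K)
    {L : IntermediateField K C} {P : IntermediateField K C → Prop}
    (hP : ∀ M, P M → IsGalois K M ∧ FiniteDimensional K M) (hPL : ∀ M, P M → ¬ M ≤ L)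
    (hav : ∀ 𝓛 : Set (IntermediateField K C), #𝓛 < #K → (∀ L' ∈ 𝓛, ¬ L' ≤ L) →
      ∃ M, P M ∧ ∀ L' ∈ 𝓛, ¬ L' ≤ M) :
    #{M // P M} = #K ∧ ∃ T : Set (IntermediateField K C), (∀ M ∈ T, P M) ∧ #T = #K ∧
      ∀ M₁ ∈ T, ∀ M₂ ∈ T, M₁ ≠ M₂ → M₁ ⊓ M₂ ≤ L := by
  have hle := mk_finite_galois_le hK.le hP
  obtain ⟨T, hT⟩ := zorn_subset
    {T : Set (IntermediateField K C) | (∀ M ∈ T, P M) ∧ T.Pairwise fun M₁ M₂ => M₁ ⊓ M₂ ≤ L}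
    fun c hc hchain => ⟨⋃₀ c, ⟨fun M ⟨t, ht, hM⟩ => (hc ht).1 M hM,
      (Set.pairwise_sUnion hchain.directedOn).2 fun t ht => (hc ht).2⟩,
      fun t ht => Set.subset_sUnion_of_mem ht⟩
  have hT' : #T ≤ #{M // P M} := mk_subtype_le_of_subset fun M hM => hT.prop.1 M hM
  suffices h : #K ≤ #T from
    ⟨hle.antisymm (h.trans hT'), T, hT.prop.1, (hT'.trans hle).antisymm h,
      fun M₁ h₁ M₂ h₂ hne => hT.prop.2 h₁ h₂ hne⟩
  by_contra! hlt
  let 𝓛 : Set (IntermediateField K C) := ⋃ M : T, {L' | L' ≤ M.1 ∧ ¬ L' ≤ L}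
  have h𝓛 : #𝓛 < #K := by
    refine (mk_iUnion_le_sum_mk.trans ((sum_le_sum _ (fun _ => ℵ₀) fun M => ?_).trans
      (sum_const' _ _).le)).trans_lt (mul_lt_of_lt hK.le hlt hK)
    haveI := (hP M.1 (hT.prop.1 _ M.2)).1
    haveI := (hP M.1 (hT.prop.1 _ M.2)).2
    haveI : Finite (IntermediateField K M.1) := Field.finite_intermediateField_of_exists_primitive_element _ _
      (Field.exists_primitive_element K M.1)
    haveI : Finite {L' : IntermediateField K C | L' ≤ M.1 ∧ ¬ L' ≤ L} :=
      Finite.of_injective (fun L' => restrict L'.2.1) fun L₁ L₂ h => Subtype.ext <| by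
        rw [← lift_restrict L₁.2.1, ← lift_restrict L₂.2.1]
        exact congrArg IntermediateField.lift h
    exact mk_le_aleph0
  obtain ⟨M, hM, hM'⟩ := hav 𝓛 h𝓛 fun L' h => by
    obtain ⟨_, h⟩ := Set.mem_iUnion.1 h
    exact h.2
  have hind : ∀ M₁ ∈ T, M ⊓ M₁ ≤ L := fun M₁ h₁ => by
    by_contra h
    exact hM' _ (Set.mem_iUnion.2 ⟨⟨M₁, h₁⟩, inf_le_right, h⟩) inf_le_left
  have hMT : M ∉ T := fun h => hPL M hM (by simpa using hind M h)
  refine hMT (hT.le_of_ge ⟨?_, ?_⟩ (Set.subset_insert M T) (Set.mem_insert M T))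
  · rintro M₁ (rfl | h₁)
    exacts [hM, hT.prop.1 _ h₁]
  · exact hT.prop.2.insert fun M₁ h₁ _ => ⟨hind M₁ h₁, inf_comm M M₁ ▸ hind M₁ h₁⟩

lemma linearDisjoint_of_inf_le {L M₁ M₂ : IntermediateField K C} [IsGalois K M₁]
    [FiniteDimensional K M₁] [FiniteDimensional K M₂] (h₁ : L ≤ M₁) (h₂ : L ≤ M₂)
    (h : M₁ ⊓ M₂ ≤ L) :
    (extendScalars h₁).LinearDisjoint (extendScalars h₂) := by
  letI : Algebra L M₁ := (inclusion h₁).toRingHom.toAlgebra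
  haveI : IsScalarTower K L M₁ := IsScalarTower.of_algebraMap_eq fun _ => rfl
  haveI : IsGalois L (extendScalars h₁) := IsGalois.tower_top_of_isGalois K L M₁
  haveI : FiniteDimensional L (extendScalars h₁) := Module.Finite.right K L M₁
  letI : Algebra L M₂ := (inclusion h₂).toRingHom.toAlgebra
  haveI : IsScalarTower K L M₂ := IsScalarTower.of_algebraMap_eq fun _ => rfl
  haveI : FiniteDimensional L (extendScalars h₂) := Module.Finite.right K L M₂
  refine LinearDisjoint.of_inf_eq_bot (eq_bot_iff.2 fun x hx => ?_)
  obtain ⟨hx₁, hx₂⟩ := mem_inf.1 hx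
  have hxL : x ∈ L := h (mem_inf.2 ⟨(mem_extendScalars h₁).1 hx₁, (mem_extendScalars h₂).1 hx₂⟩)
  exact IntermediateField.algebraMap_mem ⊥ (⟨x, hxL⟩ : L)

end Cardinality

section Main

open Cardinal IntermediateField

lemma exists_prime_lt_of_isMaximal (k : Type) [Field k] (m : Ideal (MvPowerSeries (Fin 2) k))
    (hm : m.IsMaximal) : ∃ p : Ideal (MvPowerSeries (Fin 2) k), p.IsPrime ∧ p ≠ ⊥ ∧ p < m := by
  let φ : MvPowerSeries (Fin 2) k →+* PowerSeries k :=
    (PowerSeries.constantCoeff (R := PowerSeries k)).comp (iterEquiv k).toRingHom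
  have hφ : ∀ a, φ ((iterEquiv k).symm a) = PowerSeries.constantCoeff a := fun a =>
    congrArg (PowerSeries.constantCoeff (R := PowerSeries k)) ((iterEquiv k).apply_symm_apply a)
  obtain rfl := IsLocalRing.eq_maximalIdeal hm
  have hp : (RingHom.ker φ).IsPrime := RingHom.ker_isPrime φ
  refine ⟨RingHom.ker φ, hp, fun h => ?_,
    lt_of_le_of_ne (IsLocalRing.le_maximalIdeal hp.ne_top) fun h => ?_⟩
  · have h1 : (iterEquiv k).symm PowerSeries.X ∈ RingHom.ker φ := by
      rw [RingHom.mem_ker, hφ, PowerSeries.constantCoeff_X]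
    rw [h, Ideal.mem_bot, map_eq_zero_iff _ (iterEquiv k).symm.injective] at h1
    exact PowerSeries.X_ne_zero h1
  · have h1 : (iterEquiv k).symm (PowerSeries.C PowerSeries.X) ∈ RingHom.ker φ := by
      rw [h, IsLocalRing.mem_maximalIdeal, mem_nonunits_iff]
      intro hu
      have h2 := hu.map φ
      rw [hφ, PowerSeries.constantCoeff_C] at h2
      exact PowerSeries.X_prime.not_unit h2
    rw [RingHom.mem_ker, hφ, PowerSeries.constantCoeff_C] at h1
    exact PowerSeries.X_ne_zero h1

lemma aleph0_lt_mk_psField (k : Type) [Field k] : ℵ₀ < #(PSField k) := by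
  rw [IsFractionRing.cardinalMk (PSRing k) (PSField k), mk_mvPowerSeries, ← mk_powerSeries]
  exact aleph0_lt_mk_powerSeries k

lemma IsSplitSolution.goodSolution {k : Type} [Field k] {Γ G : Type} [Group Γ] [Group G]
    [Finite Γ] {f : Γ →* G} (hf : Function.Surjective f)
    {L : IntermediateField (PSField k) (PSClosure k)} [IsGalois (PSField k) L]
    [FiniteDimensional (PSField k) L] [Algebra (PSRing k) L]
    [IsScalarTower (PSRing k) (PSField k) L] {eG : G ≃* (L ≃ₐ[PSField k] L)} {D : PSRing k}
    (hD : ∀ q : Ideal (integralClosure (PSRing k) L), (∃ σ : L ≃ₐ[PSField k] L, σ ≠ 1 ∧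
      ∀ b ∈ integralClosure (PSRing k) L, σ b - b ∈
        Subtype.val '' (q : Set (integralClosure (PSRing k) L))) → D ∈ q.under (PSRing k))
    {M : IntermediateField (PSField k) (PSClosure k)}
    (h : IsSplitSolution (PSRing k) D eG.toMonoidHom f M) : GoodSolution k Γ G f L eG M := by
  obtain ⟨hgal, hfd, hLM, e, he, hsplit⟩ := h
  refine ⟨hLM, hgal, hfd, e, fun γ x hx => congrArg Subtype.val (he γ ⟨x, hx⟩), ?_⟩
  rintro q hq - hq1 ⟨σ, hσ, -, hσq⟩
  letI : Algebra (PSRing k) M :=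
    ((algebraMap (PSField k) M).comp (algebraMap (PSRing k) (PSField k))).toAlgebra
  haveI : IsScalarTower (PSRing k) (PSField k) M := IsScalarTower.of_algebraMap_eq fun _ => rfl
  exact card_primes_over_eq_relfinrank hf eG hLM e he q (hsplit _ inferInstance
    (hD q ⟨σ, hσ, hσq⟩) (not_isMaximal_under_integralClosure (K := PSField k)
      (exists_prime_lt_of_isMaximal k) q hq1))

end Main

open Cardinal in
/-- (Harbater–Stevenson, Proposition 5.3.)  Let `k` be a field, `A = k[[x,t]]` with fraction
field `K`, and let `1 → N → Γ → G → 1` be a split exact sequence of finite groups with `N ≠ 1`.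
Every `G`-Galois extension `L/K` embeds into a `Γ`-Galois extension `M/K` compatibly with
`Γ → G`, such that `M/L` is totally split at every height-one prime of the integral closure `B`
of `A` in `L` with non-trivial inertia.  Moreover the set of such `M` inside a fixed algebraic
closure has cardinality `card K`, and it contains a subset of cardinality `card K` whose members
are pairwise linearly disjoint over `L`. -/
theorem exists_gamma_extension_totallySplit_of_ramified
    (k : Type) [Field k]
    (Γ G : Type) [Group Γ] [Group G] [Finite Γ] [Finite G]
    (f : Γ →* G) (s : G →* Γ)
    (hf : Function.Surjective f) (hs : f.comp s = MonoidHom.id G) (hker : f.ker ≠ ⊥)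
    (L : IntermediateField (PSField k) (PSClosure k))
    [IsGalois (PSField k) ↥L] [FiniteDimensional (PSField k) ↥L]
    [Algebra (PSRing k) ↥L] [IsScalarTower (PSRing k) (PSField k) ↥L]
    (eG : G ≃* (↥L ≃ₐ[PSField k] ↥L)) :
    (∃ M : IntermediateField (PSField k) (PSClosure k), GoodSolution k Γ G f L eG M) ∧
    #{M : IntermediateField (PSField k) (PSClosure k) // GoodSolution k Γ G f L eG M} =
      #(PSField k) ∧
    ∃ T : Set (IntermediateField (PSField k) (PSClosure k)),
      (∀ M ∈ T, GoodSolution k Γ G f L eG M) ∧ #T = #(PSField k) ∧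
      (∀ M₁ ∈ T, ∀ M₂ ∈ T, M₁ ≠ M₂ →
        ∀ (h₁ : L ≤ M₁) (h₂ : L ≤ M₂),
          (IntermediateField.extendScalars h₁).LinearDisjoint
            (IntermediateField.extendScalars h₂)) := by
  obtain ⟨D, hD0, hD⟩ := exists_mem_of_inertia_ne_bot (PSRing k) (PSField k) L
  have hK := aleph0_lt_mk_psField k
  have hav : HasAvoidingSolutions (PSRing k) D eG.toMonoidHom f :=
    .of_split hK eG f s hs fun n hn M _ _ => hasPatchFamily hD0 hn
  have hP : ∀ M, GoodSolution k Γ G f L eG M →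
      IsGalois (PSField k) M ∧ FiniteDimensional (PSField k) M := fun M h => ⟨h.2.1, h.2.2.1⟩
  have hav' : ∀ 𝓛 : Set (IntermediateField (PSField k) (PSClosure k)), #𝓛 < #(PSField k) →
      (∀ L' ∈ 𝓛, ¬ L' ≤ L) → ∃ M, GoodSolution k Γ G f L eG M ∧ ∀ L' ∈ 𝓛, ¬ L' ≤ M :=
    fun 𝓛 h1 h2 => let ⟨M, hM, hM'⟩ := hav 𝓛 h1 h2
      ⟨M, hM.goodSolution hf hD, hM'⟩
  obtain ⟨hcard, T, hT, hTcard, hTL⟩ := exists_independent_family hK (L := L) hP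
    (fun M ⟨hLM, _, _, e, he, _⟩ hML => hker <| by
      obtain rfl := le_antisymm hLM hML
      refine (Subgroup.eq_bot_iff_forall _).2 fun γ hγ => e.injective ?_
      rw [map_one]
      ext x
      refine (he γ x x.2).trans ?_
      rw [MonoidHom.mem_ker.1 hγ, map_one]) hav'
  obtain ⟨M, hM, -⟩ := hav' ∅ (by rw [mk_emptyCollection]; exact aleph0_pos.trans hK) (by simp)
  refine ⟨⟨M, hM⟩, hcard, T, hT, hTcard, fun M₁ h₁ M₂ h₂ hne hL₁ hL₂ => ?_⟩
  haveI := (hP _ (hT _ h₁)).1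
  haveI := (hP _ (hT _ h₁)).2
  haveI := (hP _ (hT _ h₂)).2
  exact linearDisjoint_of_inf_le hL₁ hL₂ (hTL M₁ h₁ M₂ h₂ hne)
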